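/- Let u be a second Neumann eigenfunction of a triangle T. If u has a critical point lying in the open interior of T, then for each side e of T there is a critical point of u lying in the interior of e; in particular u then has at least three additional critical points, one in the interior of each side of T. -/

import Mathlib

open Set

noncomputable section

abbrev E2 : Type := EuclideanSpace ℝ (Fin 2)

/-- The closed triangle: convex hull of the three vertices. -/
def Tri (v₁ v₂ v₃ : E2) : Set E2 := convexHull ℝ {v₁, v₂, v₃}

/-- The vertex set of the triangle. -/
def Vtx (v₁ v₂ v₃ : E2) : Set E2 := {v₁, v₂, v₃}

/-- The triangle minus its vertices. -/
def TriDom (v₁ v₂ v₃ : E2) : Set E2 := Tri v₁ v₂ v₃ \ Vtx v₁ v₂ v₃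

/-- Second (mixed) directional derivative of `u` at `p`: first in direction `v`, then `w`. -/
def mixedDeriv (u : E2 → ℝ) (p v w : E2) : ℝ :=
  fderiv ℝ (fun y => fderiv ℝ u y v) p w

/-- The (geometers') Laplacian `−(∂ₓ² + ∂_y²) u` at `p`. -/
def negLap (u : E2 → ℝ) (p : E2) : ℝ :=
  -(mixedDeriv u p (EuclideanSpace.single 0 1) (EuclideanSpace.single 0 1)
    + mixedDeriv u p (EuclideanSpace.single 1 1) (EuclideanSpace.single 1 1))

/-- `u` satisfies Neumann conditions along the segment `[a,b]`: at every non-endpoint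
point of the segment, the derivative of `u` (within `S`) annihilates every vector
orthogonal to the direction of the side; equivalently the normal derivative vanishes. -/
def NeumannOn (S : Set E2) (a b : E2) (u : E2 → ℝ) : Prop :=
  ∀ p ∈ segment ℝ a b, p ≠ a → p ≠ b →
    ∀ w : E2, @inner ℝ _ _ w (b - a) = 0 → fderivWithin ℝ u S p w = 0

/-- `u` is a Neumann eigenfunction of the triangle with vertices `v₁ v₂ v₃`,
with eigenvalue `μ > 0`. -/
structure IsNeumannEigenfun (v₁ v₂ v₃ : E2) (μ : ℝ) (u : E2 → ℝ) : Prop where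
  pos : 0 < μ
  nonconst : ¬ ∃ c : ℝ, ∀ z ∈ Tri v₁ v₂ v₃, u z = c
  cont : ContinuousOn u (Tri v₁ v₂ v₃)
  smooth : ContDiffOn ℝ (⊤ : ℕ∞) u (TriDom v₁ v₂ v₃)
  eqn : ∀ p ∈ interior (Tri v₁ v₂ v₃), negLap u p = μ * u p
  neumann₁₂ : NeumannOn (TriDom v₁ v₂ v₃) v₁ v₂ u
  neumann₂₃ : NeumannOn (TriDom v₁ v₂ v₃) v₂ v₃ u
  neumann₃₁ : NeumannOn (TriDom v₁ v₂ v₃) v₃ v₁ u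

/-- `u` is a second Neumann eigenfunction: a Neumann eigenfunction whose eigenvalue is
the least `μ > 0` admitting a Neumann eigenfunction. -/
def IsSecondNeumannEigenfun (v₁ v₂ v₃ : E2) (u : E2 → ℝ) : Prop :=
  ∃ μ : ℝ, IsNeumannEigenfun v₁ v₂ v₃ μ u ∧
    ∀ (μ' : ℝ) (u' : E2 → ℝ), IsNeumannEigenfun v₁ v₂ v₃ μ' u' → μ ≤ μ'

/-- `p` is a critical point of `u`: a non-vertex point of the triangle at which the
derivative (within the triangle minus vertices) vanishes. -/
def IsCritPt (v₁ v₂ v₃ : E2) (u : E2 → ℝ) (p : E2) : Prop :=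
  p ∈ TriDom v₁ v₂ v₃ ∧ fderivWithin ℝ u (TriDom v₁ v₂ v₃) p = 0

/-- `(a, b)` is (an ordering of) a side of the triangle `v₁ v₂ v₃`. -/
def IsSide (v₁ v₂ v₃ a b : E2) : Prop :=
  (a = v₁ ∧ b = v₂) ∨ (a = v₂ ∧ b = v₃) ∨ (a = v₃ ∧ b = v₁)

/-- Reflection of `z` across the line through `a` and `b`. -/
def lineReflect (a b z : E2) : E2 :=
  (2 : ℝ) • (a + ((@inner ℝ _ _ (z - a) (b - a)) / (@inner ℝ _ _ (b - a) (b - a))) • (b - a)) - z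

/-- Determinant of the Hessian of `w` at `p` (in the standard coordinates). -/
def hessDet (w : E2 → ℝ) (p : E2) : ℝ :=
  mixedDeriv w p (EuclideanSpace.single 0 1) (EuclideanSpace.single 0 1) *
      mixedDeriv w p (EuclideanSpace.single 1 1) (EuclideanSpace.single 1 1) -
    mixedDeriv w p (EuclideanSpace.single 0 1) (EuclideanSpace.single 1 1) *
      mixedDeriv w p (EuclideanSpace.single 1 1) (EuclideanSpace.single 0 1)

/-- The Hessian at `p` of the extension of `u` by reflection across the side `[a,b]`
satisfies the predicate `P`: there is a smooth local extension `w` of `u` near `p`,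
invariant under the reflection across the line through `a, b`, with `P (hessDet w p)`. -/
def ReflHessAt (v₁ v₂ v₃ a b : E2) (u : E2 → ℝ) (p : E2) (P : ℝ → Prop) : Prop :=
  ∃ (U : Set E2) (w : E2 → ℝ), IsOpen U ∧ p ∈ U ∧ ContDiffOn ℝ (⊤ : ℕ∞) w U ∧
    (∀ z ∈ U ∩ Tri v₁ v₂ v₃, w z = u z) ∧
    (∀ z ∈ U, lineReflect a b z ∈ U → w (lineReflect a b z) = w z) ∧
    P (hessDet w p)

/-- `p` is an isolated local extremum of `u` on the triangle: the connected component
of the level set `{z ∈ T : u z = u p}` containing `p` is `{p}`. -/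
def IsIsolatedExtremum (v₁ v₂ v₃ : E2) (u : E2 → ℝ) (p : E2) : Prop :=
  connectedComponentIn {z ∈ Tri v₁ v₂ v₃ | u z = u p} p = {p}

section
open MeasureTheory Filter Topology
open scoped ContDiff FourierTransform RealInnerProductSpace

/-- directional derivative -/
def pd (v : E2) (u : E2 → ℝ) : E2 → ℝ := fun y => fderiv ℝ u y v

abbrev ee0 : E2 := EuclideanSpace.single 0 1
abbrev ee1 : E2 := EuclideanSpace.single 1 1

/-- the Laplacian -/
def lap (u : E2 → ℝ) (p : E2) : ℝ := pd ee0 (pd ee0 u) p + pd ee1 (pd ee1 u) p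

theorem negLap_eq (u : E2 → ℝ) (p : E2) : negLap u p = - lap u p := rfl

theorem pd_contDiff {u : E2 → ℝ} {n m : ℕ∞} (v : E2) (hu : ContDiff ℝ m u) (h : n + 1 ≤ m) :
    ContDiff ℝ n (pd v u) := by
  have h' : ((n : WithTop ℕ∞) + 1) ≤ (m : WithTop ℕ∞) := by exact_mod_cast h
  exact (hu.fderiv_right h').clm_apply contDiff_const

theorem pd_contDiff_top {u : E2 → ℝ} (v : E2) (hu : ContDiff ℝ ∞ u) :
    ContDiff ℝ ∞ (pd v u) := pd_contDiff (m := ⊤) (n := ⊤) v hu (by simp)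

theorem pd_hasCompactSupport {u : E2 → ℝ} (v : E2) (hu : HasCompactSupport u) :
    HasCompactSupport (pd v u) := by
  apply hu.mono'
  refine (fun x hx => ?_)
  apply support_fderiv_subset ℝ (f := u)
  intro h; apply hx; simp [pd, h]

theorem tsupport_pd_subset (u : E2 → ℝ) (v : E2) : tsupport (pd v u) ⊆ tsupport u := by
  apply closure_minimal _ (isClosed_tsupport u)
  intro x hx
  apply support_fderiv_subset ℝ (f := u)
  intro h; apply hx; simp [pd, h]

theorem pd_mul {a b : E2 → ℝ} {x : E2} (v : E2) (ha : DifferentiableAt ℝ a x)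
    (hb : DifferentiableAt ℝ b x) :
    pd v (fun y => a y * b y) x = pd v a x * b x + a x * pd v b x := by
  simp only [pd]
  rw [fderiv_fun_mul ha hb]; simp; ring

theorem pd_add {a b : E2 → ℝ} {x : E2} (v : E2) (ha : DifferentiableAt ℝ a x)
    (hb : DifferentiableAt ℝ b x) :
    pd v (fun y => a y + b y) x = pd v a x + pd v b x := by
  simp only [pd]
  rw [fderiv_fun_add ha hb]; simp

theorem pd_const_mul {b : E2 → ℝ} {x : E2} (c : ℝ) (v : E2) (hb : DifferentiableAt ℝ b x) :
    pd v (fun y => c * b y) x = c * pd v b x := by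
  simp only [pd]
  rw [fderiv_const_mul hb]; simp

theorem pd_congr {a b : E2 → ℝ} {x : E2} (v : E2) (h : a =ᶠ[𝓝 x] b) : pd v a x = pd v b x := by
  simp only [pd, h.fderiv_eq]

theorem pd_eventuallyEq {a b : E2 → ℝ} {x : E2} (v : E2) (h : a =ᶠ[𝓝 x] b) :
    pd v a =ᶠ[𝓝 x] pd v b := by
  filter_upwards [h.eventuallyEq_nhds] with y hy using pd_congr v hy

theorem lap_congr {a b : E2 → ℝ} {x : E2} (h : a =ᶠ[𝓝 x] b) : lap a x = lap b x := by
  simp only [lap, pd_congr _ (pd_eventuallyEq _ h)]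

/-- C² at a point gives differentiability in a neighbourhood and of the derivative. -/
theorem c2_diff {a : E2 → ℝ} {x : E2} (ha : ContDiffAt ℝ 2 a x) :
    (∀ᶠ y in 𝓝 x, DifferentiableAt ℝ a y) ∧ ∀ v, DifferentiableAt ℝ (pd v a) x := by
  constructor
  · filter_upwards [ha.eventually (by simp)] with y hy
    exact hy.differentiableAt (by simp)
  · intro v
    have h1 : ContDiffAt ℝ 1 (fderiv ℝ a) x := ha.fderiv_right (by norm_num [one_add_one_eq_two])
    exact (h1.differentiableAt (by simp)).clm_apply (differentiableAt_const v)

theorem pdpd_mul {a b : E2 → ℝ} {x : E2} (v : E2) (ha : ContDiffAt ℝ 2 a x)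
    (hb : ContDiffAt ℝ 2 b x) :
    pd v (pd v (fun y => a y * b y)) x =
      pd v (pd v a) x * b x + 2 * (pd v a x * pd v b x) + a x * pd v (pd v b) x := by
  have e : pd v (fun y => a y * b y) =ᶠ[𝓝 x] fun y => pd v a y * b y + a y * pd v b y := by
    filter_upwards [(c2_diff ha).1, (c2_diff hb).1] with y h1 h2 using pd_mul v h1 h2
  rw [pd_congr v e]
  have da := (c2_diff ha).2 v
  have db := (c2_diff hb).2 v
  have da0 := ha.differentiableAt (by simp)
  have db0 := hb.differentiableAt (by simp)
  rw [pd_add v (a := fun y => pd v a y * b y) (b := fun y => a y * pd v b y)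
    (da.mul db0) (da0.mul db), pd_mul v da db0, pd_mul v da0 db]
  ring

theorem lap_mul {a b : E2 → ℝ} {x : E2} (ha : ContDiffAt ℝ 2 a x) (hb : ContDiffAt ℝ 2 b x) :
    lap (fun y => a y * b y) x = lap a x * b x +
      2 * (pd ee0 a x * pd ee0 b x + pd ee1 a x * pd ee1 b x) + a x * lap b x := by
  simp only [lap, pdpd_mul _ ha hb]; ring

theorem pdpd_add {a b : E2 → ℝ} {x : E2} (v : E2) (ha : ContDiffAt ℝ 2 a x)
    (hb : ContDiffAt ℝ 2 b x) :
    pd v (pd v (fun y => a y + b y)) x = pd v (pd v a) x + pd v (pd v b) x := by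
  have e : pd v (fun y => a y + b y) =ᶠ[𝓝 x] fun y => pd v a y + pd v b y := by
    filter_upwards [(c2_diff ha).1, (c2_diff hb).1] with y h1 h2 using pd_add v h1 h2
  rw [pd_congr v e, pd_add v ((c2_diff ha).2 v) ((c2_diff hb).2 v)]

theorem lap_add {a b : E2 → ℝ} {x : E2} (ha : ContDiffAt ℝ 2 a x) (hb : ContDiffAt ℝ 2 b x) :
    lap (fun y => a y + b y) x = lap a x + lap b x := by
  simp only [lap, pdpd_add _ ha hb]; ring

theorem lap_const_mul {b : E2 → ℝ} {x : E2} (c : ℝ) (hb : ContDiffAt ℝ 2 b x) :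
    lap (fun y => c * b y) x = c * lap b x := by
  have : ∀ v, pd v (pd v (fun y => c * b y)) x = c * pd v (pd v b) x := by
    intro v
    have e : pd v (fun y => c * b y) =ᶠ[𝓝 x] fun y => c * pd v b y := by
      filter_upwards [(c2_diff hb).1] with y h2 using pd_const_mul c v h2
    rw [pd_congr v e, pd_const_mul c v ((c2_diff hb).2 v)]
  simp only [lap, this]; ring

/-- chain rule for scalar function of a scalar function -/
theorem pd_comp {g g' : ℝ → ℝ} {a : E2 → ℝ} {x : E2} (v : E2) (hg : HasDerivAt g (g' (a x)) (a x))
    (ha : DifferentiableAt ℝ a x) : pd v (fun y => g (a y)) x = g' (a x) * pd v a x := by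
  simp only [pd]
  have := (hg.hasFDerivAt.comp x ha.hasFDerivAt).fderiv
  have e : (g ∘ a) = fun y => g (a y) := rfl
  rw [e] at this
  rw [this]; simp [mul_comm]

theorem pdpd_comp {g g' g'' : ℝ → ℝ} {a : E2 → ℝ} {x : E2} (v : E2)
    (hg : ∀ᶠ t in 𝓝 (a x), HasDerivAt g (g' t) t) (hg' : HasDerivAt g' (g'' (a x)) (a x))
    (ha : ContDiffAt ℝ 2 a x) : pd v (pd v (fun y => g (a y))) x =
      g'' (a x) * (pd v a x) ^ 2 + g' (a x) * pd v (pd v a) x := by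
  have e : pd v (fun y => g (a y)) =ᶠ[𝓝 x] fun y => g' (a y) * pd v a y := by
    filter_upwards [(c2_diff ha).1, ha.continuousAt.eventually hg] with y h1 h2
      using pd_comp v h2 h1
  rw [pd_congr v e]
  have d0 := ha.differentiableAt (by simp : (2 : WithTop ℕ∞) ≠ 0)
  rw [pd_mul (a := fun y => g' (a y)) v (hg'.differentiableAt.comp x d0) ((c2_diff ha).2 v)]
  rw [pd_comp (g' := g'') v hg' d0]; ring

theorem lap_comp {g g' g'' : ℝ → ℝ} {a : E2 → ℝ} {x : E2}
    (hg : ∀ᶠ t in 𝓝 (a x), HasDerivAt g (g' t) t) (hg' : HasDerivAt g' (g'' (a x)) (a x))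
    (ha : ContDiffAt ℝ 2 a x) : lap (fun y => g (a y)) x =
      g'' (a x) * ((pd ee0 a x) ^ 2 + (pd ee1 a x) ^ 2) + g' (a x) * lap a x := by
  simp only [lap, pdpd_comp _ hg hg' ha]; ring

/-- linear functionals -/
theorem pd_inner (ξ c v x : E2) : pd v (fun y => ⟪y - c, ξ⟫) x = ⟪v, ξ⟫ := by
  simp only [pd]
  have : HasFDerivAt (fun y : E2 => ⟪y - c, ξ⟫) (innerSL ℝ ξ) x := by
    have := ((innerSL ℝ ξ).hasFDerivAt (x := x - c)).comp x ((hasFDerivAt_id x).sub_const c)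
    refine this.congr_of_eventuallyEq ?_ |>.congr_fderiv ?_
    · filter_upwards with y; simp [real_inner_comm]
    · ext; simp
  rw [this.fderiv]; simp [real_inner_comm]

theorem pdpd_inner (ξ c v x : E2) : pd v (pd v (fun y => ⟪y - c, ξ⟫)) x = 0 := by
  have : pd v (fun y => ⟪y - c, ξ⟫) = fun _ => ⟪v, ξ⟫ := by ext y; exact pd_inner ξ c v y
  rw [this]; simp [pd]

theorem lap_inner (ξ c x : E2) : lap (fun y => ⟪y - c, ξ⟫) x = 0 := by
  simp [lap, pdpd_inner]

theorem inner_ee0 (ξ : E2) : ⟪ee0, ξ⟫ = ξ 0 := by simp [ee0, EuclideanSpace.inner_single_left]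
theorem inner_ee1 (ξ : E2) : ⟪ee1, ξ⟫ = ξ 1 := by simp [ee1, EuclideanSpace.inner_single_left]
theorem inner_e2 (a b : E2) : ⟪a, b⟫ = a 0 * b 0 + a 1 * b 1 := by
  simp [PiLp.inner_apply, Fin.sum_univ_two]; ring
theorem normsq_e2 (a : E2) : ‖a‖ ^ 2 = a 0 ^ 2 + a 1 ^ 2 := by
  rw [EuclideanSpace.norm_sq_eq]; simp [Fin.sum_univ_two]

theorem fderiv_decomp (L : E2 →L[ℝ] ℝ) (v : E2) : L v = v 0 * L ee0 + v 1 * L ee1 := by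
  have : v = v 0 • ee0 + v 1 • ee1 := by
    ext i; fin_cases i <;> simp [ee0, ee1]
  conv_lhs => rw [this]
  simp
end

section
open MeasureTheory Filter Topology
open scoped ContDiff FourierTransform RealInnerProductSpace

/-- smooth compactly supported test functions in an open set -/
structure TestIn (U : Set E2) (χ : E2 → ℝ) : Prop where
  smooth : ContDiff ℝ ∞ χ
  cpt : HasCompactSupport χ
  sub : tsupport χ ⊆ U

theorem TestIn.pd {U : Set E2} {χ : E2 → ℝ} (h : TestIn U χ) (v : E2) : TestIn U (pd v χ) :=
  ⟨pd_contDiff_top v h.smooth, pd_hasCompactSupport v h.cpt,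
    (tsupport_pd_subset χ v).trans h.sub⟩

theorem TestIn.mul_left {U : Set E2} {χ : E2 → ℝ} (h : TestIn U χ) {g : E2 → ℝ}
    (hg : ContDiff ℝ ∞ g) : TestIn U (fun x => g x * χ x) :=
  ⟨hg.mul h.smooth, h.cpt.mul_left, (tsupport_mul_subset_right).trans h.sub⟩

theorem TestIn.add {U : Set E2} {χ η : E2 → ℝ} (h : TestIn U χ) (h' : TestIn U η) :
    TestIn U (fun x => χ x + η x) := by
  refine ⟨h.smooth.add h'.smooth, h.cpt.add h'.cpt, ?_⟩
  refine (tsupport_add χ η).trans (union_subset h.sub h'.sub)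

theorem TestIn.lap {U : Set E2} {χ : E2 → ℝ} (h : TestIn U χ) : TestIn U (lap χ) :=
  ((h.pd ee0).pd ee0).add ((h.pd ee1).pd ee1)

theorem TestIn.bdd {U : Set E2} {χ : E2 → ℝ} (h : TestIn U χ) : ∃ C, ∀ x, ‖χ x‖ ≤ C :=
  h.cpt.exists_bound_of_continuous h.smooth.continuous

theorem TestIn.integrable_mul {U : Set E2} {χ f : E2 → ℝ} (h : TestIn U χ) (hf : Integrable f) :
    Integrable (fun x => f x * χ x) := by
  obtain ⟨C, hC⟩ := h.bdd
  exact hf.mul_bdd h.smooth.continuous.aestronglyMeasurable (ae_of_all _ hC)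

theorem two_le_inf : (2 : WithTop ℕ∞) ≤ ∞ := by
  have : ((2 : ℕ∞) : WithTop ℕ∞) ≤ ((⊤ : ℕ∞) : WithTop ℕ∞) := WithTop.coe_le_coe.2 le_top
  exact this

theorem int4 {α : Type*} [MeasurableSpace α] {ν : Measure α} {a b c d : α → ℝ} (ha : Integrable a ν) (hb : Integrable b ν) (hc : Integrable c ν)
    (hd : Integrable d ν) : ∫ x, (a x + b x + c x + d x) ∂ν =
      ∫ x, a x ∂ν + ∫ x, b x ∂ν + ∫ x, c x ∂ν + ∫ x, d x ∂ν := by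
  have h1 := integral_add ((ha.add hb).add hc) hd
  have h2 := integral_add (ha.add hb) hc
  have h3 := integral_add ha hb
  simp only [Pi.add_apply] at h1 h2 h3
  rw [h1, h2, h3]

/-- phase -/
def ph (ξ x : E2) : ℝ := ⟪x - 0, (2 * Real.pi) • ξ⟫

theorem ph_smooth (ξ : E2) : ContDiff ℝ ∞ (ph ξ) := by
  unfold ph; exact (contDiff_id.sub contDiff_const).inner ℝ contDiff_const

theorem pd_ph (ξ v x : E2) : pd v (ph ξ) x = 2 * Real.pi * ⟪v, ξ⟫ := by
  have := pd_inner ((2 * Real.pi) • ξ) 0 v x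
  rw [inner_smul_right] at this
  exact this

theorem lap_ph (ξ x : E2) : lap (ph ξ) x = 0 := lap_inner _ _ _

theorem lap_mul_cos {χ : E2 → ℝ} (h : ContDiff ℝ ∞ χ) (ξ x : E2) :
    lap (fun y => χ y * Real.cos (ph ξ y)) x = lap χ x * Real.cos (ph ξ x)
      - 4 * Real.pi * (ξ 0 * (pd ee0 χ x * Real.sin (ph ξ x)) + ξ 1 * (pd ee1 χ x * Real.sin (ph ξ x)))
      - 4 * Real.pi ^ 2 * ‖ξ‖ ^ 2 * (χ x * Real.cos (ph ξ x)) := by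
  have h2 : ContDiffAt ℝ 2 χ x := (h.of_le two_le_inf).contDiffAt
  have p2 : ContDiffAt ℝ 2 (ph ξ) x := ((ph_smooth ξ).of_le two_le_inf).contDiffAt
  have c2 : ContDiffAt ℝ 2 (fun y => Real.cos (ph ξ y)) x := p2.cos
  rw [lap_mul h2 c2,
    lap_comp (g := Real.cos) (g' := fun t => - Real.sin t) (g'' := fun t => - Real.cos t)
      (Eventually.of_forall fun t => Real.hasDerivAt_cos t) (Real.hasDerivAt_sin _).neg p2,
    pd_comp (g := Real.cos) (g' := fun t => - Real.sin t) _ (Real.hasDerivAt_cos _)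
      (p2.differentiableAt (by norm_num)),
    pd_comp (g := Real.cos) (g' := fun t => - Real.sin t) _ (Real.hasDerivAt_cos _)
      (p2.differentiableAt (by norm_num)), lap_ph, pd_ph, pd_ph, inner_ee0, inner_ee1, normsq_e2]
  ring

theorem lap_mul_sin {χ : E2 → ℝ} (h : ContDiff ℝ ∞ χ) (ξ x : E2) :
    lap (fun y => χ y * Real.sin (ph ξ y)) x = lap χ x * Real.sin (ph ξ x)
      + 4 * Real.pi * (ξ 0 * (pd ee0 χ x * Real.cos (ph ξ x)) + ξ 1 * (pd ee1 χ x * Real.cos (ph ξ x)))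
      - 4 * Real.pi ^ 2 * ‖ξ‖ ^ 2 * (χ x * Real.sin (ph ξ x)) := by
  have h2 : ContDiffAt ℝ 2 χ x := (h.of_le two_le_inf).contDiffAt
  have p2 : ContDiffAt ℝ 2 (ph ξ) x := ((ph_smooth ξ).of_le two_le_inf).contDiffAt
  have c2 : ContDiffAt ℝ 2 (fun y => Real.sin (ph ξ y)) x := p2.sin
  rw [lap_mul h2 c2,
    lap_comp (g := Real.sin) (g' := fun t => Real.cos t) (g'' := fun t => - Real.sin t)
      (Eventually.of_forall fun t => Real.hasDerivAt_sin t) (Real.hasDerivAt_cos _) p2,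
    pd_comp (g := Real.sin) (g' := fun t => Real.cos t) _ (Real.hasDerivAt_sin _)
      (p2.differentiableAt (by norm_num)),
    pd_comp (g := Real.sin) (g' := fun t => Real.cos t) _ (Real.hasDerivAt_sin _)
      (p2.differentiableAt (by norm_num)), lap_ph, pd_ph, pd_ph, inner_ee0, inner_ee1, normsq_e2]
  ring

/-- weak solutions of `Δ f + l f = 0` on U -/
def WeakSol (U : Set E2) (l : ℝ) (f : E2 → ℝ) : Prop :=
  ∀ η, TestIn U η → ∫ x, f x * (lap η x + l * η x) = 0

def Ic (f χ : E2 → ℝ) (ξ : E2) : ℝ := ∫ x, f x * (χ x * Real.cos (ph ξ x))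
def Is (f χ : E2 → ℝ) (ξ : E2) : ℝ := ∫ x, f x * (χ x * Real.sin (ph ξ x))

theorem TestIn.mul_cos {U : Set E2} {χ : E2 → ℝ} (h : TestIn U χ) (ξ : E2) :
    TestIn U (fun x => χ x * Real.cos (ph ξ x)) := by
  have := h.mul_left (g := fun x => Real.cos (ph ξ x)) (ph_smooth ξ).cos
  simpa only [mul_comm] using this
theorem TestIn.mul_sin {U : Set E2} {χ : E2 → ℝ} (h : TestIn U χ) (ξ : E2) :
    TestIn U (fun x => χ x * Real.sin (ph ξ x)) := by
  have := h.mul_left (g := fun x => Real.sin (ph ξ x)) (ph_smooth ξ).sin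
  simpa only [mul_comm] using this

theorem Ic_id {U : Set E2} {l : ℝ} {f χ : E2 → ℝ} (hf : Integrable f) (hw : WeakSol U l f)
    (h : TestIn U χ) (ξ : E2) :
    4 * Real.pi ^ 2 * ‖ξ‖ ^ 2 * Ic f χ ξ =
      Ic f (lap χ) ξ + l * Ic f χ ξ - 4 * Real.pi * (ξ 0 * Is f (pd ee0 χ) ξ + ξ 1 * Is f (pd ee1 χ) ξ) := by
  have h0 := hw _ (h.mul_cos ξ)
  have e : ∀ x, f x * (lap (fun y => χ y * Real.cos (ph ξ y)) x + l * (χ x * Real.cos (ph ξ x))) =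
    f x * (lap χ x * Real.cos (ph ξ x)) + (l - 4 * Real.pi ^ 2 * ‖ξ‖ ^ 2) * (f x * (χ x * Real.cos (ph ξ x)))
     + (-(4 * Real.pi * ξ 0)) * (f x * (pd ee0 χ x * Real.sin (ph ξ x)))
     + (-(4 * Real.pi * ξ 1)) * (f x * (pd ee1 χ x * Real.sin (ph ξ x))) := by
    intro x; rw [lap_mul_cos h.smooth]; ring
  simp only [e] at h0
  have i1 := (h.lap.mul_cos ξ).integrable_mul hf
  have i2 := ((h.mul_cos ξ).integrable_mul hf).const_mul (l - 4 * Real.pi ^ 2 * ‖ξ‖ ^ 2)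
  have i3 := (((h.pd ee0).mul_sin ξ).integrable_mul hf).const_mul (-(4 * Real.pi * ξ 0))
  have i4 := (((h.pd ee1).mul_sin ξ).integrable_mul hf).const_mul (-(4 * Real.pi * ξ 1))
  rw [int4 i1 i2 i3 i4,
    integral_const_mul, integral_const_mul, integral_const_mul] at h0
  simp only [Ic, Is]
  linarith

theorem Is_id {U : Set E2} {l : ℝ} {f χ : E2 → ℝ} (hf : Integrable f) (hw : WeakSol U l f)
    (h : TestIn U χ) (ξ : E2) :
    4 * Real.pi ^ 2 * ‖ξ‖ ^ 2 * Is f χ ξ =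
      Is f (lap χ) ξ + l * Is f χ ξ + 4 * Real.pi * (ξ 0 * Ic f (pd ee0 χ) ξ + ξ 1 * Ic f (pd ee1 χ) ξ) := by
  have h0 := hw _ (h.mul_sin ξ)
  have e : ∀ x, f x * (lap (fun y => χ y * Real.sin (ph ξ y)) x + l * (χ x * Real.sin (ph ξ x))) =
    f x * (lap χ x * Real.sin (ph ξ x)) + (l - 4 * Real.pi ^ 2 * ‖ξ‖ ^ 2) * (f x * (χ x * Real.sin (ph ξ x)))
     + (4 * Real.pi * ξ 0) * (f x * (pd ee0 χ x * Real.cos (ph ξ x)))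
     + (4 * Real.pi * ξ 1) * (f x * (pd ee1 χ x * Real.cos (ph ξ x))) := by
    intro x; rw [lap_mul_sin h.smooth]; ring
  simp only [e] at h0
  have i1 := (h.lap.mul_sin ξ).integrable_mul hf
  have i2 := ((h.mul_sin ξ).integrable_mul hf).const_mul (l - 4 * Real.pi ^ 2 * ‖ξ‖ ^ 2)
  have i3 := (((h.pd ee0).mul_cos ξ).integrable_mul hf).const_mul (4 * Real.pi * ξ 0)
  have i4 := (((h.pd ee1).mul_cos ξ).integrable_mul hf).const_mul (4 * Real.pi * ξ 1)
  rw [int4 i1 i2 i3 i4,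
    integral_const_mul, integral_const_mul, integral_const_mul] at h0
  simp only [Ic, Is]
  linarith

theorem abs_coord_le (ξ : E2) (i : Fin 2) : |ξ i| ≤ ‖ξ‖ := by
  simpa using EuclideanSpace.norm_eq ξ ▸ PiLp.norm_apply_le ξ i

theorem aux_step {r a c0 c1 s0 s1 b l C0 C1 C2 C3 C4 : ℝ} {m : ℕ} (hr : 0 ≤ r)
    (hs0 : |s0| ≤ r) (hs1 : |s1| ≤ r)
    (ha0 : |a| ≤ C0) (ha : r ^ m * |a| ≤ C1) (hb : r ^ m * |b| ≤ C2) (hc0 : r ^ m * |c0| ≤ C3)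
    (hc1 : r ^ m * |c1| ≤ C4)
    (e : 4 * Real.pi ^ 2 * r ^ 2 * a = b + l * a + 4 * Real.pi * (s0 * c0 + s1 * c1)) :
    r ^ (m + 1) * |a| ≤ C0 + C2 + |l| * C1 + 4 * Real.pi * (C3 + C4) := by
  have pi3 := Real.pi_gt_three
  have hpi : 1 ≤ 4 * Real.pi ^ 2 := by nlinarith
  have n0 : 0 ≤ C0 := (abs_nonneg _).trans ha0
  have n1 : 0 ≤ C1 := le_trans (by positivity) ha
  have n2 : 0 ≤ C2 := le_trans (by positivity) hb
  have n3 : 0 ≤ C3 := le_trans (by positivity) hc0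
  have n4 : 0 ≤ C4 := le_trans (by positivity) hc1
  have nl : 0 ≤ |l| := abs_nonneg l
  have nlc : 0 ≤ |l| * C1 := by positivity
  have n34 : 0 ≤ 4 * Real.pi * (C3 + C4) := by positivity
  rcases le_total r 1 with h1 | h1
  · have : r ^ (m + 1) ≤ 1 := pow_le_one₀ hr h1
    have : r ^ (m + 1) * |a| ≤ 1 * |a| := by gcongr
    linarith
  · have key : r ^ (m+2) * |a| ≤ C2 + |l| * C1 + 4 * Real.pi * (r * C3 + r * C4) := by
      have e1 : r ^ 2 * |a| ≤ |b| + |l| * |a| + 4 * Real.pi * (r * |c0| + r * |c1|) := by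
        have : |4 * Real.pi ^ 2 * r ^ 2 * a| ≤ |b| + |l| * |a| + 4 * Real.pi * (r * |c0| + r * |c1|) := by
          rw [e]
          refine (abs_add_le _ _).trans ?_
          refine add_le_add ((abs_add_le _ _).trans (by rw [abs_mul])) ?_
          rw [abs_mul, abs_of_pos (by positivity : 0 < 4 * Real.pi)]
          gcongr
          refine (abs_add_le _ _).trans ?_
          rw [abs_mul, abs_mul]; gcongr
        rw [abs_mul, abs_of_nonneg (by positivity : 0 ≤ 4 * Real.pi ^ 2 * r ^ 2)] at this
        refine le_trans ?_ this
        have : 0 ≤ r ^ 2 * |a| := by positivity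
        nlinarith
      calc r ^ (m+2) * |a| = r ^ m * (r ^ 2 * |a|) := by ring
        _ ≤ r ^ m * (|b| + |l| * |a| + 4 * Real.pi * (r * |c0| + r * |c1|)) := by gcongr
        _ = r ^ m * |b| + |l| * (r ^ m * |a|) + 4 * Real.pi * (r * (r ^ m * |c0|) + r * (r ^ m * |c1|)) := by ring
        _ ≤ _ := by gcongr
    have rp : 0 < r := by linarith
    have : r * (r ^ (m+1) * |a|) ≤ r * (C0 + C2 + |l| * C1 + 4 * Real.pi * (C3 + C4)) := by
      calc r * (r ^ (m+1) * |a|) = r ^ (m+2) * |a| := by ring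
        _ ≤ _ := key
        _ ≤ _ := by nlinarith
    exact le_of_mul_le_mul_left this rp

theorem I_bound0 {U : Set E2} {f χ : E2 → ℝ} (hf : Integrable f) (h : TestIn U χ) :
    ∃ C, ∀ ξ, |Ic f χ ξ| ≤ C ∧ |Is f χ ξ| ≤ C := by
  refine ⟨∫ x, |f x * χ x|, fun ξ => ⟨?_, ?_⟩⟩
  · refine (abs_integral_le_integral_abs).trans ?_
    refine integral_mono ((h.mul_cos ξ).integrable_mul hf).abs (h.integrable_mul hf).abs fun x => ?_
    simp only [abs_mul]
    have := Real.abs_cos_le_one (ph ξ x)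
    have h2 : |χ x| * |Real.cos (ph ξ x)| ≤ |χ x| := mul_le_of_le_one_right (abs_nonneg _) this
    exact mul_le_mul_of_nonneg_left h2 (abs_nonneg _)
  · refine (abs_integral_le_integral_abs).trans ?_
    refine integral_mono ((h.mul_sin ξ).integrable_mul hf).abs (h.integrable_mul hf).abs fun x => ?_
    simp only [abs_mul]
    have := Real.abs_sin_le_one (ph ξ x)
    have h2 : |χ x| * |Real.sin (ph ξ x)| ≤ |χ x| := mul_le_of_le_one_right (abs_nonneg _) this
    exact mul_le_mul_of_nonneg_left h2 (abs_nonneg _)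

theorem I_bound {U : Set E2} {l : ℝ} {f : E2 → ℝ} (hf : Integrable f) (hw : WeakSol U l f) (m : ℕ) :
    ∀ χ, TestIn U χ → ∃ C, ∀ ξ : E2, ‖ξ‖ ^ m * |Ic f χ ξ| ≤ C ∧ ‖ξ‖ ^ m * |Is f χ ξ| ≤ C := by
  induction m with
  | zero => intro χ h; simpa using I_bound0 hf h
  | succ m ih =>
    intro χ h
    obtain ⟨C0, h0⟩ := I_bound0 hf h
    obtain ⟨C1, h1⟩ := ih χ h
    obtain ⟨C2, h2⟩ := ih _ h.lap
    obtain ⟨C3, h3⟩ := ih _ (h.pd ee0)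
    obtain ⟨C4, h4⟩ := ih _ (h.pd ee1)
    refine ⟨C0 + C2 + |l| * C1 + 4 * Real.pi * (C3 + C4), fun ξ => ⟨?_, ?_⟩⟩
    · refine aux_step (s0 := - ξ 0) (s1 := - ξ 1) (norm_nonneg _) ?_ ?_ (h0 ξ).1 (h1 ξ).1 (h2 ξ).1 (h3 ξ).2 (h4 ξ).2 ?_
      · rw [abs_neg]; exact abs_coord_le ξ 0
      · rw [abs_neg]; exact abs_coord_le ξ 1
      · rw [Ic_id hf hw h]; ring
    · exact aux_step (norm_nonneg _) (abs_coord_le ξ 0) (abs_coord_le ξ 1) (h0 ξ).2 (h1 ξ).2 (h2 ξ).2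
        (h3 ξ).1 (h4 ξ).1 (Is_id hf hw h ξ)

theorem fourier_split {U : Set E2} {f χ : E2 → ℝ} (hf : Integrable f) (h : TestIn U χ) (ξ : E2) :
    𝓕 (fun x => ((f x * χ x : ℝ) : ℂ)) ξ = (Ic f χ ξ : ℂ) - (Is f χ ξ : ℂ) * Complex.I := by
  rw [Real.fourier_eq']
  have e : ∀ v : E2, Complex.exp ((↑(-2 * Real.pi * ⟪v, ξ⟫) * Complex.I)) • ((f v * χ v : ℝ) : ℂ) =
    ((f v * (χ v * Real.cos (ph ξ v)) : ℝ) : ℂ) - ((f v * (χ v * Real.sin (ph ξ v)) : ℝ) : ℂ) * Complex.I := by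
    intro v
    have : -2 * Real.pi * ⟪v, ξ⟫ = - ph ξ v := by simp only [ph, sub_zero, inner_smul_right]; ring
    rw [this, Complex.exp_mul_I, ← Complex.ofReal_cos, ← Complex.ofReal_sin, Real.cos_neg, Real.sin_neg]
    push_cast; simp; ring
  simp only [e]
  rw [integral_sub, integral_mul_const]
  · have h1 := integral_ofReal (𝕜 := ℂ) (μ := (volume : Measure E2)) (f := fun v => f v * (χ v * Real.cos (ph ξ v)))
    have h2 := integral_ofReal (𝕜 := ℂ) (μ := (volume : Measure E2)) (f := fun v => f v * (χ v * Real.sin (ph ξ v)))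
    exact congrArg₂ (fun a b => a - b * Complex.I) h1 h2
  · exact ((h.mul_cos ξ).integrable_mul hf).ofReal
  · exact (((h.mul_sin ξ).integrable_mul hf).ofReal).mul_const _

theorem weyl_loc {U : Set E2} {l : ℝ} {f χ : E2 → ℝ} (hf : Integrable f) (hw : WeakSol U l f)
    (h : TestIn U χ) : ∃ G : E2 → ℝ, ContDiff ℝ ∞ G ∧ ∀ᵐ x, f x * χ x = G x := by
  set g : E2 → ℂ := fun x => ((f x * χ x : ℝ) : ℂ) with hg
  have gi : Integrable g := (h.integrable_mul hf).ofReal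
  have bd : ∀ m : ℕ, ∃ C, ∀ ξ : E2, ‖ξ‖ ^ m * ‖𝓕 g ξ‖ ≤ C := by
    intro m
    obtain ⟨C, hC⟩ := I_bound hf hw m χ h
    refine ⟨C + C, fun ξ => ?_⟩
    rw [fourier_split hf h]
    have : ‖(Ic f χ ξ : ℂ) - (Is f χ ξ : ℂ) * Complex.I‖ ≤ |Ic f χ ξ| + |Is f χ ξ| := by
      refine (norm_sub_le _ _).trans ?_
      simp
    calc _ ≤ ‖ξ‖ ^ m * (|Ic f χ ξ| + |Is f χ ξ|) := by gcongr
      _ ≤ _ := by rw [mul_add]; exact add_le_add (hC ξ).1 (hC ξ).2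
  have cont : Continuous (𝓕 g) := by
    exact VectorFourier.fourierIntegral_continuous Real.continuous_fourierChar (by exact continuous_inner) gi
  have int : ∀ k : ℕ, Integrable (fun ξ : E2 => ‖ξ‖ ^ k * ‖𝓕 g ξ‖) := by
    intro k
    obtain ⟨C1, h1⟩ := bd 0
    obtain ⟨C2, h2⟩ := bd (k + (volume : Measure E2).integrablePower)
    exact integrable_of_le_of_pow_mul_le (by simpa using h1) h2 cont.aestronglyMeasurable
  have int0 : Integrable (𝓕 g) := by
    have := int 0
    simp only [pow_zero, one_mul] at this
    exact (integrable_norm_iff cont.aestronglyMeasurable).1 this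
  have sm : ContDiff ℝ ∞ (𝓕⁻ (𝓕 g)) := by
    have : ContDiff ℝ (⊤ : ℕ∞) (𝓕 (𝓕 g)) := Real.contDiff_fourier (fun n _ => int n)
    have e : 𝓕⁻ (𝓕 g) = fun w => 𝓕 (𝓕 g) (-w) := by
      ext w; exact Real.fourierInv_eq_fourier_neg _ _
    rw [e]
    exact this.comp contDiff_neg
  have ae : ∀ᵐ x, g x = 𝓕⁻ (𝓕 g) x := by
    refine ae_eq_of_integral_contDiff_smul_eq gi.locallyIntegrable sm.continuous.locallyIntegrable ?_
    intro φ hφ hc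
    have hc' : HasCompactSupport (fun x => ((φ x : ℝ) : ℂ)) := hc.comp_left (g := Complex.ofReal) rfl
    have hφ' : ContDiff ℝ ∞ (fun x => ((φ x : ℝ) : ℂ)) := Complex.ofRealCLM.contDiff.comp hφ
    set Φ : SchwartzMap E2 ℂ := hc'.toSchwartzMap hφ'
    have Φe : ∀ x, Φ x = (φ x : ℂ) := fun x => rfl
    have inv : 𝓕 (𝓕⁻ Φ) = Φ := FourierTransform.fourier_fourierInv_eq Φ
    have s1 : ∫ x, φ x • 𝓕⁻ (𝓕 g) x = ∫ x, (𝓕⁻ Φ) x * 𝓕 g x := by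
      have := VectorFourier.integral_fourierIntegral_smul_eq_flip (e := Real.fourierChar) (μ := (volume : Measure E2)) (ν := (volume : Measure E2))
        (L := - innerₗ E2) (f := Φ) (g := 𝓕 g) Real.continuous_fourierChar (by simpa using! continuous_inner.neg) Φ.integrable int0
      have e1 : ∀ ξ, (𝓕⁻ Φ) ξ = VectorFourier.fourierIntegral Real.fourierChar volume (- innerₗ E2) Φ ξ := by
        intro ξ
        rw [SchwartzMap.fourierInv_coe]; rfl
      have e2 : ∀ x, 𝓕⁻ (𝓕 g) x = VectorFourier.fourierIntegral Real.fourierChar volume (- innerₗ E2).flip (𝓕 g) x := by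
        intro x
        simp [Real.fourierInv_eq, VectorFourier.fourierIntegral, real_inner_comm]
      simp only [e1, e2]
      simp only [smul_eq_mul] at this
      rw [this]
      refine integral_congr_ae (ae_of_all _ fun x => ?_)
      simp [Φe]
    have s2 : ∫ x, φ x • g x = ∫ x, (𝓕⁻ Φ) x * 𝓕 g x := by
      have := VectorFourier.integral_fourierIntegral_smul_eq_flip (e := Real.fourierChar) (μ := (volume : Measure E2)) (ν := (volume : Measure E2))
        (L := innerₗ E2) (f := (𝓕⁻ Φ : SchwartzMap E2 ℂ)) (g := g) Real.continuous_fourierChar (by exact continuous_inner) (𝓕⁻ Φ : SchwartzMap E2 ℂ).integrable gi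
      have e1 : ∀ ξ, Φ ξ = VectorFourier.fourierIntegral Real.fourierChar volume (innerₗ E2) (𝓕⁻ Φ : SchwartzMap E2 ℂ) ξ := by
        intro ξ
        conv_lhs => rw [← inv]
        rw [SchwartzMap.fourier_coe]; rfl
      have e2 : ∀ x, 𝓕 g x = VectorFourier.fourierIntegral Real.fourierChar volume (innerₗ E2).flip g x := by
        intro x
        simp [Real.fourier_eq, VectorFourier.fourierIntegral, real_inner_comm]
      simp only [e2]
      simp only [smul_eq_mul] at this
      rw [← this]
      refine integral_congr_ae (ae_of_all _ fun x => ?_)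
      simp only [← e1, Φe]; simp
    rw [s1, s2]
  refine ⟨fun x => (𝓕⁻ (𝓕 g) x).re, Complex.reCLM.contDiff.comp sm, ?_⟩
  filter_upwards [ae] with x hx
  rw [← hx, hg]; simp
end

section
open MeasureTheory Filter Topology
open scoped ContDiff FourierTransform RealInnerProductSpace

theorem weyl {c : E2} {R l : ℝ} {f : E2 → ℝ} (hR : 0 < R) (hf : Integrable f)
    (hw : WeakSol (Metric.ball c R) l f) :
    ∃ G : E2 → ℝ, ContDiff ℝ ∞ G ∧ ∀ᵐ x, x ∈ Metric.ball c (R / 2) → f x = G x := by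
  let b : ContDiffBump c := ⟨R / 2, 3 * R / 4, by linarith, by linarith⟩
  have hb : TestIn (Metric.ball c R) b := by
    refine ⟨b.contDiff, b.hasCompactSupport, ?_⟩
    rw [b.tsupport_eq]
    exact Metric.closedBall_subset_ball (by show 3 * R / 4 < R; linarith)
  obtain ⟨G, hG, h⟩ := weyl_loc hf hw hb
  refine ⟨G, hG, ?_⟩
  filter_upwards [h] with x hx hxb
  have : b x = 1 := b.one_of_mem_closedBall (Metric.ball_subset_closedBall hxb)
  rw [← hx, this, mul_one]

/-! ### Geometry of triangles -/

def cr (a b : E2) : ℝ := a 0 * b 1 - a 1 * b 0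
def rot (a : E2) : E2 := !₂[-a 1, a 0]
@[simp] theorem rot_zero_apply (a : E2) : rot a 0 = - a 1 := rfl
@[simp] theorem rot_one_apply (a : E2) : rot a 1 = a 0 := rfl

/-- doubled signed area -/
def dt (A B C : E2) : ℝ := cr (B - A) (C - A)
theorem dt_cyc (A B C : E2) : dt B C A = dt A B C := by
  simp only [dt, cr, PiLp.sub_apply]; ring

theorem dt_ne {A B C : E2} (h : AffineIndependent ℝ ![A, B, C]) : dt A B C ≠ 0 := by
  intro h0
  rw [affineIndependent_iff_linearIndependent_vsub ℝ _ (0 : Fin 3)] at h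
  have hl : ∀ s t : ℝ, s • (B - A) + t • (C - A) = 0 → s = 0 ∧ t = 0 := by
    have h2 := (LinearIndependent.pair_iff (R := ℝ) (x := B - A) (y := C - A)).1 (by
      have := h.comp (fun i : Fin 2 => if i = 0 then (⟨1, by simp⟩ : {x : Fin 3 // x ≠ 0}) else ⟨2, by simp⟩)
        (by intro i j hij; fin_cases i <;> fin_cases j <;> simp_all)
      convert this using 1
      ext i; fin_cases i <;> simp)
    exact h2
  simp only [dt, cr, PiLp.sub_apply] at h0
  have h1 := hl ((C - A) 0) (-(B - A) 0) (by
    ext i; fin_cases i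
    · simp; ring
    · simp; linarith)
  have h2 := hl ((C - A) 1) (-(B - A) 1) (by
    ext i; fin_cases i
    · simp; linarith
    · simp; ring)
  have : (1 : ℝ) = 0 := (hl 1 0 (by
    have e1 : (B - A) 0 = 0 := by linarith [h1.2]
    have e2 : (B - A) 1 = 0 := by linarith [h2.2]
    ext i; fin_cases i
    · simpa using e1
    · simpa using e2)).1
  exact one_ne_zero this

/-- barycentric coordinate of `x` with respect to `A` -/
def bcc (A B C x : E2) : ℝ := cr (C - B) (x - B) / dt A B C

theorem bcc_sum {A B C : E2} (h : dt A B C ≠ 0) (x : E2) :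
    bcc A B C x + bcc B C A x + bcc C A B x = 1 := by
  simp only [bcc, dt_cyc A B C, dt_cyc B C A, ← add_div]
  rw [div_eq_one_iff_eq h]
  simp only [dt, cr, PiLp.sub_apply]; ring

theorem bcc_comb {A B C : E2} (h : dt A B C ≠ 0) (x : E2) :
    bcc A B C x • A + bcc B C A x • B + bcc C A B x • C = x := by
  ext i
  simp only [bcc, dt_cyc A B C, dt_cyc B C A, PiLp.add_apply, PiLp.smul_apply, smul_eq_mul]
  have : ∀ a b c : ℝ, a / dt A B C * A i + b / dt A B C * B i + c / dt A B C * C i = (a * A i + b * B i + c * C i) / dt A B C := by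
    intro a b c; ring
  rw [this, div_eq_iff h]
  fin_cases i <;> simp only [dt, cr, PiLp.sub_apply, Fin.zero_eta, Fin.mk_one] <;> ring

theorem bcc_affine {A B C : E2} (h : dt A B C ≠ 0) (a b c : ℝ) (habc : a + b + c = 1) :
    bcc A B C (a • A + b • B + c • C) = a := by
  have hc : c = 1 - a - b := by linarith
  subst hc
  rw [bcc, div_eq_iff h]
  simp only [dt, cr, PiLp.sub_apply, PiLp.add_apply, PiLp.smul_apply, smul_eq_mul]; ring

/-- unit inner normal of side `BC` -/
def nrm (A B C : E2) : E2 := (SignType.sign (dt A B C) / ‖C - B‖ : ℝ) • rot (C - B)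
/-- height -/
def hgt (A B C : E2) : ℝ := |dt A B C| / ‖C - B‖

def ell (A B C x : E2) : ℝ := ⟪x - B, nrm A B C⟫

theorem side_ne {A B C : E2} (h : dt A B C ≠ 0) : C - B ≠ 0 := by
  intro h0
  have e : C = B := sub_eq_zero.1 h0
  apply h; rw [e]; simp only [dt, cr, PiLp.sub_apply]; ring

theorem hgt_pos {A B C : E2} (h : dt A B C ≠ 0) : 0 < hgt A B C :=
  div_pos (abs_pos.2 h) (norm_pos_iff.2 (side_ne h))

theorem ell_eq {A B C : E2} (h : dt A B C ≠ 0) (x : E2) :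
    ell A B C x = hgt A B C * bcc A B C x := by
  have h1 : ‖C - B‖ ≠ 0 := norm_ne_zero_iff.2 (side_ne h)
  simp only [ell, nrm, hgt, bcc, inner_smul_right]
  have e : ⟪x - B, rot (C - B)⟫ = cr (C - B) (x - B) := by
    rw [inner_e2]; simp only [cr, rot_zero_apply, rot_one_apply]; ring
  rw [e]
  have : |dt A B C| = SignType.sign (dt A B C) * dt A B C := (sign_mul_self _).symm
  rw [this]; field_simp

theorem norm_rot (a : E2) : ‖rot a‖ = ‖a‖ := by
  have : ‖rot a‖ ^ 2 = ‖a‖ ^ 2 := by rw [normsq_e2, normsq_e2]; simp; ring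
  exact (pow_left_inj₀ (norm_nonneg _) (norm_nonneg _) two_ne_zero).1 this

theorem norm_nrm {A B C : E2} (h : dt A B C ≠ 0) : ‖nrm A B C‖ = 1 := by
  have h1 : ‖C - B‖ ≠ 0 := norm_ne_zero_iff.2 (side_ne h)
  rw [nrm, norm_smul, norm_rot, norm_div, norm_norm]
  rcases lt_or_gt_of_ne h with h | h
  · simp [sign_neg h, h1]
  · simp [sign_pos h, h1]

theorem inner_nrm (A B C : E2) : ⟪C - B, nrm A B C⟫ = 0 := by
  rw [nrm, inner_smul_right, inner_e2]; simp only [rot_zero_apply, rot_one_apply]; ring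

theorem nrm_perp {A B C w : E2} (h : dt A B C ≠ 0) (hw : ⟪w, C - B⟫ = 0) : ∃ s : ℝ, w = s • nrm A B C := by
  have h1 : ‖C - B‖ ^ 2 ≠ 0 := pow_ne_zero _ (norm_ne_zero_iff.2 (side_ne h))
  rw [normsq_e2] at h1
  have h2 : (SignType.sign (dt A B C) : ℝ) ≠ 0 := by
    rcases lt_or_gt_of_ne h with h | h
    · simp [sign_neg h]
    · simp [sign_pos h]
  have h3 : ‖C - B‖ ≠ 0 := norm_ne_zero_iff.2 (side_ne h)
  refine ⟨⟪w, rot (C - B)⟫ / ((C - B) 0 ^ 2 + (C - B) 1 ^ 2) * (SignType.sign (dt A B C) / ‖C - B‖ : ℝ)⁻¹, ?_⟩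
  rw [nrm, smul_smul, mul_assoc, inv_mul_cancel₀ (div_ne_zero h2 h3), mul_one]
  rw [inner_e2] at hw ⊢
  set p := (C - B) 0
  set q := (C - B) 1
  ext i; fin_cases i
  · simp only [PiLp.smul_apply, smul_eq_mul, rot_zero_apply, rot_one_apply, Fin.zero_eta]
    field_simp
    linear_combination p * hw
  · simp only [PiLp.smul_apply, smul_eq_mul, rot_zero_apply, rot_one_apply, Fin.mk_one]
    field_simp
    linear_combination q * hw

theorem Tri_cyc (A B C : E2) : Tri B C A = Tri A B C := by
  simp only [Tri]; congr 1; ext x; simp; tauto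
theorem Vtx_cyc (A B C : E2) : Vtx B C A = Vtx A B C := by
  simp only [Vtx]; ext x; simp; tauto
theorem TriDom_cyc (A B C : E2) : TriDom B C A = TriDom A B C := by
  simp only [TriDom, Tri_cyc, Vtx_cyc]

theorem continuous_ell (A B C : E2) : Continuous (ell A B C) := by
  unfold ell; fun_prop

theorem ell_lin (A B C x y : E2) (a b : ℝ) (h : a + b = 1) :
    ell A B C (a • x + b • y) = a * ell A B C x + b * ell A B C y := by
  have : a • x + b • y - B = a • (x - B) + b • (y - B) := by
    have : B = a • B + b • B := by rw [← add_smul, h, one_smul]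
    conv_lhs => rw [this]
    module
  simp only [ell, this, inner_add_left, inner_smul_left]; simp

theorem bcc_nonneg_iff {A B C : E2} (h : dt A B C ≠ 0) (x : E2) : 0 ≤ bcc A B C x ↔ 0 ≤ ell A B C x := by
  rw [ell_eq h, mul_nonneg_iff_of_pos_left (hgt_pos h)]
theorem bcc_pos_iff {A B C : E2} (h : dt A B C ≠ 0) (x : E2) : 0 < bcc A B C x ↔ 0 < ell A B C x := by
  rw [ell_eq h, mul_pos_iff_of_pos_left (hgt_pos h)]
theorem bcc_zero_iff {A B C : E2} (h : dt A B C ≠ 0) (x : E2) : bcc A B C x = 0 ↔ ell A B C x = 0 := by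
  rw [ell_eq h]; simp [(hgt_pos h).ne']

theorem mem_Tri' {A B C : E2} (h : dt A B C ≠ 0) (x : E2) :
    x ∈ Tri A B C ↔ 0 ≤ bcc A B C x ∧ 0 ≤ bcc B C A x ∧ 0 ≤ bcc C A B x := by
  have h2 : dt B C A ≠ 0 := by rwa [dt_cyc]
  have h3 : dt C A B ≠ 0 := by rwa [dt_cyc, dt_cyc]
  constructor
  · intro hx
    simp only [Tri, convexHull_insert (insert_nonempty B {C}), convexHull_insert (singleton_nonempty C)] at hx
    simp only [convexHull_singleton, segment_eq_image, mem_convexJoin] at hx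
    obtain ⟨p, hp, q, ⟨r, hr, s, hs, t, ht, rfl⟩, θ, hθ, rfl⟩ := hx
    simp only [mem_singleton_iff] at hp hr hs
    subst hp hr hs
    have e : ∀ P Q R : E2, (1 - θ) • P + θ • ((1 - t) • Q + t • R) = (1 - θ) • P + (θ * (1 - t)) • Q + (θ * t) • R := by
      intros; module
    have e2 : ∀ a b c : ℝ, a • p + b • r + c • s = b • r + c • s + a • p := by intros; module
    have e3 : ∀ a b c : ℝ, a • p + b • r + c • s = c • s + a • p + b • r := by intros; module
    have t0 := ht.1
    have t1 := ht.2
    have s0 := hθ.1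
    have s1 := hθ.2
    simp only [e]
    refine ⟨?_, ?_, ?_⟩
    · rw [bcc_affine h _ _ _ (by ring)]; linarith
    · rw [e2, bcc_affine h2 _ _ _ (by ring)]; exact mul_nonneg s0 (by linarith)
    · rw [e3, bcc_affine h3 _ _ _ (by ring)]; exact mul_nonneg s0 t0
  · rintro ⟨h1, h2, h3⟩
    rw [← bcc_comb h x]
    have hA : A ∈ Tri A B C := subset_convexHull ℝ _ (by simp)
    have hB : B ∈ Tri A B C := subset_convexHull ℝ _ (by simp)
    have hC : C ∈ Tri A B C := subset_convexHull ℝ _ (by simp)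
    have := (convex_convexHull ℝ ({A, B, C} : Set E2)).sum_mem (t := Finset.univ) (w := ![bcc A B C x, bcc B C A x, bcc C A B x])
      (z := ![A, B, C]) (by intro i _; fin_cases i <;> simpa) (by simpa [Fin.sum_univ_three] using bcc_sum h x)
      (by intro i _; fin_cases i <;> simpa)
    simpa [Fin.sum_univ_three, Tri] using this

theorem mem_Tri {A B C : E2} (h : dt A B C ≠ 0) (x : E2) :
    x ∈ Tri A B C ↔ 0 ≤ ell A B C x ∧ 0 ≤ ell B C A x ∧ 0 ≤ ell C A B x := by
  rw [mem_Tri' h, bcc_nonneg_iff h, bcc_nonneg_iff (by rwa [dt_cyc]), bcc_nonneg_iff (by rwa [dt_cyc, dt_cyc])]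

theorem ell_add_smul (A B C x w : E2) (t : ℝ) : ell A B C (x + t • w) = ell A B C x + t * ⟪w, nrm A B C⟫ := by
  have : x + t • w - B = (x - B) + t • w := by abel
  simp only [ell, this, inner_add_left, inner_smul_left]; simp

theorem ell_lip {A B C : E2} (h : dt A B C ≠ 0) (x y : E2) : |ell A B C x - ell A B C y| ≤ ‖x - y‖ := by
  have : ell A B C x - ell A B C y = ⟪x - y, nrm A B C⟫ := by
    simp only [ell, ← inner_sub_left]; congr 1; abel
  rw [this]
  refine (abs_real_inner_le_norm _ _).trans ?_
  rw [norm_nrm h, mul_one]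

theorem mem_int {A B C : E2} (h : dt A B C ≠ 0) (x : E2) :
    x ∈ interior (Tri A B C) ↔ 0 < ell A B C x ∧ 0 < ell B C A x ∧ 0 < ell C A B x := by
  have key : ∀ A B C : E2, dt A B C ≠ 0 → x ∈ interior (Tri A B C) → 0 < ell A B C x := by
    intro A B C h hx
    have hc : Tendsto (fun t : ℝ => x + t • nrm A B C) (𝓝 0) (𝓝 x) := by
      have : Continuous (fun t : ℝ => x + t • nrm A B C) := by fun_prop
      simpa using this.tendsto 0
    have ev := hc.eventually (mem_interior_iff_mem_nhds.1 hx)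
    obtain ⟨ε, hε, hb⟩ := Metric.eventually_nhds_iff.1 ev
    have := hb (y := -(ε / 2)) (by simp [abs_of_pos hε, hε])
    have := ((mem_Tri h _).1 this).1
    rw [ell_add_smul, real_inner_self_eq_norm_sq, norm_nrm h] at this
    linarith
  constructor
  · intro hx
    exact ⟨key _ _ _ h hx, key _ _ _ (by rwa [dt_cyc]) (by rwa [Tri_cyc]), key _ _ _ (by rwa [dt_cyc, dt_cyc]) (by rwa [Tri_cyc, Tri_cyc])⟩
  · intro hx
    rw [mem_interior]
    refine ⟨{x | 0 < ell A B C x ∧ 0 < ell B C A x ∧ 0 < ell C A B x}, ?_, ?_, hx⟩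
    · intro y hy; exact (mem_Tri h y).2 ⟨hy.1.le, hy.2.1.le, hy.2.2.le⟩
    · exact (isOpen_lt continuous_const (continuous_ell _ _ _)).inter
        ((isOpen_lt continuous_const (continuous_ell _ _ _)).inter (isOpen_lt continuous_const (continuous_ell _ _ _)))

theorem Tri_compact (A B C : E2) : IsCompact (Tri A B C) := by
  unfold Tri; exact (Set.toFinite ({A, B, C} : Set E2)).isCompact_convexHull ℝ
theorem Tri_convex (A B C : E2) : Convex ℝ (Tri A B C) := convex_convexHull _ _
theorem Tri_meas (A B C : E2) : MeasurableSet (Tri A B C) := (Tri_compact A B C).isClosed.measurableSet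

theorem Tri_int_nonempty {A B C : E2} (h : dt A B C ≠ 0) : (interior (Tri A B C)).Nonempty := by
  refine ⟨(1/3 : ℝ) • A + (1/3 : ℝ) • B + (1/3 : ℝ) • C, ?_⟩
  have h2 : dt B C A ≠ 0 := by rwa [dt_cyc]
  have h3 : dt C A B ≠ 0 := by rwa [dt_cyc, dt_cyc]
  rw [mem_int h, ← bcc_pos_iff h, ← bcc_pos_iff h2, ← bcc_pos_iff h3]
  refine ⟨?_, ?_, ?_⟩
  · rw [bcc_affine h _ _ _ (by norm_num)]; norm_num
  · rw [show (1/3 : ℝ) • A + (1/3 : ℝ) • B + (1/3 : ℝ) • C = (1/3 : ℝ) • B + (1/3 : ℝ) • C + (1/3 : ℝ) • A by abel,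
      bcc_affine h2 _ _ _ (by norm_num)]; norm_num
  · rw [show (1/3 : ℝ) • A + (1/3 : ℝ) • B + (1/3 : ℝ) • C = (1/3 : ℝ) • C + (1/3 : ℝ) • A + (1/3 : ℝ) • B by abel,
      bcc_affine h3 _ _ _ (by norm_num)]; norm_num

theorem Tri_sub_closure {A B C : E2} (h : dt A B C ≠ 0) : Tri A B C ⊆ closure (interior (Tri A B C)) := by
  rw [(Tri_convex A B C).closure_interior_eq_closure_of_nonempty_interior (Tri_int_nonempty h)]
  exact subset_closure

theorem Vtx_closed (A B C : E2) : IsClosed (Vtx A B C) := by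
  unfold Vtx; exact (Set.toFinite _).isClosed

theorem TriDom_ud {A B C : E2} (h : dt A B C ≠ 0) : UniqueDiffOn ℝ (TriDom A B C) :=
  (uniqueDiffOn_convex (Tri_convex A B C) (Tri_int_nonempty h)).inter (Vtx_closed A B C).isOpen_compl

/-- two vanishing coordinates mean a vertex -/
theorem two_zero {A B C x : E2} (h : dt A B C ≠ 0) (h1 : ell A B C x = 0) (h2 : ell B C A x = 0) : x = C := by
  have e1 := (bcc_zero_iff h x).2 h1
  have e2 := (bcc_zero_iff (by rwa [dt_cyc]) x).2 h2
  have e3 := bcc_sum h x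
  have := bcc_comb h x
  rw [e1, e2] at this e3
  simp only [zero_add] at e3
  rw [e3] at this
  simpa using this.symm

theorem interior_sub_TriDom {A B C : E2} (h : dt A B C ≠ 0) : interior (Tri A B C) ⊆ TriDom A B C := by
  intro x hx
  refine ⟨interior_subset hx, ?_⟩
  have hx' := (mem_int h x).1 hx
  have z : ∀ A B C : E2, ell A B C B = 0 := by intro A B C; simp [ell]
  have z2 : ∀ A B C : E2, ell A B C C = 0 := by intro A B C; simp only [ell]; exact inner_nrm _ _ _
  rintro (rfl | rfl | rfl)
  · have := z2 B C x; linarith [hx'.2.1]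
  · have := z A x C; linarith [hx'.1]
  · have := z2 A B x; linarith [hx'.1]

/-- points of the domain: interior or on exactly one side -/
theorem side_pos {A B C x : E2} (h : dt A B C ≠ 0) (hx : x ∈ TriDom A B C) (h1 : ell A B C x = 0) :
    0 < ell B C A x ∧ 0 < ell C A B x := by
  have hm := (mem_Tri h x).1 hx.1
  have h2 : dt B C A ≠ 0 := by rwa [dt_cyc]
  have h3 : dt C A B ≠ 0 := by rwa [dt_cyc]
  constructor
  · refine lt_of_le_of_ne hm.2.1 fun e => hx.2 ?_
    rw [two_zero h h1 e.symm]; simp [Vtx]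
  · refine lt_of_le_of_ne hm.2.2 fun e => hx.2 ?_
    rw [two_zero h3 e.symm h1]; simp [Vtx]

theorem mem_openSegment_iff' {A B C x : E2} (h : dt A B C ≠ 0) :
    x ∈ openSegment ℝ B C ↔ x ∈ TriDom A B C ∧ ell A B C x = 0 := by
  have h2 : dt B C A ≠ 0 := by rwa [dt_cyc]
  have h3 : dt C A B ≠ 0 := by rwa [dt_cyc]
  constructor
  · rintro ⟨a, b, ha, hb, hab, rfl⟩
    have e1 : bcc A B C (a • B + b • C) = 0 := by
      rw [show a • B + b • C = (0:ℝ) • A + a • B + b • C by simp]; exact bcc_affine h _ _ _ (by linarith)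
    have e2 : bcc B C A (a • B + b • C) = a := by
      rw [show a • B + b • C = a • B + b • C + (0:ℝ) • A by simp]; exact bcc_affine h2 _ _ _ (by linarith)
    have e3 : bcc C A B (a • B + b • C) = b := by
      rw [show a • B + b • C = b • C + (0:ℝ) • A + a • B by simp; abel]; exact bcc_affine h3 _ _ _ (by linarith)
    refine ⟨⟨(mem_Tri' h _).2 ⟨e1.ge, by rw [e2]; exact ha.le, by rw [e3]; exact hb.le⟩, ?_⟩, (bcc_zero_iff h _).1 e1⟩
    have fA : bcc A B C A = 1 := by simpa using bcc_affine h 1 0 0 (by norm_num)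
    have fB : bcc B C A B = 1 := by simpa using bcc_affine h2 1 0 0 (by norm_num)
    have fC : bcc C A B C = 1 := by simpa using bcc_affine h3 1 0 0 (by norm_num)
    rintro (hv | hv | hv)
    · rw [hv, fA] at e1; norm_num at e1
    · rw [hv, fB] at e2; linarith
    · rw [mem_singleton_iff] at hv; rw [hv, fC] at e3; linarith
  · rintro ⟨hx, h1⟩
    obtain ⟨p2, p3⟩ := side_pos h hx h1
    have e1 := (bcc_zero_iff h x).2 h1
    have s := bcc_sum h x
    have := bcc_comb h x
    rw [e1] at s this
    refine ⟨bcc B C A x, bcc C A B x, (bcc_pos_iff h2 x).2 p2, (bcc_pos_iff h3 x).2 p3, by linarith, by simpa using this⟩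

/-- Local structure near a side point. -/
theorem loc_side {A B C x : E2} (h : dt A B C ≠ 0) (hx : x ∈ TriDom A B C) (h1 : ell A B C x = 0) :
    ∃ r > 0, ∀ y ∈ Metric.ball x r, (y ∈ Tri A B C ↔ 0 ≤ ell A B C y) ∧ (y ∉ Vtx A B C) := by
  obtain ⟨p2, p3⟩ := side_pos h hx h1
  have e1 : ∀ᶠ y in 𝓝 x, 0 < ell B C A y := (continuous_ell _ _ _).continuousAt.eventually (lt_mem_nhds p2)
  have e2 : ∀ᶠ y in 𝓝 x, 0 < ell C A B y := (continuous_ell _ _ _).continuousAt.eventually (lt_mem_nhds p3)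
  have e3 : ∀ᶠ y in 𝓝 x, y ∉ Vtx A B C := (Vtx_closed A B C).isOpen_compl.mem_nhds hx.2
  obtain ⟨r, hr, hb⟩ := Metric.eventually_nhds_iff_ball.1 (e1.and (e2.and e3))
  refine ⟨r, hr, fun y hy => ?_⟩
  obtain ⟨a, b, c⟩ := hb y hy
  refine ⟨?_, c⟩
  rw [mem_Tri h]
  exact ⟨fun h => h.1, fun h => ⟨h, a.le, b.le⟩⟩
end

section
open MeasureTheory Filter Topology
open scoped ContDiff FourierTransform RealInnerProductSpace

def gsq (f : E2 → ℝ) (x : E2) : ℝ := (pd ee0 f x) ^ 2 + (pd ee1 f x) ^ 2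

theorem gsq_nonneg (f : E2 → ℝ) (x : E2) : 0 ≤ gsq f x := by unfold gsq; positivity

theorem pd_cont {f : E2 → ℝ} (hf : ContDiff ℝ 1 f) (v : E2) : Continuous (pd v f) := by
  exact (hf.continuous_fderiv (by norm_num)).clm_apply continuous_const

theorem gsq_cont {f : E2 → ℝ} (hf : ContDiff ℝ 1 f) : Continuous (gsq f) :=
  ((pd_cont hf ee0).pow 2).add ((pd_cont hf ee1).pow 2)

theorem pd_sq_le (f : E2 → ℝ) (x v : E2) : (pd v f x) ^ 2 ≤ ‖v‖ ^ 2 * gsq f x := by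
  have : pd v f x = v 0 * pd ee0 f x + v 1 * pd ee1 f x := fderiv_decomp _ _
  rw [this, normsq_e2, gsq]
  nlinarith [sq_nonneg (v 0 * pd ee1 f x - v 1 * pd ee0 f x)]

theorem seg_bound {f : E2 → ℝ} (hf : ContDiff ℝ 1 f) (x y : E2) :
    (f x - f y) ^ 2 ≤ ‖x - y‖ ^ 2 * ∫ t in (0:ℝ)..1, gsq f (y + t • (x - y)) := by
  have hd : ∀ t : ℝ, HasDerivAt (fun t : ℝ => f (y + t • (x - y))) (pd (x - y) f (y + t • (x - y))) t := by
    intro t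
    have h1 : HasDerivAt (fun t : ℝ => y + t • (x - y)) (x - y) t := by
      simpa using ((hasDerivAt_id t).smul_const (x - y)).const_add y
    exact ((hf.differentiable (by norm_num) _).hasFDerivAt.comp_hasDerivAt t h1)
  have hcont : Continuous fun t : ℝ => pd (x - y) f (y + t • (x - y)) :=
    (pd_cont hf _).comp (by fun_prop)
  have hcont2 : Continuous fun t : ℝ => gsq f (y + t • (x - y)) :=
    (gsq_cont hf).comp (by fun_prop)
  have ftc := intervalIntegral.integral_eq_sub_of_hasDerivAt (fun t _ => hd t) (hcont.intervalIntegrable 0 1)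
  simp only [one_smul, zero_smul, add_zero, add_sub_cancel] at ftc
  rw [← ftc]
  set I := ∫ t in (0:ℝ)..1, pd (x - y) f (y + t • (x - y))
  have h0 : 0 ≤ ∫ t in (0:ℝ)..1, (pd (x - y) f (y + t • (x - y)) - I) ^ 2 :=
    intervalIntegral.integral_nonneg (by norm_num) (fun _ _ => sq_nonneg _)
  have e : ∀ t : ℝ, (pd (x - y) f (y + t • (x - y)) - I) ^ 2 = (pd (x - y) f (y + t • (x - y))) ^ 2
     - (2 * I) * pd (x - y) f (y + t • (x - y)) + I ^ 2 := by intro t; ring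
  simp only [e] at h0
  have c1 : Continuous fun t : ℝ => (pd (x - y) f (y + t • (x - y))) ^ 2 := hcont.pow 2
  have c2 : Continuous fun t : ℝ => (2 * I) * pd (x - y) f (y + t • (x - y)) := hcont.const_mul _
  have c3 : Continuous fun t : ℝ => (pd (x - y) f (y + t • (x - y))) ^ 2 - (2 * I) * pd (x - y) f (y + t • (x - y)) := c1.sub c2
  rw [intervalIntegral.integral_add (c3.intervalIntegrable 0 1) (by simp),
    intervalIntegral.integral_sub (c1.intervalIntegrable 0 1) (c2.intervalIntegrable 0 1),
    intervalIntegral.integral_const_mul] at h0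
  simp only [intervalIntegral.integral_const, sub_zero, one_smul] at h0
  have h2 : ∫ t in (0:ℝ)..1, (pd (x - y) f (y + t • (x - y))) ^ 2 ≤ ∫ t in (0:ℝ)..1, ‖x - y‖ ^ 2 * gsq f (y + t • (x - y)) :=
    intervalIntegral.integral_mono_on (by norm_num) ((hcont.pow 2).intervalIntegrable _ _)
      ((hcont2.const_mul _).intervalIntegrable _ _) (fun t _ => pd_sq_le f _ _)
  rw [intervalIntegral.integral_const_mul] at h2
  change 0 ≤ (∫ t in (0:ℝ)..1, (pd (x - y) f (y + t • (x - y))) ^ 2) - 2 * I * I + I ^ 2 at h0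
  nlinarith

theorem lint_aff {t : ℝ} (ht : 1 / 2 ≤ t) (c : E2) {H : E2 → ENNReal} (hH : Measurable H) :
    ∫⁻ x, H (t • x + c) ≤ 4 * ∫⁻ x, H x := by
  have t0 : t ≠ 0 := by positivity
  have h1 : ∫⁻ x, H (t • x + c) = ∫⁻ y, H (y + c) ∂(Measure.map (fun x : E2 => t • x) volume) := by
    have hm : Measurable fun y => H (y + c) := hH.comp (measurable_add_const c)
    rw [lintegral_map hm (measurable_const_smul t)]
  rw [h1, Measure.map_addHaar_smul _ t0, lintegral_smul_measure, lintegral_add_right_eq_self]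
  rw [smul_eq_mul]
  gcongr
  rw [finrank_euclideanSpace, Fintype.card_fin]
  rw [← ENNReal.ofReal_ofNat]
  apply ENNReal.ofReal_le_ofReal
  rw [abs_of_nonneg (by positivity)]
  have : (1:ℝ)/4 ≤ t ^ 2 := by nlinarith
  calc (t ^ 2)⁻¹ ≤ (1/4 : ℝ)⁻¹ := by gcongr
    _ = 4 := by norm_num

theorem phi_bound {K : Set E2} (hK : Convex ℝ K) (hm : MeasurableSet K) {t : ℝ} (ht : t ∈ Icc (0:ℝ) 1)
    {G : E2 → ENNReal} (hG : Measurable G) :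
    ∫⁻ x in K, ∫⁻ y in K, G (y + t • (x - y)) ≤ 4 * volume K * ∫⁻ x in K, G x := by
  have key : ∀ s : ℝ, 1 / 2 ≤ s → s ≤ 1 → ∀ y ∈ K, ∫⁻ x in K, G (s • x + (1 - s) • y) ≤ 4 * ∫⁻ x in K, G x := by
    intro s hs hs1 y hy
    calc ∫⁻ x in K, G (s • x + (1 - s) • y) = ∫⁻ x in K, K.indicator G (s • x + (1 - s) • y) := by
          apply setLIntegral_congr_fun hm
          intro x hx
          simp only
          rw [indicator_of_mem]
          exact hK hx hy (by linarith) (by linarith) (by ring)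
      _ ≤ ∫⁻ x, K.indicator G (s • x + (1 - s) • y) := setLIntegral_le_lintegral _ _
      _ ≤ 4 * ∫⁻ x, K.indicator G x := lint_aff hs _ (hG.indicator hm)
      _ = _ := by rw [lintegral_indicator hm]
  have fin : ∀ F : E2 → E2 → ENNReal, (∀ y ∈ K, ∫⁻ x in K, F y x ≤ 4 * ∫⁻ x in K, G x) →
      ∫⁻ y in K, ∫⁻ x in K, F y x ≤ 4 * volume K * ∫⁻ x in K, G x := by
    intro F hF
    calc ∫⁻ y in K, ∫⁻ x in K, F y x ≤ ∫⁻ y in K, 4 * ∫⁻ x in K, G x := setLIntegral_mono' hm hF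
      _ = _ := by rw [setLIntegral_const]; ring
  rcases le_total (1/2) t with h | h
  · rw [lintegral_lintegral_swap]
    · apply fin
      intro y hy
      refine le_trans (le_of_eq ?_) (key t h ht.2 y hy)
      congr 1; ext x; congr 1; module
    · exact (hG.comp (by fun_prop)).aemeasurable
  · apply fin
    intro x hx
    refine le_trans (le_of_eq ?_) (key (1 - t) (by linarith) (by linarith [ht.1]) x hx)
    congr 1; ext y; congr 1; module

theorem poincare {K : Set E2} (hK : Convex ℝ K) (hm : MeasurableSet K) {d : ℝ}
    (hd : ∀ x ∈ K, ∀ y ∈ K, ‖x - y‖ ≤ d) (hb : Bornology.IsBounded K) {f : E2 → ℝ} (hf : ContDiff ℝ 1 f) :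
    volume.real K * ∫ x in K, f x ^ 2 ≤ (∫ x in K, f x) ^ 2 + 2 * d ^ 2 * volume.real K * ∫ x in K, gsq f x := by
  obtain ⟨Rr, hR⟩ := hb.subset_closedBall 0
  have hfin : volume K < ⊤ := (measure_mono hR).trans_lt measure_closedBall_lt_top
  have intg : ∀ g : E2 → ℝ, Continuous g → IntegrableOn g K := fun g hg =>
    (hg.continuousOn.integrableOn_compact (isCompact_closedBall 0 Rr)).mono_set hR
  set ν := volume.restrict K with hν
  haveI : IsFiniteMeasure ν := ⟨by simpa [hν] using hfin⟩
  have i1 : Integrable f ν := intg f hf.continuous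
  have i2 : Integrable (fun x => f x ^ 2) ν := intg _ (hf.continuous.pow 2)
  have ig : Integrable (gsq f) ν := intg _ (gsq_cont hf)
  -- double integral
  have j1 : Integrable (fun z : E2 × E2 => f z.1 ^ 2) (ν.prod ν) := i2.comp_fst ν
  have j2 : Integrable (fun z : E2 × E2 => f z.2 ^ 2) (ν.prod ν) := i2.comp_snd ν
  have j3 : Integrable (fun z : E2 × E2 => f z.1 * f z.2) (ν.prod ν) := i1.mul_prod i1
  have dbl : ∫ z, (f z.1 - f z.2) ^ 2 ∂(ν.prod ν) = 2 * (volume.real K * ∫ x in K, f x ^ 2) - 2 * (∫ x in K, f x) ^ 2 := by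
    have e : ∀ z : E2 × E2, (f z.1 - f z.2) ^ 2 = (f z.1 ^ 2 + f z.2 ^ 2) - 2 * (f z.1 * f z.2) := by intro z; ring
    simp only [e]
    have a1 := integral_sub (j1.add j2) (j3.const_mul 2)
    have a2 := integral_add j1 j2
    simp only [Pi.add_apply] at a1 a2
    rw [a1, a2, integral_const_mul, integral_prod_mul (μ := ν) (ν := ν) f f]
    have b1 : ∫ z : E2 × E2, f z.1 ^ 2 ∂(ν.prod ν) = volume.real K * ∫ x in K, f x ^ 2 := by
      have := integral_fun_fst (μ := ν) (ν := ν) (fun x => f x ^ 2)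
      rw [this]; simp [hν]
    have b2 : ∫ z : E2 × E2, f z.2 ^ 2 ∂(ν.prod ν) = volume.real K * ∫ x in K, f x ^ 2 := by
      have := integral_fun_snd (μ := ν) (ν := ν) (fun x => f x ^ 2)
      rw [this]; simp [hν]
    rw [b1, b2]; ring
  have bnd : ENNReal.ofReal (∫ z, (f z.1 - f z.2) ^ 2 ∂(ν.prod ν)) ≤
      ENNReal.ofReal (4 * d ^ 2 * volume.real K * ∫ x in K, gsq f x) := by
    have jj : Integrable (fun z : E2 × E2 => (f z.1 - f z.2) ^ 2) (ν.prod ν) := by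
      have := (j1.add j2).sub (j3.const_mul 2)
      refine this.congr (ae_of_all _ fun z => ?_)
      simp only [Pi.sub_apply, Pi.add_apply]; ring
    rw [ofReal_integral_eq_lintegral_ofReal jj (ae_of_all _ fun z => sq_nonneg _)]
    have cG : Measurable fun x => ENNReal.ofReal (gsq f x) := (gsq_cont hf).measurable.ennreal_ofReal
    rw [lintegral_prod _ (by
      have : Continuous fun z : E2 × E2 => (f z.1 - f z.2) ^ 2 :=
        ((hf.continuous.comp continuous_fst).sub (hf.continuous.comp continuous_snd)).pow 2
      exact this.measurable.ennreal_ofReal.aemeasurable)]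
    have step : ∀ x ∈ K, ∀ y ∈ K, ENNReal.ofReal ((f x - f y) ^ 2) ≤
        ENNReal.ofReal (d ^ 2) * ∫⁻ t in Icc (0:ℝ) 1, ENNReal.ofReal (gsq f (y + t • (x - y))) := by
      intro x hx y hy
      have ct : Continuous fun t : ℝ => gsq f (y + t • (x - y)) := (gsq_cont hf).comp (by fun_prop)
      have n0 : 0 ≤ ∫ t in (0:ℝ)..1, gsq f (y + t • (x - y)) :=
        intervalIntegral.integral_nonneg (by norm_num) (fun _ _ => gsq_nonneg _ _)
      have := seg_bound hf x y
      have h2 : ‖x - y‖ ^ 2 ≤ d ^ 2 := pow_le_pow_left₀ (norm_nonneg _) (hd x hx y hy) 2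
      have h3 : (f x - f y) ^ 2 ≤ d ^ 2 * ∫ t in (0:ℝ)..1, gsq f (y + t • (x - y)) :=
        this.trans (mul_le_mul_of_nonneg_right h2 n0)
      rw [← ofReal_integral_eq_lintegral_ofReal (ct.continuousOn.integrableOn_compact isCompact_Icc)
        (ae_of_all _ fun _ => gsq_nonneg _ _), ← ENNReal.ofReal_mul (sq_nonneg _), integral_Icc_eq_integral_Ioc,
        ← intervalIntegral.integral_of_le (by norm_num)]
      exact ENNReal.ofReal_le_ofReal h3
    have mJ : Measurable fun z : (E2 × E2) × ℝ => ENNReal.ofReal (gsq f (z.1.2 + z.2 • (z.1.1 - z.1.2))) :=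
      cG.comp (by fun_prop)
    calc ∫⁻ x, ∫⁻ y, ENNReal.ofReal ((f x - f y) ^ 2) ∂ν ∂ν
        ≤ ∫⁻ x in K, ∫⁻ y in K, ENNReal.ofReal (d ^ 2) * ∫⁻ t in Icc (0:ℝ) 1, ENNReal.ofReal (gsq f (y + t • (x - y))) :=
          setLIntegral_mono' hm fun x hx => setLIntegral_mono' hm fun y hy => step x hx y hy
      _ = ENNReal.ofReal (d ^ 2) * ∫⁻ t in Icc (0:ℝ) 1, ∫⁻ x in K, ∫⁻ y in K, ENNReal.ofReal (gsq f (y + t • (x - y))) := by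
          simp_rw [lintegral_const_mul' _ _ ENNReal.ofReal_ne_top]
          congr 1
          have s1 : ∀ x : E2, ∫⁻ y in K, ∫⁻ t in Icc (0:ℝ) 1, ENNReal.ofReal (gsq f (y + t • (x - y))) =
             ∫⁻ t in Icc (0:ℝ) 1, ∫⁻ y in K, ENNReal.ofReal (gsq f (y + t • (x - y))) := by
            intro x
            rw [lintegral_lintegral_swap]
            exact (cG.comp (by fun_prop)).aemeasurable
          simp_rw [s1]
          rw [lintegral_lintegral_swap]
          apply Measurable.aemeasurable
          have : Measurable fun w : (E2 × ℝ) × E2 => ENNReal.ofReal (gsq f (w.2 + w.1.2 • (w.1.1 - w.2))) :=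
            cG.comp (by fun_prop)
          exact this.lintegral_prod_right'
      _ ≤ ENNReal.ofReal (d ^ 2) * ∫⁻ t in Icc (0:ℝ) 1, (4 * volume K * ∫⁻ x in K, ENNReal.ofReal (gsq f x)) := by
          exact mul_le_mul' le_rfl (setLIntegral_mono' measurableSet_Icc fun t ht => phi_bound hK hm ht cG)
      _ = ENNReal.ofReal (4 * d ^ 2 * volume.real K * ∫ x in K, gsq f x) := by
          rw [setLIntegral_const, Real.volume_Icc, ← ofReal_integral_eq_lintegral_ofReal ig (ae_of_all _ fun _ => gsq_nonneg _ _)]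
          have : volume K = ENNReal.ofReal (volume.real K) := (ofReal_measureReal hfin.ne).symm
          rw [this, show (4 : ENNReal) = ENNReal.ofReal 4 by simp, ← ENNReal.ofReal_mul (by norm_num), ← ENNReal.ofReal_mul (by positivity)]
          rw [sub_zero, ENNReal.ofReal_one, mul_one, ← ENNReal.ofReal_mul (by positivity)]
          congr 1; ring
  have nn : 0 ≤ 4 * d ^ 2 * volume.real K * ∫ x in K, gsq f x := by
    have : 0 ≤ ∫ x in K, gsq f x := integral_nonneg fun _ => gsq_nonneg _ _
    positivity
  have := (ENNReal.ofReal_le_ofReal_iff nn).1 bnd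
  rw [dbl] at this
  linarith
end

section
open MeasureTheory Filter Topology
open scoped ContDiff FourierTransform RealInnerProductSpace

def gin (f h : E2 → ℝ) (x : E2) : ℝ := pd ee0 f x * pd ee0 h x + pd ee1 f x * pd ee1 h x

theorem gin_cont {f h : E2 → ℝ} (hf : ContDiff ℝ 1 f) (hh : ContDiff ℝ 1 h) : Continuous (gin f h) :=
  ((pd_cont hf ee0).mul (pd_cont hh ee0)).add ((pd_cont hf ee1).mul (pd_cont hh ee1))

theorem pd_lin {f h : E2 → ℝ} (hf : ContDiff ℝ 1 f) (hh : ContDiff ℝ 1 h) (s t : ℝ) (v x : E2) :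
    pd v (fun y => s * f y + t * h y) x = s * pd v f x + t * pd v h x := by
  have h1 : DifferentiableAt ℝ f x := hf.differentiable (by norm_num) x
  have h2 : DifferentiableAt ℝ h x := hh.differentiable (by norm_num) x
  unfold pd
  rw [fderiv_fun_add (h1.const_mul s) (h2.const_mul t), fderiv_const_mul h1, fderiv_const_mul h2]
  simp

theorem gsq_lin {f h : E2 → ℝ} (hf : ContDiff ℝ 1 f) (hh : ContDiff ℝ 1 h) (s t : ℝ) (x : E2) :
    gsq (fun y => s * f y + t * h y) x = s ^ 2 * gsq f x + 2 * s * t * gin f h x + t ^ 2 * gsq h x := by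
  unfold gsq gin
  rw [pd_lin hf hh, pd_lin hf hh]; ring

theorem lin_contDiff {f h : E2 → ℝ} (hf : ContDiff ℝ 1 f) (hh : ContDiff ℝ 1 h) (s t : ℝ) :
    ContDiff ℝ 1 (fun y => s * f y + t * h y) :=
  (contDiff_const.mul hf).add (contDiff_const.mul hh)

section
variable {K : Set E2}

theorem intK (hK : IsCompact K) {g : E2 → ℝ} (hg : Continuous g) : IntegrableOn g K :=
  hg.continuousOn.integrableOn_compact hK

theorem int3 (hK : IsCompact K) {a b c : E2 → ℝ} (ha : Continuous a) (hb : Continuous b) (hc : Continuous c) (p q r : ℝ) :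
    ∫ x in K, (p * a x + q * b x + r * c x) = p * (∫ x in K, a x) + q * (∫ x in K, b x) + r * ∫ x in K, c x := by
  rw [integral_add (intK hK (by fun_prop)) (intK hK (by fun_prop)), integral_add (intK hK (by fun_prop)) (intK hK (by fun_prop)),
    integral_const_mul, integral_const_mul, integral_const_mul]

theorem E_lin (hK : IsCompact K) {f h : E2 → ℝ} (hf : ContDiff ℝ 1 f) (hh : ContDiff ℝ 1 h) (s t : ℝ) :
    ∫ x in K, gsq (fun y => s * f y + t * h y) x =
     s ^ 2 * (∫ x in K, gsq f x) + 2 * s * t * (∫ x in K, gin f h x) + t ^ 2 * ∫ x in K, gsq h x := by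
  simp_rw [gsq_lin hf hh]
  exact int3 hK (gsq_cont hf) (gin_cont hf hh) (gsq_cont hh) _ _ _

theorem S_lin (hK : IsCompact K) {f h : E2 → ℝ} (hf : Continuous f) (hh : Continuous h) (s t : ℝ) :
    ∫ x in K, (s * f x + t * h x) ^ 2 =
     s ^ 2 * (∫ x in K, f x ^ 2) + 2 * s * t * (∫ x in K, f x * h x) + t ^ 2 * ∫ x in K, h x ^ 2 := by
  rw [← int3 (a := fun x => f x ^ 2) (b := fun x => f x * h x) (c := fun x => h x ^ 2) hK (hf.pow 2) (hf.mul hh) (hh.pow 2)]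
  congr 1; ext x; ring

theorem M_lin (hK : IsCompact K) {f h : E2 → ℝ} (hf : Continuous f) (hh : Continuous h) (s t : ℝ) :
    ∫ x in K, (s * f x + t * h x) = s * (∫ x in K, f x) + t * ∫ x in K, h x := by
  rw [integral_add (intK hK (by fun_prop)) (intK hK (by fun_prop)), integral_const_mul, integral_const_mul]

def cell (K : Set E2) (N : ℕ) (j : ℤ × ℤ) : Set E2 := K ∩ {x | ⌊(N:ℝ) * x 0⌋ = j.1 ∧ ⌊(N:ℝ) * x 1⌋ = j.2}

theorem cell_eq (N : ℕ) (j : ℤ × ℤ) : cell K N j = K ∩ ({x | (j.1:ℝ) ≤ N * x 0} ∩ {x | (N:ℝ) * x 0 < j.1 + 1} ∩ {x | (j.2:ℝ) ≤ N * x 1} ∩ {x | (N:ℝ) * x 1 < j.2 + 1}) := by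
  ext x
  simp only [cell, mem_inter_iff, mem_ofPred_eq, Int.floor_eq_iff]
  tauto

theorem cell_convex (hc : Convex ℝ K) (N : ℕ) (j : ℤ × ℤ) : Convex ℝ (cell K N j) := by
  rw [cell_eq]
  have l : ∀ i : Fin 2, IsLinearMap ℝ (fun x : E2 => (N:ℝ) * x i) := fun i =>
    ⟨fun x y => by simp; ring, fun c x => by simp; ring⟩
  exact hc.inter ((((convex_halfSpace_ge (l 0) _).inter (convex_halfSpace_lt (l 0) _)).inter (convex_halfSpace_ge (l 1) _)).inter (convex_halfSpace_lt (l 1) _))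

theorem cell_meas (hm : MeasurableSet K) (N : ℕ) (j : ℤ × ℤ) : MeasurableSet (cell K N j) := by
  rw [cell_eq]
  have c : ∀ i : Fin 2, Continuous (fun x : E2 => (N:ℝ) * x i) := fun i => by fun_prop
  exact hm.inter ((((measurableSet_le measurable_const (c 0).measurable).inter (measurableSet_lt (c 0).measurable measurable_const)).inter
    (measurableSet_le measurable_const (c 1).measurable)).inter (measurableSet_lt (c 1).measurable measurable_const))

theorem cell_diam {N : ℕ} (hN : 0 < N) (j : ℤ × ℤ) : ∀ x ∈ cell K N j, ∀ y ∈ cell K N j, ‖x - y‖ ≤ 2 / N := by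
  intro x hx y hy
  rw [cell_eq] at hx hy
  obtain ⟨-, ⟨⟨h1, h2⟩, h3⟩, h4⟩ := hx
  obtain ⟨-, ⟨⟨g1, g2⟩, g3⟩, g4⟩ := hy
  simp only [mem_ofPred_eq] at *
  have hN' : (0:ℝ) < N := by exact_mod_cast hN
  rw [le_div_iff₀ hN']
  apply le_of_sq_le_sq _ (by norm_num)
  rw [mul_pow, normsq_e2]
  simp only [PiLp.sub_apply]
  have a1 : ((N:ℝ) * x 0 - N * y 0) ^ 2 ≤ 1 := by
    rw [sq_le_one_iff_abs_le_one, abs_le]; constructor <;> linarith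
  have a2 : ((N:ℝ) * x 1 - N * y 1) ^ 2 ≤ 1 := by
    rw [sq_le_one_iff_abs_le_one, abs_le]; constructor <;> linarith
  nlinarith

def cidx (N : ℕ) (R : ℝ) : Finset (ℤ × ℤ) := Finset.Icc (⌊-(N * R)⌋) (⌊(N:ℝ) * R⌋) ×ˢ Finset.Icc (⌊-(N * R)⌋) (⌊(N:ℝ) * R⌋)

theorem cell_cover {R : ℝ} (hR : K ⊆ Metric.closedBall 0 R) (N : ℕ) : K = ⋃ j ∈ cidx N R, cell K N j := by
  ext x
  simp only [mem_iUnion]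
  constructor
  · intro hx
    refine ⟨(⌊(N:ℝ) * x 0⌋, ⌊(N:ℝ) * x 1⌋), ?_, hx, rfl, rfl⟩
    have hn : ‖x‖ ≤ R := by simpa using hR hx
    have b : ∀ i, |x i| ≤ R := fun i => (abs_coord_le x i).trans hn
    simp only [cidx, Finset.mem_product, Finset.mem_Icc]
    have q : ∀ i, ⌊-((N:ℝ) * R)⌋ ≤ ⌊(N:ℝ) * x i⌋ ∧ ⌊(N:ℝ) * x i⌋ ≤ ⌊(N:ℝ) * R⌋ := by
      intro i
      have := abs_le.1 (b i)
      have n0 : (0:ℝ) ≤ N := by positivity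
      constructor <;> apply Int.floor_le_floor <;> nlinarith
    exact ⟨q 0, q 1⟩
  · rintro ⟨j, -, hx, -⟩; exact hx

theorem cell_sum (hK : IsCompact K) {R : ℝ} (hR : K ⊆ Metric.closedBall 0 R) (N : ℕ) {g : E2 → ℝ} (hg : Continuous g) :
    ∫ x in K, g x = ∑ j ∈ cidx N R, ∫ x in cell K N j, g x := by
  conv_lhs => rw [cell_cover hR N]
  rw [integral_biUnion_finset]
  · intro j _; exact cell_meas hK.measurableSet N j
  · intro i _ j _ hij
    rw [Function.onFun, Set.disjoint_left]
    rintro x ⟨-, h1, h2⟩ ⟨-, h3, h4⟩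
    exact hij (Prod.ext (h1.symm.trans h3) (h2.symm.trans h4))
  · intro j _; exact (intK hK hg).mono_set inter_subset_left

theorem rellich_ineq (hK : IsCompact K) (hc : Convex ℝ K) {R : ℝ} (hR : K ⊆ Metric.closedBall 0 R) {N : ℕ} (hN : 0 < N)
    {f : E2 → ℝ} (hf : ContDiff ℝ 1 f) :
    ∫ x in K, f x ^ 2 ≤ ∑ j ∈ cidx N R, (∫ x in cell K N j, f x) ^ 2 / volume.real (cell K N j) + 2 * (2 / N) ^ 2 * ∫ x in K, gsq f x := by
  rw [cell_sum (g := fun x => f x ^ 2) hK hR N (hf.continuous.pow 2), cell_sum hK hR N (gsq_cont hf), Finset.mul_sum, ← Finset.sum_add_distrib]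
  apply Finset.sum_le_sum
  intro j _
  have p := poincare (cell_convex hc N j) (cell_meas hK.measurableSet N j) (cell_diam hN j) (hK.isBounded.subset inter_subset_left) hf
  rcases (measureReal_nonneg (μ := volume) (s := cell K N j)).eq_or_lt with h0 | h0
  · have : volume (cell K N j) = 0 := by
      have hfin : volume (cell K N j) ≠ ⊤ := ((measure_mono inter_subset_left).trans_lt hK.measure_lt_top).ne
      exact (measureReal_eq_zero_iff hfin).1 h0.symm
    rw [Measure.restrict_eq_zero.2 this]
    simp
  · have e : (∫ x in cell K N j, f x) ^ 2 / volume.real (cell K N j) + 2 * (2 / N:ℝ) ^ 2 * ∫ x in cell K N j, gsq f x =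
      ((∫ x in cell K N j, f x) ^ 2 + 2 * (2 / N:ℝ) ^ 2 * volume.real (cell K N j) * ∫ x in cell K N j, gsq f x) / volume.real (cell K N j) := by
      field_simp
    rw [e, le_div_iff₀ h0]
    linarith

theorem cell_int_bdd (hK : IsCompact K) {f : E2 → ℝ} (hf : Continuous f) (N : ℕ) (j : ℤ × ℤ) :
    |∫ x in cell K N j, f x| ≤ volume.real K + ∫ x in K, f x ^ 2 := by
  have c1 : Continuous fun x => 1 + f x ^ 2 := by fun_prop
  calc |∫ x in cell K N j, f x| ≤ ∫ x in cell K N j, |f x| := abs_integral_le_integral_abs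
    _ ≤ ∫ x in cell K N j, (1 + f x ^ 2) := by
        apply setIntegral_mono ((intK hK hf.abs).mono_set inter_subset_left) ((intK hK c1).mono_set inter_subset_left)
        intro x
        simp only
        rw [abs_le]; constructor <;> nlinarith [sq_nonneg (f x - 1), sq_nonneg (f x + 1)]
    _ ≤ ∫ x in K, (1 + f x ^ 2) := setIntegral_mono_set (intK hK c1) (ae_of_all _ fun x => by positivity) (LE.le.eventuallyLE inter_subset_left)
    _ = volume.real K + ∫ x in K, f x ^ 2 := by
        rw [integral_add (intK hK continuous_const) (intK hK (by fun_prop))]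
        simp

theorem memLpK (hK : IsCompact K) {f : E2 → ℝ} (hf : Continuous f) : MemLp f 2 (volume.restrict K) :=
  have : IsFiniteMeasure (volume.restrict K) := ⟨by simpa using hK.measure_lt_top⟩
  (memLp_two_iff_integrable_sq hf.aestronglyMeasurable).2 (intK hK (by fun_prop))

theorem inner_toLp {ν : Measure E2} {f g : E2 → ℝ} (hf : MemLp f 2 ν) (hg : MemLp g 2 ν) :
    ⟪hf.toLp f, hg.toLp g⟫ = ∫ x, f x * g x ∂ν := by
  rw [L2.inner_def]
  apply integral_congr_ae
  filter_upwards [hf.coeFn_toLp, hg.coeFn_toLp] with x h1 h2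
  rw [h1, h2]; simp [mul_comm]

theorem rellich (hK : IsCompact K) (hc : Convex ℝ K) {f : ℕ → E2 → ℝ} (hf : ∀ n, ContDiff ℝ 1 (f n)) {C : ℝ}
    (h1 : ∀ n, ∫ x in K, f n x ^ 2 = 1) (hE : ∀ n, ∫ x in K, gsq (f n) x ≤ C) :
    ∃ g : E2 → ℝ, MemLp g 2 (volume.restrict K) ∧ ∫ x in K, g x ^ 2 = 1 ∧
      ∀ h : E2 → ℝ, Continuous h → Tendsto (fun n => ∫ x in K, f n x * h x) (hyperfilter ℕ : Filter ℕ) (𝓝 (∫ x in K, g x * h x)) := by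
  obtain ⟨R, hR⟩ := hK.isBounded.subset_closedBall 0
  set 𝒰 : Filter ℕ := (hyperfilter ℕ : Filter ℕ)
  have C0 : 0 ≤ C := (integral_nonneg fun x => gsq_nonneg _ _).trans (hE 0)
  have lims : ∀ N j, ∃ L, Tendsto (fun n => ∫ x in cell K N j, f n x) 𝒰 (𝓝 L) := by
    intro N j
    have hb : ∀ n, (∫ x in cell K N j, f n x) ∈ Icc (-(volume.real K + 1)) (volume.real K + 1) := by
      intro n
      have := cell_int_bdd hK (hf n).continuous N j
      rw [h1 n] at this
      exact abs_le.1 this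
    have hu := (isCompact_Icc (a := -(volume.real K + 1)) (b := volume.real K + 1)).ultrafilter_le_nhds
      ((hyperfilter ℕ).map (fun n => ∫ x in cell K N j, f n x)) (by
        rw [le_principal_iff]; exact Filter.mem_map.2 (univ_mem' hb))
    obtain ⟨L, -, hL⟩ := hu
    exact ⟨L, hL⟩
  choose L hL using lims
  have m : ∀ n, MemLp (f n) 2 (volume.restrict K) := fun n => memLpK hK (hf n).continuous
  set F : ℕ → Lp ℝ 2 (volume.restrict K) := fun n => (m n).toLp (f n)
  have dist_eq : ∀ n k, dist (F n) (F k) ^ 2 = ∫ x in K, (1 * f n x + (-1) * f k x) ^ 2 := by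
    intro n k
    rw [dist_eq_norm, S_lin hK (hf n).continuous (hf k).continuous, ← real_inner_self_eq_norm_sq, inner_sub_sub_self, inner_toLp, inner_toLp, inner_toLp, inner_toLp]
    have : ∫ x in K, f k x * f n x = ∫ x in K, f n x * f k x := by simp_rw [mul_comm]
    rw [this]
    simp_rw [sq]
    ring
  have cau : Cauchy (map F 𝒰) := by
    rw [Metric.cauchy_iff]
    refine ⟨inferInstance, fun ε hε => ?_⟩
    -- choose N
    obtain ⟨N, hN⟩ := exists_nat_gt (64 * (C + 1) / ε ^ 2 + 1)
    have hN1 : (1:ℝ) < N := lt_of_le_of_lt (by have : 0 ≤ 64 * (C + 1) / ε ^ 2 := by positivity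
                                               linarith) hN
    have hNpos : 0 < N := by exact_mod_cast (zero_lt_one.trans hN1)
    have hterm : 2 * (2 / (N:ℝ)) ^ 2 * (4 * C) ≤ ε ^ 2 / 2 := by
      have n1 : 64 * (C + 1) < N * ε ^ 2 := by
        have := (div_lt_iff₀ (by positivity : (0:ℝ) < ε ^ 2)).1 (lt_of_le_of_lt (le_add_of_nonneg_right zero_le_one) hN)
        linarith
      have n2 : (N:ℝ) * ε ^ 2 ≤ N ^ 2 * ε ^ 2 := by
        have : (N:ℝ) ≤ N ^ 2 := by nlinarith
        gcongr
      have : 2 * (2 / (N:ℝ)) ^ 2 * (4 * C) = 32 * C / N ^ 2 := by ring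
      rw [this, div_le_iff₀ (by positivity)]
      nlinarith
    have ev : ∀ᶠ n in 𝒰, ∀ j ∈ cidx N R, |(∫ x in cell K N j, f n x) - L N j| ^ 2 / volume.real (cell K N j) * 4 < ε ^ 2 / (2 * ((cidx N R).card + 1)) := by
      rw [Filter.eventually_all_finset]
      intro j _
      have t : Tendsto (fun n => |(∫ x in cell K N j, f n x) - L N j| ^ 2 / volume.real (cell K N j) * 4) 𝒰 (𝓝 (|L N j - L N j| ^ 2 / volume.real (cell K N j) * 4)) :=
        ((((hL N j).sub_const _).abs.pow 2).div_const _).mul_const _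
      simp only [sub_self, abs_zero, ne_eq, OfNat.ofNat_ne_zero, not_false_eq_true, zero_pow, zero_div, zero_mul] at t
      exact t.eventually (gt_mem_nhds (by positivity))
    refine ⟨F '' {n | ∀ j ∈ cidx N R, |(∫ x in cell K N j, f n x) - L N j| ^ 2 / volume.real (cell K N j) * 4 < ε ^ 2 / (2 * ((cidx N R).card + 1))}, image_mem_map ev, ?_⟩
    rintro _ ⟨n, hn, rfl⟩ _ ⟨k, hk, rfl⟩
    apply lt_of_pow_lt_pow_left₀ 2 hε.le
    rw [dist_eq]
    refine (rellich_ineq hK hc hR hNpos (lin_contDiff (hf n) (hf k) 1 (-1))).trans_lt ?_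
    have e1 : ∫ x in K, gsq (fun y => 1 * f n y + -1 * f k y) x ≤ 4 * C := by
      have a1 := E_lin hK (hf n) (hf k) 1 (-1)
      have a2 := E_lin hK (hf n) (hf k) 1 1
      have a3 : 0 ≤ ∫ x in K, gsq (fun y => 1 * f n y + 1 * f k y) x := integral_nonneg fun x => gsq_nonneg _ _
      have := hE n; have := hE k
      linarith
    have e2 : 2 * (2 / (N:ℝ)) ^ 2 * (∫ x in K, gsq (fun y => 1 * f n y + -1 * f k y) x) ≤ ε ^ 2 / 2 :=
      (mul_le_mul_of_nonneg_left e1 (by positivity)).trans hterm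
    have e3 : ∑ j ∈ cidx N R, (∫ x in cell K N j, (1 * f n x + -1 * f k x)) ^ 2 / volume.real (cell K N j) < ε ^ 2 / 2 := by
      calc _ ≤ ∑ j ∈ cidx N R, ε ^ 2 / (2 * ((cidx N R).card + 1)) := by
            apply Finset.sum_le_sum
            intro j hj
            have q1 := hn j hj
            have q2 := hk j hj
            have icell : ∀ i, IntegrableOn (f i) (cell K N j) := fun i => (intK hK (hf i).continuous).mono_set inter_subset_left
            rw [integral_add ((icell n).const_mul _) ((icell k).const_mul _),
              integral_const_mul, integral_const_mul]
            set X := ∫ x in cell K N j, f n x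
            set Y := ∫ x in cell K N j, f k x
            rw [sq_abs] at q1 q2
            have : (1 * X + -1 * Y) ^ 2 ≤ 2 * (X - L N j) ^ 2 + 2 * (Y - L N j) ^ 2 := by nlinarith [sq_nonneg (X + Y - 2 * L N j)]
            have h3 : (1 * X + -1 * Y) ^ 2 / volume.real (cell K N j) ≤ (2 * (X - L N j) ^ 2 + 2 * (Y - L N j) ^ 2) / volume.real (cell K N j) := by
              gcongr
            refine h3.trans ?_
            have : (2 * (X - L N j) ^ 2 + 2 * (Y - L N j) ^ 2) / volume.real (cell K N j) = ((X - L N j) ^ 2 / volume.real (cell K N j) * 4 + (Y - L N j) ^ 2 / volume.real (cell K N j) * 4) / 2 := by ring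
            rw [this]; linarith
        _ < ε ^ 2 / 2 := by
            rw [Finset.sum_const, nsmul_eq_mul, mul_div_assoc', div_lt_div_iff₀ (by positivity) (by norm_num)]
            have : 0 < ε ^ 2 := by positivity
            nlinarith
    linarith
  obtain ⟨G, hG⟩ := CompleteSpace.complete cau
  have hG' : Tendsto F 𝒰 (𝓝 G) := hG
  refine ⟨G, Lp.memLp G, ?_, ?_⟩
  · have n1 : ∀ n, ‖F n‖ ^ 2 = 1 := by
      intro n
      rw [← real_inner_self_eq_norm_sq, inner_toLp, ← h1 n]; simp_rw [sq]
    have t := (hG'.norm.pow 2)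
    simp_rw [n1] at t
    have := tendsto_nhds_unique t tendsto_const_nhds
    rw [← real_inner_self_eq_norm_sq, L2.inner_def] at this
    rw [← this]
    congr 1; ext x; simp [sq]
  · intro h hh
    have mh := memLpK hK hh
    have t := Filter.Tendsto.inner (𝕜 := ℝ) hG' (tendsto_const_nhds (x := mh.toLp h))
    have e1 : ∀ n, ⟪F n, mh.toLp h⟫ = ∫ x in K, f n x * h x := fun n => inner_toLp _ _
    have e2 : ⟪G, mh.toLp h⟫ = ∫ x in K, G x * h x := by
      have := inner_toLp (Lp.memLp G) mh
      rwa [Lp.toLp_coeFn] at this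
    rw [e2] at t
    simpa only [e1] using t

theorem minimizer (hK : IsCompact K) (hc : Convex ℝ K) (hv : 0 < volume.real K) {μ : ℝ} {f0 : E2 → ℝ}
    (hf0 : ContDiff ℝ 1 f0) (hm0 : ∫ x in K, f0 x = 0) (hlt : ∫ x in K, gsq f0 x < μ * ∫ x in K, f0 x ^ 2) :
    ∃ (l C : ℝ) (f : ℕ → E2 → ℝ) (g : E2 → ℝ), 0 < l ∧ l < μ ∧ (∀ n, ContDiff ℝ 1 (f n)) ∧ (∀ n, ∫ x in K, gsq (f n) x ≤ C) ∧
      MemLp g 2 (volume.restrict K) ∧ ∫ x in K, g x ^ 2 = 1 ∧ ∫ x in K, g x = 0 ∧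
      (∀ h : E2 → ℝ, Continuous h → Tendsto (fun n => ∫ x in K, f n x * h x) (hyperfilter ℕ : Filter ℕ) (𝓝 (∫ x in K, g x * h x))) ∧
      (∀ h : E2 → ℝ, ContDiff ℝ 1 h → Tendsto (fun n => ∫ x in K, gin (f n) h x) (hyperfilter ℕ : Filter ℕ) (𝓝 (l * ∫ x in K, g x * h x))) := by
  obtain ⟨R, hR⟩ := hK.isBounded.subset_closedBall 0
  set S : Set ℝ := {e | ∃ f : E2 → ℝ, ContDiff ℝ 1 f ∧ ∫ x in K, f x = 0 ∧ ∫ x in K, f x ^ 2 = 1 ∧ ∫ x in K, gsq f x = e} with hS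
  have norml : ∀ f : E2 → ℝ, ContDiff ℝ 1 f → ∫ x in K, f x = 0 → 0 < ∫ x in K, f x ^ 2 → (∫ x in K, gsq f x) / (∫ x in K, f x ^ 2) ∈ S := by
    intro f hf hm hp
    set s := (∫ x in K, f x ^ 2)
    set c := (Real.sqrt s)⁻¹
    have hc2 : c ^ 2 * s = 1 := by
      simp only [c, inv_pow, Real.sq_sqrt hp.le]; field_simp
    refine ⟨fun y => c * f y + 0 * f y, lin_contDiff hf hf _ _, ?_, ?_, ?_⟩
    · rw [M_lin hK hf.continuous hf.continuous, hm]; ring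
    · rw [S_lin hK hf.continuous hf.continuous]
      change c ^ 2 * s + _ + _ = _
      rw [hc2]; ring
    · rw [E_lin hK hf hf, eq_div_iff hp.ne']
      linear_combination (∫ x in K, gsq f x) * hc2
  have p0 : 0 < ∫ x in K, f0 x ^ 2 := by
    have h1 : 0 ≤ ∫ x in K, f0 x ^ 2 := integral_nonneg fun x => sq_nonneg _
    rcases h1.eq_or_lt with h | h
    · rw [← h, mul_zero] at hlt
      have : 0 ≤ ∫ x in K, gsq f0 x := integral_nonneg fun x => gsq_nonneg _ _
      linarith
    · exact h
  have Sne : S.Nonempty := ⟨_, norml f0 hf0 hm0 p0⟩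
  have Rnn : ∀ x ∈ K, ∀ y ∈ K, ‖x - y‖ ≤ 2 * |R| + 1 := by
    intro x hx y hy
    have h1 : ‖x‖ ≤ R := by simpa using hR hx
    have h2 : ‖y‖ ≤ R := by simpa using hR hy
    linarith [norm_sub_le x y, le_abs_self R]
  have Slb : ∀ e ∈ S, 1 / (2 * (2 * |R| + 1) ^ 2) ≤ e := by
    rintro e ⟨f, hf, hm, h1, rfl⟩
    have := poincare hc hK.measurableSet Rnn hK.isBounded hf
    rw [hm, h1] at this
    rw [div_le_iff₀ (by positivity)]
    nlinarith
  have Sbb : BddBelow S := ⟨_, Slb⟩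
  set l := sInf S
  have lpos : 0 < l := lt_of_lt_of_le (by positivity) (le_csInf Sne Slb)
  have lμ : l < μ := by
    refine lt_of_le_of_lt (csInf_le Sbb (norml f0 hf0 hm0 p0)) ?_
    rwa [div_lt_iff₀ p0]
  obtain ⟨e, eanti, et, eS⟩ := exists_seq_tendsto_sInf Sne Sbb
  choose f hf hm h1 hfe using eS
  have hE : ∀ n, ∫ x in K, gsq (f n) x ≤ e 0 := fun n => by rw [hfe]; exact eanti (Nat.zero_le n)
  obtain ⟨g, g2, gn, gt⟩ := rellich hK hc hf h1 hE
  have hle : (hyperfilter ℕ : Filter ℕ) ≤ atTop := by rw [← Nat.cofinite_eq_atTop]; exact hyperfilter_le_cofinite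
  refine ⟨l, e 0, f, g, lpos, lμ, hf, hE, g2, gn, ?_, gt, ?_⟩
  · have t := gt (fun _ => 1) continuous_const
    simp only [mul_one, hm] at t
    exact (tendsto_nhds_unique t tendsto_const_nhds)
  · have Qnn : ∀ k : E2 → ℝ, ContDiff ℝ 1 k → ∫ x in K, k x = 0 → 0 ≤ (∫ x in K, gsq k x) - l * ∫ x in K, k x ^ 2 := by
      intro k hk hkm
      have h1 : 0 ≤ ∫ x in K, k x ^ 2 := integral_nonneg fun x => sq_nonneg _
      rcases h1.eq_or_lt with h | h
      · rw [← h]; simpa using integral_nonneg fun x => gsq_nonneg _ _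
      · have := csInf_le Sbb (norml k hk hkm h)
        rw [le_div_iff₀ h] at this
        linarith
    have main : ∀ h : E2 → ℝ, ContDiff ℝ 1 h → ∫ x in K, h x = 0 →
        Tendsto (fun n => (∫ x in K, gin (f n) h x) - l * ∫ x in K, f n x * h x) atTop (𝓝 0) := by
      intro h hh hhm
      set Qh := (∫ x in K, gsq h x) - l * ∫ x in K, h x ^ 2
      have cs : ∀ n, ((∫ x in K, gin (f n) h x) - l * ∫ x in K, f n x * h x) ^ 2 ≤ (e n - l) * Qh := by
        intro n
        set B := (∫ x in K, gin (f n) h x) - l * ∫ x in K, f n x * h x with hB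
        have key : ∀ t : ℝ, 0 ≤ Qh * (t * t) + (2 * B) * t + (e n - l) := by
          intro t
          have := Qnn _ (lin_contDiff (hf n) hh 1 t) (by rw [M_lin hK (hf n).continuous hh.continuous, hm, hhm]; ring)
          rw [E_lin hK (hf n) hh, S_lin hK (hf n).continuous hh.continuous, hfe, h1] at this
          simp only [Qh, hB]; linarith
        have := discrim_le_zero key
        rw [discrim] at this; nlinarith
      have t0 : Tendsto (fun n => (e n - l) * Qh) atTop (𝓝 0) := by
        have := (et.sub_const l).mul_const Qh
        simpa [l] using this
      have t1 := squeeze_zero (fun n => sq_nonneg _) cs t0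
      have t2 := t1.sqrt
      simp only [Real.sqrt_sq_eq_abs, Real.sqrt_zero] at t2
      exact (tendsto_zero_iff_abs_tendsto_zero _).2 t2
    intro h hh
    set a := (∫ x in K, h x) / volume.real K
    have hh' : ContDiff ℝ 1 (fun y => 1 * h y + (-a) * (1:ℝ)) := lin_contDiff hh contDiff_const 1 (-a)
    have ginq : ∀ n x, gin (f n) (fun y => 1 * h y + (-a) * (1:ℝ)) x = gin (f n) h x := by
      intro n x
      unfold gin
      rw [pd_lin hh contDiff_const, pd_lin hh contDiff_const]
      have : ∀ v, pd v (fun _ : E2 => (1:ℝ)) x = 0 := by intro v; simp [pd]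
      rw [this, this]; ring
    have t := (main _ hh' (by
      rw [M_lin hK hh.continuous continuous_const]
      simp [a]; field_simp; ring)).mono_left hle
    simp only [ginq] at t
    have s1 : ∀ n, ∫ x in K, f n x * (1 * h x + (-a) * (1:ℝ)) = ∫ x in K, f n x * h x := by
      intro n
      have := M_lin hK ((hf n).continuous.mul hh.continuous) (hf n).continuous 1 (-a)
      rw [hm n, mul_zero, add_zero, one_mul] at this
      simp only [Pi.mul_apply] at this
      rw [← this]
      congr 1; ext x; ring
    simp only [s1] at t
    have t3 := t.add ((gt h hh.continuous).const_mul l)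
    simpa using t3
end
end

section
open MeasureTheory Filter Topology
open scoped ContDiff FourierTransform RealInnerProductSpace

theorem int_pd_zero {X : E2 → ℝ} (v : E2) (hX : ContDiff ℝ 1 X) (hc : HasCompactSupport X) : ∫ x, pd v X x = 0 := by
  have c1 : Continuous (pd v X) := pd_cont hX v
  have c2 : HasCompactSupport (pd v X) := pd_hasCompactSupport v hc
  have := integral_mul_fderiv_eq_neg_fderiv_mul_of_integrable (μ := (volume : Measure E2)) (f := fun _ : E2 => (1:ℝ)) (g := X) (v := v)
    (by simp) (by simp only [one_mul]; exact c1.integrable_of_hasCompactSupport c2) (by simpa using hX.continuous.integrable_of_hasCompactSupport hc)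
    (fun x _ => by fun_prop) (fun x _ => hX.differentiable (by norm_num) x)
  simpa [pd] using this

theorem st_deriv_bdd : ∃ M : ℝ, 0 ≤ M ∧ ∀ x, |deriv Real.smoothTransition x| ≤ M := by
  have cd : ContDiff ℝ 1 Real.smoothTransition := Real.smoothTransition.contDiff
  have cc : Continuous (deriv Real.smoothTransition) := cd.continuous_deriv (by norm_num)
  obtain ⟨M, hM⟩ := (isCompact_Icc (a := (0:ℝ)) (b := 1)).exists_bound_of_continuousOn cc.continuousOn
  refine ⟨max M 0, le_max_right _ _, fun x => ?_⟩
  by_cases hx : x ∈ Icc (0:ℝ) 1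
  · exact (hM x hx).trans (le_max_left _ _)
  · have : deriv Real.smoothTransition x = 0 := by
      simp only [mem_Icc, not_and_or, not_le] at hx
      rcases hx with h | h
      · have : Real.smoothTransition =ᶠ[𝓝 x] fun _ => 0 := by
          filter_upwards [gt_mem_nhds h] with y hy
          exact Real.smoothTransition.zero_of_nonpos hy.le
        rw [this.deriv_eq]; simp
      · have : Real.smoothTransition =ᶠ[𝓝 x] fun _ => 1 := by
          filter_upwards [lt_mem_nhds h] with y hy
          exact Real.smoothTransition.one_of_one_le hy.le
        rw [this.deriv_eq]; simp
    rw [this]; simp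

theorem st_deriv_zero {x : ℝ} (h : 1 < x) : deriv Real.smoothTransition x = 0 := by
  have : Real.smoothTransition =ᶠ[𝓝 x] fun _ => 1 := by
    filter_upwards [lt_mem_nhds h] with y hy
    exact Real.smoothTransition.one_of_one_le hy.le
  rw [this.deriv_eq]; simp

def cut (n c : E2) (k : ℕ) (x : E2) : ℝ := Real.smoothTransition ((k:ℝ) * ⟪x - c, n⟫ - 1)

theorem cut_smooth (n c : E2) (k : ℕ) : ContDiff ℝ ∞ (cut n c k) := by
  have : ContDiff ℝ ∞ Real.smoothTransition := Real.smoothTransition.contDiff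
  exact this.comp ((contDiff_const.mul ((contDiff_id.sub contDiff_const).inner ℝ contDiff_const)).sub contDiff_const)

theorem pd_cut (n c : E2) (k : ℕ) (v x : E2) :
    pd v (cut n c k) x = deriv Real.smoothTransition ((k:ℝ) * ⟪x - c, n⟫ - 1) * (k * ⟪v, n⟫) := by
  have hst : ContDiff ℝ 1 Real.smoothTransition := Real.smoothTransition.contDiff
  have h2 : DifferentiableAt ℝ (fun y : E2 => ⟪y - c, n⟫) x := (differentiableAt_id.sub_const c).inner ℝ (differentiableAt_const n)
  have h1 : DifferentiableAt ℝ (fun y : E2 => (k:ℝ) * ⟪y - c, n⟫ - 1) x := (h2.const_mul _).sub_const _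
  have := pd_comp (g := Real.smoothTransition) (g' := deriv Real.smoothTransition) (a := fun y : E2 => (k:ℝ) * ⟪y - c, n⟫ - 1) (x := x) v
    (hst.differentiable (by norm_num) _).hasDerivAt h1
  have e : pd v (fun y : E2 => (k:ℝ) * ⟪y - c, n⟫ - 1) x = k * ⟪v, n⟫ := by
    rw [← pd_inner n c v x, ← pd_const_mul _ _ h2]
    unfold pd
    rw [fderiv_sub_const]
  rw [e] at this
  exact this

theorem cut_zero_nhds {n c : E2} {k : ℕ} {x : E2} (h : ⟪x - c, n⟫ ≤ 0) : cut n c k =ᶠ[𝓝 x] fun _ => 0 := by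
  have : ContinuousAt (fun y : E2 => (k:ℝ) * ⟪y - c, n⟫ - 1) x := by fun_prop
  have h2 : (k:ℝ) * ⟪x - c, n⟫ - 1 < 0 := by
    have : (k:ℝ) * ⟪x - c, n⟫ ≤ 0 := mul_nonpos_of_nonneg_of_nonpos (by positivity) h
    linarith
  filter_upwards [this.eventually (gt_mem_nhds h2)] with y hy
  exact Real.smoothTransition.zero_of_nonpos hy.le

theorem halfmeas (n c : E2) : MeasurableSet {x : E2 | 0 < ⟪x - c, n⟫} :=
  (isOpen_lt continuous_const (by fun_prop)).measurableSet

theorem div_half {n c : E2} {X0 X1 : E2 → ℝ} {R M : ℝ} (hM : 0 ≤ M)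
    (h0 : ∀ x, 0 < ⟪x - c, n⟫ → ContDiffAt ℝ 1 X0 x) (h1 : ∀ x, 0 < ⟪x - c, n⟫ → ContDiffAt ℝ 1 X1 x)
    (hR : ∀ x, R < ‖x‖ → X0 x = 0 ∧ X1 x = 0)
    (hb : ∀ x, 0 < ⟪x - c, n⟫ → |n 0 * X0 x + n 1 * X1 x| ≤ M * ⟪x - c, n⟫)
    (hD : IntegrableOn (fun x => pd ee0 X0 x + pd ee1 X1 x) {x | 0 < ⟪x - c, n⟫}) :
    ∫ x in {x | 0 < ⟪x - c, n⟫}, (pd ee0 X0 x + pd ee1 X1 x) = 0 := by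
  obtain ⟨S, hS0, hS⟩ := st_deriv_bdd
  have cs : ∀ (X : E2 → ℝ), (∀ x, R < ‖x‖ → X x = 0) → ∀ k, HasCompactSupport fun x => cut n c k x * X x := by
    intro X hX k
    apply HasCompactSupport.intro (isCompact_closedBall (0:E2) R)
    intro x hx
    rw [hX x (by simpa using hx), mul_zero]
  have cd : ∀ (X : E2 → ℝ), (∀ x, 0 < ⟪x - c, n⟫ → ContDiffAt ℝ 1 X x) → ∀ k, ContDiff ℝ 1 fun x => cut n c k x * X x := by
    intro X hX k
    rw [contDiff_iff_contDiffAt]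
    intro x
    by_cases hx : 0 < ⟪x - c, n⟫
    · exact (((cut_smooth n c k).of_le (by simp)).contDiffAt).mul (hX x hx)
    · have : (fun x => cut n c k x * X x) =ᶠ[𝓝 x] fun _ => 0 := by
        filter_upwards [cut_zero_nhds (k := k) (not_lt.1 hx)] with y hy
        rw [hy, zero_mul]
      exact contDiffAt_const.congr_of_eventuallyEq this
  have form : ∀ (X : E2 → ℝ), (∀ x, 0 < ⟪x - c, n⟫ → ContDiffAt ℝ 1 X x) → ∀ k v x, 0 < ⟪x - c, n⟫ →
      pd v (fun x => cut n c k x * X x) x = cut n c k x * pd v X x + deriv Real.smoothTransition ((k:ℝ) * ⟪x - c, n⟫ - 1) * (k * ⟪v, n⟫) * X x := by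
    intro X hX k v x hx
    rw [pd_mul v ((cut_smooth n c k).differentiable (by simp) x) ((hX x hx).differentiableAt (by norm_num)), pd_cut]
    ring
  have form0 : ∀ (X : E2 → ℝ), ∀ k v x, ¬ 0 < ⟪x - c, n⟫ → pd v (fun x => cut n c k x * X x) x = 0 := by
    intro X k v x hx
    have : (fun x => cut n c k x * X x) =ᶠ[𝓝 x] fun _ => 0 := by
      filter_upwards [cut_zero_nhds (k := k) (not_lt.1 hx)] with y hy
      rw [hy, zero_mul]
    rw [pd_congr v this]; simp [pd]
  have id : ∀ k : ℕ, ∫ x in {x | 0 < ⟪x - c, n⟫}, (cut n c k x * (pd ee0 X0 x + pd ee1 X1 x) + deriv Real.smoothTransition ((k:ℝ) * ⟪x - c, n⟫ - 1) * k * (n 0 * X0 x + n 1 * X1 x)) = 0 := by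
    intro k
    have C0 := cd X0 h0 k
    have C1 := cd X1 h1 k
    have S0 := cs X0 (fun x hx => (hR x hx).1) k
    have S1 := cs X1 (fun x hx => (hR x hx).2) k
    have e : ∫ x, (pd ee0 (fun x => cut n c k x * X0 x) x + pd ee1 (fun x => cut n c k x * X1 x) x) = 0 := by
      rw [integral_add ((pd_cont C0 _).integrable_of_hasCompactSupport (pd_hasCompactSupport _ S0)) ((pd_cont C1 _).integrable_of_hasCompactSupport (pd_hasCompactSupport _ S1)),
        int_pd_zero _ C0 S0, int_pd_zero _ C1 S1, add_zero]
    rw [← setIntegral_eq_integral_of_forall_compl_eq_zero (s := {x | 0 < ⟪x - c, n⟫}) (by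
      intro x hx
      rw [form0 _ _ _ _ hx, form0 _ _ _ _ hx, add_zero])] at e
    refine Eq.trans ?_ e
    apply setIntegral_congr_fun (halfmeas n c)
    intro x hx
    simp only
    rw [form X0 h0 _ _ _ hx, form X1 h1 _ _ _ hx, inner_ee0, inner_ee1]
    ring
  have lim : Tendsto (fun k : ℕ => ∫ x in {x | 0 < ⟪x - c, n⟫}, (cut n c k x * (pd ee0 X0 x + pd ee1 X1 x) + deriv Real.smoothTransition ((k:ℝ) * ⟪x - c, n⟫ - 1) * k * (n 0 * X0 x + n 1 * X1 x))) atTop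
      (𝓝 (∫ x in {x | 0 < ⟪x - c, n⟫}, (pd ee0 X0 x + pd ee1 X1 x))) := by
    apply tendsto_integral_of_dominated_convergence (fun x => |pd ee0 X0 x + pd ee1 X1 x| + (Metric.closedBall (0:E2) R).indicator (fun _ => 2 * S * M) x)
    · intro k
      refine AEStronglyMeasurable.add ((cut_smooth n c k).continuous.aestronglyMeasurable.mul hD.aestronglyMeasurable) ?_
      have cst : Continuous (deriv Real.smoothTransition) := (Real.smoothTransition.contDiff (n := 1)).continuous_deriv (by norm_num)
      have c1 : Continuous fun x : E2 => deriv Real.smoothTransition ((k:ℝ) * ⟪x - c, n⟫ - 1) * k := (cst.comp (by fun_prop)).mul continuous_const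
      refine c1.aestronglyMeasurable.mul ?_
      have : ContinuousOn (fun x => n 0 * X0 x + n 1 * X1 x) {x | 0 < ⟪x - c, n⟫} := by
        intro x hx
        exact ((continuousAt_const.mul (h0 x hx).continuousAt).add (continuousAt_const.mul (h1 x hx).continuousAt)).continuousWithinAt
      exact this.aestronglyMeasurable (halfmeas n c)
    · refine Integrable.add hD.abs ?_
      refine Integrable.integrableOn ?_
      exact (integrable_indicator_iff Metric.isClosed_closedBall.measurableSet).2 (integrableOn_const (measure_closedBall_lt_top).ne)
    · intro k
      refine (ae_restrict_iff' (halfmeas n c)).2 (ae_of_all _ fun x hx => ?_)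
      rw [Real.norm_eq_abs]
      refine (abs_add_le _ _).trans (add_le_add ?_ ?_)
      · rw [abs_mul]
        have : |cut n c k x| ≤ 1 := by
          unfold cut
          rw [abs_of_nonneg (Real.smoothTransition.nonneg _)]; exact Real.smoothTransition.le_one _
        exact (mul_le_mul_of_nonneg_right this (abs_nonneg _)).trans (by rw [one_mul])
      · by_cases hxR : x ∈ Metric.closedBall (0:E2) R
        · rw [indicator_of_mem hxR, abs_mul, abs_mul, abs_of_nonneg (by positivity : (0:ℝ) ≤ (k:ℝ))]
          have hx' : 0 < ⟪x - c, n⟫ := hx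
          have b := hb x hx
          by_cases h2 : 1 < (k:ℝ) * ⟪x - c, n⟫ - 1
          · rw [st_deriv_zero h2]; simp; positivity
          · push Not at h2
            calc _ ≤ S * k * (M * ⟪x - c, n⟫) := by gcongr; exact hS _
              _ = S * M * (k * ⟪x - c, n⟫) := by ring
              _ ≤ S * M * 2 := by gcongr; linarith
              _ = _ := by ring
        · rw [indicator_of_notMem hxR]
          obtain ⟨e0, e1⟩ := hR x (by simpa using hxR)
          rw [e0, e1]; simp
    · refine (ae_restrict_iff' (halfmeas n c)).2 (ae_of_all _ fun x hx => ?_)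
      apply tendsto_const_nhds.congr'
      obtain ⟨N, hN⟩ := exists_nat_gt (2 / ⟪x - c, n⟫)
      filter_upwards [eventually_ge_atTop N] with k hk
      have hx' : 0 < ⟪x - c, n⟫ := hx
      have : 2 < (k:ℝ) * ⟪x - c, n⟫ := by
        rw [div_lt_iff₀ hx'] at hN
        refine hN.trans_le ?_
        gcongr
      rw [st_deriv_zero (by linarith), cut, Real.smoothTransition.one_of_one_le (by linarith)]
      ring
  simp_rw [id] at lim
  exact (tendsto_nhds_unique lim tendsto_const_nhds)

/-- reflection -/
def sg (n c x : E2) : E2 := x - (2 * ⟪x - c, n⟫) • n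

theorem sg_inner {n : E2} (hn : ‖n‖ = 1) (c x : E2) : ⟪sg n c x - c, n⟫ = -⟪x - c, n⟫ := by
  have : sg n c x - c = (x - c) - (2 * ⟪x - c, n⟫) • n := by unfold sg; abel
  rw [this, inner_sub_left, inner_smul_left, real_inner_self_eq_norm_sq, hn]; simp; ring

theorem sg_sg {n : E2} (hn : ‖n‖ = 1) (c x : E2) : sg n c (sg n c x) = x := by
  conv_lhs => rw [sg, sg_inner hn]
  unfold sg; module

theorem sg_fix {n c x : E2} (h : ⟪x - c, n⟫ = 0) : sg n c x = x := by simp [sg, h]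

theorem sg_sub (n c x y : E2) : sg n c x - sg n c y = (x - y) - (2 * ⟪x - y, n⟫) • n := by
  have : ⟪x - y, n⟫ = ⟪x - c, n⟫ - ⟪y - c, n⟫ := by rw [← inner_sub_left]; congr 1; abel
  rw [this]; unfold sg; module

theorem sg_norm {n : E2} (hn : ‖n‖ = 1) (c x y : E2) : ‖sg n c x - sg n c y‖ = ‖x - y‖ := by
  rw [sg_sub]
  have : ‖(x - y) - (2 * ⟪x - y, n⟫) • n‖ ^ 2 = ‖x - y‖ ^ 2 := by
    rw [norm_sub_sq_real, inner_smul_right, norm_smul, hn]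
    simp [mul_pow]; ring
  exact (sq_eq_sq₀ (norm_nonneg _) (norm_nonneg _)).1 this

theorem sg_mp {n : E2} (hn : ‖n‖ = 1) (c : E2) : MeasurePreserving (sg n c) (volume : Measure E2) volume := by
  have h1 := (Submodule.reflection (ℝ ∙ n)).measurePreserving
  have h2 := (Measure.measurePreserving_neg (volume : Measure E2)).comp h1
  have h3 := (measurePreserving_add_right (volume : Measure E2) ((2 * ⟪c, n⟫) • n)).comp h2
  have e : sg n c = (fun x => x + (2 * ⟪c, n⟫) • n) ∘ Neg.neg ∘ (Submodule.reflection (ℝ ∙ n)) := by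
    funext x
    have e1 : Submodule.reflection (ℝ ∙ n) x = (2 * ⟪x, n⟫) • n - x := by
      rw [Submodule.reflection_singleton_apply, hn, real_inner_comm]
      simp [smul_smul]; module
    simp only [Function.comp, e1, sg]
    rw [inner_sub_left]
    module
  rw [e]; exact h3
end

section
open MeasureTheory Filter Topology
open scoped ContDiff FourierTransform RealInnerProductSpace

theorem line_null {n : E2} (hn : ‖n‖ = 1) (c : E2) : volume {x : E2 | ⟪x - c, n⟫ = 0} = 0 := by
  have h1 : volume ((ℝ ∙ n)ᗮ : Set E2) = 0 := by
    apply Measure.addHaar_submodule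
    intro h
    have : n ∈ (ℝ ∙ n)ᗮ := by rw [h]; trivial
    rw [Submodule.mem_orthogonal_singleton_iff_inner_left, real_inner_self_eq_norm_sq, hn] at this
    norm_num at this
  have h2 : {x : E2 | ⟪x - c, n⟫ = 0} = (fun x => x + (-c)) ⁻¹' ((ℝ ∙ n)ᗮ : Set E2) := by
    ext x
    simp only [mem_ofPred_eq, mem_preimage, SetLike.mem_coe, Submodule.mem_orthogonal_singleton_iff_inner_left, sub_eq_add_neg]
  rw [h2, measure_preimage_add_right, h1]

def sgL (n : E2) : E2 →L[ℝ] E2 := ContinuousLinearMap.id ℝ E2 - (innerSL ℝ n).smulRight ((2:ℝ) • n)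

theorem sgL_apply (n v : E2) : sgL n v = v - (2 * ⟪v, n⟫) • n := by
  simp only [sgL, sub_apply, ContinuousLinearMap.coe_id', id_eq, ContinuousLinearMap.smulRight_apply, innerSL_apply_apply]
  rw [real_inner_comm]; module

theorem sg_eq (n c x : E2) : sg n c x = sgL n x + (2 * ⟪c, n⟫) • n := by
  rw [sgL_apply, sg, inner_sub_left]; module

theorem sg_hasFDerivAt (n c x : E2) : HasFDerivAt (sg n c) (sgL n) x := by
  have : sg n c = fun x => sgL n x + (2 * ⟪c, n⟫) • n := funext fun x => sg_eq n c x
  rw [this]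
  exact (sgL n).hasFDerivAt.add_const _

theorem sg_contDiff (n c : E2) : ContDiff ℝ ∞ (sg n c) := by
  have : sg n c = fun x => sgL n x + (2 * ⟪c, n⟫) • n := funext fun x => sg_eq n c x
  rw [this]
  exact (sgL n).contDiff.add contDiff_const

theorem sg_cont (n c : E2) : Continuous (sg n c) := (sg_contDiff n c).continuous

theorem sg_emb {n : E2} (hn : ‖n‖ = 1) (c : E2) : MeasurableEmbedding (sg n c) :=
  (sg_cont n c).measurableEmbedding fun x y h => by rw [← sg_sg hn c x, h, sg_sg hn]

theorem pd_sg {n c v x : E2} {η : E2 → ℝ} (h : DifferentiableAt ℝ η (sg n c x)) :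
    pd v (fun y => η (sg n c y)) x = pd (sgL n v) η (sg n c x) := by
  unfold pd
  have := h.hasFDerivAt.comp x (sg_hasFDerivAt n c x)
  rw [show (fun y => η (sg n c y)) = η ∘ sg n c from rfl, this.fderiv]; rfl

theorem pd_decomp (η : E2 → ℝ) (v x : E2) : pd v η x = v 0 * pd ee0 η x + v 1 * pd ee1 η x := fderiv_decomp _ _

theorem pdpd_decomp {η : E2 → ℝ} (h : ContDiff ℝ ∞ η) (w x : E2) : pd w (pd w η) x =
    w 0 ^ 2 * pd ee0 (pd ee0 η) x + w 0 * w 1 * (pd ee0 (pd ee1 η) x + pd ee1 (pd ee0 η) x) + w 1 ^ 2 * pd ee1 (pd ee1 η) x := by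
  have h0 : ContDiff ℝ 1 (pd ee0 η) := (pd_contDiff_top _ h).of_le (by simp)
  have h1 : ContDiff ℝ 1 (pd ee1 η) := (pd_contDiff_top _ h).of_le (by simp)
  have e : pd w η = fun y => w 0 * pd ee0 η y + w 1 * pd ee1 η y := funext fun y => pd_decomp η w y
  rw [e, pd_lin h0 h1, pd_decomp (pd ee0 η), pd_decomp (pd ee1 η)]
  ring

theorem lap_sg {n : E2} (hn : ‖n‖ = 1) (c : E2) {η : E2 → ℝ} (h : ContDiff ℝ ∞ η) (x : E2) :
    lap (fun y => η (sg n c y)) x = lap η (sg n c x) := by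
  have e : ∀ v, pd v (pd v (fun y => η (sg n c y))) x = pd (sgL n v) (pd (sgL n v) η) (sg n c x) := by
    intro v
    have : pd v (fun y => η (sg n c y)) = fun y => pd (sgL n v) η (sg n c y) :=
      funext fun y => pd_sg (h.differentiable (by simp) _)
    rw [this, pd_sg ((pd_contDiff_top _ h).differentiable (by simp) _)]
  unfold lap
  rw [e ee0, e ee1, pdpd_decomp h (sgL n ee0), pdpd_decomp h (sgL n ee1)]
  simp only [sgL_apply, inner_ee0, inner_ee1]
  have hn2 : n 0 ^ 2 + n 1 ^ 2 = 1 := by rw [← normsq_e2, hn]; norm_num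
  have z00 : ee0 0 = 1 := by simp [ee0]
  have z01 : ee0 1 = 0 := by simp [ee0]
  have z10 : ee1 0 = 0 := by simp [ee1]
  have z11 : ee1 1 = 1 := by simp [ee1]
  simp only [PiLp.sub_apply, PiLp.smul_apply, smul_eq_mul, z00, z01, z10, z11]
  linear_combination (4 * n 0 ^ 2 * pd ee0 (pd ee0 η) (sg n c x) + 4 * n 1 ^ 2 * pd ee1 (pd ee1 η) (sg n c x) + 4 * n 0 * n 1 * (pd ee0 (pd ee1 η) (sg n c x) + pd ee1 (pd ee0 η) (sg n c x))) * hn2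

theorem TestIn.comp_sg {n c p : E2} (hn : ‖n‖ = 1) {r : ℝ} {η : E2 → ℝ} (hp : ⟪p - c, n⟫ = 0) (h : TestIn (Metric.ball p r) η) :
    TestIn (Metric.ball p r) (fun y => η (sg n c y)) := by
  have hemb : Topology.IsClosedEmbedding (sg n c) := by
    have : Isometry (sg n c) := Isometry.of_dist_eq fun x y => by rw [dist_eq_norm, dist_eq_norm, sg_norm hn]
    exact this.isClosedEmbedding
  refine ⟨h.smooth.comp (sg_contDiff n c), h.cpt.comp_isClosedEmbedding hemb, ?_⟩
  intro x hx
  have h1 : sg n c x ∈ tsupport η := tsupport_comp_subset_preimage η (sg_cont n c) hx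
  have h2 := h.sub h1
  rw [Metric.mem_ball, dist_eq_norm] at h2 ⊢
  rwa [← sg_fix hp, sg_norm hn] at h2

theorem sg_ball {n c p x : E2} (hn : ‖n‖ = 1) {r : ℝ} (hp : ⟪p - c, n⟫ = 0) : sg n c x ∈ Metric.ball p r ↔ x ∈ Metric.ball p r := by
  rw [Metric.mem_ball, Metric.mem_ball, dist_eq_norm, dist_eq_norm]
  conv_lhs => rw [← sg_fix hp, sg_norm hn]

theorem lap_cont {G : E2 → ℝ} (hG : ContDiff ℝ ∞ G) : Continuous (lap G) :=
  (pd_contDiff_top _ (pd_contDiff_top _ hG)).continuous.add (pd_contDiff_top _ (pd_contDiff_top _ hG)).continuous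

theorem green_full {U : Set E2} {G η : E2 → ℝ} (hG : ContDiff ℝ ∞ G) (hη : TestIn U η) :
    ∫ x, G x * lap η x = ∫ x, η x * lap G x := by
  have X : ∀ v, ContDiff ℝ 1 fun x => G x * pd v η x + (-1) * (η x * pd v G x) := fun v =>
    ((hG.mul (hη.pd v).smooth).add (contDiff_const.mul (hη.smooth.mul (pd_contDiff_top v hG)))).of_le (by simp)
  have S : ∀ v, HasCompactSupport fun x => G x * pd v η x + (-1) * (η x * pd v G x) := fun v =>
    (HasCompactSupport.mul_left (hη.pd v).cpt).add (HasCompactSupport.mul_left (hη.cpt.mul_right))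
  have D : ∀ v x, pd v (fun x => G x * pd v η x + (-1) * (η x * pd v G x)) x = G x * pd v (pd v η) x - η x * pd v (pd v G) x := by
    intro v x
    have d1 := hG.differentiable (by simp) x
    have d2 := hη.smooth.differentiable (by simp) x
    have d3 := (hη.pd v).smooth.differentiable (by simp) x
    have d4 := (pd_contDiff_top v hG).differentiable (by simp) x
    have m1 : DifferentiableAt ℝ (fun x => G x * pd v η x) x := d1.mul d3
    have m2 : DifferentiableAt ℝ (fun x => η x * pd v G x) x := d2.mul d4
    rw [pd_add v m1 (m2.const_mul _), pd_const_mul _ _ m2, pd_mul v d1 d3, pd_mul v d2 d4]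
    ring
  have i1 : ∀ v, ∫ x, (G x * pd v (pd v η) x - η x * pd v (pd v G) x) = 0 := by
    intro v
    rw [← int_pd_zero v (X v) (S v)]
    congr 1; ext x; rw [D]
  have I1 : ∀ v, Integrable fun x => G x * pd v (pd v η) x := fun v =>
    (hG.continuous.mul ((hη.pd v).pd v).smooth.continuous).integrable_of_hasCompactSupport (HasCompactSupport.mul_left ((hη.pd v).pd v).cpt)
  have I2 : ∀ v, Integrable fun x => η x * pd v (pd v G) x := fun v =>
    (hη.smooth.continuous.mul (pd_contDiff_top v (pd_contDiff_top v hG)).continuous).integrable_of_hasCompactSupport (hη.cpt.mul_right)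
  have a := i1 ee0
  have b := i1 ee1
  rw [integral_sub (I1 _) (I2 _)] at a b
  have e1 : ∫ x, G x * lap η x = (∫ x, G x * pd ee0 (pd ee0 η) x) + ∫ x, G x * pd ee1 (pd ee1 η) x := by
    rw [← integral_add (I1 _) (I1 _)]; congr 1; ext x; unfold lap; ring
  have e2 : ∫ x, η x * lap G x = (∫ x, η x * pd ee0 (pd ee0 G) x) + ∫ x, η x * pd ee1 (pd ee1 G) x := by
    rw [← integral_add (I2 _) (I2 _)]; congr 1; ext x; unfold lap; ring
  rw [e1, e2]; linarith

theorem weak_strong {U : Set E2} (hU : IsOpen U) {l : ℝ} {G : E2 → ℝ} (hG : ContDiff ℝ ∞ G) (hw : WeakSol U l G) :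
    ∀ x ∈ U, lap G x = -(l * G x) := by
  have cF : Continuous fun x => lap G x + l * G x := (lap_cont hG).add (continuous_const.mul hG.continuous)
  have h := hU.ae_eq_zero_of_integral_contDiff_smul_eq_zero (μ := volume) (f := fun x => lap G x + l * G x)
    (cF.locallyIntegrable.locallyIntegrableOn _) (by
      intro η h1 h2 h3
      have hη : TestIn U η := ⟨h1, h2, h3⟩
      have w := hw η hη
      have g := green_full hG hη
      have I1 : Integrable fun x => G x * lap η x :=
        (hG.continuous.mul hη.lap.smooth.continuous).integrable_of_hasCompactSupport (HasCompactSupport.mul_left hη.lap.cpt)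
      have I2 : Integrable fun x => l * (G x * η x) :=
        ((hG.continuous.mul hη.smooth.continuous).integrable_of_hasCompactSupport (HasCompactSupport.mul_left hη.cpt)).const_mul l
      have I3 : Integrable fun x => η x * lap G x :=
        (hη.smooth.continuous.mul (lap_cont hG)).integrable_of_hasCompactSupport hη.cpt.mul_right
      have e1 : ∫ x, G x * (lap η x + l * η x) = (∫ x, G x * lap η x) + ∫ x, l * (G x * η x) := by
        rw [← integral_add I1 I2]; congr 1; ext x; ring
      have e2 : ∫ x, η x • (lap G x + l * G x) = (∫ x, η x * lap G x) + ∫ x, l * (G x * η x) := by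
        rw [← integral_add I3 I2]; congr 1; ext x; simp; ring
      rw [e2, ← g, ← e1, w])
  have h2 := Measure.eqOn_open_of_ae_eq (μ := volume) (f := fun x => lap G x + l * G x) (g := fun _ => 0) (U := U)
    ((ae_restrict_iff' hU.measurableSet).2 h) hU cF.continuousOn continuousOn_const
  intro x hx
  have := h2 hx
  simp only at this; linarith

theorem WeakSol.congr {U : Set E2} {l : ℝ} {f g : E2 → ℝ} (hw : WeakSol U l f) (h : ∀ᵐ x, x ∈ U → f x = g x) : WeakSol U l g := by
  intro η hη
  rw [← hw η hη]
  apply integral_congr_ae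
  filter_upwards [h] with x hx
  by_cases hxU : x ∈ U
  · rw [hx hxU]
  · have z : ∀ {ξ : E2 → ℝ}, TestIn U ξ → ξ x = 0 := fun hξ => image_eq_zero_of_notMem_tsupport fun h' => hxU (hξ.sub h')
    rw [z hη, z hη.lap]; ring

theorem WeakSol.mono {U V : Set E2} {l : ℝ} {f : E2 → ℝ} (hw : WeakSol U l f) (h : V ⊆ U) : WeakSol V l f :=
  fun η hη => hw η ⟨hη.smooth, hη.cpt, hη.sub.trans h⟩

theorem nice_int {f : E2 → ℝ} {p : E2} {r l : ℝ} (hr : 0 < r) (hf : IntegrableOn f (Metric.ball p r))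
    (hw : ∀ h, TestIn (Metric.ball p r) h → ∫ x in Metric.ball p r, f x * (lap h x + l * h x) = 0) :
    ∃ G, ContDiff ℝ ∞ G ∧ (∀ x ∈ Metric.ball p (r / 2), lap G x = -(l * G x)) ∧
      ∀ᵐ x, x ∈ Metric.ball p (r / 2) → f x = G x := by
  have mb : MeasurableSet (Metric.ball p r) := Metric.isOpen_ball.measurableSet
  have hsub : Metric.ball p (r / 2) ⊆ Metric.ball p r := Metric.ball_subset_ball (by linarith)
  have w : WeakSol (Metric.ball p r) l ((Metric.ball p r).indicator f) := by
    intro η hη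
    rw [← hw η hη, ← integral_indicator mb]
    congr 1; ext x
    by_cases hx : x ∈ Metric.ball p r <;> simp [hx]
  obtain ⟨G, hG, hae⟩ := weyl hr ((integrable_indicator_iff mb).2 hf) w
  refine ⟨G, hG, weak_strong Metric.isOpen_ball hG ((w.mono hsub).congr hae), ?_⟩
  filter_upwards [hae] with x hx hxb
  rw [← hx hxb, indicator_of_mem (hsub hxb)]

theorem nice_side {f : E2 → ℝ} {n c p : E2} {r l : ℝ} (hn : ‖n‖ = 1) (hp : ⟪p - c, n⟫ = 0) (hr : 0 < r)
    (hf : IntegrableOn f (Metric.ball p r ∩ {x | 0 < ⟪x - c, n⟫}))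
    (hw : ∀ h, TestIn (Metric.ball p r) h → (∀ x, h (sg n c x) = h x) →
      ∫ x in Metric.ball p r ∩ {x | 0 < ⟪x - c, n⟫}, f x * (lap h x + l * h x) = 0) :
    ∃ G, ContDiff ℝ ∞ G ∧ (∀ x ∈ Metric.ball p (r / 2), lap G x = -(l * G x)) ∧
      (∀ x ∈ Metric.ball p (r / 2), G (sg n c x) = G x) ∧
      ∀ᵐ x, x ∈ Metric.ball p (r / 2) → 0 < ⟪x - c, n⟫ → f x = G x := by
  classical
  have mb : MeasurableSet (Metric.ball p r) := Metric.isOpen_ball.measurableSet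
  set H : Set E2 := {x | 0 < ⟪x - c, n⟫} with hH
  have mH : MeasurableSet H := halfmeas n c
  set F : E2 → ℝ := fun x => if x ∈ H then f x else f (sg n c x) with hF
  set S := Metric.ball p r ∩ H
  have pre : (sg n c) ⁻¹' S =ᵐ[volume] (Metric.ball p r \ H : Set E2) := by
    have nul := line_null hn c
    have : ∀ᵐ x : E2, ¬ ⟪x - c, n⟫ = 0 := by
      rw [ae_iff]; simpa using nul
    filter_upwards [this] with x hx
    have : x ∈ (sg n c) ⁻¹' S ↔ x ∈ Metric.ball p r \ H := by
      simp only [S, hH, mem_preimage, mem_inter_iff, Set.mem_sdiff, mem_ofPred_eq, sg_ball hn hp, sg_inner hn]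
      refine and_congr_right fun _ => ?_
      rw [not_lt]
      constructor
      · intro h; linarith
      · intro h; have := lt_of_le_of_ne h hx; linarith
    exact propext this
  have Feq : ∀ x, x ∈ Metric.ball p r \ H → F x = f (sg n c x) := fun x hx => by simp [hF, hx.2]
  have FH : ∀ x, x ∈ S → F x = f x := fun x hx => by simp [hF, hx.2]
  have hm2 : MeasurableSet (Metric.ball p r \ H) := mb.diff mH
  have iF2 : IntegrableOn F (Metric.ball p r \ H) := by
    have h1 : IntegrableOn (f ∘ sg n c) ((sg n c) ⁻¹' S) := ((sg_mp hn c).integrableOn_comp_preimage (sg_emb hn c)).2 hf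
    have h2 : IntegrableOn (f ∘ sg n c) (Metric.ball p r \ H) := h1.congr_set_ae pre.symm
    exact h2.congr_fun (fun x hx => (Feq x hx).symm) hm2
  have iF1 : IntegrableOn F (Metric.ball p r ∩ H) := hf.congr_fun (fun x hx => (FH x hx).symm) (mb.inter mH)
  have iF : IntegrableOn F (Metric.ball p r) := by
    have := iF1.union iF2
    rwa [inter_union_sdiff] at this
  have wF : ∀ h, TestIn (Metric.ball p r) h → ∫ x in Metric.ball p r, F x * (lap h x + l * h x) = 0 := by
    intro η hη
    have hη' := hη.comp_sg hn hp
    have bdm : ∀ {ξ : E2 → ℝ} {V : Set E2} {k : E2 → ℝ}, TestIn (Metric.ball p r) ξ → IntegrableOn k V → IntegrableOn (fun x => k x * (lap ξ x + l * ξ x)) V := by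
      intro ξ V k hξ hk
      have T : TestIn (Metric.ball p r) fun x => lap ξ x + l * ξ x := hξ.lap.add (hξ.mul_left contDiff_const)
      obtain ⟨C, hC⟩ := T.bdd
      exact Integrable.mul_bdd (c := C) hk T.smooth.continuous.aestronglyMeasurable (ae_of_all _ hC)
    rw [← integral_inter_add_sdiff mH (bdm hη iF)]
    have e1 : ∫ x in Metric.ball p r ∩ H, F x * (lap η x + l * η x) = ∫ x in S, f x * (lap η x + l * η x) :=
      setIntegral_congr_fun (mb.inter mH) fun x hx => by beta_reduce; rw [FH x hx]
    have e2 : ∫ x in Metric.ball p r \ H, F x * (lap η x + l * η x) = ∫ x in S, f x * (lap (fun y => η (sg n c y)) x + l * η (sg n c x)) := by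
      rw [setIntegral_congr_fun hm2 (g := fun x => f (sg n c x) * (lap η x + l * η x)) (fun x hx => by beta_reduce; rw [Feq x hx]),
        ← setIntegral_congr_set pre]
      have := (sg_mp hn c).setIntegral_preimage_emb (sg_emb hn c) (fun x => f x * (lap (fun y => η (sg n c y)) x + l * η (sg n c x))) S
      rw [← this]
      congr 1; ext x
      beta_reduce
      rw [lap_sg hn c hη.smooth, sg_sg hn]
    rw [e1, e2, ← integral_add (bdm hη hf) (bdm hη' hf)]
    rw [← hw (fun y => η y + η (sg n c y)) (hη.add hη') (fun x => by beta_reduce; rw [sg_sg hn, add_comm])]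
    congr 1; ext x
    have := lap_add (x := x) (hη.smooth.contDiffAt.of_le two_le_inf) (hη'.smooth.contDiffAt.of_le two_le_inf)
    rw [this]; ring
  obtain ⟨G, hG, hpde, hae⟩ := nice_int hr iF wF
  have hsub : Metric.ball p (r / 2) ⊆ Metric.ball p r := Metric.ball_subset_ball (by linarith)
  refine ⟨G, hG, hpde, ?_, ?_⟩
  · have h2 : ∀ᵐ x, x ∈ Metric.ball p (r / 2) → F (sg n c x) = G (sg n c x) := by
      have := (sg_mp hn c).quasiMeasurePreserving.ae hae
      filter_upwards [this] with x hx hxb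
      exact hx ((sg_ball hn hp).2 hxb)
    have nul := line_null hn c
    have h3 : ∀ᵐ x : E2, ¬ ⟪x - c, n⟫ = 0 := by
      rw [ae_iff]; simpa using nul
    have h4 : ∀ᵐ x, x ∈ Metric.ball p (r / 2) → G (sg n c x) = G x := by
      filter_upwards [h2, h3, hae] with x a1 a2 a3 hxb
      rw [← a1 hxb, ← a3 hxb]
      simp only [hF, hH, mem_ofPred_eq, sg_inner hn, sg_sg hn]
      rcases lt_or_gt_of_ne a2 with h | h
      · rw [if_pos (by linarith), if_neg (by linarith)]
      · rw [if_neg (by linarith), if_pos (by linarith)]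
    exact Measure.eqOn_open_of_ae_eq ((ae_restrict_iff' Metric.isOpen_ball.measurableSet).2 h4) Metric.isOpen_ball
      (hG.continuous.comp (sg_cont n c)).continuousOn hG.continuous.continuousOn
  · filter_upwards [hae] with x hx hxb hxH
    rw [← hx hxb, FH x ⟨hsub hxb, hxH⟩]
end

section
open MeasureTheory Filter Topology
open scoped ContDiff FourierTransform RealInnerProductSpace

def Sd (A B C n c : E2) : Prop :=
  (n = nrm A B C ∧ c = B) ∨ (n = nrm B C A ∧ c = C) ∨ (n = nrm C A B ∧ c = A)

/-- `T` is a half plane near `p`. -/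
def Half (T : Set E2) (p : E2) (r : ℝ) (n c : E2) : Prop :=
  ‖n‖ = 1 ∧ ⟪p - c, n⟫ = 0 ∧ ∀ y ∈ Metric.ball p r, (y ∈ T ↔ 0 ≤ ⟪y - c, n⟫)

theorem Half.mono {T : Set E2} {p n c : E2} {r s : ℝ} (h : Half T p r n c) (hs : s ≤ r) : Half T p s n c :=
  ⟨h.1, h.2.1, fun y hy => h.2.2 y (Metric.ball_subset_ball hs hy)⟩

theorem loc {A B C p : E2} (h : dt A B C ≠ 0) (hp : p ∈ TriDom A B C) :
    ∃ r > 0, (∀ y ∈ Metric.ball p r, y ∉ Vtx A B C) ∧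
      (Metric.ball p r ⊆ Tri A B C ∨ ∃ n c, Sd A B C n c ∧ Half (Tri A B C) p r n c) := by
  have h2 : dt B C A ≠ 0 := by rwa [dt_cyc]
  have h3 : dt C A B ≠ 0 := by rwa [dt_cyc]
  have hm := (mem_Tri h p).1 hp.1
  rcases hm.1.eq_or_lt with e1 | e1
  · obtain ⟨r, hr, H⟩ := loc_side h hp e1.symm
    exact ⟨r, hr, fun y hy => (H y hy).2, Or.inr ⟨_, _, Or.inl ⟨rfl, rfl⟩, norm_nrm h, e1.symm, fun y hy => (H y hy).1⟩⟩
  rcases hm.2.1.eq_or_lt with e2 | e2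
  · obtain ⟨r, hr, H⟩ := loc_side h2 (by rwa [TriDom_cyc]) e2.symm
    rw [Tri_cyc, Vtx_cyc] at H
    exact ⟨r, hr, fun y hy => (H y hy).2, Or.inr ⟨_, _, Or.inr (Or.inl ⟨rfl, rfl⟩), norm_nrm h2, e2.symm, fun y hy => (H y hy).1⟩⟩
  rcases hm.2.2.eq_or_lt with e3 | e3
  · obtain ⟨r, hr, H⟩ := loc_side h3 (by rwa [TriDom_cyc, TriDom_cyc]) e3.symm
    rw [Tri_cyc, Vtx_cyc, Tri_cyc, Vtx_cyc] at H
    exact ⟨r, hr, fun y hy => (H y hy).2, Or.inr ⟨_, _, Or.inr (Or.inr ⟨rfl, rfl⟩), norm_nrm h3, e3.symm, fun y hy => (H y hy).1⟩⟩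
  have hi : p ∈ interior (Tri A B C) := (mem_int h p).2 ⟨e1, e2, e3⟩
  obtain ⟨r, hr, H⟩ := Metric.isOpen_iff.1 isOpen_interior p hi
  exact ⟨r, hr, fun y hy => (interior_sub_TriDom h (H hy)).2, Or.inl (H.trans interior_subset)⟩

theorem line_ae {n : E2} (hn : ‖n‖ = 1) (c : E2) : ∀ᵐ x : E2, ¬ ⟪x - c, n⟫ = 0 := by
  rw [ae_iff]; simpa using line_null hn c

/-- transfer of an integral over `T` to the half ball -/
theorem int_half {T : Set E2} {p n c : E2} {r : ℝ} (hT : MeasurableSet T) (h : Half T p r n c) {k : E2 → ℝ}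
    (hk : ∀ x, x ∉ Metric.ball p r → k x = 0) :
    ∫ x in T, k x = ∫ x in Metric.ball p r ∩ {x | 0 < ⟪x - c, n⟫}, k x := by
  rw [← integral_indicator hT, ← integral_indicator (Metric.isOpen_ball.measurableSet.inter (halfmeas n c))]
  apply integral_congr_ae
  filter_upwards [line_ae h.1 c] with x hx
  by_cases hb : x ∈ Metric.ball p r
  · have e : x ∈ T ↔ x ∈ Metric.ball p r ∩ {x | 0 < ⟪x - c, n⟫} := by
      rw [h.2.2 x hb]
      exact ⟨fun h0 => ⟨hb, lt_of_le_of_ne h0 (Ne.symm hx)⟩, fun h0 => le_of_lt h0.2⟩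
    by_cases ht : x ∈ T
    · rw [indicator_of_mem ht, indicator_of_mem (e.1 ht)]
    · rw [indicator_of_notMem ht, indicator_of_notMem (fun h => ht (e.2 h))]
  · classical
    simp only [indicator_apply, hk x hb, ite_self]

theorem int_half2 {p n c : E2} {r : ℝ} {k : E2 → ℝ}
    (hk : ∀ x, x ∉ Metric.ball p r → k x = 0) :
    ∫ x in {x | 0 < ⟪x - c, n⟫}, k x = ∫ x in Metric.ball p r ∩ {x | 0 < ⟪x - c, n⟫}, k x := by
  rw [← integral_indicator (halfmeas n c), ← integral_indicator (Metric.isOpen_ball.measurableSet.inter (halfmeas n c))]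
  congr 1; ext x
  classical
  by_cases hb : x ∈ Metric.ball p r
  · simp only [indicator_apply, mem_inter_iff, hb, true_and]
  · simp only [indicator_apply, hk x hb, ite_self]

theorem TestIn.zero {U : Set E2} {h : E2 → ℝ} (H : TestIn U h) {x : E2} (hx : x ∉ U) : h x = 0 :=
  image_eq_zero_of_notMem_tsupport fun h' => hx (H.sub h')

/-- even functions have a normal derivative bounded by the distance -/
theorem pd_even_bound {U : Set E2} {h : E2 → ℝ} (H : TestIn U h) {n c : E2} (hn : ‖n‖ = 1) (he : ∀ x, h (sg n c x) = h x) :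
    ∃ K, 0 ≤ K ∧ ∀ x, 0 < ⟪x - c, n⟫ → |pd n h x| ≤ K * ⟪x - c, n⟫ := by
  obtain ⟨K, hK⟩ := ContDiff.lipschitzWith_of_hasCompactSupport (pd_hasCompactSupport n H.cpt)
    (pd_contDiff_top n H.smooth) (by simp)
  refine ⟨K, K.2, fun x hx => ?_⟩
  have e : pd n h x = - pd n h (sg n c x) := by
    have e1 : (fun y => h (sg n c y)) = h := funext he
    have e2 := pd_sg (n := n) (c := c) (x := x) (v := n) (η := h) (H.smooth.differentiable (by simp) _)
    rw [e1] at e2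
    rw [e2, sgL_apply]
    have : n - (2 * ⟪n, n⟫) • n = -n := by
      rw [real_inner_self_eq_norm_sq, hn]; norm_num [two_smul]
    rw [this]; simp [pd]
  have b := hK.dist_le_mul x (sg n c x)
  rw [Real.dist_eq, dist_eq_norm] at b
  have e3 : x - sg n c x = (2 * ⟪x - c, n⟫) • n := by simp [sg]
  rw [e3, norm_smul, hn, mul_one, Real.norm_eq_abs, abs_of_pos (show 0 < 2 * ⟪x - c, n⟫ by linarith)] at b
  have : |2 * pd n h x| ≤ K * (2 * ⟪x - c, n⟫) := by
    refine le_trans (le_of_eq ?_) b; congr 1; rw [two_mul]; nth_rewrite 2 [e]; rw [sub_eq_add_neg]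
  rw [abs_mul, abs_two] at this; linarith

theorem TestIn.far {p : E2} {r : ℝ} {h : E2 → ℝ} (H : TestIn (Metric.ball p r) h) {x : E2} (hx : ‖p‖ + r < ‖x‖) : x ∉ Metric.ball p r := by
  intro hb
  rw [Metric.mem_ball, dist_eq_norm] at hb
  have := norm_sub_norm_le x p
  linarith

theorem green_half {p n c : E2} {r : ℝ} {h f : E2 → ℝ} (hn : ‖n‖ = 1) (H : TestIn (Metric.ball p r) h)
    (he : ∀ x, h (sg n c x) = h x) (hf : ContDiff ℝ 1 f) :
    ∫ x in {x | 0 < ⟪x - c, n⟫}, (gin f h x + f x * lap h x) = 0 := by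
  obtain ⟨K, hK0, hK⟩ := pd_even_bound H hn he
  obtain ⟨M, hM⟩ := (isCompact_closedBall p r).exists_bound_of_continuousOn hf.continuous.continuousOn
  have hD : ∀ x, pd ee0 (fun x => f x * pd ee0 h x) x + pd ee1 (fun x => f x * pd ee1 h x) x = gin f h x + f x * lap h x := by
    intro x
    rw [pd_mul ee0 (hf.differentiable (by simp) x) ((H.pd ee0).smooth.differentiable (by simp) x),
      pd_mul ee1 (hf.differentiable (by simp) x) ((H.pd ee1).smooth.differentiable (by simp) x)]
    unfold gin lap; ring
  have cX : ∀ v, ContDiff ℝ 1 (fun x => f x * pd v h x) := fun v => hf.mul ((H.pd v).smooth.of_le (by simp))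
  have key := div_half (n := n) (c := c) (X0 := fun x => f x * pd ee0 h x) (X1 := fun x => f x * pd ee1 h x) (R := ‖p‖ + r)
    (M := |M| * K) (by positivity) (fun x _ => (cX ee0).contDiffAt) (fun x _ => (cX ee1).contDiffAt)
    (fun x hx => by
      have := H.far hx
      simp only [(H.pd ee0).zero this, (H.pd ee1).zero this, mul_zero, and_self])
    (fun x hx => by
      have e : n 0 * (f x * pd ee0 h x) + n 1 * (f x * pd ee1 h x) = f x * pd n h x := by rw [pd_decomp h n x]; ring
      rw [e]
      by_cases hb : x ∈ Metric.ball p r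
      · rw [abs_mul, mul_assoc]
        refine mul_le_mul ((hM x (Metric.ball_subset_closedBall hb)).trans (le_abs_self M)) (hK x hx) (abs_nonneg _) (abs_nonneg _)
      · rw [(H.pd n).zero hb]; simp; positivity)
    (by
      have : Continuous fun x => pd ee0 (fun x => f x * pd ee0 h x) x + pd ee1 (fun x => f x * pd ee1 h x) x :=
        (pd_cont (cX ee0) ee0).add (pd_cont (cX ee1) ee1)
      refine (this.integrable_of_hasCompactSupport ?_).integrableOn
      exact (pd_hasCompactSupport _ (HasCompactSupport.mul_left (H.pd ee0).cpt)).add (pd_hasCompactSupport _ (HasCompactSupport.mul_left (H.pd ee1).cpt)))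
  simpa only [hD] using key

theorem green_int {U : Set E2} {h f : E2 → ℝ} (H : TestIn U h) (hf : ContDiff ℝ 1 f) :
    ∫ x, (gin f h x + f x * lap h x) = 0 := by
  have hD : ∀ x, pd ee0 (fun x => f x * pd ee0 h x) x + pd ee1 (fun x => f x * pd ee1 h x) x = gin f h x + f x * lap h x := by
    intro x
    rw [pd_mul ee0 (hf.differentiable (by simp) x) ((H.pd ee0).smooth.differentiable (by simp) x),
      pd_mul ee1 (hf.differentiable (by simp) x) ((H.pd ee1).smooth.differentiable (by simp) x)]
    unfold gin lap; ring
  have cX : ∀ v, ContDiff ℝ 1 (fun x => f x * pd v h x) := fun v => hf.mul ((H.pd v).smooth.of_le (by simp))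
  have cs : ∀ v, HasCompactSupport (fun x => f x * pd v h x) := fun v => HasCompactSupport.mul_left (H.pd v).cpt
  have I : ∀ v, Integrable (pd v (fun x => f x * pd v h x)) := fun v =>
    (pd_cont (cX v) v).integrable_of_hasCompactSupport (pd_hasCompactSupport _ (cs v))
  rw [← integral_congr_ae (ae_of_all _ hD), integral_add (I _) (I _), int_pd_zero _ (cX _) (cs _), int_pd_zero _ (cX _) (cs _), add_zero]

theorem green_half_u {p n c : E2} {r l M : ℝ} {h u : E2 → ℝ} (H : TestIn (Metric.ball p r) h) (hn : ‖n‖ = 1)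
    (he : ∀ x, h (sg n c x) = h x) (hM : 0 ≤ M)
    (hu : ∀ x ∈ Metric.ball p r, 0 < ⟪x - c, n⟫ → ContDiffAt ℝ 2 u x ∧ |u x| ≤ M ∧ |pd n u x| ≤ M * ⟪x - c, n⟫ ∧ lap u x = -(l * u x))
    (hi : IntegrableOn u (Metric.ball p r ∩ {x | 0 < ⟪x - c, n⟫})) :
    ∫ x in Metric.ball p r ∩ {x | 0 < ⟪x - c, n⟫}, u x * (lap h x + l * h x) = 0 := by
  obtain ⟨K, hK0, hK⟩ := pd_even_bound H hn he
  obtain ⟨Q, hQ⟩ := H.bdd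
  have hz : ∀ x, x ∉ Metric.ball p r → h =ᶠ[𝓝 x] fun _ => 0 := fun x hx =>
    notMem_tsupport_iff_eventuallyEq.1 fun h' => hx (H.sub h')
  have hX0 : ∀ v x, x ∉ Metric.ball p r → (fun x => u x * pd v h x + (-1) * (h x * pd v u x)) =ᶠ[𝓝 x] fun _ => 0 := by
    intro v x hx
    filter_upwards [hz x hx, pd_eventuallyEq v (hz x hx)] with y h1 h2
    rw [h1, h2]; simp [pd]
  have hD : ∀ x, 0 < ⟪x - c, n⟫ → pd ee0 (fun x => u x * pd ee0 h x + (-1) * (h x * pd ee0 u x)) x +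
      pd ee1 (fun x => u x * pd ee1 h x + (-1) * (h x * pd ee1 u x)) x = u x * (lap h x + l * h x) := by
    intro x hx
    by_cases hb : x ∈ Metric.ball p r
    · obtain ⟨c2, _, _, pde⟩ := hu x hb hx
      have d1 := c2.differentiableAt (by simp)
      have d2 := H.smooth.differentiable (by simp) x
      have D : ∀ v, pd v (fun x => u x * pd v h x + (-1) * (h x * pd v u x)) x = u x * pd v (pd v h) x - h x * pd v (pd v u) x := by
        intro v
        have d3 := (H.pd v).smooth.differentiable (by simp) x
        have d4 := (c2_diff c2).2 v
        have m1 : DifferentiableAt ℝ (fun x => u x * pd v h x) x := d1.mul d3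
        have m2 : DifferentiableAt ℝ (fun x => h x * pd v u x) x := d2.mul d4
        rw [pd_add v m1 (m2.const_mul _), pd_const_mul _ _ m2, pd_mul v d1 d3, pd_mul v d2 d4]
        ring
      rw [D, D]
      have : lap u x = pd ee0 (pd ee0 u) x + pd ee1 (pd ee1 u) x := rfl
      have h2 : lap h x = pd ee0 (pd ee0 h) x + pd ee1 (pd ee1 h) x := rfl
      rw [pde] at this
      rw [h2]; linear_combination (h x) * this
    · rw [pd_congr _ (hX0 ee0 x hb), pd_congr _ (hX0 ee1 x hb), H.zero hb, H.lap.zero hb]; simp [pd]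
  have cX : ∀ v x, 0 < ⟪x - c, n⟫ → ContDiffAt ℝ 1 (fun x => u x * pd v h x + (-1) * (h x * pd v u x)) x := by
    intro v x hx
    by_cases hb : x ∈ Metric.ball p r
    · obtain ⟨c2, _, _, pde⟩ := hu x hb hx
      have c1 : ContDiffAt ℝ 1 (pd v u) x := (c2.fderiv_right (m := 1) (by norm_num)).clm_apply contDiffAt_const
      exact ((c2.of_le (by norm_num)).mul ((H.pd v).smooth.contDiffAt.of_le (by simp))).add
        (contDiffAt_const.mul ((H.smooth.contDiffAt.of_le (by simp)).mul c1))
    · exact contDiffAt_const.congr_of_eventuallyEq (hX0 v x hb)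
  have iD : IntegrableOn (fun x => u x * (lap h x + l * h x)) (Metric.ball p r ∩ {x | 0 < ⟪x - c, n⟫}) := by
    have T : TestIn (Metric.ball p r) fun x => lap h x + l * h x := H.lap.add (H.mul_left contDiff_const)
    obtain ⟨C, hC⟩ := T.bdd
    exact Integrable.mul_bdd (c := C) hi T.smooth.continuous.aestronglyMeasurable (ae_of_all _ hC)
  have hk : ∀ x, x ∉ Metric.ball p r → u x * (lap h x + l * h x) = 0 := fun x hx => by
    rw [H.zero hx, H.lap.zero hx]; ring
  rw [← int_half2 hk]
  have iD' : IntegrableOn (fun x => u x * (lap h x + l * h x)) {x | 0 < ⟪x - c, n⟫} := by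
    refine iD.of_forall_sdiff_eq_zero (halfmeas n c) ?_
    intro x hx
    exact hk x fun hb => hx.2 ⟨hb, hx.1⟩
  have key := div_half (n := n) (c := c) (X0 := fun x => u x * pd ee0 h x + (-1) * (h x * pd ee0 u x))
    (X1 := fun x => u x * pd ee1 h x + (-1) * (h x * pd ee1 u x)) (R := ‖p‖ + r)
    (M := M * K + |Q| * M) (by positivity) (cX ee0) (cX ee1)
    (fun x hx => by
      have := H.far hx
      exact ⟨(hX0 ee0 x this).eq_of_nhds, (hX0 ee1 x this).eq_of_nhds⟩)
    (fun x hx => by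
      by_cases hb : x ∈ Metric.ball p r
      · obtain ⟨c2, b1, b2, pde⟩ := hu x hb hx
        have e : n 0 * (u x * pd ee0 h x + (-1) * (h x * pd ee0 u x)) + n 1 * (u x * pd ee1 h x + (-1) * (h x * pd ee1 u x)) = u x * pd n h x - h x * pd n u x := by
          rw [pd_decomp h n x, pd_decomp u n x]; ring
        rw [e, add_mul, mul_assoc, mul_assoc]
        refine (abs_sub _ _).trans ?_
        rw [abs_mul, abs_mul]
        exact add_le_add (mul_le_mul b1 (hK x hx) (abs_nonneg _) hM) (mul_le_mul ((hQ x).trans (le_abs_self Q)) b2 (abs_nonneg _) (abs_nonneg _))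
      · have h1 := (hX0 ee0 x hb).eq_of_nhds
        have h2 := (hX0 ee1 x hb).eq_of_nhds
        simp only [h1, h2]; simp; positivity)
    (iD'.congr_fun (fun x hx => (hD x hx).symm) (halfmeas n c))
  rw [← setIntegral_congr_fun (halfmeas n c) (fun x hx => hD x hx)]
  exact key
end

section
open MeasureTheory Filter Topology
open scoped ContDiff FourierTransform RealInnerProductSpace

/-- local data: a smooth solution near `p`, even across the side through `p` if there is one -/
def NiceD (A B C : E2) (l : ℝ) (p : E2) (r : ℝ) (F : E2 → ℝ) : Prop :=
  0 < r ∧ ContDiff ℝ ∞ F ∧ (∀ x ∈ Metric.ball p r, lap F x = -(l * F x)) ∧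
  (∀ y ∈ Metric.ball p r, y ∉ Vtx A B C) ∧
  (Metric.ball p r ⊆ Tri A B C ∨ ∃ n c, Sd A B C n c ∧ Half (Tri A B C) p r n c ∧ ∀ x ∈ Metric.ball p r, F (sg n c x) = F x)

def NiceAt (A B C : E2) (l : ℝ) (f : E2 → ℝ) (p : E2) : Prop :=
  ∃ r F, NiceD A B C l p r F ∧ ∀ x ∈ Metric.ball p r, x ∈ Tri A B C → f x = F x

theorem weak_of_seq {K : Set E2} (hK : IsCompact K) {l : ℝ} {f : ℕ → E2 → ℝ} {g h : E2 → ℝ} {U : Set E2} (H : TestIn U h)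
    (hf : ∀ n, ContDiff ℝ 1 (f n)) (hg : IntegrableOn g K)
    (t1 : ∀ h : E2 → ℝ, Continuous h → Tendsto (fun n => ∫ x in K, f n x * h x) (hyperfilter ℕ : Filter ℕ) (𝓝 (∫ x in K, g x * h x)))
    (t2 : ∀ h : E2 → ℝ, ContDiff ℝ 1 h → Tendsto (fun n => ∫ x in K, gin (f n) h x) (hyperfilter ℕ : Filter ℕ) (𝓝 (l * ∫ x in K, g x * h x)))
    (hz : ∀ n, ∫ x in K, (gin (f n) h x + f n x * lap h x) = 0) :
    ∫ x in K, g x * (lap h x + l * h x) = 0 := by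
  have a := (t2 h (H.smooth.of_le (by simp))).add (t1 (lap h) H.lap.smooth.continuous)
  have e : ∀ n, (∫ x in K, gin (f n) h x) + ∫ x in K, f n x * lap h x = 0 := by
    intro n
    have i2 : IntegrableOn (fun x => f n x * lap h x) K := intK hK ((hf n).continuous.mul H.lap.smooth.continuous)
    rw [← hz n, integral_add (intK hK (gin_cont (hf n) (H.smooth.of_le (by simp)))) i2]
  simp only [e] at a
  have a' := tendsto_nhds_unique a tendsto_const_nhds
  have bm : ∀ {ξ : E2 → ℝ}, TestIn U ξ → IntegrableOn (fun x => g x * ξ x) K := by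
    intro ξ hξ
    obtain ⟨C, hC⟩ := hξ.bdd
    exact Integrable.mul_bdd (c := C) hg hξ.smooth.continuous.aestronglyMeasurable (ae_of_all _ hC)
  have e2 : ∫ x in K, g x * (lap h x + l * h x) = (∫ x in K, g x * lap h x) + l * ∫ x in K, g x * h x := by
    rw [← integral_const_mul, ← integral_add (bm H.lap) ((bm H).const_mul l)]
    congr 1; ext x; ring
  rw [e2]; linarith

theorem nice_ae {A B C p : E2} (hd : dt A B C ≠ 0) (hp : p ∈ TriDom A B C) {l : ℝ} {f : ℕ → E2 → ℝ} {g : E2 → ℝ}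
    (hf : ∀ n, ContDiff ℝ 1 (f n)) (hg : IntegrableOn g (Tri A B C))
    (t1 : ∀ h : E2 → ℝ, Continuous h → Tendsto (fun n => ∫ x in Tri A B C, f n x * h x) (hyperfilter ℕ : Filter ℕ) (𝓝 (∫ x in Tri A B C, g x * h x)))
    (t2 : ∀ h : E2 → ℝ, ContDiff ℝ 1 h → Tendsto (fun n => ∫ x in Tri A B C, gin (f n) h x) (hyperfilter ℕ : Filter ℕ) (𝓝 (l * ∫ x in Tri A B C, g x * h x))) :
    ∃ r F, NiceD A B C l p r F ∧ ∀ᵐ x, x ∈ Metric.ball p r → x ∈ Tri A B C → g x = F x := by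
  obtain ⟨r, hr, hv, hcase⟩ := loc hd hp
  have hsub : Metric.ball p (r / 2) ⊆ Metric.ball p r := Metric.ball_subset_ball (by linarith)
  have hT := Tri_meas A B C
  have hK := Tri_compact A B C
  have gz : ∀ {h : E2 → ℝ} (_ : TestIn (Metric.ball p r) h) n x, x ∉ Metric.ball p r → gin (f n) h x + f n x * lap h x = 0 := by
    intro h H n x hx
    rw [gin, (H.pd ee0).zero hx, (H.pd ee1).zero hx, H.lap.zero hx]; ring
  have gz2 : ∀ {h : E2 → ℝ} (_ : TestIn (Metric.ball p r) h) x, x ∉ Metric.ball p r → g x * (lap h x + l * h x) = 0 := by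
    intro h H x hx
    rw [H.zero hx, H.lap.zero hx]; ring
  rcases hcase with hb | ⟨n, c, hs, hh⟩
  · have w : ∀ h, TestIn (Metric.ball p r) h → ∫ x in Metric.ball p r, g x * (lap h x + l * h x) = 0 := by
      intro h H
      have h0 := weak_of_seq hK H hf hg t1 t2 (fun n => by
        rw [setIntegral_eq_integral_of_forall_compl_eq_zero (fun x hx => gz H n x fun h' => hx (hb h'))]
        exact green_int H (hf n))
      rw [setIntegral_eq_integral_of_forall_compl_eq_zero (fun x hx => gz2 H x fun h' => hx (hb h'))] at h0
      rw [setIntegral_eq_integral_of_forall_compl_eq_zero (fun x hx => gz2 H x hx)]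
      exact h0
    obtain ⟨G, hG, pde, hae⟩ := nice_int hr (hg.mono_set hb) w
    refine ⟨r / 2, G, ⟨by linarith, hG, pde, fun y hy => hv y (hsub hy), Or.inl (hsub.trans hb)⟩, ?_⟩
    filter_upwards [hae] with x hx hxb _ using hx hxb
  · have w : ∀ h, TestIn (Metric.ball p r) h → (∀ x, h (sg n c x) = h x) →
        ∫ x in Metric.ball p r ∩ {x | 0 < ⟪x - c, n⟫}, g x * (lap h x + l * h x) = 0 := by
      intro h H he
      have h0 := weak_of_seq hK H hf hg t1 t2 (fun m => by
        rw [int_half hT hh (gz H m), ← int_half2 (gz H m)]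
        exact green_half hh.1 H he (hf m))
      rwa [int_half hT hh (gz2 H)] at h0
    have hi : IntegrableOn g (Metric.ball p r ∩ {x | 0 < ⟪x - c, n⟫}) := by
      refine hg.mono_set fun x hx => (hh.2.2 x hx.1).2 (le_of_lt hx.2)
    obtain ⟨G, hG, pde, hev, hae⟩ := nice_side hh.1 hh.2.1 hr hi w
    refine ⟨r / 2, G, ⟨by linarith, hG, pde, fun y hy => hv y (hsub hy), Or.inr ⟨n, c, hs, hh.mono (by linarith), hev⟩⟩, ?_⟩
    filter_upwards [hae, line_ae hh.1 c] with x hx hne hxb hxT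
    refine hx hxb (lt_of_le_of_ne ((hh.2.2 x (hsub hxb)).1 hxT) (Ne.symm hne))

theorem ae_glue {A B C : E2} (hd : dt A B C ≠ 0) {F G : E2 → ℝ} (hF : Continuous F) (hG : Continuous G) {O : Set E2} (hO : IsOpen O)
    (h : ∀ᵐ x, x ∈ O → x ∈ Tri A B C → F x = G x) {y : E2} (hy : y ∈ O) (hyT : y ∈ Tri A B C) : F y = G y := by
  have hU : IsOpen (O ∩ interior (Tri A B C)) := hO.inter isOpen_interior
  have e : EqOn F G (O ∩ interior (Tri A B C)) := by
    refine Measure.eqOn_open_of_ae_eq (μ := volume) ((ae_restrict_iff' hU.measurableSet).2 ?_) hU hF.continuousOn hG.continuousOn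
    filter_upwards [h] with x hx hxU using hx hxU.1 (interior_subset hxU.2)
  have hc : y ∈ closure (O ∩ interior (Tri A B C)) := hO.inter_closure ⟨hy, Tri_sub_closure hd hyT⟩
  exact e.closure hF hG hc

theorem glue {A B C : E2} (hd : dt A B C ≠ 0) {l : ℝ} {g : E2 → ℝ}
    (H : ∀ p ∈ TriDom A B C, ∃ r F, NiceD A B C l p r F ∧ ∀ᵐ x, x ∈ Metric.ball p r → x ∈ Tri A B C → g x = F x) :
    ∃ f : E2 → ℝ, (∀ p ∈ TriDom A B C, NiceAt A B C l f p) ∧ ∀ᵐ x, x ∈ Tri A B C → g x = f x := by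
  classical
  choose! r F hN hae using H
  set f : E2 → ℝ := fun x => F x x with hfdef
  have key : ∀ p ∈ TriDom A B C, ∀ x ∈ Metric.ball p (r p), x ∈ Tri A B C → f x = F p x := by
    intro p hp x hx hxT
    have hxD : x ∈ TriDom A B C := ⟨hxT, (hN p hp).2.2.2.1 x hx⟩
    refine ae_glue hd (hN x hxD).2.1.continuous (hN p hp).2.1.continuous
      (O := Metric.ball x (r x) ∩ Metric.ball p (r p)) (Metric.isOpen_ball.inter Metric.isOpen_ball) ?_
      ⟨Metric.mem_ball_self (hN x hxD).1, hx⟩ hxT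
    filter_upwards [hae x hxD, hae p hp] with y h1 h2 hy hyT
    rw [← h1 hy.1 hyT, h2 hy.2 hyT]
  refine ⟨f, fun p hp => ⟨r p, F p, hN p hp, key p hp⟩, ?_⟩
  have hnull : volume {x | x ∈ TriDom A B C ∧ g x ≠ f x} = 0 := by
    refine measure_null_of_locally_null _ fun x hx => ?_
    refine ⟨{x | x ∈ TriDom A B C ∧ g x ≠ f x} ∩ Metric.ball x (r x), inter_mem_nhdsWithin _ (Metric.ball_mem_nhds _ (hN x hx.1).1), ?_⟩
    have h0 := hae x hx.1
    rw [ae_iff] at h0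
    refine measure_mono_null ?_ h0
    rintro y ⟨⟨hy1, hy2⟩, hy3⟩ hcon
    exact hy2 ((hcon hy3 hy1.1).trans (key x hx.1 y hy3 hy1.1).symm)
  have hV : volume (Vtx A B C) = 0 := (Set.toFinite ({A, B, C} : Set E2)).measure_zero _
  rw [ae_iff]
  refine measure_mono_null ?_ (measure_union_null hnull hV)
  intro x hx
  simp only [mem_ofPred_eq, Classical.not_imp] at hx
  by_cases hv : x ∈ Vtx A B C
  · exact Or.inr hv
  · exact Or.inl ⟨⟨hx.1, hv⟩, hx.2⟩

theorem nice_smooth {A B C : E2} {l : ℝ} {f : E2 → ℝ} (H : ∀ p ∈ TriDom A B C, NiceAt A B C l f p) :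
    ContDiffOn ℝ ∞ f (TriDom A B C) := by
  intro p hp
  obtain ⟨r, F, hN, e⟩ := H p hp
  refine (hN.2.1.contDiffAt.contDiffWithinAt).congr_of_eventuallyEq ?_ (e p (Metric.mem_ball_self hN.1) hp.1)
  filter_upwards [self_mem_nhdsWithin, mem_nhdsWithin_of_mem_nhds (Metric.ball_mem_nhds p hN.1)] with x h1 h2
  exact e x h2 h1.1

theorem nice_pde {A B C : E2} (hd : dt A B C ≠ 0) {l : ℝ} {f : E2 → ℝ} (H : ∀ p ∈ TriDom A B C, NiceAt A B C l f p)
    {p : E2} (hp : p ∈ interior (Tri A B C)) : lap f p = -(l * f p) := by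
  obtain ⟨r, F, hN, e⟩ := H p (interior_sub_TriDom hd hp)
  have : f =ᶠ[𝓝 p] F := by
    filter_upwards [isOpen_interior.mem_nhds hp, Metric.ball_mem_nhds p hN.1] with x h1 h2 using e x h2 (interior_subset h1)
  rw [lap_congr this, hN.2.2.1 p (Metric.mem_ball_self hN.1), this.eq_of_nhds]

theorem even_pd {F : E2 → ℝ} (hF : ContDiff ℝ ∞ F) {p n c : E2} {r : ℝ} (hr : 0 < r) (hn : ‖n‖ = 1) (hp : ⟪p - c, n⟫ = 0)
    (he : ∀ x ∈ Metric.ball p r, F (sg n c x) = F x) : pd n F p = 0 := by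
  have e1 : (fun y => F (sg n c y)) =ᶠ[𝓝 p] F := by
    filter_upwards [Metric.ball_mem_nhds p hr] with x hx using he x hx
  have e2 := pd_sg (n := n) (c := c) (x := p) (v := n) (η := F) (hF.differentiable (by simp) _)
  rw [pd_congr _ e1, sg_fix hp, sgL_apply] at e2
  have : n - (2 * ⟪n, n⟫) • n = -n := by
    rw [real_inner_self_eq_norm_sq, hn]; norm_num [two_smul]
  rw [this] at e2
  have e3 : pd (-n) F p = - pd n F p := by simp [pd]
  linarith

theorem nice_fderivWithin {A B C : E2} (hd : dt A B C ≠ 0) {f F : E2 → ℝ} {p : E2} {r : ℝ} (hF : ContDiff ℝ ∞ F)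
    (e : ∀ x ∈ Metric.ball p r, x ∈ Tri A B C → f x = F x) {x : E2} (hx : x ∈ Metric.ball p r) (hxT : x ∈ TriDom A B C) :
    fderivWithin ℝ f (TriDom A B C) x = fderiv ℝ F x := by
  have e1 : f =ᶠ[𝓝[TriDom A B C] x] F := by
    filter_upwards [self_mem_nhdsWithin, mem_nhdsWithin_of_mem_nhds (Metric.isOpen_ball.mem_nhds hx)] with y h1 h2
    exact e y h2 h1.1
  rw [e1.fderivWithin_eq (e x hx hxT.1), fderivWithin_eq_fderiv (TriDom_ud hd x hxT) (hF.differentiable (by simp) x)]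

theorem Sd_side {A B C n c p : E2} (hd : dt A B C ≠ 0) (hp : p ∈ TriDom A B C) (h1 : ell A B C p = 0) (hs : Sd A B C n c)
    (hpc : ⟪p - c, n⟫ = 0) : n = nrm A B C := by
  obtain ⟨p2, p3⟩ := side_pos hd hp h1
  rcases hs with ⟨rfl, rfl⟩ | ⟨rfl, rfl⟩ | ⟨rfl, rfl⟩
  · rfl
  · exact absurd hpc p2.ne'
  · exact absurd hpc p3.ne'

theorem Sd_cyc {A B C n c : E2} (h : Sd A B C n c) : Sd B C A n c := by
  unfold Sd at *; tauto

theorem NiceAt_cyc {A B C p : E2} {l : ℝ} {f : E2 → ℝ} (h : NiceAt A B C l f p) : NiceAt B C A l f p := by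
  obtain ⟨r, F, ⟨h1, h2, h3, h4, h5⟩, e⟩ := h
  refine ⟨r, F, ⟨h1, h2, h3, by rwa [Vtx_cyc], ?_⟩, by rwa [Tri_cyc]⟩
  rw [Tri_cyc]
  rcases h5 with h5 | ⟨n, c, hs, hh⟩
  · exact Or.inl h5
  · exact Or.inr ⟨n, c, Sd_cyc hs, hh⟩

theorem nice_neumann {A B C : E2} (hd : dt A B C ≠ 0) {l : ℝ} {f : E2 → ℝ} (H : ∀ p ∈ TriDom A B C, NiceAt A B C l f p) :
    NeumannOn (TriDom A B C) B C f := by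
  intro p hp hpB hpC w hw
  have hop : p ∈ openSegment ℝ B C := mem_openSegment_of_ne_left_right hpB.symm hpC.symm hp
  obtain ⟨hpD, h1⟩ := (mem_openSegment_iff' hd).1 hop
  obtain ⟨r, F, ⟨hr, hF, _, _, h5⟩, e⟩ := H p hpD
  rw [nice_fderivWithin hd hF e (Metric.mem_ball_self hr) hpD]
  obtain ⟨s, rfl⟩ := nrm_perp hd hw
  rcases h5 with h5 | ⟨n, c, hs, hh, hev⟩
  · exfalso
    have := (mem_int hd p).1 (mem_interior.2 ⟨_, h5, Metric.isOpen_ball, Metric.mem_ball_self hr⟩)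
    linarith
  · rw [← Sd_side hd hpD h1 hs hh.2.1]
    have := even_pd hF hr hh.1 hh.2.1 hev
    rw [pd] at this
    rw [map_smul, this, smul_zero]
end

section
open MeasureTheory Filter Topology
open scoped ContDiff FourierTransform RealInnerProductSpace

theorem TestIn.ev_zero {U : Set E2} {h : E2 → ℝ} (H : TestIn U h) {x : E2} (hx : x ∉ U) : h =ᶠ[𝓝 x] fun _ => 0 :=
  notMem_tsupport_iff_eventuallyEq.1 fun h' => hx (H.sub h')

theorem TestIn.mul_on {U : Set E2} {χ q : E2 → ℝ} (h : TestIn U χ) (hq : ∀ x ∈ U, ContDiffAt ℝ ∞ q x) :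
    TestIn U (fun x => χ x * q x) := by
  refine ⟨?_, h.cpt.mul_right, (tsupport_mul_subset_left).trans h.sub⟩
  rw [contDiff_iff_contDiffAt]
  intro x
  by_cases hx : x ∈ U
  · exact h.smooth.contDiffAt.mul (hq x hx)
  · refine contDiffAt_const (c := (0:ℝ)) |>.congr_of_eventuallyEq ?_
    filter_upwards [h.ev_zero hx] with y hy
    rw [hy, zero_mul]

theorem ibp_on {U : Set E2} {f X : E2 → ℝ} (hX : TestIn U X) (hf : ∀ x ∈ U, ContDiffAt ℝ 1 f x) (v : E2) :
    ∫ x, f x * pd v X x = -∫ x, pd v f x * X x := by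
  have ez : ∀ x, x ∉ U → (fun x => f x * X x) =ᶠ[𝓝 x] fun _ => 0 := by
    intro x hx
    filter_upwards [hX.ev_zero hx] with y hy
    rw [hy, mul_zero]
  have sm : ContDiff ℝ 1 (fun x => f x * X x) := by
    rw [contDiff_iff_contDiffAt]
    intro x
    by_cases hx : x ∈ U
    · exact (hf x hx).mul (hX.smooth.contDiffAt.of_le (by simp))
    · exact contDiffAt_const.congr_of_eventuallyEq (ez x hx)
  have e : ∀ x, pd v (fun x => f x * X x) x = pd v f x * X x + f x * pd v X x := by
    intro x
    by_cases hx : x ∈ U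
    · exact pd_mul v ((hf x hx).differentiableAt (by simp)) (hX.smooth.differentiable (by simp) x)
    · rw [pd_congr v (ez x hx), hX.zero hx, (hX.pd v).zero hx]; simp [pd]
  have key := int_pd_zero v sm (HasCompactSupport.mul_left hX.cpt)
  have c1 : Continuous fun x => f x * pd v X x := by
    rw [continuous_iff_continuousAt]
    intro x
    by_cases hx : x ∈ U
    · exact (hf x hx).continuousAt.mul (hX.pd v).smooth.continuous.continuousAt
    · refine (continuousAt_const (y := (0:ℝ))).congr ?_
      filter_upwards [(hX.pd v).ev_zero hx] with y hy
      rw [hy, mul_zero]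
  have i1 : Integrable fun x => f x * pd v X x := c1.integrable_of_hasCompactSupport (HasCompactSupport.mul_left (hX.pd v).cpt)
  have i2 : Integrable fun x => pd v f x * X x := by
    have : (fun x => pd v f x * X x) = fun x => pd v (fun x => f x * X x) x - f x * pd v X x := by
      ext x; rw [e]; ring
    rw [this]
    exact ((pd_cont sm v).integrable_of_hasCompactSupport (pd_hasCompactSupport v (HasCompactSupport.mul_left hX.cpt))).sub i1
  rw [integral_congr_ae (ae_of_all _ e), integral_add i2 i1] at key
  linarith

theorem pd_smooth_on {U : Set E2} {f : E2 → ℝ} (hf : ∀ x ∈ U, ContDiffAt ℝ ∞ f x) (v : E2) : ∀ x ∈ U, ContDiffAt ℝ ∞ (pd v f) x :=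
  fun x hx => ((hf x hx).fderiv_right (m := ∞) (by simp)).clm_apply contDiffAt_const

theorem energy_cut {T : Set E2} (hT : IsCompact T) {F g : E2 → ℝ} {f : ℕ → E2 → ℝ} {Cst : ℝ}
    (hf : ∀ n, ContDiff ℝ 1 (f n)) (hE : ∀ n, ∫ x in T, gsq (f n) x ≤ Cst)
    (t1 : ∀ h : E2 → ℝ, Continuous h → Tendsto (fun n => ∫ x in T, f n x * h x) (hyperfilter ℕ : Filter ℕ) (𝓝 (∫ x in T, g x * h x)))
    (hF : ∀ x ∈ interior T, ContDiffAt ℝ ∞ F x) (hg : ∀ᵐ x, x ∈ T → g x = F x) {χ : E2 → ℝ} (hχ : TestIn (interior T) χ)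
    (h0 : ∀ x, 0 ≤ χ x) (h1 : ∀ x, χ x ≤ 1) : ∫ x, χ x * gsq F x ≤ Cst := by
  have hm : MeasurableSet T := hT.isClosed.measurableSet
  have X : ∀ v, TestIn (interior T) (fun x => χ x * pd v F x) := fun v => hχ.mul_on (pd_smooth_on hF v)
  have z : ∀ {h : E2 → ℝ}, TestIn (interior T) h → ∀ x, x ∉ T → h x = 0 := fun H x hx => H.zero fun h' => hx (interior_subset h')
  have G : TestIn (interior T) (fun x => χ x * gsq F x) :=
    hχ.mul_on (fun x hx => ((pd_smooth_on hF ee0 x hx).pow 2).add ((pd_smooth_on hF ee1 x hx).pow 2))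
  have iG : Integrable (fun x => χ x * gsq F x) := G.smooth.continuous.integrable_of_hasCompactSupport G.cpt
  -- the limit
  have D : TestIn (interior T) (fun x => pd ee0 (fun x => χ x * pd ee0 F x) x + pd ee1 (fun x => χ x * pd ee1 F x) x) :=
    ((X ee0).pd ee0).add ((X ee1).pd ee1)
  have t := t1 _ D.smooth.continuous
  have split : ∀ {q : E2 → ℝ}, (∀ x ∈ interior T, ContDiffAt ℝ 1 q x) →
      ∫ x in T, q x * (pd ee0 (fun x => χ x * pd ee0 F x) x + pd ee1 (fun x => χ x * pd ee1 F x) x) =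
      - ∫ x, χ x * gin q F x := by
    intro q hq
    have cc : ∀ {k : E2 → ℝ}, TestIn (interior T) k → Integrable fun x => q x * k x := by
      intro k hk
      have : Continuous fun x => q x * k x := by
        rw [continuous_iff_continuousAt]
        intro x
        by_cases hx : x ∈ interior T
        · exact (hq x hx).continuousAt.mul hk.smooth.continuous.continuousAt
        · refine (continuousAt_const (y := (0:ℝ))).congr ?_
          filter_upwards [hk.ev_zero hx] with y hy
          rw [hy, mul_zero]
      exact this.integrable_of_hasCompactSupport (HasCompactSupport.mul_left hk.cpt)
    have cc2 : ∀ v {k : E2 → ℝ}, TestIn (interior T) k → Integrable fun x => pd v q x * k x := by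
      intro v k hk
      have : Continuous fun x => pd v q x * k x := by
        rw [continuous_iff_continuousAt]
        intro x
        by_cases hx : x ∈ interior T
        · exact (((hq x hx).fderiv_right (m := 0) (by simp)).clm_apply contDiffAt_const).continuousAt.mul hk.smooth.continuous.continuousAt
        · refine (continuousAt_const (y := (0:ℝ))).congr ?_
          filter_upwards [hk.ev_zero hx] with y hy
          rw [hy, mul_zero]
      exact this.integrable_of_hasCompactSupport (HasCompactSupport.mul_left hk.cpt)
    rw [setIntegral_eq_integral_of_forall_compl_eq_zero (fun x hx => by rw [z D x hx, mul_zero])]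
    simp only [mul_add]
    rw [integral_add (cc ((X ee0).pd ee0)) (cc ((X ee1).pd ee1)), ibp_on (X ee0) hq ee0, ibp_on (X ee1) hq ee1, ← neg_add,
      ← integral_add (cc2 _ (X ee0)) (cc2 _ (X ee1))]
    congr 2; ext x; unfold gin; ring
  have tlim : ∫ x in T, g x * (pd ee0 (fun x => χ x * pd ee0 F x) x + pd ee1 (fun x => χ x * pd ee1 F x) x) = - ∫ x, χ x * gsq F x := by
    have e1 : ∫ x in T, g x * (pd ee0 (fun x => χ x * pd ee0 F x) x + pd ee1 (fun x => χ x * pd ee1 F x) x) =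
        ∫ x in T, F x * (pd ee0 (fun x => χ x * pd ee0 F x) x + pd ee1 (fun x => χ x * pd ee1 F x) x) := by
      apply integral_congr_ae
      refine (ae_restrict_iff' hm).2 ?_
      filter_upwards [hg] with x hx hxT
      rw [hx hxT]
    rw [e1, split (fun x hx => (hF x hx).of_le (by simp))]
    congr 2; ext x; unfold gin gsq; ring
  rw [tlim] at t
  have bd : ∀ n, -(Cst / 2 + (∫ x, χ x * gsq F x) / 2) ≤ ∫ x in T, f n x * (pd ee0 (fun x => χ x * pd ee0 F x) x + pd ee1 (fun x => χ x * pd ee1 F x) x) := by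
    intro n
    rw [split (fun x _ => (hf n).contDiffAt)]
    refine neg_le_neg ?_
    have e2 : ∫ x, χ x * gin (f n) F x = ∫ x in T, χ x * gin (f n) F x := by
      rw [setIntegral_eq_integral_of_forall_compl_eq_zero (fun x hx => by rw [z hχ x hx, zero_mul])]
    have e3 : ∫ x, χ x * gsq F x = ∫ x in T, χ x * gsq F x := by
      rw [setIntegral_eq_integral_of_forall_compl_eq_zero (fun x hx => by rw [z G x hx])]
    have i1 : IntegrableOn (gsq (f n)) T := intK hT (gsq_cont (hf n))
    have i2 : IntegrableOn (fun x => χ x * gin (f n) F x) T := by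
      have : (fun x => χ x * gin (f n) F x) = fun x => pd ee0 (f n) x * (χ x * pd ee0 F x) + pd ee1 (f n) x * (χ x * pd ee1 F x) := by
        ext x; unfold gin; ring
      rw [this]
      exact intK hT (((pd_cont (hf n) ee0).mul (X ee0).smooth.continuous).add ((pd_cont (hf n) ee1).mul (X ee1).smooth.continuous))
    have m : ∫ x in T, χ x * gin (f n) F x ≤ ∫ x in T, (gsq (f n) x / 2 + χ x * gsq F x / 2) := by
      refine setIntegral_mono_on i2 ((i1.div_const 2).add (iG.integrableOn.div_const 2)) hm ?_
      intro x _
      have a0 := h0 x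
      have a1 := h1 x
      unfold gin gsq
      nlinarith [sq_nonneg (pd ee0 (f n) x - χ x * pd ee0 F x), sq_nonneg (pd ee1 (f n) x - χ x * pd ee1 F x),
        mul_nonneg (mul_nonneg a0 (sub_nonneg.2 a1)) (sq_nonneg (pd ee0 F x)), mul_nonneg (mul_nonneg a0 (sub_nonneg.2 a1)) (sq_nonneg (pd ee1 F x))]
    rw [integral_add (i1.div_const 2) (iG.integrableOn.div_const 2), integral_div, integral_div] at m
    have := hE n
    rw [e2, e3]; linarith
  have := ge_of_tendsto' t bd
  linarith

theorem energy_bound {A B C : E2} (hd : dt A B C ≠ 0) {F g : E2 → ℝ} {f : ℕ → E2 → ℝ} {Cst : ℝ}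
    (hf : ∀ n, ContDiff ℝ 1 (f n)) (hE : ∀ n, ∫ x in Tri A B C, gsq (f n) x ≤ Cst)
    (t1 : ∀ h : E2 → ℝ, Continuous h → Tendsto (fun n => ∫ x in Tri A B C, f n x * h x) (hyperfilter ℕ : Filter ℕ) (𝓝 (∫ x in Tri A B C, g x * h x)))
    (hF : ∀ x ∈ interior (Tri A B C), ContDiffAt ℝ ∞ F x) (hg : ∀ᵐ x, x ∈ Tri A B C → g x = F x) :
    ∫⁻ x in interior (Tri A B C), ENNReal.ofReal (gsq F x) ≤ ENNReal.ofReal Cst := by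
  have h2 : dt B C A ≠ 0 := by rwa [dt_cyc]
  have h3 : dt C A B ≠ 0 := by rwa [dt_cyc]
  set s : E2 → E2 → E2 → ℕ → E2 → ℝ := fun A B C k x => Real.smoothTransition (k * ell A B C x - 1) with hs
  set χ : ℕ → E2 → ℝ := fun k x => s A B C k x * (s B C A k x * s C A B k x) with hχ
  have s0 : ∀ A B C k x, 0 ≤ s A B C k x := fun A B C k x => Real.smoothTransition.nonneg _
  have s1 : ∀ A B C k x, s A B C k x ≤ 1 := fun A B C k x => Real.smoothTransition.le_one _
  have sc : ∀ A B C k, ContDiff ℝ ∞ (s A B C k) := by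
    intro A B C k
    refine Real.smoothTransition.contDiff.comp ((contDiff_const.mul ?_).sub contDiff_const)
    exact (contDiff_id.sub contDiff_const).inner ℝ contDiff_const
  have hχ0 : ∀ k x, 0 ≤ χ k x := fun k x => mul_nonneg (s0 _ _ _ _ _) (mul_nonneg (s0 _ _ _ _ _) (s0 _ _ _ _ _))
  have hχ1 : ∀ k x, χ k x ≤ 1 := fun k x => mul_le_one₀ (s1 _ _ _ _ _) (mul_nonneg (s0 _ _ _ _ _) (s0 _ _ _ _ _)) (mul_le_one₀ (s1 _ _ _ _ _) (s0 _ _ _ _ _) (s1 _ _ _ _ _))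
  have sp : ∀ (A B C : E2) (k : ℕ) (x : E2), 1 < (k:ℝ) * ell A B C x ∨ s A B C k x = 0 := by
    intro A B C k x
    rcases lt_or_ge (1:ℝ) (k * ell A B C x) with h | h
    · exact Or.inl h
    · exact Or.inr (Real.smoothTransition.zero_of_nonpos (by linarith))
  have supp : ∀ k : ℕ, tsupport (χ k) ⊆ {x | 1 ≤ k * ell A B C x} ∩ ({x | 1 ≤ k * ell B C A x} ∩ {x | 1 ≤ k * ell C A B x}) := by
    intro k
    have cl : ∀ A B C : E2, IsClosed {x | 1 ≤ (k:ℝ) * ell A B C x} := fun A B C =>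
      isClosed_le continuous_const (continuous_const.mul (continuous_ell A B C))
    refine closure_minimal ?_ ((cl _ _ _).inter ((cl _ _ _).inter (cl _ _ _)))
    intro x hx
    have hx' : χ k x ≠ 0 := hx
    simp only [hχ, mul_ne_zero_iff] at hx'
    exact ⟨((sp A B C k x).resolve_right hx'.1).le, ((sp B C A k x).resolve_right hx'.2.1).le, ((sp C A B k x).resolve_right hx'.2.2).le⟩
  have pos : ∀ (k : ℕ) (t : ℝ), 1 ≤ k * t → 0 < t := by
    intro k t h
    by_contra hc
    have : (k:ℝ) * t ≤ 0 := mul_nonpos_of_nonneg_of_nonpos (Nat.cast_nonneg k) (not_lt.1 hc)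
    linarith
  have sub : ∀ k, tsupport (χ k) ⊆ interior (Tri A B C) := by
    intro k x hx
    obtain ⟨a1, a2, a3⟩ := supp k hx
    exact (mem_int hd x).2 ⟨pos k _ a1, pos k _ a2, pos k _ a3⟩
  have T : ∀ k, TestIn (interior (Tri A B C)) (χ k) := fun k =>
    ⟨(sc _ _ _ _).mul ((sc _ _ _ _).mul (sc _ _ _ _)), (Tri_compact A B C).of_isClosed_subset (isClosed_tsupport _) ((sub k).trans interior_subset), sub k⟩
  have key : ∀ k, ∫⁻ x in interior (Tri A B C), ENNReal.ofReal (χ k x * gsq F x) ≤ ENNReal.ofReal Cst := by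
    intro k
    have G : TestIn (interior (Tri A B C)) (fun x => χ k x * gsq F x) :=
      (T k).mul_on (fun x hx => ((pd_smooth_on hF ee0 x hx).pow 2).add ((pd_smooth_on hF ee1 x hx).pow 2))
    refine (setLIntegral_le_lintegral _ _).trans ?_
    rw [← ofReal_integral_eq_lintegral_ofReal (G.smooth.continuous.integrable_of_hasCompactSupport G.cpt)
      (ae_of_all _ fun x => mul_nonneg (hχ0 k x) (gsq_nonneg F x))]
    exact ENNReal.ofReal_le_ofReal (energy_cut (Tri_compact A B C) hf hE t1 hF hg (T k) (hχ0 k) (hχ1 k))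
  have lim : ∀ x ∈ interior (Tri A B C), Tendsto (fun k => ENNReal.ofReal (χ k x * gsq F x)) atTop (𝓝 (ENNReal.ofReal (gsq F x))) := by
    intro x hx
    obtain ⟨b1, b2, b3⟩ := (mem_int hd x).1 hx
    have ev : ∀ t : ℝ, 0 < t → ∀ᶠ k : ℕ in atTop, 1 ≤ k * t - 1 := by
      intro t ht
      have := (tendsto_natCast_atTop_atTop (R := ℝ)).atTop_mul_const ht
      filter_upwards [this.eventually_ge_atTop 2] with k hk
      linarith
    refine tendsto_const_nhds.congr' ?_
    filter_upwards [ev _ b1, ev _ b2, ev _ b3] with k k1 k2 k3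
    have : χ k x = 1 := by
      simp only [hχ, hs, Real.smoothTransition.one_of_one_le k1, Real.smoothTransition.one_of_one_le k2, Real.smoothTransition.one_of_one_le k3, mul_one]
    rw [this, one_mul]
  calc ∫⁻ x in interior (Tri A B C), ENNReal.ofReal (gsq F x)
      = ∫⁻ x in interior (Tri A B C), liminf (fun k => ENNReal.ofReal (χ k x * gsq F x)) atTop := by
        refine setLIntegral_congr_fun isOpen_interior.measurableSet fun x hx => ?_
        exact (lim x hx).liminf_eq.symm
    _ ≤ liminf (fun k => ∫⁻ x in interior (Tri A B C), ENNReal.ofReal (χ k x * gsq F x)) atTop := by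
        refine lintegral_liminf_le fun k => ?_
        have G : TestIn (interior (Tri A B C)) (fun x => χ k x * gsq F x) :=
          (T k).mul_on (fun x hx => ((pd_smooth_on hF ee0 x hx).pow 2).add ((pd_smooth_on hF ee1 x hx).pow 2))
        exact G.smooth.continuous.measurable.ennreal_ofReal
    _ ≤ ENNReal.ofReal Cst := by
        refine liminf_le_of_le (by isBoundedDefault) ?_
        intro b hb
        obtain ⟨k, hk⟩ := hb.exists
        exact hk.trans (key k)
end

section
open MeasureTheory Filter Topology
open scoped ContDiff FourierTransform RealInnerProductSpace

def Ph (A B C : E2) (s t : ℝ) : E2 := A + s • (B - A) + (s * t) • (C - B)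

theorem Ph_aff (A B C : E2) (s t : ℝ) : Ph A B C s t = (1 - s) • A + (s * (1 - t)) • B + (s * t) • C := by
  unfold Ph; module

theorem bcc_Ph {A B C : E2} (h : dt A B C ≠ 0) (s t : ℝ) :
    bcc A B C (Ph A B C s t) = 1 - s ∧ bcc B C A (Ph A B C s t) = s * (1 - t) ∧ bcc C A B (Ph A B C s t) = s * t := by
  have h2 : dt B C A ≠ 0 := by rwa [dt_cyc]
  have h3 : dt C A B ≠ 0 := by rwa [dt_cyc]
  refine ⟨?_, ?_, ?_⟩
  · rw [Ph_aff]; exact bcc_affine h _ _ _ (by ring)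
  · rw [Ph_aff, show (1 - s) • A + (s * (1 - t)) • B + (s * t) • C = (s * (1 - t)) • B + (s * t) • C + (1 - s) • A by module]
    exact bcc_affine h2 _ _ _ (by ring)
  · rw [Ph_aff, show (1 - s) • A + (s * (1 - t)) • B + (s * t) • C = (s * t) • C + (1 - s) • A + (s * (1 - t)) • B by module]
    exact bcc_affine h3 _ _ _ (by ring)

def PhL (A B C : E2) (z : E2) : E2 →L[ℝ] E2 :=
  (EuclideanSpace.proj (𝕜 := ℝ) 0 : E2 →L[ℝ] ℝ).smulRight (B - A) +
    ((z 0) • (EuclideanSpace.proj (𝕜 := ℝ) 1 : E2 →L[ℝ] ℝ) + (z 1) • (EuclideanSpace.proj (𝕜 := ℝ) 0 : E2 →L[ℝ] ℝ)).smulRight (C - B)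

theorem PhL_deriv (A B C z : E2) : HasFDerivAt (fun z : E2 => Ph A B C (z 0) (z 1)) (PhL A B C z) z := by
  have h0 : HasFDerivAt (fun z : E2 => z 0) (EuclideanSpace.proj (𝕜 := ℝ) 0 : E2 →L[ℝ] ℝ) z :=
    (EuclideanSpace.proj (𝕜 := ℝ) 0 : E2 →L[ℝ] ℝ).hasFDerivAt
  have h1 : HasFDerivAt (fun z : E2 => z 1) (EuclideanSpace.proj (𝕜 := ℝ) 1 : E2 →L[ℝ] ℝ) z :=
    (EuclideanSpace.proj (𝕜 := ℝ) 1 : E2 →L[ℝ] ℝ).hasFDerivAt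
  have := ((h0.smul_const (B - A)).const_add A).add ((h0.mul h1).smul_const (C - B))
  exact this

theorem PhL_det (A B C z : E2) : (PhL A B C z).det = z 0 * dt A B C := by
  rw [ContinuousLinearMap.det, ← LinearMap.det_toMatrix (EuclideanSpace.basisFun (Fin 2) ℝ).toBasis, Matrix.det_fin_two]
  simp [LinearMap.toMatrix_apply, PhL, dt, cr]
  ring

theorem mem_int_bcc {A B C : E2} (h : dt A B C ≠ 0) (x : E2) :
    x ∈ interior (Tri A B C) ↔ 0 < bcc A B C x ∧ 0 < bcc B C A x ∧ 0 < bcc C A B x := by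
  have h2 : dt B C A ≠ 0 := by rwa [dt_cyc]
  have h3 : dt C A B ≠ 0 := by rwa [dt_cyc]
  rw [mem_int h, bcc_pos_iff h, bcc_pos_iff h2, bcc_pos_iff h3]

theorem mem_Tri_bcc {A B C : E2} (h : dt A B C ≠ 0) (x : E2) :
    x ∈ (Tri A B C) ↔ 0 ≤ bcc A B C x ∧ 0 ≤ bcc B C A x ∧ 0 ≤ bcc C A B x := by
  have h2 : dt B C A ≠ 0 := by rwa [dt_cyc]
  have h3 : dt C A B ≠ 0 := by rwa [dt_cyc]
  rw [mem_Tri h, bcc_nonneg_iff h, bcc_nonneg_iff h2, bcc_nonneg_iff h3]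

theorem Ph_int {A B C : E2} (h : dt A B C ≠ 0) {s t : ℝ} (hs : s ∈ Ioo (0:ℝ) 1) (ht : t ∈ Ioo (0:ℝ) 1) :
    Ph A B C s t ∈ interior (Tri A B C) := by
  obtain ⟨h1, h2, h3⟩ := bcc_Ph h s t
  rw [mem_int_bcc h, h1, h2, h3]
  exact ⟨by linarith [hs.2], mul_pos hs.1 (by linarith [ht.2]), mul_pos hs.1 ht.1⟩

theorem Ph_tri {A B C : E2} (h : dt A B C ≠ 0) {s t : ℝ} (hs : s ∈ Icc (0:ℝ) 1) (ht : t ∈ Icc (0:ℝ) 1) :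
    Ph A B C s t ∈ (Tri A B C) := by
  obtain ⟨h1, h2, h3⟩ := bcc_Ph h s t
  rw [mem_Tri_bcc h, h1, h2, h3]
  exact ⟨by linarith [hs.2], mul_nonneg hs.1 (by linarith [ht.2]), mul_nonneg hs.1 ht.1⟩

theorem Ph_inv {A B C : E2} (h : dt A B C ≠ 0) {x : E2} (hx : x ∈ Tri A B C) (h1 : bcc A B C x < 1) :
    ∃ t ∈ Icc (0:ℝ) 1, Ph A B C (1 - bcc A B C x) t = x := by
  obtain ⟨a, b, c⟩ := (mem_Tri_bcc h x).1 hx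
  have hs := bcc_sum h x
  have hc := bcc_comb h x
  have hp : 0 < 1 - bcc A B C x := by linarith
  refine ⟨bcc C A B x / (1 - bcc A B C x), ⟨by positivity, ?_⟩, ?_⟩
  · rw [div_le_one hp]; linarith
  · rw [Ph_aff]
    have e1 : (1 - bcc A B C x) * (bcc C A B x / (1 - bcc A B C x)) = bcc C A B x := by field_simp
    have e2 : (1 - bcc A B C x) * (1 - bcc C A B x / (1 - bcc A B C x)) = bcc B C A x := by
      rw [mul_sub, e1]; linarith
    rw [e1, e2]
    rw [show 1 - (1 - bcc A B C x) = bcc A B C x by ring]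
    exact hc

theorem Ph_image {A B C : E2} (h : dt A B C ≠ 0) :
    (fun z : E2 => Ph A B C (z 0) (z 1)) '' {z : E2 | z 0 ∈ Ioo (0:ℝ) 1 ∧ z 1 ∈ Ioo (0:ℝ) 1} = interior (Tri A B C) := by
  ext x
  constructor
  · rintro ⟨z, ⟨h0, h1⟩, rfl⟩
    exact Ph_int h h0 h1
  · intro hx
    obtain ⟨a, b, c⟩ := (mem_int_bcc h x).1 hx
    have hs := bcc_sum h x
    obtain ⟨t, ht, e⟩ := Ph_inv h (interior_subset hx) (by linarith)
    obtain ⟨_, e2, e3⟩ := bcc_Ph h (1 - bcc A B C x) t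
    rw [e] at e2 e3
    refine ⟨!₂[1 - bcc A B C x, t], ⟨by simp; constructor <;> linarith, ?_, ?_⟩, by simpa using e⟩
    · have : 0 < (1 - bcc A B C x) * t := e3 ▸ c
      simpa using pos_of_mul_pos_right this (by linarith)
    · have : 0 < (1 - bcc A B C x) * (1 - t) := e2 ▸ b
      have := pos_of_mul_pos_right this (by linarith)
      simp; linarith

theorem Ph_inj {A B C : E2} (h : dt A B C ≠ 0) :
    InjOn (fun z : E2 => Ph A B C (z 0) (z 1)) {z : E2 | z 0 ∈ Ioo (0:ℝ) 1 ∧ z 1 ∈ Ioo (0:ℝ) 1} := by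
  rintro z ⟨h0, h1⟩ w ⟨h0', h1'⟩ e
  simp only at e
  obtain ⟨a1, _, a3⟩ := bcc_Ph h (z 0) (z 1)
  obtain ⟨b1, _, b3⟩ := bcc_Ph h (w 0) (w 1)
  rw [e] at a1 a3
  have e0 : z 0 = w 0 := by linarith
  have e1 : z 1 = w 1 := by
    have : z 0 * z 1 = z 0 * w 1 := by rw [← a3, b3, e0]
    exact mul_left_cancel₀ h0.1.ne' this
  ext i; fin_cases i
  · exact e0
  · exact e1

def toE2 (z : ℝ × ℝ) : E2 := !₂[z.1, z.2]

theorem toE2_mp : MeasurePreserving toE2 := by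
  have h1 := (volume_preserving_finTwoArrow ℝ).symm
  have h2 := (PiLp.volume_preserving_toLp (Fin 2))
  have := h2.comp h1
  have e : toE2 = WithLp.toLp 2 ∘ ⇑(MeasurableEquiv.finTwoArrow (α := ℝ)).symm := by
    funext z; rfl
  rw [e]; exact this

theorem toE2_emb : MeasurableEmbedding toE2 := by
  have h1 := (MeasurableEquiv.finTwoArrow (α := ℝ)).symm.measurableEmbedding
  have h2 := (MeasurableEquiv.toLp 2 (Fin 2 → ℝ)).measurableEmbedding
  have := h2.comp h1
  have e : toE2 = ⇑(MeasurableEquiv.toLp 2 (Fin 2 → ℝ)) ∘ ⇑(MeasurableEquiv.finTwoArrow (α := ℝ)).symm := by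
    funext z; rfl
  rw [e]; exact this

theorem Ph_lint0 {A B C : E2} (h : dt A B C ≠ 0) (K : E2 → ENNReal) :
    ∫⁻ x in interior (Tri A B C), K x = ∫⁻ z in (Ioo (0:ℝ) 1) ×ˢ (Ioo (0:ℝ) 1), ENNReal.ofReal (|dt A B C| * z.1) * K (Ph A B C z.1 z.2) := by
  have ms : MeasurableSet {z : E2 | z 0 ∈ Ioo (0:ℝ) 1 ∧ z 1 ∈ Ioo (0:ℝ) 1} :=
    (measurableSet_Ioo.preimage (by fun_prop)).inter (measurableSet_Ioo.preimage (by fun_prop))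
  rw [← Ph_image h, lintegral_image_eq_lintegral_abs_det_fderiv_mul volume ms (fun z _ => (PhL_deriv A B C z).hasFDerivWithinAt) (Ph_inj h)]
  rw [← toE2_mp.setLIntegral_comp_preimage_emb toE2_emb]
  refine setLIntegral_congr_fun (s := (Ioo (0:ℝ) 1) ×ˢ (Ioo (0:ℝ) 1)) (measurableSet_Ioo.prod measurableSet_Ioo) ?_
  rintro ⟨s, t⟩ ⟨hs, ht⟩
  simp only [PhL_det, toE2]
  simp [abs_mul, abs_of_pos hs.1, mul_comm]

theorem Ph_int0 {A B C : E2} (h : dt A B C ≠ 0) (K : E2 → ℝ) :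
    ∫ x in interior (Tri A B C), K x = ∫ z in (Ioo (0:ℝ) 1) ×ˢ (Ioo (0:ℝ) 1), (|dt A B C| * z.1) * K (Ph A B C z.1 z.2) := by
  have ms : MeasurableSet {z : E2 | z 0 ∈ Ioo (0:ℝ) 1 ∧ z 1 ∈ Ioo (0:ℝ) 1} :=
    (measurableSet_Ioo.preimage (by fun_prop)).inter (measurableSet_Ioo.preimage (by fun_prop))
  rw [← Ph_image h, integral_image_eq_integral_abs_det_fderiv_smul volume ms (fun z _ => (PhL_deriv A B C z).hasFDerivWithinAt) (Ph_inj h)]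
  rw [← toE2_mp.setIntegral_preimage_emb toE2_emb]
  refine setIntegral_congr_fun (s := (Ioo (0:ℝ) 1) ×ˢ (Ioo (0:ℝ) 1)) (measurableSet_Ioo.prod measurableSet_Ioo) ?_
  rintro ⟨s, t⟩ ⟨hs, ht⟩
  simp only [PhL_det, toE2]
  simp [abs_mul, abs_of_pos hs.1, mul_comm]
end

section
open MeasureTheory Filter Topology
open scoped ContDiff FourierTransform RealInnerProductSpace

theorem osc1 {a b M : ℝ} {φ φ' k1 k2 : ℝ → ℝ} (hab : a ≤ b) (hφ : ∀ x ∈ Icc a b, HasDerivAt φ (φ' x) x)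
    (hc : ContinuousOn φ' (Icc a b)) (hk : ∀ x ∈ Icc a b, 2 * |φ' x| ≤ k1 x + k2 x)
    (hk1 : ∀ x ∈ Icc a b, 0 ≤ k1 x) (hk2 : ∀ x ∈ Icc a b, 0 ≤ k2 x) (hc2 : ContinuousOn k2 (Icc a b)) (hM : 0 ≤ M)
    (hI : ∫⁻ x in Icc a b, ENNReal.ofReal (k1 x) ≤ ENNReal.ofReal M) :
    2 * |φ b - φ a| ≤ M + ∫ x in a..b, k2 x := by
  have hu : uIcc a b = Icc a b := uIcc_of_le hab
  have ii : IntervalIntegrable φ' volume a b := (hu ▸ hc).intervalIntegrable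
  have e1 : ∫ x in a..b, φ' x = φ b - φ a :=
    intervalIntegral.integral_eq_sub_of_hasDerivAt (fun x hx => hφ x (hu ▸ hx)) ii
  have e2 : 2 * |φ b - φ a| ≤ ∫ x in a..b, 2 * |φ' x| := by
    rw [← e1, intervalIntegral.integral_const_mul]
    have := intervalIntegral.abs_integral_le_integral_abs (f := φ') (μ := volume) hab
    linarith
  refine e2.trans ?_
  have n2 : 0 ≤ ∫ x in a..b, k2 x := intervalIntegral.integral_nonneg hab hk2
  rw [← ENNReal.ofReal_le_ofReal_iff (by positivity), ENNReal.ofReal_add hM n2]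
  rw [intervalIntegral.integral_of_le hab, intervalIntegral.integral_of_le hab, ← integral_Icc_eq_integral_Ioc, ← integral_Icc_eq_integral_Ioc]
  have i1 : IntegrableOn (fun x => 2 * |φ' x|) (Icc a b) := (continuousOn_const.mul hc.abs).integrableOn_Icc
  have i2 : IntegrableOn k2 (Icc a b) := hc2.integrableOn_Icc
  rw [ofReal_integral_eq_lintegral_ofReal i1 (ae_of_all _ fun x => by positivity),
    ofReal_integral_eq_lintegral_ofReal i2 ((ae_restrict_iff' measurableSet_Icc).2 (ae_of_all _ hk2))]
  calc ∫⁻ x in Icc a b, ENNReal.ofReal (2 * |φ' x|) ≤ ∫⁻ x in Icc a b, (ENNReal.ofReal (k1 x) + ENNReal.ofReal (k2 x)) := by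
        refine setLIntegral_mono' measurableSet_Icc fun x hx => ?_
        rw [← ENNReal.ofReal_add (hk1 x hx) (hk2 x hx)]
        exact ENNReal.ofReal_le_ofReal (hk x hx)
    _ = (∫⁻ x in Icc a b, (ENNReal.ofReal (k1 x))) + ∫⁻ x in Icc a b, ENNReal.ofReal (k2 x) :=
        lintegral_add_right' _ i2.aemeasurable.ennreal_ofReal
    _ ≤ _ := by gcongr

theorem gsq_contAt {f : E2 → ℝ} {x : E2} (h : ContDiffAt ℝ ∞ f x) : ContinuousAt (gsq f) x := by
  have h1 : ContinuousAt (fderiv ℝ f) x := (h.fderiv_right (m := 0) (by simp)).continuousAt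
  have h2 (v : E2) : ContinuousAt (pd v f) x := h1.clm_apply continuousAt_const
  exact ((h2 ee0).pow 2).add ((h2 ee1).pow 2)

theorem Ph_cont (A B C : E2) : Continuous fun z : ℝ × ℝ => Ph A B C z.1 z.2 := by unfold Ph; fun_prop

theorem inv_not_int {δ η : ℝ} (hδ : 0 < δ) (hη : 0 < η) : ∫⁻ s in Ioo 0 δ, ENNReal.ofReal (η / s) = ⊤ := by
  by_contra hne
  have hi : IntegrableOn (fun s => η / s) (Ioo 0 δ) := by
    refine ⟨(measurable_const.div measurable_id).aestronglyMeasurable, ?_⟩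
    rw [hasFiniteIntegral_iff_ofReal]
    · exact lt_top_iff_ne_top.2 hne
    · refine (ae_restrict_iff' measurableSet_Ioo).2 (ae_of_all _ fun s hs => ?_)
      have := hs.1
      simp only [Pi.zero_apply]
      positivity
  have h2 : IntervalIntegrable (fun s : ℝ => s⁻¹) volume 0 δ := by
    rw [intervalIntegrable_iff_integrableOn_Ioo_of_le hδ.le]
    have := hi.const_mul η⁻¹
    refine this.congr (ae_of_all _ fun s => ?_)
    simp only; field_simp
  rw [intervalIntegrable_inv_iff] at h2
  rcases h2 with h | h
  · exact hδ.ne h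
  · exact h left_mem_uIcc

section CL
variable {A B C : E2} {f : E2 → ℝ}

theorem en_fin (h : dt A B C ≠ 0) (hE : ∫⁻ x in interior (Tri A B C), ENNReal.ofReal (gsq f x) ≠ ⊤) :
    ∫⁻ z in (Ioo (0:ℝ) 1) ×ˢ (Ioo (0:ℝ) 1), ENNReal.ofReal (z.1 * gsq f (Ph A B C z.1 z.2)) ≠ ⊤ := by
  rw [Ph_lint0 h] at hE
  intro ht
  apply hE
  have e : ∀ z ∈ (Ioo (0:ℝ) 1) ×ˢ (Ioo (0:ℝ) 1), ENNReal.ofReal (|dt A B C| * z.1) * ENNReal.ofReal (gsq f (Ph A B C z.1 z.2)) =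
      ENNReal.ofReal |dt A B C| * ENNReal.ofReal (z.1 * gsq f (Ph A B C z.1 z.2)) := by
    rintro ⟨s, t⟩ ⟨hs, -⟩
    have := hs.1
    rw [← ENNReal.ofReal_mul (by positivity), ← ENNReal.ofReal_mul (by positivity)]
    congr 1; ring
  rw [setLIntegral_congr_fun (measurableSet_Ioo.prod measurableSet_Ioo) e, lintegral_const_mul' _ _ ENNReal.ofReal_ne_top, ht]
  exact ENNReal.mul_top (by simpa using h)

theorem en_meas (h : dt A B C ≠ 0) (hF : ∀ x ∈ interior (Tri A B C), ContDiffAt ℝ ∞ f x) :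
    AEMeasurable (fun z : ℝ × ℝ => ENNReal.ofReal (z.1 * gsq f (Ph A B C z.1 z.2)))
      ((volume.restrict (Ioo (0:ℝ) 1)).prod (volume.restrict (Ioo (0:ℝ) 1))) := by
  rw [Measure.prod_restrict]
  refine AEMeasurable.ennreal_ofReal (ContinuousOn.aemeasurable ?_ (measurableSet_Ioo.prod measurableSet_Ioo))
  rintro ⟨s, t⟩ ⟨hs, ht⟩
  refine ContinuousAt.continuousWithinAt (continuousAt_fst.mul ?_)
  exact ContinuousAt.comp (f := fun z : ℝ × ℝ => Ph A B C z.1 z.2) (gsq_contAt (hF _ (Ph_int h hs ht))) (Ph_cont A B C).continuousAt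

theorem en_s (h : dt A B C ≠ 0) (hF : ∀ x ∈ interior (Tri A B C), ContDiffAt ℝ ∞ f x)
    (hE : ∫⁻ x in interior (Tri A B C), ENNReal.ofReal (gsq f x) ≠ ⊤) {δ η : ℝ} (hδ : 0 < δ) (hδ1 : δ ≤ 1) (hη : 0 < η) :
    ∃ s ∈ Ioo 0 δ, ∫⁻ t in Ioo (0:ℝ) 1, ENNReal.ofReal (s * gsq f (Ph A B C s t)) ≤ ENNReal.ofReal (η / s) := by
  by_contra! hc
  have e := en_fin h hE
  rw [Measure.volume_eq_prod, ← Measure.prod_restrict, lintegral_prod _ (en_meas h hF)] at e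
  apply e
  rw [← top_le_iff, ← inv_not_int hδ hη]
  calc ∫⁻ s in Ioo 0 δ, ENNReal.ofReal (η / s) ≤ ∫⁻ s in Ioo 0 δ, ∫⁻ t in Ioo (0:ℝ) 1, ENNReal.ofReal (s * gsq f (Ph A B C s t)) :=
        setLIntegral_mono' measurableSet_Ioo fun s hs => (hc s hs).le
    _ ≤ _ := lintegral_mono_set (Ioo_subset_Ioo_right hδ1)

theorem en_t (h : dt A B C ≠ 0) (hF : ∀ x ∈ interior (Tri A B C), ContDiffAt ℝ ∞ f x)
    (hE : ∫⁻ x in interior (Tri A B C), ENNReal.ofReal (gsq f x) ≠ ⊤) :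
    ∃ t ∈ Ioo (0:ℝ) 1, ∫⁻ s in Ioo (0:ℝ) 1, ENNReal.ofReal (s * gsq f (Ph A B C s t)) ≠ ⊤ := by
  by_contra! hc
  have e := en_fin h hE
  rw [Measure.volume_eq_prod, ← Measure.prod_restrict, lintegral_prod_symm _ (en_meas h hF)] at e
  apply e
  rw [setLIntegral_congr_fun measurableSet_Ioo hc]
  simp

theorem der_t (h : dt A B C ≠ 0) (hF : ∀ x ∈ interior (Tri A B C), ContDiffAt ℝ ∞ f x) {s t : ℝ} (hs : s ∈ Ioo (0:ℝ) 1) (ht : t ∈ Ioo (0:ℝ) 1) :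
    HasDerivAt (fun t => f (Ph A B C s t)) (s * pd (C - B) f (Ph A B C s t)) t := by
  have d := ((hF _ (Ph_int h hs ht)).differentiableAt (by simp)).hasFDerivAt
  have g : HasDerivAt (fun t => Ph A B C s t) (s • (C - B)) t := by
    have := (((hasDerivAt_id t).const_mul s).smul_const (C - B)).const_add (A + s • (B - A))
    simpa [Ph] using this
  have := d.comp_hasDerivAt t g
  have e : s * pd (C - B) f (Ph A B C s t) = fderiv ℝ f (Ph A B C s t) (s • (C - B)) := by simp [pd]
  rw [e]; exact this

theorem der_s (h : dt A B C ≠ 0) (hF : ∀ x ∈ interior (Tri A B C), ContDiffAt ℝ ∞ f x) {s t : ℝ} (hs : s ∈ Ioo (0:ℝ) 1) (ht : t ∈ Ioo (0:ℝ) 1) :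
    HasDerivAt (fun s => f (Ph A B C s t)) (pd (B - A + t • (C - B)) f (Ph A B C s t)) s := by
  have d := ((hF _ (Ph_int h hs ht)).differentiableAt (by simp)).hasFDerivAt
  have g : HasDerivAt (fun s => Ph A B C s t) (B - A + t • (C - B)) s := by
    have := ((hasDerivAt_id s).smul_const (B - A + t • (C - B))).const_add A
    simp only [one_smul] at this
    refine this.congr_of_eventuallyEq (Eventually.of_forall fun s => ?_)
    simp only [Ph, id]; module
  exact d.comp_hasDerivAt s g

theorem pd_contAt {x v : E2} (h : ContDiffAt ℝ ∞ f x) : ContinuousAt (pd v f) x :=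
  ((h.fderiv_right (m := 0) (by simp)).continuousAt).clm_apply continuousAt_const

theorem line_osc (h : dt A B C ≠ 0) (hF : ∀ x ∈ interior (Tri A B C), ContDiffAt ℝ ∞ f x) {s ε : ℝ} (hs : s ∈ Ioo (0:ℝ) 1) (hε : 0 < ε)
    (hI : ∫⁻ t in Ioo (0:ℝ) 1, ENNReal.ofReal (s * gsq f (Ph A B C s t)) ≤ ENNReal.ofReal ((ε ^ 2 / ‖C - B‖ ^ 2) / s))
    {a b : ℝ} (ha : a ∈ Ioo (0:ℝ) 1) (hb : b ∈ Ioo (0:ℝ) 1) (hab : a ≤ b) :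
    |f (Ph A B C s b) - f (Ph A B C s a)| ≤ ε := by
  have hsub : ∀ t ∈ Icc a b, t ∈ Ioo (0:ℝ) 1 := fun t ht => ⟨ha.1.trans_le ht.1, ht.2.trans_lt hb.2⟩
  have hD : 0 < ‖C - B‖ := norm_pos_iff.2 (side_ne h)
  have s0 := hs.1
  have := osc1 (M := ε) (φ := fun t => f (Ph A B C s t)) (φ' := fun t => s * pd (C - B) f (Ph A B C s t)) (k2 := fun _ => ε)
    (k1 := fun t => (ε⁻¹ * s * ‖C - B‖ ^ 2) * (s * gsq f (Ph A B C s t)))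
    hab (fun t ht => der_t h hF hs (hsub t ht)) ?_ ?_ ?_ ?_ continuousOn_const hε.le ?_
  · simp only [intervalIntegral.integral_const, smul_eq_mul] at this
    have h3 : (b - a) * ε ≤ ε := by nlinarith [ha.1, hb.2]
    linarith
  · intro t ht
    refine ContinuousAt.continuousWithinAt (continuousAt_const.mul ?_)
    refine ContinuousAt.comp (f := fun t : ℝ => Ph A B C s t) (pd_contAt (hF _ (Ph_int h hs (hsub t ht)))) ?_
    exact (show Continuous fun t : ℝ => Ph A B C s t by unfold Ph; fun_prop).continuousAt
  · intro t ht
    have p := pd_sq_le f (Ph A B C s t) (C - B)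
    set P := pd (C - B) f (Ph A B C s t)
    set G := gsq f (Ph A B C s t)
    have q : ε⁻¹ * (s * P) ^ 2 ≤ ε⁻¹ * s * ‖C - B‖ ^ 2 * (s * G) := by
      have : ε⁻¹ * s ^ 2 * P ^ 2 ≤ ε⁻¹ * s ^ 2 * (‖C - B‖ ^ 2 * G) := by gcongr
      nlinarith
    have q2 : 2 * |s * P| ≤ ε⁻¹ * (s * P) ^ 2 + ε := by
      rw [← sq_abs (s * P)]
      set Z := |s * P|
      have : 0 ≤ ε⁻¹ * (Z - ε) ^ 2 := by positivity
      have e : ε⁻¹ * (Z - ε) ^ 2 = ε⁻¹ * Z ^ 2 + ε - 2 * Z := by field_simp; ring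
      linarith
    linarith
  · intro t ht
    have := gsq_nonneg f (Ph A B C s t)
    positivity
  · intro t ht; exact hε.le
  · have c0 : 0 ≤ ε⁻¹ * s * ‖C - B‖ ^ 2 := by positivity
    simp only [ENNReal.ofReal_mul c0]
    rw [lintegral_const_mul' _ _ ENNReal.ofReal_ne_top]
    calc _ ≤ ENNReal.ofReal (ε⁻¹ * s * ‖C - B‖ ^ 2) * ENNReal.ofReal ((ε ^ 2 / ‖C - B‖ ^ 2) / s) := by
          gcongr
          exact (lintegral_mono_set hsub).trans hI
      _ = ENNReal.ofReal ε := by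
          rw [← ENNReal.ofReal_mul c0]; congr 1; field_simp

theorem ray_log (h : dt A B C ≠ 0) (hF : ∀ x ∈ interior (Tri A B C), ContDiffAt ℝ ∞ f x)
    (hE : ∫⁻ x in interior (Tri A B C), ENNReal.ofReal (gsq f x) ≠ ⊤) :
    ∃ t ∈ Ioo (0:ℝ) 1, ∀ δ > 0, ∃ N : ℝ, ∀ s ∈ Ioc (0:ℝ) (1/2), |f (Ph A B C s t)| ≤ N - δ * Real.log s := by
  obtain ⟨t, ht, hI⟩ := en_t h hF hE
  refine ⟨t, ht, fun δ hδ => ?_⟩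
  set I := ∫⁻ s in Ioo (0:ℝ) 1, ENNReal.ofReal (s * gsq f (Ph A B C s t)) with hI'
  set D := ‖B - A + t • (C - B)‖ with hDd
  set K := (1/(2*δ)) * D ^ 2 with hK
  have K0 : 0 ≤ K := by positivity
  refine ⟨|f (Ph A B C (1/2) t)| + K * I.toReal, fun s hs => ?_⟩
  have hsub : ∀ r ∈ Icc s (1/2), r ∈ Ioo (0:ℝ) 1 := fun r hr => ⟨hs.1.trans_le hr.1, hr.2.trans_lt (by norm_num)⟩
  have := osc1 (M := K * I.toReal) (φ := fun s => f (Ph A B C s t)) (φ' := fun s => pd (B - A + t • (C - B)) f (Ph A B C s t)) (k2 := fun s => (2 * δ) * s⁻¹)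
    (k1 := fun s => K * (s * gsq f (Ph A B C s t)))
    hs.2 (fun r hr => der_s h hF (hsub r hr) ht) ?_ ?_ ?_ ?_ ?_ (by positivity) ?_
  · rw [intervalIntegral.integral_const_mul, integral_inv_of_pos hs.1 (by norm_num)] at this
    rw [Real.log_div (by norm_num) hs.1.ne'] at this
    have l2 : Real.log (1/2) ≤ 0 := Real.log_nonpos (by norm_num) (by norm_num)
    have a1 := abs_sub_abs_le_abs_sub (f (Ph A B C s t)) (f (Ph A B C (1/2) t))
    rw [abs_sub_comm] at a1
    have K1 : 0 ≤ K * I.toReal := by positivity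
    nlinarith
  · intro r hr
    refine ContinuousAt.continuousWithinAt ?_
    refine ContinuousAt.comp (f := fun s : ℝ => Ph A B C s t) (pd_contAt (hF _ (Ph_int h (hsub r hr) ht))) ?_
    exact (show Continuous fun s : ℝ => Ph A B C s t by unfold Ph; fun_prop).continuousAt
  · intro r hr
    have r0 := (hsub r hr).1
    have p := pd_sq_le f (Ph A B C r t) (B - A + t • (C - B))
    rw [← hDd] at p
    set P := pd (B - A + t • (C - B)) f (Ph A B C r t)
    set G := gsq f (Ph A B C r t)
    have q : (1/(2*δ)) * r * P ^ 2 ≤ K * (r * G) := by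
      have : (1/(2*δ)) * r * P ^ 2 ≤ (1/(2*δ)) * r * (D ^ 2 * G) := by gcongr
      rw [hK]; nlinarith
    have q2 : 2 * |P| ≤ (1/(2*δ)) * r * P ^ 2 + (2 * δ) * r⁻¹ := by
      rw [← sq_abs P]
      set Z := |P|
      have : 0 ≤ (1/(2*δ)) * r⁻¹ * (r * Z - 2 * δ) ^ 2 := by positivity
      have e : (1/(2*δ)) * r⁻¹ * (r * Z - 2 * δ) ^ 2 = (1/(2*δ)) * r * Z ^ 2 + (2 * δ) * r⁻¹ - 2 * Z := by field_simp; ring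
      linarith
    linarith
  · intro r hr
    have := gsq_nonneg f (Ph A B C r t)
    have := (hsub r hr).1
    positivity
  · intro r hr; have := (hsub r hr).1; positivity
  · intro r hr
    exact ContinuousAt.continuousWithinAt (continuousAt_const.mul (continuousAt_inv₀ (hsub r hr).1.ne'))
  · simp only [ENNReal.ofReal_mul K0]
    rw [lintegral_const_mul' _ _ ENNReal.ofReal_ne_top, ENNReal.ofReal_toReal hI]
    gcongr
    exact (lintegral_mono_set hsub)

theorem Ph_dom (h : dt A B C ≠ 0) {s t : ℝ} (hs : s ∈ Ioo (0:ℝ) 1) (ht : t ∈ Icc (0:ℝ) 1) :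
    Ph A B C s t ∈ TriDom A B C := by
  refine ⟨Ph_tri h ⟨hs.1.le, hs.2.le⟩ ht, ?_⟩
  have b1 := (bcc_Ph h s t).1
  have vA := (bcc_affine h 1 0 0 (by norm_num))
  have vB := (bcc_affine h 0 1 0 (by norm_num))
  have vC := (bcc_affine h 0 0 1 (by norm_num))
  simp only [one_smul, zero_smul, add_zero, zero_add] at vA vB vC
  rintro (e | e | e)
  · rw [e, vA] at b1; linarith [hs.1]
  · rw [e, vB] at b1; linarith [hs.2]
  · rw [mem_singleton_iff] at e
    rw [e, vC] at b1; linarith [hs.2]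

theorem line_good (h : dt A B C ≠ 0) (hF : ∀ x ∈ interior (Tri A B C), ContDiffAt ℝ ∞ f x) (hc : ContinuousOn f (TriDom A B C))
    (hE : ∫⁻ x in interior (Tri A B C), ENNReal.ofReal (gsq f x) ≠ ⊤) {δ s0 : ℝ} (hδ : 0 < δ) (hs0 : 0 < s0) :
    ∃ s ∈ Ioo (0:ℝ) 1, s < s0 ∧ (∀ t ∈ Icc (0:ℝ) 1, ∀ t' ∈ Icc (0:ℝ) 1, |f (Ph A B C s t) - f (Ph A B C s t')| ≤ δ) ∧
      ∀ t ∈ Icc (0:ℝ) 1, |f (Ph A B C s t)| ≤ - δ * Real.log s := by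
  obtain ⟨t0, ht0, H⟩ := ray_log h hF hE
  obtain ⟨N, hN⟩ := H (δ / 2) (by positivity)
  have hD : 0 < ‖C - B‖ := norm_pos_iff.2 (side_ne h)
  obtain ⟨s, hs, hI⟩ := en_s h hF hE (δ := min s0 (min (1/2) (Real.exp (-(2 * (|N| + δ) / δ))))) (by positivity)
    ((min_le_right _ _).trans ((min_le_left _ _).trans (by norm_num))) (η := δ ^ 2 / ‖C - B‖ ^ 2) (by positivity)
  have h1 : s < s0 := hs.2.trans_le (min_le_left _ _)
  have h2 : s < 1/2 := hs.2.trans_le ((min_le_right _ _).trans (min_le_left _ _))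
  have h3 : s < Real.exp (-(2 * (|N| + δ) / δ)) := hs.2.trans_le ((min_le_right _ _).trans (min_le_right _ _))
  have hs1 : s ∈ Ioo (0:ℝ) 1 := ⟨hs.1, by linarith⟩
  have o1 : ∀ t ∈ Ioo (0:ℝ) 1, ∀ t' ∈ Ioo (0:ℝ) 1, |f (Ph A B C s t) - f (Ph A B C s t')| ≤ δ := by
    intro t ht t' ht'
    rcases le_total t t' with hh | hh
    · rw [abs_sub_comm]; exact line_osc h hF hs1 hδ hI ht ht' hh
    · exact line_osc h hF hs1 hδ hI ht' ht hh
  have cl : closure (Ioo (0:ℝ) 1) = Icc 0 1 := closure_Ioo (by norm_num)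
  have cont : ContinuousOn (fun t => f (Ph A B C s t)) (Icc 0 1) :=
    hc.comp (show Continuous fun t : ℝ => Ph A B C s t by unfold Ph; fun_prop).continuousOn fun t ht => Ph_dom h hs1 ht
  have o2 : ∀ t ∈ Icc (0:ℝ) 1, ∀ t' ∈ Icc (0:ℝ) 1, |f (Ph A B C s t) - f (Ph A B C s t')| ≤ δ := by
    have step : ∀ t ∈ Icc (0:ℝ) 1, ∀ t' ∈ Ioo (0:ℝ) 1, |f (Ph A B C s t) - f (Ph A B C s t')| ≤ δ := by
      intro t ht t' ht'
      have : ContinuousWithinAt (fun t => |f (Ph A B C s t) - f (Ph A B C s t')|) (Ioo 0 1) t :=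
        ((cont t ht).mono Ioo_subset_Icc_self |>.sub continuousWithinAt_const).abs
      have hm := this.mem_closure (t := Iic δ) (by rwa [cl]) (fun r hr => o1 r hr t' ht')
      rwa [isClosed_Iic.closure_eq] at hm
    intro t ht t' ht'
    have : ContinuousWithinAt (fun t' => |f (Ph A B C s t) - f (Ph A B C s t')|) (Ioo 0 1) t' :=
      (continuousWithinAt_const.sub ((cont t' ht').mono Ioo_subset_Icc_self)).abs
    have hm := this.mem_closure (t := Iic δ) (by rwa [cl]) (fun r hr => step t ht r hr)
    rwa [isClosed_Iic.closure_eq] at hm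
  refine ⟨s, hs1, h1, o2, fun t ht => ?_⟩
  have a := o2 t ht t0 ⟨ht0.1.le, ht0.2.le⟩
  have b := hN s ⟨hs.1, h2.le⟩
  have l : Real.log s < -(2 * (|N| + δ) / δ) := (Real.log_lt_iff_lt_exp hs.1).2 h3
  have l2 : |N| + δ < -(δ/2) * Real.log s := by
    have : (δ/2) * Real.log s < (δ/2) * (-(2 * (|N| + δ) / δ)) := by gcongr
    have e : (δ/2) * (-(2 * (|N| + δ) / δ)) = -(|N| + δ) := by field_simp
    linarith
  have := abs_sub_abs_le_abs_sub (f (Ph A B C s t)) (f (Ph A B C s t0))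
  have := le_abs_self N
  linarith
end CL
end

section
open MeasureTheory Filter Topology
open scoped ContDiff FourierTransform RealInnerProductSpace

theorem pdpd_min {f : E2 → ℝ} {x : E2} (hf : ContDiffAt ℝ 2 f x) (hm : IsLocalMin f x) (v : E2) : 0 ≤ pd v (pd v f) x := by
  by_contra! hlt
  set γ : ℝ → E2 := fun t => x + t • v with hγ
  have γ0 : γ 0 = x := by simp [hγ]
  have γd : ∀ t, HasDerivAt γ v t := by
    intro t
    have := ((hasDerivAt_id t).smul_const v).const_add x
    simpa [hγ] using this
  have γc : Tendsto γ (𝓝 0) (𝓝 x) := by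
    have := (γd 0).continuousAt.tendsto
    rwa [γ0] at this
  obtain ⟨d1, d2⟩ := c2_diff hf
  have D1 : deriv (fun t => f (γ t)) =ᶠ[𝓝 0] fun t => pd v f (γ t) := by
    filter_upwards [γc.eventually d1] with t ht
    exact (ht.hasFDerivAt.comp_hasDerivAt t (γd t)).deriv
  have D2 : deriv (deriv (fun t => f (γ t))) 0 = pd v (pd v f) x := by
    rw [D1.deriv_eq]
    have := d2 v
    rw [← γ0] at this
    have := (this.hasFDerivAt.comp_hasDerivAt (0:ℝ) (γd 0)).deriv
    rw [γ0] at this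
    exact this
  have hm' : IsLocalMin (fun t => f (γ t)) 0 := by
    have := γc.eventually hm
    filter_upwards [this] with t ht
    rwa [γ0]
  have hM := isLocalMax_of_deriv_deriv_neg (f := fun t => f (γ t)) (x₀ := 0) (by rw [D2]; exact hlt) hm'.deriv_eq_zero
    (by
      have : ContinuousAt f (γ 0) := by rw [γ0]; exact hf.continuousAt
      exact ContinuousAt.comp this (γd 0).continuousAt)
  have ec : (fun t => f (γ t)) =ᶠ[𝓝 0] fun _ => f (γ 0) := by
    filter_upwards [hm', hM] with t h1 h2 using le_antisymm h2 h1
  have : deriv (deriv (fun t => f (γ t))) 0 = 0 := by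
    rw [ec.deriv.deriv_eq]; simp
  rw [D2] at this
  linarith

theorem lap_min {f : E2 → ℝ} {x : E2} (hf : ContDiffAt ℝ 2 f x) (hm : IsLocalMin f x) : 0 ≤ lap f x :=
  add_nonneg (pdpd_min hf hm _) (pdpd_min hf hm _)

theorem lap_sub {a b : E2 → ℝ} {x : E2} (ha : ContDiffAt ℝ 2 a x) (hb : ContDiffAt ℝ 2 b x) :
    lap (fun y => a y - b y) x = lap a x - lap b x := by
  have : (fun y => a y - b y) = fun y => a y + (-1) * b y := by funext y; ring
  rw [this, lap_add ha (contDiffAt_const.mul hb), lap_const_mul _ hb]; ring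

/-- squared distance -/
def qd (A x : E2) : ℝ := ‖x - A‖ ^ 2

theorem qd_smooth (A : E2) {n : WithTop ℕ∞} : ContDiff ℝ n (qd A) := (contDiff_id.sub contDiff_const).norm_sq ℝ

theorem pd_qd (A v x : E2) : pd v (qd A) x = 2 * ⟪x - A, v⟫ := by
  have h := ((hasFDerivAt_id x).sub_const A).norm_sq
  have e : fderiv ℝ (qd A) x = _ := h.fderiv
  simp only [pd, e]
  simp [inner_sub_left]

theorem pdpd_qd (A v x : E2) : pd v (pd v (qd A)) x = 2 * ⟪v, v⟫ := by
  have : pd v (qd A) = fun y => 2 * ⟪y - A, v⟫ := funext fun y => pd_qd A v y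
  rw [this]
  have d : DifferentiableAt ℝ (fun y : E2 => ⟪y - A, v⟫) x := (differentiableAt_id.sub_const A).inner ℝ (differentiableAt_const v)
  rw [pd, fderiv_const_mul d]
  have := pd_inner v A v x
  rw [pd] at this
  simp [this]

theorem lap_qd (A x : E2) : lap (qd A) x = 4 := by
  simp only [lap, pdpd_qd, inner_ee0, inner_ee1]; simp [ee0, ee1]; norm_num

theorem lap_radial {G G' G'' : ℝ → ℝ} {A x : E2} (hg : ∀ t > 0, HasDerivAt G (G' t) t) (hg' : ∀ t > 0, HasDerivAt G' (G'' t) t)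
    (hx : x ≠ A) : lap (fun y => G (qd A y)) x = 4 * qd A x * G'' (qd A x) + 4 * G' (qd A x) := by
  have q0 : 0 < qd A x := by unfold qd; have := sub_ne_zero.2 hx; positivity
  rw [lap_comp (g := G) (g' := G') (g'' := G'') ((lt_mem_nhds q0).mono fun t ht => hg t ht) (hg' _ q0) (qd_smooth A).contDiffAt, lap_qd]
  have : (pd ee0 (qd A) x) ^ 2 + (pd ee1 (qd A) x) ^ 2 = 4 * qd A x := by
    rw [pd_qd, pd_qd, qd, normsq_e2, real_inner_comm, inner_ee0, real_inner_comm, inner_ee1]; ring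
  rw [this]; ring

theorem touch {A B C x0 : E2} {l : ℝ} {f : E2 → ℝ} {G : ℝ → ℝ} (hf : NiceAt A B C l f x0) (hx0 : x0 ∈ Tri A B C)
    (hl : 0 < ell A B C x0) (hG : ContDiffAt ℝ 2 (fun y => G (qd A y)) x0)
    (hle : ∀ᶠ y in 𝓝 x0, y ∈ Tri A B C → f y ≤ G (qd A y)) (heq : f x0 = G (qd A x0)) :
    -(l * f x0) ≤ lap (fun y => G (qd A y)) x0 := by
  obtain ⟨r, F, ⟨hr, hF, hp, -, hs⟩, e⟩ := hf
  have hF2 : ContDiffAt ℝ 2 F x0 := hF.contDiffAt.of_le two_le_inf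
  have e0 : f x0 = F x0 := e x0 (Metric.mem_ball_self hr) hx0
  suffices hm : IsLocalMin (fun y => G (qd A y) - F y) x0 by
    have := lap_min (hG.sub hF2) hm
    rw [lap_sub hG hF2, hp _ (Metric.mem_ball_self hr)] at this
    rw [e0]; linarith
  have hz : G (qd A x0) - F x0 = 0 := by rw [← heq, e0]; ring
  have inT : ∀ᶠ y in 𝓝 x0, y ∈ Tri A B C → 0 ≤ G (qd A y) - F y := by
    filter_upwards [hle, Metric.ball_mem_nhds x0 hr] with y hy hb hT
    rw [← e y hb hT]; linarith [hy hT]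
  rcases hs with hs | ⟨n, c, hsd, ⟨hn, hpn, hh⟩, hev⟩
  · filter_upwards [inT, Metric.ball_mem_nhds x0 hr] with y hy hb
    rw [hz]; exact hy (hs hb)
  · have hA : ⟪A - c, n⟫ = 0 := by
      rcases hsd with ⟨rfl, rfl⟩ | ⟨rfl, rfl⟩ | ⟨rfl, rfl⟩
      · rw [ell] at hl; linarith
      · exact inner_nrm B _ A
      · simp
    have fx : sg n c x0 = x0 := sg_fix hpn
    have tc : Tendsto (sg n c) (𝓝 x0) (𝓝 x0) := by
      have := (sg_cont n c).tendsto x0; rwa [fx] at this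
    filter_upwards [inT, tc.eventually inT, Metric.ball_mem_nhds x0 hr] with y h1 h2 hb
    rw [hz]
    by_cases hT : y ∈ Tri A B C
    · exact h1 hT
    · have hb' := (sg_ball hn hpn (r := r) (x := y)).2 hb
      have hT' : sg n c y ∈ Tri A B C := by
        rw [hh _ hb', sg_inner hn]
        rw [hh _ hb] at hT; linarith
      have := h2 hT'
      have eq : qd A (sg n c y) = qd A y := by
        have := sg_norm hn c y A
        rw [sg_fix hA] at this
        simp [qd, this]
      rwa [hev y hb, eq] at this

/-- truncated cone -/
def Cone (A B C : E2) (s s1 : ℝ) : Set E2 := {x | x ∈ Tri A B C ∧ s ≤ 1 - bcc A B C x ∧ 1 - bcc A B C x ≤ s1}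

theorem bcc_cont {A B C : E2} (h : dt A B C ≠ 0) : Continuous (bcc A B C) := by
  have : bcc A B C = fun x => (hgt A B C)⁻¹ * ell A B C x := by
    funext x; rw [ell_eq h]; have := hgt_pos h; field_simp
  rw [this]; exact continuous_const.mul (continuous_ell A B C)

theorem Cone_compact {A B C : E2} (h : dt A B C ≠ 0) (s s1 : ℝ) : IsCompact (Cone A B C s s1) := by
  refine (Tri_compact A B C).inter_right (t := {x | s ≤ 1 - bcc A B C x ∧ 1 - bcc A B C x ≤ s1}) ?_
  exact (isClosed_le continuous_const (continuous_const.sub (bcc_cont h))).inter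
    (isClosed_le (continuous_const.sub (bcc_cont h)) continuous_const)

theorem Cone_dom {A B C x : E2} (h : dt A B C ≠ 0) {s s1 : ℝ} (hs : 0 < s) (hs1 : s1 < 1) (hx : x ∈ Cone A B C s s1) :
    x ∈ TriDom A B C := by
  obtain ⟨t, ht, e⟩ := Ph_inv h hx.1 (by linarith [hx.2.1])
  rw [← e]; exact Ph_dom h ⟨by linarith [hx.2.1], by linarith [hx.2.2]⟩ ht

theorem Cone_max {A B C : E2} (h : dt A B C ≠ 0) {s s1 : ℝ} {H : E2 → ℝ} (hH : ContinuousOn H (Cone A B C s s1))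
    {z : E2} (hz : z ∈ Cone A B C s s1) :
    ∃ x0 ∈ Cone A B C s s1, H z ≤ H x0 ∧ ((1 - bcc A B C x0 = s ∨ 1 - bcc A B C x0 = s1) ∨ ∀ᶠ y in 𝓝 x0, y ∈ Tri A B C → y ∈ Cone A B C s s1 ∧ H y ≤ H x0) := by
  obtain ⟨x0, hx0, hm⟩ := (Cone_compact h s s1).exists_isMaxOn ⟨z, hz⟩ hH
  refine ⟨x0, hx0, hm hz, ?_⟩
  by_cases e : 1 - bcc A B C x0 = s ∨ 1 - bcc A B C x0 = s1
  · exact Or.inl e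
  · push Not at e
    right
    have h1 : s < 1 - bcc A B C x0 := lt_of_le_of_ne hx0.2.1 (Ne.symm e.1)
    have h2 : 1 - bcc A B C x0 < s1 := lt_of_le_of_ne hx0.2.2 e.2
    have c : Continuous fun x => 1 - bcc A B C x := continuous_const.sub (bcc_cont h)
    filter_upwards [c.continuousAt.eventually (lt_mem_nhds h1), c.continuousAt.eventually (gt_mem_nhds h2)] with y a b hT
    have : y ∈ Cone A B C s s1 := ⟨hT, a.le, b.le⟩
    exact ⟨this, hm this⟩

theorem Ph_norm {A B C x : E2} (h : dt A B C ≠ 0) (hx : x ∈ Tri A B C) :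
    ‖x - A‖ ≤ (‖B - A‖ + ‖C - B‖) * (1 - bcc A B C x) := by
  by_cases h1 : bcc A B C x < 1
  · obtain ⟨t, ht, e⟩ := Ph_inv h hx h1
    have : x - A = (1 - bcc A B C x) • ((B - A) + t • (C - B)) := by
      conv_lhs => rw [← e]
      unfold Ph; module
    rw [this, norm_smul, Real.norm_eq_abs, abs_of_pos (by linarith), mul_comm]
    have hb : 0 < 1 - bcc A B C x := by linarith
    gcongr
    refine (norm_add_le _ _).trans ?_
    gcongr
    rw [norm_smul, Real.norm_eq_abs, abs_of_nonneg ht.1]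
    exact mul_le_of_le_one_left (norm_nonneg _) ht.2
  · obtain ⟨a, b, c⟩ := (mem_Tri_bcc h x).1 hx
    have hs := bcc_sum h x
    have e1 : bcc A B C x = 1 := by linarith
    have e2 : bcc B C A x = 0 := by linarith
    have e3 : bcc C A B x = 0 := by linarith
    have := bcc_comb h x
    rw [e1, e2, e3] at this
    simp at this
    rw [← this] at e1 ⊢
    simp [e1]

theorem ell_of_bcc {A B C x : E2} (h : dt A B C ≠ 0) (hx : 0 < bcc A B C x) : 0 < ell A B C x := by
  rwa [← bcc_pos_iff h]
end

section
open MeasureTheory Filter Topology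
open scoped ContDiff FourierTransform RealInnerProductSpace

def PG (l : ℝ) (q : ℝ) : ℝ := -(1/2) * Real.log q + l / 2 * (q * Real.log q)

theorem PG_d1 (l : ℝ) : ∀ t > 0, HasDerivAt (PG l) (-(1/2) * t⁻¹ + l / 2 * (Real.log t + 1)) t := by
  intro t ht
  have h1 := Real.hasDerivAt_log ht.ne'
  have := (h1.const_mul (-(1/2))).add (((hasDerivAt_id t).mul h1).const_mul (l / 2))
  refine this.congr_deriv ?_
  simp only [id]; field_simp

theorem PG_d2 (l : ℝ) : ∀ t > 0, HasDerivAt (fun t => -(1/2) * t⁻¹ + l / 2 * (Real.log t + 1)) ((1/2) * (t ^ 2)⁻¹ + l / 2 * t⁻¹) t := by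
  intro t ht
  have h1 := Real.hasDerivAt_log ht.ne'
  have := ((hasDerivAt_inv ht.ne').const_mul (-(1/2))).add ((h1.add_const 1).const_mul (l / 2))
  refine this.congr_deriv ?_
  ring

section
variable {A B C : E2} {f : E2 → ℝ} {l : ℝ}

theorem comp_mul (h : dt A B C ≠ 0) (hn : ∀ p ∈ TriDom A B C, NiceAt A B C l f p) (hc : ContinuousOn f (TriDom A B C))
    {s s1 : ℝ} (hs : 0 < s) (hs1 : s1 < 1) {G : ℝ → ℝ} (hG : ∀ x ∈ Cone A B C s s1, ContDiffAt ℝ 2 (fun y => G (qd A y)) x)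
    (pos : ∀ x ∈ Cone A B C s s1, 0 < G (qd A x))
    (sup : ∀ x ∈ Cone A B C s s1, lap (fun y => G (qd A y)) x < -(l * G (qd A x)))
    (b1 : ∀ x ∈ Cone A B C s s1, 1 - bcc A B C x = s → f x ≤ G (qd A x))
    (b2 : ∀ x ∈ Cone A B C s s1, 1 - bcc A B C x = s1 → f x ≤ G (qd A x))
    {x : E2} (hx : x ∈ Cone A B C s s1) : f x ≤ G (qd A x) := by
  have hq : ContinuousOn (fun x => f x / G (qd A x)) (Cone A B C s s1) :=
    (hc.mono fun x hx => Cone_dom h hs hs1 hx).div (fun x hx => (hG x hx).continuousAt.continuousWithinAt) fun x hx => (pos x hx).ne'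
  obtain ⟨x0, h0, hle, hh⟩ := Cone_max h hq hx
  have p0 := pos x0 h0
  have px := pos x hx
  have key : f x0 / G (qd A x0) ≤ 1 := by
    rcases hh with (e | e) | ev
    · rw [div_le_one p0]; exact b1 x0 h0 e
    · rw [div_le_one p0]; exact b2 x0 h0 e
    · by_contra! hm
      set m := f x0 / G (qd A x0) with hmd
      have fm : f x0 = m * G (qd A x0) := by rw [hmd]; field_simp
      have := touch (G := fun q => m * G q) (hn x0 (Cone_dom h hs hs1 h0)) h0.1 (ell_of_bcc h (by linarith [h0.2.2]))
        (contDiffAt_const.mul (hG x0 h0)) (ev.mono fun y hy hT => by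
          obtain ⟨hy1, hy2⟩ := hy hT
          have := pos y hy1
          rwa [div_le_iff₀ this] at hy2) fm
      rw [lap_const_mul _ (hG x0 h0), fm] at this
      nlinarith [sup x0 h0]
  have : f x / G (qd A x) ≤ 1 := hle.trans key
  rwa [div_le_one px] at this

theorem comp_add (h : dt A B C ≠ 0) (hn : ∀ p ∈ TriDom A B C, NiceAt A B C l f p) (hc : ContinuousOn f (TriDom A B C))
    (hl : 0 ≤ l) {s s1 M : ℝ} (hs : 0 < s) (hs1 : s1 < 1) {G : ℝ → ℝ} (hG : ∀ x ∈ Cone A B C s s1, ContDiffAt ℝ 2 (fun y => G (qd A y)) x)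
    (hM : ∀ x ∈ Cone A B C s s1, f x ≤ M)
    (sup : ∀ x ∈ Cone A B C s s1, lap (fun y => G (qd A y)) x < -(l * M))
    (b1 : ∀ x ∈ Cone A B C s s1, 1 - bcc A B C x = s → f x ≤ G (qd A x))
    (b2 : ∀ x ∈ Cone A B C s s1, 1 - bcc A B C x = s1 → f x ≤ G (qd A x))
    {x : E2} (hx : x ∈ Cone A B C s s1) : f x ≤ G (qd A x) := by
  have hq : ContinuousOn (fun x => f x - G (qd A x)) (Cone A B C s s1) :=
    (hc.mono fun x hx => Cone_dom h hs hs1 hx).sub (fun x hx => (hG x hx).continuousAt.continuousWithinAt)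
  obtain ⟨x0, h0, hle, hh⟩ := Cone_max h hq hx
  have key : f x0 - G (qd A x0) ≤ 0 := by
    rcases hh with (e | e) | ev
    · linarith [b1 x0 h0 e]
    · linarith [b2 x0 h0 e]
    · exfalso
      set m := f x0 - G (qd A x0) with hmd
      have := touch (G := fun q => m + G q) (hn x0 (Cone_dom h hs hs1 h0)) h0.1 (ell_of_bcc h (by linarith [h0.2.2]))
        (contDiffAt_const.add (hG x0 h0)) (ev.mono fun y hy hT => by
          obtain ⟨hy1, hy2⟩ := hy hT
          linarith) (by rw [hmd]; ring)
      rw [lap_add contDiffAt_const (hG x0 h0)] at this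
      have l0 : lap (fun _ : E2 => m) x0 = 0 := by
        have : ∀ v, pd v (fun _ : E2 => m) = fun _ => 0 := by intro v; funext y; simp [pd]
        simp only [lap, this]; simp [pd]
      have := sup x0 h0
      have := mul_le_mul_of_nonneg_left (hM x0 h0) hl
      linarith
  linarith

theorem cd_radial {G : ℝ → ℝ} {x : E2} (hx : x ≠ A) (hG : ∀ t > 0, ContDiffAt ℝ 2 G t) : ContDiffAt ℝ 2 (fun y => G (qd A y)) x := by
  have q0 : 0 < qd A x := by unfold qd; have := sub_ne_zero.2 hx; positivity
  exact (hG _ q0).comp x (qd_smooth A).contDiffAt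

theorem dom_ne {x : E2} (hx : x ∈ TriDom A B C) : x ≠ A := fun e => hx.2 (by simp [Vtx, e])

theorem bdd_above (h : dt A B C ≠ 0) (hn : ∀ p ∈ TriDom A B C, NiceAt A B C l f p) (hc : ContinuousOn f (TriDom A B C)) (hl : 0 < l)
    (hL : ∀ δ > 0, ∀ s0 > 0, ∃ s ∈ Ioo (0:ℝ) 1, s < s0 ∧ ∀ t ∈ Icc (0:ℝ) 1, |f (Ph A B C s t)| ≤ - δ * Real.log s) :
    ∃ M, 0 ≤ M ∧ ∃ s1 ∈ Ioo (0:ℝ) 1, ∀ x ∈ TriDom A B C, 1 - bcc A B C x ≤ s1 → f x ≤ M := by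
  set D := ‖B - A‖ + ‖C - B‖ with hD
  have D0 : 0 < D := by have : 0 < ‖C - B‖ := norm_pos_iff.2 (side_ne h); positivity
  -- threshold for q
  obtain ⟨q1, q1p, hq1⟩ : ∃ q1 > 0, ∀ q, q ≤ q1 → l * q ≤ 1/2 ∧ q ≤ Real.exp (-3) := by
    refine ⟨min (1/(2*l)) (Real.exp (-3)), by positivity, fun q hq => ⟨?_, hq.trans (min_le_right _ _)⟩⟩
    calc l * q ≤ l * (1/(2*l)) := by gcongr; exact hq.trans (min_le_left _ _)
      _ = 1/2 := by field_simp
  set s1 := min (1/2) (Real.sqrt q1 / D) with hs1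
  have s1p : 0 < s1 := by positivity
  have s1h : s1 ≤ 1/2 := min_le_left _ _
  have qs : ∀ x ∈ Tri A B C, 1 - bcc A B C x ≤ s1 → qd A x ≤ q1 := by
    intro x hx hxs
    have := Ph_norm h hx
    rw [← hD] at this
    have h2 : ‖x - A‖ ≤ Real.sqrt q1 := by
      calc ‖x - A‖ ≤ D * (Real.sqrt q1 / D) := this.trans (by gcongr; exact hxs.trans (min_le_right _ _))
        _ = Real.sqrt q1 := by field_simp
    calc qd A x = ‖x - A‖ ^ 2 := rfl
      _ ≤ (Real.sqrt q1) ^ 2 := by gcongr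
      _ = q1 := Real.sq_sqrt q1p.le
  obtain ⟨N, hN⟩ := (Cone_compact h s1 s1).exists_bound_of_continuousOn (hc.mono fun x hx => Cone_dom h s1p (by linarith) hx)
  set N' := |N| with hN'
  refine ⟨2 * N', by positivity, s1, ⟨s1p, by linarith⟩, fun x hx hxs => ?_⟩
  have xA := dom_ne hx
  have hbx : 0 < 1 - bcc A B C x := by
    have := Ph_norm h hx.1
    by_contra! hle
    have : ‖x - A‖ ≤ 0 := this.trans (mul_nonpos_of_nonneg_of_nonpos D0.le hle)
    exact xA (sub_eq_zero.1 (norm_le_zero_iff.1 this))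
  have q0 : ∀ y, y ≠ A → 0 < qd A y := by intro y hy; unfold qd; have := sub_ne_zero.2 hy; positivity
  have Ppos : ∀ q, 0 < q → q ≤ q1 → -(1/4) * Real.log q ≤ PG l q := by
    intro q hq hqq
    obtain ⟨a, b⟩ := hq1 q hqq
    have lq : Real.log q ≤ -3 := (Real.log_le_iff_le_exp hq).2 b
    have e : PG l q = (-(1/2) * Real.log q) * (1 - l * q) := by unfold PG; ring
    rw [e]; nlinarith
  have main : ∀ δ > 0, f x ≤ 2 * N' + δ * PG l (qd A x) := by
    intro δ hδ
    obtain ⟨s, hs, hss, hf⟩ := hL (δ / 4) (by positivity) (min (1 - bcc A B C x) (1 / D ^ 2)) (by positivity)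
    have sx : s < 1 - bcc A B C x := hss.trans_le (min_le_left _ _)
    have sD : s < 1 / D ^ 2 := hss.trans_le (min_le_right _ _)
    have xc : x ∈ Cone A B C s s1 := ⟨hx.1, sx.le, hxs⟩
    set G : ℝ → ℝ := fun q => 2 * N' * (1 - l / 2 * q) + δ * PG l q with hGd
    have GA : ∀ y ∈ Cone A B C s s1, y ≠ A := fun y hy => dom_ne (Cone_dom h hs.1 (by linarith) hy)
    have g1 : ∀ t > 0, HasDerivAt G (2 * N' * (-(l/2)) + δ * (-(1/2) * t⁻¹ + l / 2 * (Real.log t + 1))) t := by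
      intro t ht
      have := ((((hasDerivAt_id t).const_mul (l/2)).const_sub 1).const_mul (2 * N')).add ((PG_d1 l t ht).const_mul δ)
      refine this.congr_deriv ?_
      ring
    have g2 : ∀ t > 0, HasDerivAt (fun t => 2 * N' * (-(l/2)) + δ * (-(1/2) * t⁻¹ + l / 2 * (Real.log t + 1))) (δ * ((1/2) * (t ^ 2)⁻¹ + l / 2 * t⁻¹)) t := by
      intro t ht
      exact ((PG_d2 l t ht).const_mul δ).const_add _
    have gc : ∀ t > 0, ContDiffAt ℝ 2 G t := by
      intro t ht
      have : ContDiffAt ℝ 2 Real.log t := Real.contDiffAt_log.2 ht.ne'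
      simp only [hGd, PG]
      exact (contDiffAt_const.mul (contDiffAt_const.sub (contDiffAt_const.mul contDiffAt_id))).add
        (contDiffAt_const.mul ((contDiffAt_const.mul this).add (contDiffAt_const.mul (contDiffAt_id.mul this))))
    have Ng : ∀ y ∈ Cone A B C s s1, N' - δ / 4 * Real.log (qd A y) ≤ G (qd A y) := by
      intro y hy
      have hq := qs y hy.1 hy.2.2
      have hp := q0 y (GA y hy)
      have := Ppos _ hp hq
      have a := (hq1 _ hq).1
      have : 0 ≤ N' := abs_nonneg N
      simp only [hGd]; nlinarith
    have lq : ∀ y ∈ Cone A B C s s1, Real.log (qd A y) ≤ -3 := fun y hy =>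
      (Real.log_le_iff_le_exp (q0 y (GA y hy))).2 (hq1 _ (qs y hy.1 hy.2.2)).2
    have N0 : 0 ≤ N' := abs_nonneg N
    have := comp_mul h hn hc hs.1 (s1 := s1) (by linarith) (G := G) (fun y hy => cd_radial (GA y hy) gc) ?_ ?_ ?_ ?_ xc
    · refine this.trans ?_
      simp only [hGd]
      have := (q0 x xA).le
      have : 0 ≤ N' * (l * qd A x) := by positivity
      linarith
    · intro y hy
      have := Ng y hy
      have := lq y hy
      nlinarith
    · intro y hy
      rw [lap_radial g1 g2 (GA y hy)]
      have hp := q0 y (GA y hy)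
      have ll := lq y hy
      have a := (hq1 _ (qs y hy.1 hy.2.2)).1
      simp only [hGd, PG]
      set q := qd A y
      set L := Real.log q
      have e : 4 * q * (δ * (1 / 2 * (q ^ 2)⁻¹ + l / 2 * q⁻¹)) + 4 * (2 * N' * -(l / 2) + δ * (-(1 / 2) * q⁻¹ + l / 2 * (L + 1))) =
        -4 * N' * l + δ * (4 * l + 2 * l * L) := by field_simp; ring
      rw [e]
      have k1 : 0 ≤ N' * l := by positivity
      have k2 : 0 < δ * l := by positivity
      have k3 : 0 < l * q := by positivity
      have k4 : l * q * L ≤ 0 := by nlinarith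
      have k5 : δ * l * (4 + 3 / 2 * L + (l * q) * L / 2) < 0 := by
        apply mul_neg_of_pos_of_neg k2; linarith
      have k6 : 0 ≤ N' * l * (l * q) := by positivity
      nlinarith
    · intro y hy hys
      refine le_trans ?_ (Ng y hy)
      obtain ⟨t, ht, e⟩ := Ph_inv h hy.1 (by linarith [hs.1])
      rw [hys] at e
      have := hf t ht
      rw [e] at this
      have n1 := Ph_norm h hy.1
      rw [hys, ← hD] at n1
      have hp := q0 y (GA y hy)
      have s0 := hs.1
      have ql : qd A y ≤ s := by
        calc qd A y = ‖y - A‖ ^ 2 := rfl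
          _ ≤ (D * s) ^ 2 := by gcongr
          _ = D ^ 2 * s * s := by ring
          _ ≤ 1 * s := by
            gcongr
            rw [lt_div_iff₀ (by positivity)] at sD; linarith
          _ = s := one_mul s
      have := Real.log_le_log hp ql
      have := le_abs_self (f y)
      nlinarith
    · intro y hy hys
      have h1 := hN y ⟨hy.1, hys.ge, hys.le⟩
      have := Ng y hy
      have := lq y hy
      have := le_abs_self (f y)
      have := le_abs_self N
      rw [Real.norm_eq_abs] at h1
      nlinarith
  refine le_of_forall_pos_le_add fun ε hε => ?_
  set P := |PG l (qd A x)|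
  have := main (ε / (P + 1)) (by positivity)
  have h2 : ε / (P + 1) * PG l (qd A x) ≤ ε := by
    calc ε / (P + 1) * PG l (qd A x) ≤ ε / (P + 1) * (P + 1) := by
          gcongr; have := le_abs_self (PG l (qd A x)); linarith
      _ = ε := div_mul_cancel₀ _ (by positivity)
  linarith

theorem near_above (h : dt A B C ≠ 0) (hn : ∀ p ∈ TriDom A B C, NiceAt A B C l f p) (hc : ContinuousOn f (TriDom A B C)) (hl : 0 < l)
    {M s1 s2 c ε : ℝ} (hM0 : 0 ≤ M) (hs1 : s1 < 1) (hM : ∀ x ∈ TriDom A B C, 1 - bcc A B C x ≤ s1 → f x ≤ M)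
    (h0 : 0 < s2) (h1 : s2 ≤ s1) (hD1 : (‖B - A‖ + ‖C - B‖) * s2 ≤ 1) (hε : l * (M + 1) * ((‖B - A‖ + ‖C - B‖) * s2) ^ 2 ≤ ε)
    (hline : ∀ t ∈ Icc (0:ℝ) 1, f (Ph A B C s2 t) ≤ c) {x : E2} (hx : x ∈ TriDom A B C) (hxs : 1 - bcc A B C x ≤ s2) : f x ≤ c + ε := by
  set D := ‖B - A‖ + ‖C - B‖ with hD
  have D0 : 0 < D := by have : 0 < ‖C - B‖ := norm_pos_iff.2 (side_ne h); positivity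
  have xA := dom_ne hx
  have hbx : 0 < 1 - bcc A B C x := by
    have := Ph_norm h hx.1
    by_contra! hle
    have : ‖x - A‖ ≤ 0 := this.trans (mul_nonpos_of_nonneg_of_nonpos D0.le hle)
    exact xA (sub_eq_zero.1 (norm_le_zero_iff.1 this))
  have q0 : ∀ y, y ≠ A → 0 < qd A y := by intro y hy; unfold qd; have := sub_ne_zero.2 hy; positivity
  have main : ∀ δ > 0, f x ≤ c + ε + δ * (-Real.log (qd A x)) := by
    intro δ hδ
    set s := min (1 - bcc A B C x) (min (1 / D ^ 2) (Real.exp (-((M + |c|) / δ)))) with hsd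
    have s0 : 0 < s := by positivity
    have sx : s ≤ 1 - bcc A B C x := min_le_left _ _
    have sD : s ≤ 1 / D ^ 2 := (min_le_right _ _).trans (min_le_left _ _)
    have sM : s ≤ Real.exp (-((M + |c|) / δ)) := (min_le_right _ _).trans (min_le_right _ _)
    have xc : x ∈ Cone A B C s s2 := ⟨hx.1, sx, hxs⟩
    set G : ℝ → ℝ := fun q => c + l * (M + 1) * ((D * s2) ^ 2 - q) + δ * (-Real.log q) with hGd
    have hdom : ∀ y ∈ Cone A B C s s2, y ∈ TriDom A B C := fun y hy => Cone_dom h s0 (by linarith) hy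
    have GA : ∀ y ∈ Cone A B C s s2, y ≠ A := fun y hy => dom_ne (hdom y hy)
    have g1 : ∀ t > 0, HasDerivAt G (-(l * (M + 1)) + δ * (-t⁻¹)) t := by
      intro t ht
      have := ((((hasDerivAt_id t).const_sub ((D * s2) ^ 2)).const_mul (l * (M + 1))).const_add c).add (((Real.hasDerivAt_log ht.ne').neg).const_mul δ)
      refine this.congr_deriv ?_
      ring
    have g2 : ∀ t > 0, HasDerivAt (fun t => -(l * (M + 1)) + δ * (-t⁻¹)) (δ * (t ^ 2)⁻¹) t := by
      intro t ht
      have := ((hasDerivAt_inv ht.ne').neg.const_mul δ).const_add (-(l * (M + 1)))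
      refine this.congr_deriv ?_
      ring
    have gc : ∀ t > 0, ContDiffAt ℝ 2 G t := by
      intro t ht
      have : ContDiffAt ℝ 2 Real.log t := Real.contDiffAt_log.2 ht.ne'
      exact (contDiffAt_const.add (contDiffAt_const.mul (contDiffAt_const.sub contDiffAt_id))).add (contDiffAt_const.mul this.neg)
    have qb : ∀ y ∈ Cone A B C s s2, qd A y ≤ (D * s2) ^ 2 := by
      intro y hy
      have := Ph_norm h hy.1
      have h3 : ‖y - A‖ ≤ D * s2 := this.trans (by rw [← hD]; gcongr; exact hy.2.2)
      unfold qd; gcongr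
    have qb1 : ∀ y ∈ Cone A B C s s2, Real.log (qd A y) ≤ 0 := by
      intro y hy
      refine Real.log_nonpos (q0 y (GA y hy)).le ((qb y hy).trans ?_)
      have : 0 ≤ D * s2 := by positivity
      nlinarith
    have Gl : ∀ y ∈ Cone A B C s s2, c + δ * (-Real.log (qd A y)) ≤ G (qd A y) := by
      intro y hy
      have := qb y hy
      have : 0 ≤ l * (M + 1) * ((D * s2) ^ 2 - qd A y) := mul_nonneg (by positivity) (by linarith)
      simp only [hGd]; linarith
    have := comp_add h hn hc hl.le (M := M) s0 (s1 := s2) (by linarith) (G := G) (fun y hy => cd_radial (GA y hy) gc) ?_ ?_ ?_ ?_ xc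
    · refine this.trans ?_
      simp only [hGd]
      have := (q0 x xA).le
      have : 0 ≤ l * (M + 1) * qd A x := by positivity
      linarith
    · intro y hy
      exact hM y (hdom y hy) (hy.2.2.trans h1)
    · intro y hy
      rw [lap_radial g1 g2 (GA y hy)]
      have hp := q0 y (GA y hy)
      set q := qd A y
      have e : 4 * q * (δ * (q ^ 2)⁻¹) + 4 * (-(l * (M + 1)) + δ * (-q⁻¹)) = -4 * (l * (M + 1)) := by field_simp; ring
      rw [e]
      have : 0 ≤ l * M := by positivity
      linarith
    · intro y hy hys
      refine le_trans ?_ (Gl y hy)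
      refine (hM y (hdom y hy) (hy.2.2.trans h1)).trans ?_
      have n1 := Ph_norm h hy.1
      rw [hys, ← hD] at n1
      have hp := q0 y (GA y hy)
      have ql : qd A y ≤ s := by
        calc qd A y = ‖y - A‖ ^ 2 := rfl
          _ ≤ (D * s) ^ 2 := by gcongr
          _ = D ^ 2 * s * s := by ring
          _ ≤ 1 * s := by
            gcongr
            rw [le_div_iff₀ (by positivity)] at sD; linarith
          _ = s := one_mul s
      have l1 := Real.log_le_log hp (ql.trans sM)
      rw [Real.log_exp] at l1
      have l2 : δ * ((M + |c|) / δ) ≤ δ * (-Real.log (qd A y)) := by gcongr; linarith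
      have l3 : δ * ((M + |c|) / δ) = M + |c| := by field_simp
      have := neg_abs_le c
      linarith
    · intro y hy hys
      refine le_trans ?_ (Gl y hy)
      obtain ⟨t, ht, e⟩ := Ph_inv h hy.1 (by linarith)
      rw [hys] at e
      have := hline t ht
      rw [e] at this
      have := qb1 y hy
      nlinarith
  refine le_of_forall_pos_le_add fun η hη => ?_
  set P := |-Real.log (qd A x)|
  have := main (η / (P + 1)) (by positivity)
  have h2 : η / (P + 1) * (-Real.log (qd A x)) ≤ η := by
    calc η / (P + 1) * (-Real.log (qd A x)) ≤ η / (P + 1) * (P + 1) := by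
          gcongr; have := le_abs_self (-Real.log (qd A x)); linarith
      _ = η := div_mul_cancel₀ _ (by positivity)
  linarith

theorem NiceAt.neg {p : E2} (hf : NiceAt A B C l f p) : NiceAt A B C l (fun x => -f x) p := by
  obtain ⟨r, F, ⟨hr, hF, hp, hv, hs⟩, e⟩ := hf
  refine ⟨r, fun x => -F x, ⟨hr, hF.neg, ?_, hv, ?_⟩, fun x hx hT => by simp only [e x hx hT]⟩
  · intro x hx
    have : (fun x => -F x) = fun x => (-1) * F x := by funext x; ring
    rw [this, lap_const_mul _ (hF.contDiffAt.of_le two_le_inf), hp x hx]; ring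
  · rcases hs with hs | ⟨n, c, h1, h2, h3⟩
    · exact Or.inl hs
    · exact Or.inr ⟨n, c, h1, h2, fun x hx => by simp only [h3 x hx]⟩

theorem vertex_lim (h : dt A B C ≠ 0) (hn : ∀ p ∈ TriDom A B C, NiceAt A B C l f p) (hc : ContinuousOn f (TriDom A B C)) (hl : 0 < l)
    (hF : ∀ x ∈ interior (Tri A B C), ContDiffAt ℝ ∞ f x)
    (hE : ∫⁻ x in interior (Tri A B C), ENNReal.ofReal (gsq f x) ≠ ⊤) :
    ∃ L, Tendsto f (𝓝[TriDom A B C] A) (𝓝 L) := by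
  have hn' : ∀ p ∈ TriDom A B C, NiceAt A B C l (fun x => -f x) p := fun p hp => (hn p hp).neg
  obtain ⟨M1, hM1, s1, hs1, H1⟩ := bdd_above h hn hc hl (fun δ hδ s0 hs0 => by
    obtain ⟨s, a, b, -, c⟩ := line_good h hF hc hE hδ hs0
    exact ⟨s, a, b, c⟩)
  obtain ⟨M2, hM2, s2, hs2, H2⟩ := bdd_above h hn' hc.neg hl (fun δ hδ s0 hs0 => by
    obtain ⟨s, a, b, -, c⟩ := line_good h hF hc hE hδ hs0
    exact ⟨s, a, b, fun t ht => by rw [abs_neg]; exact c t ht⟩)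
  set D := ‖B - A‖ + ‖C - B‖ with hD
  have D0 : 0 < D := by have : 0 < ‖C - B‖ := norm_pos_iff.2 (side_ne h); positivity
  have bA : bcc A B C A = 1 := by
    have := (bcc_affine h 1 0 0 (by norm_num)); simpa using this
  have key : ∀ ε > 0, ∃ c, ∀ᶠ x in 𝓝[TriDom A B C] A, |f x - c| ≤ ε := by
    intro ε hε
    set m := min (min s1 s2) (min (1 / D) (min ((ε/2) / (l * (M1 + 1) * D)) ((ε/2) / (l * (M2 + 1) * D)))) with hm
    have m0 : 0 < m := by have := hs1.1; have := hs2.1; positivity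
    obtain ⟨s, hs, hsm, hosc, -⟩ := line_good h hF hc hE (half_pos hε) m0
    have s0 := hs.1
    have a1 : s ≤ s1 := hsm.le.trans ((min_le_left _ _).trans (min_le_left _ _))
    have a2 : s ≤ s2 := hsm.le.trans ((min_le_left _ _).trans (min_le_right _ _))
    have a3 : s ≤ 1 / D := hsm.le.trans ((min_le_right _ _).trans (min_le_left _ _))
    have a4 : s ≤ (ε/2) / (l * (M1 + 1) * D) := hsm.le.trans ((min_le_right _ _).trans ((min_le_right _ _).trans (min_le_left _ _)))
    have a5 : s ≤ (ε/2) / (l * (M2 + 1) * D) := hsm.le.trans ((min_le_right _ _).trans ((min_le_right _ _).trans (min_le_right _ _)))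
    have d1 : D * s ≤ 1 := by rw [le_div_iff₀ D0] at a3; linarith
    have d0 : 0 ≤ D * s := by positivity
    have e1 : ∀ M, 0 ≤ M → s ≤ (ε/2) / (l * (M + 1) * D) → l * (M + 1) * (D * s) ^ 2 ≤ ε/2 := by
      intro M hM ha
      rw [le_div_iff₀ (by positivity)] at ha
      have : l * (M + 1) * (D * s) ^ 2 ≤ l * (M + 1) * (D * s) := by gcongr; nlinarith
      linarith
    refine ⟨f (Ph A B C s 0), ?_⟩
    have c : Continuous fun x => 1 - bcc A B C x := continuous_const.sub (bcc_cont h)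
    have ev : ∀ᶠ x in 𝓝 A, 1 - bcc A B C x < s := c.continuousAt.eventually (gt_mem_nhds (by simp [bA, s0]))
    filter_upwards [self_mem_nhdsWithin, nhdsWithin_le_nhds ev] with x hx hxs
    have u := near_above h hn hc hl (c := f (Ph A B C s 0) + ε/2) (ε := ε/2) hM1 hs1.2 H1 s0 a1 d1 (e1 M1 hM1 a4)
      (fun t ht => by have := (abs_le.1 (hosc t ht 0 (by simp))).2; linarith) hx hxs.le
    have v := near_above h hn' hc.neg hl (c := -f (Ph A B C s 0) + ε/2) (ε := ε/2) hM2 hs2.2 H2 s0 a2 d1 (e1 M2 hM2 a5)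
      (fun t ht => by have := (abs_le.1 (hosc t ht 0 (by simp))).1; linarith) hx hxs.le
    rw [abs_le]; constructor <;> linarith
  have cau : ∀ F : Filter E2, F = 𝓝[TriDom A B C] A → F.NeBot → ∃ L, Tendsto f F (𝓝 L) := by
    intro F hFe hne
    rw [← cauchy_map_iff_exists_tendsto, Metric.cauchy_iff]
    refine ⟨hne.map f, fun ε hε => ?_⟩
    obtain ⟨c, hc'⟩ := key (ε/3) (by positivity)
    rw [← hFe] at hc'
    refine ⟨f '' {x | |f x - c| ≤ ε/3}, image_mem_map hc', ?_⟩
    rintro _ ⟨x, hx, rfl⟩ _ ⟨y, hy, rfl⟩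
    rw [mem_ofPred_eq, abs_le] at hx hy
    rw [Real.dist_eq, abs_lt]; constructor <;> linarith [hx.1, hx.2, hy.1, hy.2]
  by_cases hb : 𝓝[TriDom A B C] A = ⊥
  · exact ⟨0, by rw [hb]; exact tendsto_bot⟩
  · exact cau _ rfl ⟨hb⟩
end
end

section
open MeasureTheory Filter Topology
open scoped ContDiff FourierTransform RealInnerProductSpace

section
variable {A B C : E2}

theorem NiceAt.congr {l : ℝ} {f g : E2 → ℝ} {p : E2} (hf : NiceAt A B C l f p) (e : ∀ x ∈ TriDom A B C, g x = f x) : NiceAt A B C l g p := by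
  obtain ⟨r, F, hN, e'⟩ := hf
  exact ⟨r, F, hN, fun x hx hT => by rw [e x ⟨hT, hN.2.2.2.1 x hx⟩]; exact e' x hx hT⟩

theorem NiceAt.cwa {l : ℝ} {f : E2 → ℝ} {p : E2} (hf : NiceAt A B C l f p) (hp : p ∈ Tri A B C) : ContinuousWithinAt f (Tri A B C) p := by
  obtain ⟨r, F, hN, e'⟩ := hf
  refine (hN.2.1.continuous.continuousWithinAt).congr_of_eventuallyEq ?_ (e' p (Metric.mem_ball_self hN.1) hp)
  filter_upwards [self_mem_nhdsWithin, mem_nhdsWithin_of_mem_nhds (Metric.ball_mem_nhds p hN.1)] with x h1 h2 using e' x h2 h1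

theorem NiceAt.cda {l : ℝ} {f : E2 → ℝ} {p : E2} (hf : NiceAt A B C l f p) (hp : p ∈ interior (Tri A B C)) : ContDiffAt ℝ ∞ f p := by
  obtain ⟨r, F, hN, e⟩ := hf
  refine hN.2.1.contDiffAt.congr_of_eventuallyEq ?_
  filter_upwards [isOpen_interior.mem_nhds hp, Metric.ball_mem_nhds p hN.1] with x h1 h2 using e x h2 (interior_subset h1)

theorem vert_ne (h : dt A B C ≠ 0) : A ≠ B ∧ B ≠ C ∧ C ≠ A := by
  have h2 : dt B C A ≠ 0 := by rwa [dt_cyc]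
  have h3 : dt C A B ≠ 0 := by rwa [dt_cyc]
  exact ⟨fun e => side_ne h3 (by rw [e, sub_self]), fun e => side_ne h (by rw [e, sub_self]), fun e => side_ne h2 (by rw [e, sub_self])⟩

theorem cont_vert {f : E2 → ℝ} (h : dt A B C ≠ 0) (hl : Tendsto f (𝓝[TriDom A B C] A) (𝓝 (f A))) : ContinuousWithinAt f (Tri A B C) A := by
  obtain ⟨n1, n2, n3⟩ := vert_ne h
  intro U hU
  have h1 := hl hU
  rw [mem_map, mem_nhdsWithin_iff_eventually] at h1
  change ∀ᶠ x in 𝓝[Tri A B C] A, f x ∈ U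
  rw [eventually_nhdsWithin_iff]
  filter_upwards [h1, isOpen_ne.mem_nhds n1, isOpen_ne.mem_nhds n3.symm] with x hx hB hC hT
  by_cases hA : x = A
  · rw [hA]; exact mem_of_mem_nhds hU
  · refine hx ⟨hT, ?_⟩
    rintro (e | e | e)
    · exact hA e
    · exact hB e
    · exact hC e

theorem poinc_mu (h : dt A B C ≠ 0) {μ : ℝ} (hmin : ∀ l f, IsNeumannEigenfun A B C l f → μ ≤ l) {f0 : E2 → ℝ}
    (hf0 : ContDiff ℝ 1 f0) (hm0 : ∫ x in Tri A B C, f0 x = 0) :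
    μ * ∫ x in Tri A B C, f0 x ^ 2 ≤ ∫ x in Tri A B C, gsq f0 x := by
  classical
  by_contra! hlt
  have h2 : dt B C A ≠ 0 := by rwa [dt_cyc]
  have h3 : dt C A B ≠ 0 := by rwa [dt_cyc]
  have hfin : volume (Tri A B C) ≠ ⊤ := (Tri_compact A B C).measure_lt_top.ne
  have hv : 0 < volume.real (Tri A B C) :=
    ENNReal.toReal_pos ((isOpen_interior.measure_pos volume (Tri_int_nonempty h)).trans_le (measure_mono interior_subset)).ne' hfin
  obtain ⟨l, Cst, f, g, l0, lμ, hf, hE, hg, hg1, hgm, t1, t2⟩ := minimizer (Tri_compact A B C) (Tri_convex A B C) hv hf0 hm0 hlt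
  have : IsFiniteMeasure (volume.restrict (Tri A B C)) := ⟨by simpa using hfin.lt_top⟩
  have hgi : IntegrableOn g (Tri A B C) := hg.integrable (by norm_num)
  obtain ⟨F, hN, hae⟩ := glue h fun p hp => nice_ae h hp hf hgi t1 t2
  have hcd : ∀ x ∈ interior (Tri A B C), ContDiffAt ℝ ∞ F x := fun x hx => (hN x (interior_sub_TriDom h hx)).cda hx
  have hen : ∫⁻ x in interior (Tri A B C), ENNReal.ofReal (gsq F x) ≠ ⊤ :=
    ((energy_bound h hf hE t1 hcd hae).trans_lt ENNReal.ofReal_lt_top).ne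
  have hcont : ContinuousOn F (TriDom A B C) := fun x hx => ((hN x hx).cwa hx.1).mono sdiff_subset
  have hN2 : ∀ p ∈ TriDom B C A, NiceAt B C A l F p := fun p hp => NiceAt_cyc (hN p (by rwa [TriDom_cyc] at hp))
  have hN3 : ∀ p ∈ TriDom C A B, NiceAt C A B l F p := fun p hp => NiceAt_cyc (hN2 p (by rwa [TriDom_cyc] at hp))
  obtain ⟨LA, hLA⟩ := vertex_lim h hN hcont l0 hcd hen
  obtain ⟨LB, hLB⟩ := vertex_lim h2 hN2 (by rwa [TriDom_cyc]) l0 (by rwa [Tri_cyc]) (by rwa [Tri_cyc])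
  obtain ⟨LC, hLC⟩ := vertex_lim h3 hN3 (by rwa [TriDom_cyc, TriDom_cyc]) l0 (by rwa [Tri_cyc, Tri_cyc]) (by rwa [Tri_cyc, Tri_cyc])
  set u : E2 → ℝ := fun x => if x = A then LA else if x = B then LB else if x = C then LC else F x with hu
  obtain ⟨n1, n2, n3⟩ := vert_ne h
  have uA : u A = LA := by simp [hu]
  have uB : u B = LB := by simp [hu, n1.symm]
  have uC : u C = LC := by simp [hu, n3, n2.symm]
  have ue : ∀ x ∈ TriDom A B C, u x = F x := by
    intro x hx
    have : x ≠ A ∧ x ≠ B ∧ x ≠ C := by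
      have := hx.2; simp only [Vtx, mem_insert_iff, mem_singleton_iff] at this; tauto
    simp [hu, this]
  have hNu : ∀ p ∈ TriDom A B C, NiceAt A B C l u p := fun p hp => (hN p hp).congr ue
  have hNu2 : ∀ p ∈ TriDom B C A, NiceAt B C A l u p := fun p hp => NiceAt_cyc (hNu p (by rwa [TriDom_cyc] at hp))
  have hNu3 : ∀ p ∈ TriDom C A B, NiceAt C A B l u p := fun p hp => NiceAt_cyc (hNu2 p (by rwa [TriDom_cyc] at hp))
  have eig : IsNeumannEigenfun A B C l u := by
    refine ⟨l0, ?_, ?_, nice_smooth hNu, ?_, ?_, nice_neumann h hNu, ?_⟩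
    · rintro ⟨c, hc⟩
      have gc : ∀ᵐ x ∂(volume.restrict (Tri A B C)), g x = c := by
        rw [ae_restrict_iff' (Tri_meas A B C)]
        have hV : ∀ᵐ x : E2, x ∉ Vtx A B C := by
          rw [ae_iff]
          have : {x : E2 | ¬ x ∉ Vtx A B C} = Vtx A B C := by ext; simp
          rw [this]
          exact (Set.Finite.measure_zero (by simp [Vtx]) _)
        filter_upwards [hae, hV] with x hx hxV hT
        rw [hx hT, ← ue x ⟨hT, hxV⟩, hc x hT]
      have i1 : ∫ x in Tri A B C, g x = ∫ x in Tri A B C, c := integral_congr_ae gc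
      have i2 : ∫ x in Tri A B C, g x ^ 2 = ∫ x in Tri A B C, c ^ 2 := integral_congr_ae (gc.mono fun x hx => by simp only [hx])
      rw [hgm] at i1
      rw [hg1] at i2
      simp only [setIntegral_const, smul_eq_mul] at i1 i2
      have : c = 0 := by
        rcases mul_eq_zero.1 i1.symm with e | e
        · exact absurd e hv.ne'
        · exact e
      rw [this] at i2; simp at i2
    · intro x hx
      by_cases hxV : x ∈ Vtx A B C
      · have tl : ∀ v L, Tendsto F (𝓝[TriDom A B C] v) (𝓝 L) → u v = L → Tendsto u (𝓝[TriDom A B C] v) (𝓝 (u v)) := by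
          intro v L hL hv
          rw [hv]
          refine hL.congr' ?_
          filter_upwards [self_mem_nhdsWithin] with y hy using (ue y hy).symm
        rcases hxV with e | e | e
        · rw [e]; exact cont_vert h (tl A LA hLA uA)
        · rw [e, ← Tri_cyc]
          refine cont_vert h2 ?_
          rw [TriDom_cyc]
          refine tl B LB ?_ uB
          rwa [TriDom_cyc] at hLB
        · rw [mem_singleton_iff] at e
          rw [e, ← Tri_cyc, ← Tri_cyc]
          refine cont_vert h3 ?_
          rw [TriDom_cyc, TriDom_cyc]
          refine tl C LC ?_ uC
          rwa [TriDom_cyc, TriDom_cyc] at hLC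
      · exact (hNu x ⟨hx, hxV⟩).cwa hx
    · intro p hp
      rw [negLap_eq, nice_pde h hNu hp]; ring
    · have := nice_neumann h3 hNu3
      rwa [TriDom_cyc, TriDom_cyc] at this
    · have := nice_neumann h2 hNu2
      rwa [TriDom_cyc] at this
  linarith [hmin l u eig]
end
end

section
open MeasureTheory Filter Topology
open scoped ContDiff FourierTransform RealInnerProductSpace

theorem neumann_n {A B C n c x : E2} {μ : ℝ} {u : E2 → ℝ} (h : dt A B C ≠ 0) (hu : IsNeumannEigenfun A B C μ u) (hs : Sd A B C n c)
    (hx : x ∈ TriDom A B C) (h0 : ⟪x - c, n⟫ = 0) : fderivWithin ℝ u (TriDom A B C) x n = 0 := by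
  have h2 : dt B C A ≠ 0 := by rwa [dt_cyc]
  have h3 : dt C A B ≠ 0 := by rwa [dt_cyc]
  have key : ∀ {A B C : E2} {D : Set E2}, dt A B C ≠ 0 → NeumannOn D B C u → x ∈ TriDom A B C → ell A B C x = 0 →
      fderivWithin ℝ u D x (nrm A B C) = 0 := by
    intro A B C D h hN hx h0
    have hop := (mem_openSegment_iff' h).2 ⟨hx, h0⟩
    refine hN x (openSegment_subset_segment _ _ _ hop) ?_ ?_ _ (by rw [real_inner_comm]; exact inner_nrm A B C)
    · rintro rfl; exact hx.2 (by simp [Vtx])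
    · rintro rfl; exact hx.2 (by simp [Vtx])
  rcases hs with ⟨rfl, rfl⟩ | ⟨rfl, rfl⟩ | ⟨rfl, rfl⟩
  · exact key h hu.neumann₂₃ hx h0
  · exact key h2 hu.neumann₃₁ (by rwa [TriDom_cyc]) h0
  · exact key h3 hu.neumann₁₂ (by rwa [TriDom_cyc, TriDom_cyc]) h0

theorem nice_u {A B C p : E2} {μ : ℝ} {u : E2 → ℝ} (h : dt A B C ≠ 0) (hu : IsNeumannEigenfun A B C μ u)
    (hp : p ∈ TriDom A B C) : NiceAt A B C μ u p := by
  have hci : ∀ x ∈ interior (Tri A B C), ContDiffAt ℝ ∞ u x := fun x hx =>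
    (hu.smooth x (interior_sub_TriDom h hx)).contDiffAt
      (mem_of_superset (isOpen_interior.mem_nhds hx) (interior_sub_TriDom h))
  have hlap : ∀ x ∈ interior (Tri A B C), lap u x = -(μ * u x) := by
    intro x hx
    have := hu.eqn x hx
    rw [negLap_eq] at this; linarith
  obtain ⟨r, hr, hv, hcase⟩ := loc h hp
  rcases hcase with hb | ⟨n, c, hs, hn, hpc, hH⟩
  · have hbi : Metric.ball p r ⊆ interior (Tri A B C) := interior_maximal hb Metric.isOpen_ball
    let χ : ContDiffBump p := ⟨r / 4, r / 2, by linarith, by linarith⟩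
    have hχ : TestIn (Metric.ball p r) (fun x => χ x) :=
      ⟨χ.contDiff, χ.hasCompactSupport, by
        rw [χ.tsupport_eq]; exact Metric.closedBall_subset_ball (by show r / 2 < r; linarith)⟩
    have hF := hχ.mul_on (q := u) fun x hx => hci x (hbi hx)
    have e : ∀ x ∈ Metric.ball p (r / 4), χ x = 1 := fun x hx => χ.one_of_mem_closedBall (Metric.ball_subset_closedBall hx)
    have hsub : Metric.ball p (r / 4) ⊆ Metric.ball p r := Metric.ball_subset_ball (by linarith)
    refine ⟨r / 4, _, ⟨by linarith, hF.smooth, ?_, fun y hy => hv y (hsub hy), Or.inl (hsub.trans hb)⟩, ?_⟩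
    · intro x hx
      have : (fun x => χ x * u x) =ᶠ[𝓝 x] u := by
        filter_upwards [Metric.isOpen_ball.mem_nhds hx] with y hy
        rw [e y hy, one_mul]
      rw [lap_congr this, hlap x (hbi (hsub hx)), this.eq_of_nhds]
    · intro x hx _
      simp only [e x hx, one_mul]
  · have hbD : Metric.ball p r ∩ Tri A B C ⊆ TriDom A B C := fun x hx => ⟨hx.2, hv x hx.1⟩
    have hD : ContDiffOn ℝ 1 (fderivWithin ℝ u (TriDom A B C)) (TriDom A B C) :=
      hu.smooth.fderivWithin (TriDom_ud h) (by norm_cast)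
    have hpT := hp.1
    have hcv : Convex ℝ (Metric.ball p r ∩ Tri A B C) := (convex_ball p r).inter (Tri_convex A B C)
    obtain ⟨K, t, ht, hK⟩ := ((hD p hp).mono hbD).exists_lipschitzOnWith hcv
    obtain ⟨r', hr', hb'⟩ := Metric.mem_nhdsWithin_iff.1 ht
    obtain ⟨M, hM⟩ := (Tri_compact A B C).exists_bound_of_continuousOn hu.cont
    set ρ := min r r' with hρ
    have hρ0 : 0 < ρ := lt_min hr hr'
    have hio : ∀ x ∈ Metric.ball p r, 0 < ⟪x - c, n⟫ → x ∈ interior (Tri A B C) := by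
      intro x hx hx0
      refine mem_interior.2 ⟨Metric.ball p r ∩ {x | 0 < ⟪x - c, n⟫}, fun y hy => (hH y hy.1).2 hy.2.le, ?_, hx, hx0⟩
      exact Metric.isOpen_ball.inter (isOpen_lt continuous_const (by fun_prop))
    have hM0 : 0 ≤ M := (norm_nonneg _).trans (hM p hpT)
    have hdata : ∀ x ∈ Metric.ball p ρ, 0 < ⟪x - c, n⟫ → ContDiffAt ℝ 2 u x ∧ |u x| ≤ max M (K * ‖n‖) ∧
        |pd n u x| ≤ max M (K * ‖n‖) * ⟪x - c, n⟫ ∧ lap u x = -(μ * u x) := by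
      intro x hx hx0
      have hxr : x ∈ Metric.ball p r := Metric.ball_subset_ball (min_le_left _ _) hx
      have hxi := hio x hxr hx0
      refine ⟨(hci x hxi).of_le two_le_inf, (hM x (interior_subset hxi)).trans (le_max_left _ _), ?_, hlap x hxi⟩
      set t0 := ⟪x - c, n⟫ with ht0
      set y := x - t0 • n with hy
      have hy0 : ⟪y - c, n⟫ = 0 := by
        have : y - c = (x - c) - t0 • n := by rw [hy]; abel
        rw [this, inner_sub_left, inner_smul_left, real_inner_self_eq_norm_sq, hn]; simp [ht0]
      have hyb : y ∈ Metric.ball p ρ := by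
        rw [mem_ball_iff_norm] at hx ⊢
        refine lt_of_le_of_lt ?_ hx
        have e1 : x - p = (y - p) + t0 • n := by rw [hy]; abel
        have e2 : ⟪y - p, n⟫ = 0 := by
          have : y - p = (y - c) - (p - c) := by abel
          rw [this, inner_sub_left, hy0, hpc]; simp
        have e3 : ‖x - p‖ ^ 2 = ‖y - p‖ ^ 2 + t0 ^ 2 := by
          rw [e1, norm_add_sq_real, inner_smul_right, e2, norm_smul, hn]; simp
        exact (sq_le_sq₀ (norm_nonneg _) (norm_nonneg _)).1 (by rw [e3]; nlinarith [sq_nonneg t0])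
      have hyr : y ∈ Metric.ball p r := Metric.ball_subset_ball (min_le_left _ _) hyb
      have hyT : y ∈ Tri A B C := (hH y hyr).2 hy0.ge
      have hyD := hbD ⟨hyr, hyT⟩
      have z := neumann_n h hu hs hyD hy0
      have hl := hK.norm_sub_le (hb' ⟨Metric.ball_subset_ball (min_le_right _ _) hx, hxr, interior_subset hxi⟩)
        (hb' ⟨Metric.ball_subset_ball (min_le_right _ _) hyb, hyr, hyT⟩)
      have e4 : pd n u x = (fderivWithin ℝ u (TriDom A B C) x - fderivWithin ℝ u (TriDom A B C) y) n := by
        rw [sub_apply, z, sub_zero,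
          fderivWithin_of_mem_nhds (mem_of_superset (isOpen_interior.mem_nhds hxi) (interior_sub_TriDom h))]; rfl
      have e5 : ‖x - y‖ = t0 := by
        have : x - y = t0 • n := by rw [hy]; abel
        rw [this, norm_smul, hn, mul_one, Real.norm_of_nonneg hx0.le]
      rw [e4, ← Real.norm_eq_abs]
      refine (ContinuousLinearMap.le_opNorm _ _).trans ?_
      calc _ ≤ (K * ‖x - y‖) * ‖n‖ := by gcongr
        _ = (K * ‖n‖) * t0 := by rw [e5]; ring
        _ ≤ _ := by gcongr; exact le_max_right _ _
    have hi : IntegrableOn u (Metric.ball p ρ ∩ {x | 0 < ⟪x - c, n⟫}) :=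
      (hu.cont.integrableOn_compact (Tri_compact A B C)).mono_set fun x hx =>
        (hH x (Metric.ball_subset_ball (min_le_left _ _) hx.1)).2 hx.2.le
    obtain ⟨G, hG, hGl, hGe, hGae⟩ := nice_side hn hpc hρ0 hi fun η hη he =>
      green_half_u hη hn he (hM0.trans (le_max_left _ _)) hdata hi
    have hsub : Metric.ball p (ρ / 2) ⊆ Metric.ball p r := Metric.ball_subset_ball (by have := min_le_left r r'; linarith)
    refine ⟨ρ / 2, G, ⟨by linarith, hG, hGl, fun y hy => hv y (hsub hy), Or.inr ⟨n, c, hs, ⟨hn, hpc, fun y hy => hH y (hsub hy)⟩, hGe⟩⟩, ?_⟩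
    have hU : IsOpen (Metric.ball p (ρ / 2) ∩ interior (Tri A B C)) := Metric.isOpen_ball.inter isOpen_interior
    have e1 : EqOn u G (Metric.ball p (ρ / 2) ∩ interior (Tri A B C)) := by
      refine Measure.eqOn_open_of_ae_eq (μ := volume) ((ae_restrict_iff' hU.measurableSet).2 ?_) hU
        (hu.cont.mono fun x hx => interior_subset hx.2) hG.continuous.continuousOn
      filter_upwards [hGae, line_ae hn c] with x hx h0 hxU
      exact hx hxU.1 (lt_of_le_of_ne ((hH x (hsub hxU.1)).1 (interior_subset hxU.2)) (Ne.symm h0))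
    have e2 : EqOn u G (Metric.ball p (ρ / 2) ∩ Tri A B C) :=
      e1.of_subset_closure (hu.cont.mono fun x hx => hx.2) hG.continuous.continuousOn
        (fun x hx => ⟨hx.1, interior_subset hx.2⟩)
        fun x hx => Metric.isOpen_ball.inter_closure ⟨hx.1, Tri_sub_closure h hx.2⟩
    exact fun x hx hT => e2 ⟨hx, hT⟩
end

section
open MeasureTheory Filter Topology
open scoped ContDiff FourierTransform RealInnerProductSpace

theorem pd_comm {F : E2 → ℝ} {x : E2} (hF : ContDiffAt ℝ 2 F x) (v w : E2) : pd v (pd w F) x = pd w (pd v F) x := by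
  have hd : DifferentiableAt ℝ (fderiv ℝ F) x := (hF.fderiv_right (m := 1) (by norm_num)).differentiableAt (by norm_num)
  have e : ∀ a b, pd a (pd b F) x = fderiv ℝ (fderiv ℝ F) x a b := by
    intro a b
    show fderiv ℝ (fun y => fderiv ℝ F y b) x a = _
    rw [fderiv_clm_apply hd (differentiableAt_const b)]
    simp
  rw [e, e]
  exact (hF.isSymmSndFDerivAt (by simp)).eq v w

theorem pd_cda {F : E2 → ℝ} {x : E2} (hF : ContDiffAt ℝ ∞ F x) (v : E2) : ContDiffAt ℝ ∞ (pd v F) x :=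
  (hF.fderiv_right (m := ∞) (by simp)).clm_apply contDiffAt_const

theorem lap_pd {F : E2 → ℝ} {x : E2} {l : ℝ} (hF : ContDiffAt ℝ ∞ F x) (h : ∀ᶠ y in 𝓝 x, lap F y = -(l * F y)) (v : E2) :
    lap (pd v F) x = -(l * pd v F x) := by
  have hs : ∀ᶠ y in 𝓝 x, ContDiffAt ℝ 4 F y := (hF.of_le (m := 4) (by norm_cast)).eventually (by norm_num)
  have e : ∀ w, pd w (pd w (pd v F)) x = pd v (pd w (pd w F)) x := by
    intro w
    have e1 : pd w (pd v F) =ᶠ[𝓝 x] pd v (pd w F) := by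
      filter_upwards [hs] with y hy using pd_comm (hy.of_le (by norm_num)) w v
    rw [pd_congr w e1, pd_comm ((pd_cda hF w).of_le two_le_inf)]
  have d : ∀ w, DifferentiableAt ℝ (pd w (pd w F)) x := fun w => (pd_cda (pd_cda hF w) w).differentiableAt (by simp)
  have h2 : pd v (lap F) x = pd v (fun y => (-l) * F y) x := pd_congr v (h.mono fun y hy => by rw [hy]; ring)
  rw [pd_const_mul _ _ (hF.differentiableAt (by simp))] at h2
  have h3 : pd v (lap F) x = pd v (pd ee0 (pd ee0 F)) x + pd v (pd ee1 (pd ee1 F)) x := pd_add v (d _) (d _)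
  rw [lap, e, e, ← h3, h2]; ring

theorem gsq_sg {F : E2 → ℝ} (hF : ContDiff ℝ ∞ F) {n c x : E2} (hn : ‖n‖ = 1) (he : ∀ᶠ y in 𝓝 x, F (sg n c y) = F y) :
    gsq F (sg n c x) = gsq F x := by
  have e : ∀ v, pd v F x = pd (sgL n v) F (sg n c x) := by
    intro v
    rw [← pd_sg (hF.differentiable (by simp) _)]
    exact (pd_congr v he).symm
  have h1 : n 0 ^ 2 + n 1 ^ 2 = 1 := by rw [← normsq_e2, hn]; norm_num
  unfold gsq
  rw [e ee0, e ee1]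
  unfold pd
  set L := fderiv ℝ F (sg n c x)
  rw [sgL_apply, sgL_apply, map_sub, map_sub, map_smul, map_smul, fderiv_decomp L n, inner_ee0, inner_ee1]
  simp only [smul_eq_mul]
  set a := L ee0; set b := L ee1
  have : (a - 2 * n 0 * (n 0 * a + n 1 * b)) ^ 2 + (b - 2 * n 1 * (n 0 * a + n 1 * b)) ^ 2 =
    a ^ 2 + b ^ 2 + 4 * (n 0 * a + n 1 * b) ^ 2 * (n 0 ^ 2 + n 1 ^ 2 - 1) := by ring
  rw [this, h1]; ring

/-- a local maximum on the triangle side of an even function is a local maximum -/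
theorem even_max {A B C x0 : E2} {l r : ℝ} {F H : E2 → ℝ} (hN : NiceD A B C l x0 r F)
    (hev : ∀ n c, ‖n‖ = 1 → Sd A B C n c → ⟪x0 - c, n⟫ = 0 → (∀ y ∈ Metric.ball x0 r, F (sg n c y) = F y) → ∀ y ∈ Metric.ball x0 r, H (sg n c y) = H y)
    (hm : ∀ᶠ y in 𝓝 x0, y ∈ Tri A B C → H y ≤ H x0) : IsLocalMax H x0 := by
  obtain ⟨hr, hF, hp, -, hs⟩ := hN
  rcases hs with hs | ⟨n, c, hsd, ⟨hn, hpn, hh⟩, hFe⟩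
  · filter_upwards [hm, Metric.ball_mem_nhds x0 hr] with y hy hb using hy (hs hb)
  · have hHe := hev n c hn hsd hpn hFe
    have fx : sg n c x0 = x0 := sg_fix hpn
    have tc : Tendsto (sg n c) (𝓝 x0) (𝓝 x0) := by
      have := (sg_cont n c).tendsto x0; rwa [fx] at this
    filter_upwards [hm, tc.eventually hm, Metric.ball_mem_nhds x0 hr] with y h1 h2 hb
    by_cases hT : y ∈ Tri A B C
    · exact h1 hT
    · have hb' := (sg_ball hn hpn (r := r) (x := y)).2 hb
      have hT' : sg n c y ∈ Tri A B C := by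
        rw [hh _ hb', sg_inner hn]
        rw [hh _ hb] at hT; linarith
      have := h2 hT'
      rwa [hHe y hb] at this

theorem qd_sg {A B C x0 n c : E2} (hl : 0 < ell A B C x0) (hn : ‖n‖ = 1) (hsd : Sd A B C n c) (hpn : ⟪x0 - c, n⟫ = 0) (y : E2) :
    qd A (sg n c y) = qd A y := by
  have hA : ⟪A - c, n⟫ = 0 := by
    rcases hsd with ⟨rfl, rfl⟩ | ⟨rfl, rfl⟩ | ⟨rfl, rfl⟩
    · rw [ell] at hl; linarith
    · exact inner_nrm B _ A
    · simp
  have := sg_norm hn c y A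
  rw [sg_fix hA] at this
  simp [qd, this]

theorem lap_gsq {F : E2 → ℝ} {x : E2} {l : ℝ} (hF : ContDiffAt ℝ ∞ F x) (h : ∀ᶠ y in 𝓝 x, lap F y = -(l * F y)) :
    lap (gsq F) x = -(2 * l * gsq F x) + 2 * ((pd ee0 (pd ee0 F) x) ^ 2 + (pd ee1 (pd ee0 F) x) ^ 2 +
      (pd ee0 (pd ee1 F) x) ^ 2 + (pd ee1 (pd ee1 F) x) ^ 2) := by
  have c2 : ∀ v, ContDiffAt ℝ 2 (pd v F) x := fun v => (pd_cda hF v).of_le two_le_inf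
  have e : gsq F = fun y => pd ee0 F y * pd ee0 F y + pd ee1 F y * pd ee1 F y := by funext y; unfold gsq; ring
  rw [e, lap_add ((c2 _).mul (c2 _)) ((c2 _).mul (c2 _)), lap_mul (c2 _) (c2 _), lap_mul (c2 _) (c2 _), lap_pd hF h, lap_pd hF h]
  ring

theorem pd_gsq {F : E2 → ℝ} {x : E2} (hF : ContDiffAt ℝ ∞ F x) (v : E2) :
    pd v (gsq F) x = 2 * (pd ee0 F x * pd v (pd ee0 F) x + pd ee1 F x * pd v (pd ee1 F) x) := by
  have d : ∀ w, DifferentiableAt ℝ (pd w F) x := fun w => (pd_cda hF w).differentiableAt (by simp)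
  have e : gsq F = fun y => pd ee0 F y * pd ee0 F y + pd ee1 F y * pd ee1 F y := by funext y; unfold gsq; ring
  rw [e, pd_add (a := fun y => pd ee0 F y * pd ee0 F y) (b := fun y => pd ee1 F y * pd ee1 F y) v ((d _).mul (d _)) ((d _).mul (d _)), pd_mul v (d _) (d _), pd_mul v (d _) (d _)]
  ring

theorem gsq_cda {F : E2 → ℝ} {x : E2} (hF : ContDiffAt ℝ ∞ F x) : ContDiffAt ℝ 2 (gsq F) x := by
  have c2 : ∀ v, ContDiffAt ℝ 2 (pd v F) x := fun v => (pd_cda hF v).of_le two_le_inf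
  exact ((c2 ee0).pow 2).add ((c2 ee1).pow 2)

set_option maxHeartbeats 1000000 in
theorem bern_alg {k q X0 X1 f0 f1 a00 a10 a01 a11 et et' l L D : ℝ} (hk : 0 < k) (hq : q = X0 ^ 2 + X1 ^ 2) (q1 : k / 2 ≤ q) (q2 : q ≤ 2 * k)
    (het : et = (q - k / 2) * (2 * k - q)) (het' : et' = 5 / 2 * k - 2 * q) (hl : 0 ≤ l) (hlk : l * k ≤ 1)
    (hD : (4 * q * (2 * et' ^ 2 - 4 * et) + 4 * (2 * et * et')) * (f0 ^ 2 + f1 ^ 2) +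
      2 * (2 * et * et' * (2 * X0) * (2 * (f0 * a00 + f1 * a01)) + 2 * et * et' * (2 * X1) * (2 * (f0 * a10 + f1 * a11))) +
      et ^ 2 * (-(2 * l * (f0 ^ 2 + f1 ^ 2)) + 2 * (a00 ^ 2 + a10 ^ 2 + a01 ^ 2 + a11 ^ 2)) +
      L * (2 * (f0 ^ 2 + f1 ^ 2) - 2 * D) ≤ 0) (hL : L = 100 * k ^ 3) : f0 ^ 2 + f1 ^ 2 ≤ 10 * D := by
  have q0 : 0 < q := by linarith
  set g := f0 ^ 2 + f1 ^ 2 with hg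
  have g0 : 0 ≤ g := by positivity
  have et0 : 0 ≤ et := by rw [het]; exact mul_nonneg (by linarith) (by linarith)
  have et1 : et ≤ 3 / 4 * k ^ 2 := by rw [het]; nlinarith [sq_nonneg (q - 5 / 4 * k)]
  have eb : et' ^ 2 ≤ 9 / 4 * k ^ 2 := by rw [het']; nlinarith
  have eb1 : -(3 / 2 * k) ≤ et' := by rw [het']; linarith
  -- first term
  have t1 : -(32 * k ^ 3) ≤ 4 * q * (2 * et' ^ 2 - 4 * et) + 4 * (2 * et * et') := by
    have i1 : q * et ≤ 2 * k * (3 / 4 * k ^ 2) := by gcongr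
    have i2 : 0 ≤ q * et' ^ 2 := by positivity
    have i3 : et * (3 / 2 * k) ≤ 3 / 4 * k ^ 2 * (3 / 2 * k) := by gcongr
    have i4 : et * (-(3 / 2 * k)) ≤ et * et' := by gcongr
    have k3 : 0 < k ^ 3 := by positivity
    nlinarith
  -- cross term
  set S0 := X0 * a00 + X1 * a10 with hS0
  set S1 := X0 * a01 + X1 * a11 with hS1
  have c0 : S0 ^ 2 ≤ q * (a00 ^ 2 + a10 ^ 2) := by rw [hq, hS0]; nlinarith [sq_nonneg (X0 * a10 - X1 * a00)]
  have c1 : S1 ^ 2 ≤ q * (a01 ^ 2 + a11 ^ 2) := by rw [hq, hS1]; nlinarith [sq_nonneg (X0 * a11 - X1 * a01)]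
  have am : ∀ f S N : ℝ, S ^ 2 ≤ q * N → -(2 * et ^ 2 * N) - 32 * q * et' ^ 2 * f ^ 2 ≤ 16 * et * et' * f * S := by
    intro f S N h
    have h1 : 0 ≤ 2 / q * (et * S + 4 * q * et' * f) ^ 2 := by positivity
    have h2 : 2 / q * (et * S + 4 * q * et' * f) ^ 2 = 2 * et ^ 2 * (S ^ 2 / q) + 16 * et * et' * f * S + 32 * q * et' ^ 2 * f ^ 2 := by
      field_simp; ring
    have h3 : S ^ 2 / q ≤ N := by rw [div_le_iff₀ q0]; linarith
    have h4 : 2 * et ^ 2 * (S ^ 2 / q) ≤ 2 * et ^ 2 * N := by gcongr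
    linarith
  have cr0 := am f0 S0 _ c0
  have cr1 := am f1 S1 _ c1
  have ce : 2 * (2 * et * et' * (2 * X0) * (2 * (f0 * a00 + f1 * a01)) + 2 * et * et' * (2 * X1) * (2 * (f0 * a10 + f1 * a11))) =
      16 * et * et' * f0 * S0 + 16 * et * et' * f1 * S1 := by rw [hS0, hS1]; ring
  have b0 : q * et' ^ 2 ≤ (2 * k) * (9 / 4 * k ^ 2) := mul_le_mul q2 eb (sq_nonneg _) (by linarith)
  have b1 : (q * et' ^ 2) * g ≤ ((2 * k) * (9 / 4 * k ^ 2)) * g := mul_le_mul_of_nonneg_right b0 g0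
  have b2 : et ^ 2 * (2 * l * g) ≤ (3 / 4 * k ^ 2) ^ 2 * (2 * l * g) :=
    mul_le_mul_of_nonneg_right (pow_le_pow_left₀ et0 et1 2) (by positivity)
  have b3 : (3 / 4 * k ^ 2) ^ 2 * (2 * l * g) ≤ 2 * k ^ 3 * g := by
    have : (3 / 4 * k ^ 2) ^ 2 * (2 * l * g) = (9 / 8 * k ^ 3 * g) * (l * k) := by ring
    rw [this]
    have : (9 / 8 * k ^ 3 * g) * (l * k) ≤ (9 / 8 * k ^ 3 * g) * 1 := mul_le_mul_of_nonneg_left hlk (by positivity)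
    have k3 : 0 ≤ k ^ 3 * g := by positivity
    linarith
  have b4 : -(32 * k ^ 3) * g ≤ (4 * q * (2 * et' ^ 2 - 4 * et) + 4 * (2 * et * et')) * g := mul_le_mul_of_nonneg_right t1 g0
  have b5 : 32 * q * et' ^ 2 * f0 ^ 2 + 32 * q * et' ^ 2 * f1 ^ 2 = 32 * q * et' ^ 2 * g := by rw [hg]; ring
  have fin : k ^ 3 * (20 * g) ≤ k ^ 3 * (200 * D) := by
    rw [ce, hL] at hD
    clear_value g S0 S1
    clear hS0 hS1 hg hq het het' c0 c1 am ce t1 eb eb1 et0 et1 hL b0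
    generalize 16 * et * et' * f0 * S0 = Z0 at *
    generalize 16 * et * et' * f1 * S1 = Z1 at *
    nlinarith only [hD, cr0, cr1, b1, b2, b3, b4, b5, mul_nonneg (pow_nonneg hk.le 3) g0]
  have := le_of_mul_le_mul_left fin (by positivity : 0 < k ^ 3)
  linarith

theorem bern_max {A x0 : E2} {l k c : ℝ} {F : E2 → ℝ} (hF : ContDiff ℝ ∞ F) (h : ∀ᶠ y in 𝓝 x0, lap F y = -(l * F y))
    (hk : 0 < k) (q1 : k / 2 ≤ qd A x0) (q2 : qd A x0 ≤ 2 * k) (hl : 0 ≤ l) (hlk : l * k ≤ 1)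
    (hm : IsLocalMax (fun y => ((qd A y - k / 2) * (2 * k - qd A y)) ^ 2 * gsq F y + (100 * k ^ 3) * (F y - c) ^ 2) x0) :
    gsq F x0 ≤ 10 * (l * F x0 * (F x0 - c)) := by
  have cF : ContDiffAt ℝ 2 F x0 := hF.contDiffAt.of_le two_le_inf
  let et : ℝ → ℝ := fun t => (t - k / 2) * (2 * k - t)
  let et' : ℝ → ℝ := fun t => 5 / 2 * k - 2 * t
  have d1 : ∀ t, HasDerivAt et (et' t) t := by
    intro t
    have := ((hasDerivAt_id t).sub_const (k / 2)).mul ((hasDerivAt_id t).const_sub (2 * k))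
    exact this.congr_deriv (by simp [et']; ring)
  have d2 : ∀ t, HasDerivAt et' (-2) t := by
    intro t
    have := ((hasDerivAt_id t).const_mul 2).const_sub (5 / 2 * k)
    exact this.congr_deriv (by simp)
  have D1 : ∀ t, HasDerivAt (fun t => et t ^ 2) (2 * et t * et' t) t := by
    intro t
    have := (d1 t).pow 2
    exact this.congr_deriv (by simp)
  have D2 : ∀ t, HasDerivAt (fun t => 2 * et t * et' t) (2 * et' t ^ 2 - 4 * et t) t := by
    intro t
    have := ((d1 t).const_mul 2).mul (d2 t)
    exact this.congr_deriv (by ring)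
  have ca : ContDiffAt ℝ 2 (fun y => et (qd A y) ^ 2) x0 := by
    have : ContDiff ℝ 2 (qd A) := qd_smooth A
    exact (((this.sub contDiff_const).mul (contDiff_const.sub this)).pow 2).contDiffAt
  have la : lap (fun y => et (qd A y) ^ 2) x0 = 4 * qd A x0 * (2 * et' (qd A x0) ^ 2 - 4 * et (qd A x0)) + 4 * (2 * et (qd A x0) * et' (qd A x0)) := by
    have q0 : 0 < qd A x0 := by linarith
    refine lap_radial (G := fun t => et t ^ 2) (G' := fun t => 2 * et t * et' t) (G'' := fun t => 2 * et' t ^ 2 - 4 * et t) (fun t _ => D1 t) (fun t _ => D2 t) ?_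
    rintro rfl; simp [qd] at q0
  have pa : ∀ v, pd v (fun y => et (qd A y) ^ 2) x0 = (2 * et (qd A x0) * et' (qd A x0)) * (2 * ⟪x0 - A, v⟫) := by
    intro v
    rw [pd_comp (g := fun t => et t ^ 2) (g' := fun t => 2 * et t * et' t) v (D1 _) ((qd_smooth A (n := 2)).differentiable (by norm_num) x0), pd_qd]
  have cb := gsq_cda (hF.contDiffAt (x := x0))
  have cc : ContDiffAt ℝ 2 (fun y => F y - c) x0 := cF.sub contDiffAt_const
  have lc0 : ∀ v, pd v (fun y => F y - c) x0 = pd v F x0 := by intro v; simp [pd, fderiv_sub_const]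
  have lc1 : lap (fun y => F y - c) x0 = lap F x0 := by
    have : ∀ v, pd v (fun y => F y - c) = pd v F := by intro v; funext y; simp [pd, fderiv_sub_const]
    simp only [lap, this]
  have e : (fun y => ((qd A y - k / 2) * (2 * k - qd A y)) ^ 2 * gsq F y + (100 * k ^ 3) * (F y - c) ^ 2) =
      fun y => (et (qd A y) ^ 2 * gsq F y) + (100 * k ^ 3) * ((F y - c) * (F y - c)) := by funext y; simp only [et]; ring
  rw [e] at hm
  have cP : ContDiffAt ℝ 2 (fun y => (et (qd A y) ^ 2 * gsq F y) + (100 * k ^ 3) * ((F y - c) * (F y - c))) x0 :=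
    (ca.mul cb).add (contDiffAt_const.mul (cc.mul cc))
  have lp := lap_min cP.neg hm.neg
  have en : lap (fun y => -((et (qd A y) ^ 2 * gsq F y) + (100 * k ^ 3) * ((F y - c) * (F y - c)))) x0 =
      -lap (fun y => (et (qd A y) ^ 2 * gsq F y) + (100 * k ^ 3) * ((F y - c) * (F y - c))) x0 := by
    have := lap_const_mul (-1) cP
    simpa using this
  have lp' : lap (fun y => (et (qd A y) ^ 2 * gsq F y) + (100 * k ^ 3) * ((F y - c) * (F y - c))) x0 ≤ 0 := by
    have : 0 ≤ lap (fun y => -((et (qd A y) ^ 2 * gsq F y) + (100 * k ^ 3) * ((F y - c) * (F y - c)))) x0 := lp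
    rw [en] at this; linarith
  rw [lap_add (ca.mul cb) (contDiffAt_const.mul (cc.mul cc)), lap_mul ca cb, lap_const_mul _ (cc.mul cc), lap_mul cc cc, la, pa, pa, lc0, lc0, lc1,
    lap_gsq hF.contDiffAt h, pd_gsq hF.contDiffAt, pd_gsq hF.contDiffAt, h.self_of_nhds] at lp'
  have := bern_alg (k := k) (q := qd A x0) (X0 := ⟪x0 - A, ee0⟫) (X1 := ⟪x0 - A, ee1⟫) (f0 := pd ee0 F x0) (f1 := pd ee1 F x0)
    (a00 := pd ee0 (pd ee0 F) x0) (a10 := pd ee1 (pd ee0 F) x0) (a01 := pd ee0 (pd ee1 F) x0) (a11 := pd ee1 (pd ee1 F) x0)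
    (et := et (qd A x0)) (et' := et' (qd A x0)) (l := l) (L := 100 * k ^ 3) (D := l * F x0 * (F x0 - c)) hk
    (by rw [qd, normsq_e2, real_inner_comm, inner_ee0, real_inner_comm, inner_ee1]) q1 q2 rfl rfl hl hlk ?_ rfl
  · exact this
  · refine le_trans (le_of_eq ?_) lp'
    simp only [gsq]; ring
end

section
open MeasureTheory Filter Topology
open scoped ContDiff FourierTransform RealInnerProductSpace

def gw (D : Set E2) (u : E2 → ℝ) (x : E2) : ℝ := (fderivWithin ℝ u D x ee0) ^ 2 + (fderivWithin ℝ u D x ee1) ^ 2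

theorem ell_A {A B C : E2} (h : dt A B C ≠ 0) : 0 < ell A B C A := by
  rw [ell_eq h]
  have : bcc A B C A = 1 := by
    have := bcc_affine h 1 0 0 (by norm_num)
    simpa using this
  rw [this]; simpa using hgt_pos h

theorem ell_B (A B C : E2) : ell A B C B = 0 := by simp [ell]
theorem ell_C (A B C : E2) : ell A B C C = 0 := by rw [ell]; exact inner_nrm A B C

theorem gw_cont {A B C : E2} {l : ℝ} {u : E2 → ℝ} (h : dt A B C ≠ 0) (hn : ∀ p ∈ TriDom A B C, NiceAt A B C l u p) (v : E2) :
    ContinuousOn (fun x => fderivWithin ℝ u (TriDom A B C) x v) (TriDom A B C) :=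
  ((nice_smooth hn).continuousOn_fderivWithin (TriDom_ud h) (by simp)).clm_apply continuousOn_const

theorem grad_pt {A B C x1 : E2} {l k M M0 : ℝ} {u : E2 → ℝ} (h : dt A B C ≠ 0) (hn : ∀ p ∈ TriDom A B C, NiceAt A B C l u p)
    (hl : 0 < l) (hk : k = qd A x1) (hk0 : 0 < k) (hlk : l * k ≤ 1) (hx1 : x1 ∈ Tri A B C)
    (hM0 : ∀ x ∈ Tri A B C, |u x| ≤ M0) (hM : ∀ x ∈ Tri A B C, qd A x ≤ 2 * k → |u x - u A| ≤ M)
    (hell : ∀ x, qd A x ≤ 2 * k → 0 < ell A B C x) :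
    k * gw (TriDom A B C) u x1 ≤ 24 * M0 * M + 400 * M ^ 2 := by
  set D := TriDom A B C with hD
  set R : Set E2 := Tri A B C ∩ {x | k / 2 ≤ qd A x ∧ qd A x ≤ 2 * k} with hR
  have cq : Continuous (qd A) := (qd_smooth A (n := 0)).continuous
  have Rc : IsCompact R := (Tri_compact A B C).inter_right ((isClosed_le continuous_const cq).inter (isClosed_le cq continuous_const))
  have Rd : R ⊆ D := by
    rintro x ⟨hT, h1, h2⟩
    refine ⟨hT, ?_⟩
    rintro (rfl | rfl | rfl)
    · simp [qd] at h1; linarith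
    · have := hell _ h2; rw [ell_B] at this; exact lt_irrefl _ this
    · have := hell _ h2; rw [ell_C] at this; exact lt_irrefl _ this
  set P : E2 → ℝ := fun y => ((qd A y - k / 2) * (2 * k - qd A y)) ^ 2 * gw D u y + (100 * k ^ 3) * (u y - u A) ^ 2 with hP
  have uc : ContinuousOn u D := (nice_smooth hn).continuousOn
  have Pc : ContinuousOn P R := by
    have c1 : Continuous fun y => ((qd A y - k / 2) * (2 * k - qd A y)) ^ 2 := by fun_prop
    exact (c1.continuousOn.mul (((gw_cont h hn ee0).mono Rd).pow 2 |>.add (((gw_cont h hn ee1).mono Rd).pow 2))).add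
      (continuousOn_const.mul (((uc.mono Rd).sub continuousOn_const).pow 2))
  have x1R : x1 ∈ R := ⟨hx1, by show k / 2 ≤ qd A x1; linarith, by show qd A x1 ≤ 2 * k; linarith⟩
  obtain ⟨x0, hx0, hmax⟩ := Rc.exists_isMaxOn ⟨x1, x1R⟩ Pc
  have hle : P x1 ≤ P x0 := hmax x1R
  have P1 : P x1 = k ^ 4 / 4 * gw D u x1 + (100 * k ^ 3) * (u x1 - u A) ^ 2 := by
    simp only [hP, ← hk]; ring
  have m0 := hM x0 hx0.1 hx0.2.2
  have M00 : 0 ≤ M := (abs_nonneg _).trans m0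
  have M01 : 0 ≤ M0 := (abs_nonneg _).trans (hM0 x0 hx0.1)
  have sqM : (u x0 - u A) ^ 2 ≤ M ^ 2 := by rw [← sq_abs]; gcongr
  have key : P x0 ≤ 6 * k ^ 3 * M0 * M + 100 * k ^ 3 * M ^ 2 := by
    by_cases hin : k / 2 < qd A x0 ∧ qd A x0 < 2 * k
    · obtain ⟨r, F, hN, e⟩ := hn x0 (Rd hx0)
      have hr := hN.1
      have hF := hN.2.1
      set H : E2 → ℝ := fun y => ((qd A y - k / 2) * (2 * k - qd A y)) ^ 2 * gsq F y + (100 * k ^ 3) * (F y - u A) ^ 2 with hH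
      have eP : ∀ y ∈ Metric.ball x0 r, y ∈ Tri A B C → P y = H y ∧ gw D u y = gsq F y := by
        intro y hy hT
        have hyD : y ∈ D := ⟨hT, hN.2.2.2.1 y hy⟩
        have e1 := nice_fderivWithin h hF e hy hyD
        have e2 : gw D u y = gsq F y := by simp only [gw, hD, e1, gsq, pd]
        exact ⟨by simp only [hP, hH, e2, e y hy hT], e2⟩
      have e0 := eP x0 (Metric.mem_ball_self hr) hx0.1
      have hm : ∀ᶠ y in 𝓝 x0, y ∈ Tri A B C → H y ≤ H x0 := by
        filter_upwards [Metric.ball_mem_nhds x0 hr, cq.continuousAt.eventually (lt_mem_nhds hin.1), cq.continuousAt.eventually (gt_mem_nhds hin.2)] with y h1 h2 h3 hT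
        rw [← (eP y h1 hT).1, ← e0.1]
        exact hmax ⟨hT, h2.le, h3.le⟩
      have hloc := even_max hN (H := H) (fun n c hn' hs hp0 hFe y hy => by
        have g := gsq_sg (x := y) hF hn' (c := c) (by
          filter_upwards [Metric.isOpen_ball.mem_nhds hy] with z hz using hFe z hz)
        simp only [hH, g, qd_sg (hell x0 hx0.2.2) hn' hs hp0 y, hFe y hy]) hm
      have hb := bern_max (A := A) (c := u A) hF (by
          filter_upwards [Metric.ball_mem_nhds x0 hr] with y hy using hN.2.2.1 y hy) hk0 hin.1.le hin.2.le hl.le hlk hloc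
      rw [← e0.2, ← e x0 (Metric.mem_ball_self hr) hx0.1] at hb
      have hb2 : l * u x0 * (u x0 - u A) ≤ l * (M0 * M) := by
        rw [mul_assoc]
        refine mul_le_mul_of_nonneg_left ?_ hl.le
        refine (le_abs_self _).trans ?_
        rw [abs_mul]
        exact mul_le_mul (hM0 x0 hx0.1) m0 (abs_nonneg _) M01
      have et0 : 0 ≤ (qd A x0 - k / 2) * (2 * k - qd A x0) := mul_nonneg (by linarith [hin.1]) (by linarith [hin.2])
      have et1 : (qd A x0 - k / 2) * (2 * k - qd A x0) ≤ 3 / 4 * k ^ 2 := by nlinarith [sq_nonneg (qd A x0 - 5 / 4 * k)]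
      have g1 : gw D u x0 ≤ 10 * (l * (M0 * M)) := by linarith
      have s1 : ((qd A x0 - k / 2) * (2 * k - qd A x0)) ^ 2 * gw D u x0 ≤ (3 / 4 * k ^ 2) ^ 2 * (10 * (l * (M0 * M))) :=
        mul_le_mul (pow_le_pow_left₀ et0 et1 2) g1 (by unfold gw; positivity) (by positivity)
      have s2 : (3 / 4 * k ^ 2) ^ 2 * (10 * (l * (M0 * M))) = (45 / 8 * k ^ 3 * M0 * M) * (l * k) := by ring
      have s3 : (45 / 8 * k ^ 3 * M0 * M) * (l * k) ≤ (45 / 8 * k ^ 3 * M0 * M) * 1 := mul_le_mul_of_nonneg_left hlk (by positivity)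
      have s4 : (100 * k ^ 3) * (u x0 - u A) ^ 2 ≤ (100 * k ^ 3) * M ^ 2 := by gcongr
      have s5 : 0 ≤ k ^ 3 * M0 * M := by positivity
      show ((qd A x0 - k / 2) * (2 * k - qd A x0)) ^ 2 * gw D u x0 + (100 * k ^ 3) * (u x0 - u A) ^ 2 ≤ _
      linarith
    · have z : (qd A x0 - k / 2) * (2 * k - qd A x0) = 0 := by
        have h1 := hx0.2.1
        have h2 := hx0.2.2
        by_cases h3 : k / 2 < qd A x0
        · have : qd A x0 = 2 * k := le_antisymm h2 (not_lt.1 fun h4 => hin ⟨h3, h4⟩)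
          rw [this]; ring
        · have : qd A x0 = k / 2 := le_antisymm (not_lt.1 h3) h1
          rw [this]; ring
      have s4 : (100 * k ^ 3) * (u x0 - u A) ^ 2 ≤ (100 * k ^ 3) * M ^ 2 := by gcongr
      have s5 : 0 ≤ k ^ 3 * M0 * M := by positivity
      show ((qd A x0 - k / 2) * (2 * k - qd A x0)) ^ 2 * gw D u x0 + (100 * k ^ 3) * (u x0 - u A) ^ 2 ≤ _
      rw [z]; linarith
  have s6 : 0 ≤ (100 * k ^ 3) * (u x1 - u A) ^ 2 := by positivity
  have fin : k ^ 3 * (k * gw D u x1) ≤ k ^ 3 * (24 * M0 * M + 400 * M ^ 2) := by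
    rw [P1] at hle
    linarith
  exact le_of_mul_le_mul_left fin (by positivity)

theorem grad_est {A B C : E2} {l : ℝ} {u : E2 → ℝ} (h : dt A B C ≠ 0) (hn : ∀ p ∈ TriDom A B C, NiceAt A B C l u p)
    (hl : 0 < l) (hc : ContinuousOn u (Tri A B C)) {δ : ℝ} (hδ : 0 < δ) :
    ∃ ρ > 0, ∀ x ∈ Tri A B C, x ≠ A → ‖x - A‖ < ρ → qd A x * gw (TriDom A B C) u x ≤ δ := by
  obtain ⟨M0, hM0⟩ := (Tri_compact A B C).exists_bound_of_continuousOn hc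
  have hAT : A ∈ Tri A B C := subset_convexHull ℝ _ (by simp)
  have M00 : 0 ≤ M0 := (norm_nonneg _).trans (hM0 A hAT)
  set M := min 1 (δ / (24 * M0 + 400)) with hM
  have Mp : 0 < M := lt_min one_pos (by positivity)
  have hMδ : 24 * M0 * M + 400 * M ^ 2 ≤ δ := by
    have h1 : M ≤ 1 := min_le_left _ _
    have h2 : M * (24 * M0 + 400) ≤ δ := by
      rw [← le_div_iff₀ (by positivity)]; exact min_le_right _ _
    nlinarith
  obtain ⟨ρ0, hρ0, hc0⟩ := Metric.continuousOn_iff.1 hc A hAT M Mp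
  obtain ⟨ρ1, hρ1, hc1⟩ := Metric.eventually_nhds_iff_ball.1 ((continuous_ell A B C).continuousAt.eventually (lt_mem_nhds (ell_A h)))
  set ρ := min (min (ρ0 / 2) (ρ1 / 2)) (min 1 (1 / l)) with hρ
  have ρp : 0 < ρ := by positivity
  have r0 : ρ ≤ ρ0 / 2 := (min_le_left _ _).trans (min_le_left _ _)
  have r1 : ρ ≤ ρ1 / 2 := (min_le_left _ _).trans (min_le_right _ _)
  have r2 : ρ ≤ 1 := (min_le_right _ _).trans (min_le_left _ _)
  have r3 : ρ ≤ 1 / l := (min_le_right _ _).trans (min_le_right _ _)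
  refine ⟨ρ, ρp, fun x hx hxA hxρ => ?_⟩
  have q0 : 0 < qd A x := by unfold qd; have := sub_ne_zero.2 hxA; positivity
  have nn := norm_nonneg (x - A)
  have near : ∀ y, qd A y ≤ 2 * qd A x → ‖y - A‖ < 2 * ρ := by
    intro y hy
    refine lt_of_pow_lt_pow_left₀ 2 (by positivity) ?_
    unfold qd at hy
    nlinarith
  refine (grad_pt (M := M) (M0 := M0) h hn hl rfl q0 ?_ hx hM0 ?_ ?_).trans hMδ
  · have : qd A x ≤ 1 / l := by
      unfold qd
      nlinarith
    rw [le_div_iff₀ hl] at this; linarith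
  · intro y hy hq
    have := hc0 y hy (by rw [dist_eq_norm]; linarith [near y hq])
    rw [Real.dist_eq] at this; exact this.le
  · intro y hq
    exact hc1 y (by rw [mem_ball_iff_norm]; linarith [near y hq])
end

section
open MeasureTheory Filter Topology
open scoped ContDiff FourierTransform RealInnerProductSpace

theorem PL_comp {A B C : E2} {μ s s1 : ℝ} {g ψ : E2 → ℝ} (h : dt A B C ≠ 0) (hs : 0 < s) (hs1 : s1 < 1)
    (gc : ContinuousOn g (TriDom A B C)) (g2 : ∀ x ∈ interior (Tri A B C), ContDiffAt ℝ 2 g x)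
    (gl : ∀ x ∈ interior (Tri A B C), lap g x = -(μ * g x))
    (gs : ∀ x ∈ TriDom A B C, x ∉ interior (Tri A B C) → 0 < ell A B C x → g x ≤ 0)
    (p0 : ∀ x ∈ Cone A B C s s1, 0 < ψ x) (p2 : ∀ x ∈ Cone A B C s s1, ContDiffAt ℝ 2 ψ x)
    (pl : ∀ x ∈ Cone A B C s s1, lap ψ x < -(μ * ψ x))
    (b0 : ∀ x ∈ Cone A B C s s1, 1 - bcc A B C x = s → g x ≤ ψ x)
    (b1 : ∀ x ∈ Cone A B C s s1, 1 - bcc A B C x = s1 → g x ≤ ψ x)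
    {z : E2} (hz : z ∈ Cone A B C s s1) : g z ≤ ψ z := by
  by_contra! hlt
  have hdom : ∀ y ∈ Cone A B C s s1, y ∈ TriDom A B C := fun y hy => Cone_dom h hs hs1 hy
  have Hc : ContinuousOn (fun y => g y / ψ y) (Cone A B C s s1) :=
    (gc.mono hdom).div (fun y hy => (p2 y hy).continuousAt.continuousWithinAt) fun y hy => (p0 y hy).ne'
  obtain ⟨x0, hx0, hm, hc⟩ := Cone_max h Hc hz
  set k := g x0 / ψ x0 with hk
  have k1 : 1 < k := lt_of_lt_of_le ((one_lt_div (p0 z hz)).2 hlt) hm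
  have e0 : g x0 = k * ψ x0 := by rw [hk]; field_simp [(p0 x0 hx0).ne']
  have px := p0 x0 hx0
  have gt : ψ x0 < g x0 := by rw [e0]; nlinarith
  rcases hc with (hb | hb) | hev
  · exact absurd (b0 x0 hx0 hb) (not_le.2 gt)
  · exact absurd (b1 x0 hx0 hb) (not_le.2 gt)
  have hin : x0 ∈ interior (Tri A B C) := by
    by_contra hn
    have := gs x0 (hdom x0 hx0) hn (ell_of_bcc h (by linarith [hx0.2.2]))
    linarith
  have lm : IsLocalMin (fun y => k * ψ y - g y) x0 := by
    filter_upwards [hev, isOpen_interior.mem_nhds hin] with y hy hyi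
    obtain ⟨hyc, hle⟩ := hy (interior_subset hyi)
    have := (div_le_iff₀ (p0 y hyc)).1 hle
    simp only [e0]; linarith
  have cψ : ContDiffAt ℝ 2 (fun y => k * ψ y) x0 := contDiffAt_const.mul (p2 x0 hx0)
  have := lap_min (cψ.sub (g2 x0 hin)) lm
  rw [show (fun y => k * ψ y - g y) = fun y => (fun y => k * ψ y) y - g y from rfl, lap_sub cψ (g2 x0 hin),
    lap_const_mul _ (p2 x0 hx0), gl x0 hin, e0] at this
  nlinarith [pl x0 hx0]

theorem lap_X {A ξ x : E2} {G G' G'' : ℝ → ℝ} (hg : ∀ t > 0, HasDerivAt G (G' t) t) (hg' : ∀ t > 0, HasDerivAt G' (G'' t) t)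
    (hG : ∀ t > 0, ContDiffAt ℝ 2 G t) (hx : x ≠ A) :
    lap (fun y => ⟪y - A, ξ⟫ * G (qd A y)) x = ⟪x - A, ξ⟫ * (4 * qd A x * G'' (qd A x) + 8 * G' (qd A x)) := by
  have q0 : 0 < qd A x := by unfold qd; have := sub_ne_zero.2 hx; positivity
  have cX : ContDiffAt ℝ 2 (fun y : E2 => ⟪y - A, ξ⟫) x := ((contDiff_id.sub contDiff_const).inner ℝ contDiff_const).contDiffAt
  rw [lap_mul cX (cd_radial hx hG), lap_inner, lap_radial hg hg' hx]
  have e : ∀ v, pd v (fun y => G (qd A y)) x = G' (qd A x) * pd v (qd A) x := by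
    intro v
    have d := (qd_smooth A (n := 1)).differentiable (by norm_num) x
    have : HasFDerivAt (fun y => G (qd A y)) (G' (qd A x) • fderiv ℝ (qd A) x) x := (hg _ q0).comp_hasFDerivAt x d.hasFDerivAt
    rw [pd, this.fderiv]; simp [pd]
  rw [e, e, pd_qd, pd_qd, pd_inner, pd_inner]
  have : ⟪x - A, ξ⟫ = ⟪x - A, ee0⟫ * ⟪ee0, ξ⟫ + ⟪x - A, ee1⟫ * ⟪ee1, ξ⟫ := by
    rw [inner_e2, real_inner_comm ee0 (x - A), inner_ee0, real_inner_comm ee1 (x - A), inner_ee1, inner_ee0, inner_ee1]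
  rw [this]; ring

theorem XG_eq {A B C : E2} (h : dt A B C ≠ 0) (x : E2) : ⟪x - A, -nrm A B C⟫ = hgt A B C * (1 - bcc A B C x) := by
  have e1 := ell_eq h x
  have e2 := ell_eq h A
  have : bcc A B C A = 1 := by
    have := bcc_affine h 1 0 0 (by norm_num)
    simpa using this
  rw [this] at e2
  have : ⟪x - A, -nrm A B C⟫ = ell A B C A - ell A B C x := by
    unfold ell; rw [inner_neg_right, ← inner_neg_left, ← inner_sub_left]; congr 1; abel
  rw [this, e1, e2]; ring

set_option maxHeartbeats 1000000 in
theorem PL {A B C : E2} {μ : ℝ} {g : E2 → ℝ} (h : dt A B C ≠ 0) (hμ : 0 < μ)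
    (gc : ContinuousOn g (TriDom A B C)) (g2 : ∀ x ∈ interior (Tri A B C), ContDiffAt ℝ 2 g x)
    (gl : ∀ x ∈ interior (Tri A B C), lap g x = -(μ * g x))
    (gs : ∀ x ∈ TriDom A B C, x ∉ interior (Tri A B C) → 0 < ell A B C x → g x ≤ 0)
    (hsing : ∀ δ > 0, ∃ ρ > 0, ∀ x ∈ TriDom A B C, ‖x - A‖ < ρ → g x * ‖x - A‖ ≤ δ) {ε : ℝ} (hε : 0 < ε) :
    ∃ ρ > 0, ∀ x ∈ TriDom A B C, ‖x - A‖ < ρ → g x ≤ ε := by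
  have H0 := hgt_pos h
  have nN := norm_nrm h
  have hPh := fun x hx => Ph_norm (x := x) h hx
  set D := ‖B - A‖ + ‖C - B‖ with hD
  have D0 : 0 < D := by have : 0 < ‖C - B‖ := norm_pos_iff.2 (side_ne h); positivity
  have hXe := XG_eq h
  set H := hgt A B C with hH
  set X : E2 → ℝ := fun y => ⟪y - A, -nrm A B C⟫ with hX
  have hXr : ∀ y, X y ≤ ‖y - A‖ := by
    intro y
    have := real_inner_le_norm (y - A) (-nrm A B C)
    rw [norm_neg, nN, mul_one] at this; exact this
  have q0 : ∀ y, y ≠ A → 0 < qd A y := by intro y hy; unfold qd; have := sub_ne_zero.2 hy; positivity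
  obtain ⟨η, η0, hη⟩ : ∃ η > 0, ∀ q, 0 < q → q ≤ η → μ * q ≤ 1 ∧ Real.log q ≤ 0 ∧ -1 ≤ μ * (q * Real.log q) := by
    have c1 : Continuous fun q : ℝ => μ * (q * Real.log q) := Real.continuous_mul_log.const_mul μ
    have : ∀ᶠ q in 𝓝 (0:ℝ), -1 < μ * (q * Real.log q) := c1.continuousAt.eventually (lt_mem_nhds (by simp))
    obtain ⟨d, d0, hd⟩ := Metric.eventually_nhds_iff.1 this
    refine ⟨min (d / 2) (min 1 (1 / μ)), by positivity, fun q hq hle => ⟨?_, ?_, ?_⟩⟩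
    · have := hle.trans ((min_le_right _ _).trans (min_le_right _ _))
      rw [le_div_iff₀ hμ] at this; linarith
    · exact Real.log_nonpos hq.le (hle.trans ((min_le_right _ _).trans (min_le_left _ _)))
    · refine (hd ?_).le
      have := hle.trans (min_le_left _ _)
      rw [Real.dist_eq, sub_zero, abs_of_pos hq]; linarith
  set s1 := min (1 / 2) (Real.sqrt η / D) with hs1
  have s10 : 0 < s1 := by positivity
  have s11 : s1 < 1 := lt_of_le_of_lt (min_le_left _ _) (by norm_num)
  have s1D : (D * s1) ^ 2 ≤ η := by
    have : D * s1 ≤ Real.sqrt η := by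
      have : s1 ≤ Real.sqrt η / D := min_le_right _ _
      rw [le_div_iff₀ D0] at this; linarith
    calc (D * s1) ^ 2 ≤ (Real.sqrt η) ^ 2 := by gcongr
      _ = η := Real.sq_sqrt η0.le
  obtain ⟨K, hK0, hK⟩ : ∃ K, 0 ≤ K ∧ ∀ y ∈ Cone A B C s1 s1, g y ≤ K := by
    obtain ⟨K, hK⟩ := (Cone_compact h s1 s1).exists_bound_of_continuousOn (gc.mono fun y hy => Cone_dom h s10 s11 hy)
    exact ⟨|K|, abs_nonneg _, fun y hy => (le_abs_self _).trans ((hK y hy).trans (le_abs_self _))⟩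
  set M := (K + 1) * 2 / (H * s1) with hM
  have M0 : 0 < M := by positivity
  have hMe : H * s1 * (M / 2) = K + 1 := by rw [hM]; field_simp
  clear_value M s1
  have main : ∀ x ∈ TriDom A B C, 1 - bcc A B C x ≤ s1 → g x ≤ X x * M := by
    intro x hx hxs
    have xA := dom_ne hx
    have hbx : 0 < 1 - bcc A B C x := by
      have := hPh x hx.1
      by_contra! hle
      have : ‖x - A‖ ≤ 0 := this.trans (mul_nonpos_of_nonneg_of_nonpos D0.le hle)
      exact xA (sub_eq_zero.1 (norm_le_zero_iff.1 this))
    have Xx : 0 < X x := by simp only [hX]; rw [hXe]; positivity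
    have hqx : 0 < qd A x ∧ qd A x ≤ η := by
      refine ⟨q0 x xA, le_trans ?_ s1D⟩
      have : ‖x - A‖ ≤ D * s1 := (hPh x hx.1).trans (by gcongr)
      unfold qd; gcongr
    set N := (qd A x)⁻¹ - μ * Real.log (qd A x) with hN
    have N0 : 0 < N := by
      have := (hη _ hqx.1 hqx.2).2.1
      have : 0 ≤ μ * -Real.log (qd A x) := by apply mul_nonneg hμ.le; linarith
      have : 0 < (qd A x)⁻¹ := inv_pos.2 hqx.1
      rw [hN]; linarith
    refine le_of_forall_pos_le_add fun e he => ?_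
    set δ := e / (X x * N) with hδ
    have δ0 : 0 < δ := by positivity
    have hδe : X x * (δ * N) = e := by rw [hδ]; field_simp
    clear_value δ
    obtain ⟨ρ, ρ0, hρ⟩ := hsing (δ * (H / D)) (by positivity)
    set s := min (1 - bcc A B C x) (ρ / (2 * D)) with hsd
    have s0 : 0 < s := by positivity
    have sρ : D * s < ρ := by
      have : s ≤ ρ / (2 * D) := min_le_right _ _
      rw [le_div_iff₀ (by positivity)] at this; nlinarith
    have sx : s ≤ 1 - bcc A B C x := min_le_left _ _
    clear_value s
    set G : ℝ → ℝ := fun q => M * (1 - μ * q / 4) + δ * (q⁻¹ - μ * Real.log q) with hG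
    have g1 : ∀ t > 0, HasDerivAt G (M * (-(μ / 4)) + δ * (-(t ^ 2)⁻¹ - μ * t⁻¹)) t := by
      intro t ht
      have := (((((hasDerivAt_id t).const_mul μ).div_const 4).const_sub 1).const_mul M).add
        (((hasDerivAt_inv ht.ne').sub ((Real.hasDerivAt_log ht.ne').const_mul μ)).const_mul δ)
      refine this.congr_deriv ?_
      ring
    have g1' : ∀ t > 0, HasDerivAt (fun t : ℝ => M * (-(μ / 4)) + δ * (-(t ^ 2)⁻¹ - μ * t⁻¹)) (δ * (2 * (t ^ 3)⁻¹ + μ * (t ^ 2)⁻¹)) t := by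
      intro t ht
      have := (((((hasDerivAt_pow 2 t).inv (by positivity)).neg).sub ((hasDerivAt_inv ht.ne').const_mul μ)).const_mul δ).const_add (M * (-(μ / 4)))
      refine this.congr_deriv ?_
      field_simp
      ring
    have gcd : ∀ t > 0, ContDiffAt ℝ 2 G t := by
      intro t ht
      have l1 : ContDiffAt ℝ 2 Real.log t := Real.contDiffAt_log.2 ht.ne'
      have l2 : ContDiffAt ℝ 2 (fun q : ℝ => q⁻¹) t := contDiffAt_inv ℝ ht.ne'
      exact (contDiffAt_const.mul (contDiffAt_const.sub ((contDiffAt_const.mul contDiffAt_id).div_const 4))).add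
        (contDiffAt_const.mul (l2.sub (contDiffAt_const.mul l1)))
    have hdom : ∀ y ∈ Cone A B C s s1, y ∈ TriDom A B C := fun y hy => Cone_dom h s0 s11 hy
    have GA : ∀ y ∈ Cone A B C s s1, y ≠ A := fun y hy => dom_ne (hdom y hy)
    have qb : ∀ y ∈ Cone A B C s s1, 0 < qd A y ∧ qd A y ≤ η := by
      intro y hy
      refine ⟨q0 y (GA y hy), le_trans ?_ s1D⟩
      have : ‖y - A‖ ≤ D * s1 := (hPh y hy.1).trans (by gcongr; exact hy.2.2)
      unfold qd; gcongr
    have Xp : ∀ y ∈ Cone A B C s s1, 0 < X y := by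
      intro y hy
      simp only [hX]; rw [hXe]
      have : 0 < 1 - bcc A B C y := lt_of_lt_of_le s0 hy.2.1
      positivity
    have Gl : ∀ q, 0 < q → q ≤ η → M / 2 + δ * q⁻¹ ≤ G q := by
      intro q h1 h2
      obtain ⟨a1, a2, a3⟩ := hη q h1 h2
      have : 0 ≤ δ * (μ * -Real.log q) := by
        have : 0 ≤ -Real.log q := by linarith
        positivity
      simp only [hG]
      nlinarith
    have := PL_comp (μ := μ) (s := s) (s1 := s1) (ψ := fun y => X y * G (qd A y)) h s0 s11 gc g2 gl gs ?_ ?_ ?_ ?_ ?_ (z := x) ⟨hx.1, sx, hxs⟩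
    · refine this.trans ?_
      simp only [hG]
      rw [mul_add, hδe]
      have : M * (1 - μ * qd A x / 4) ≤ M := by
        have : 0 ≤ μ * qd A x := mul_nonneg hμ.le hqx.1.le
        nlinarith
      have := mul_le_mul_of_nonneg_left this Xx.le
      linarith
    · intro y hy
      obtain ⟨a, b⟩ := qb y hy
      have := Gl _ a b
      have : 0 < G (qd A y) := lt_of_lt_of_le (by positivity) this
      exact mul_pos (Xp y hy) this
    · intro y hy
      have cX : ContDiffAt ℝ 2 X y := ((contDiff_id.sub contDiff_const).inner ℝ contDiff_const).contDiffAt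
      exact cX.mul (cd_radial (GA y hy) gcd)
    · intro y hy
      obtain ⟨a, b⟩ := qb y hy
      obtain ⟨a1, a2, a3⟩ := hη _ a b
      rw [lap_X g1 g1' gcd (GA y hy)]
      have xy := Xp y hy
      change X y * _ < _
      set q := qd A y with hq
      rw [show -(μ * (X y * G q)) = X y * (-(μ * G q)) by ring]
      refine mul_lt_mul_of_pos_left ?_ xy
      simp only [hG]
      have e : 4 * q * (δ * (2 * (q ^ 3)⁻¹ + μ * (q ^ 2)⁻¹)) + 8 * (M * (-(μ / 4)) + δ * (-(q ^ 2)⁻¹ - μ * q⁻¹)) = -2 * M * μ - 4 * μ * δ * q⁻¹ := by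
        field_simp; ring
      rw [e]
      have e2 : -1 * q⁻¹ ≤ μ * Real.log q := by
        have := mul_le_mul_of_nonneg_right a3 (inv_pos.2 a).le
        calc _ ≤ _ := this
          _ = μ * Real.log q := by field_simp
      have qi : 0 < q⁻¹ := inv_pos.2 a
      have m1 : 0 < μ * M := by positivity
      have m2 : 0 < μ * δ * q⁻¹ := by positivity
      have m3 : 0 < μ * M * (μ * q) := by positivity
      have m4 := mul_le_mul_of_nonneg_left e2 (by positivity : 0 ≤ μ * δ)
      nlinarith only [m1, m2, m3, m4]
    · intro y hy hb
      obtain ⟨a, b⟩ := qb y hy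
      have h1 := Gl _ a b
      have r0 : 0 < ‖y - A‖ := norm_pos_iff.2 (sub_ne_zero.2 (GA y hy))
      have hr := hPh y hy.1
      rw [hb] at hr
      have h2 := hρ y (hdom y hy) (lt_of_le_of_lt hr sρ)
      have h3 : (H / D) * ‖y - A‖ ≤ X y := by
        simp only [hX]; rw [hXe, hb]
        calc (H / D) * ‖y - A‖ ≤ (H / D) * (D * s) := by gcongr
          _ = H * s := by field_simp
      have h4 : g y ≤ δ * (H / D) * ‖y - A‖⁻¹ := by
        rw [← div_eq_mul_inv, le_div_iff₀ r0]; exact h2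
      refine h4.trans ?_
      calc δ * (H / D) * ‖y - A‖⁻¹ = (H / D * ‖y - A‖) * (δ * (qd A y)⁻¹) := by unfold qd; field_simp
        _ ≤ X y * G (qd A y) := by
          apply mul_le_mul h3 (le_trans (by linarith) h1) (by positivity) (Xp y hy).le
    · intro y hy hb
      obtain ⟨a, b⟩ := qb y hy
      have h1 := Gl _ a b
      have h2 := hK y ⟨hy.1, hb.ge, hb.le⟩
      have h3 : X y = H * s1 := by simp only [hX]; rw [hXe, hb]
      have h4 : 0 < δ * (qd A y)⁻¹ := by positivity
      have h5 : H * s1 * (M / 2) ≤ H * s1 * G (qd A y) := mul_le_mul_of_nonneg_left (by linarith) (by positivity)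
      change _ ≤ X y * _
      rw [h3]; linarith
  refine ⟨min (H * s1) (ε / M), by positivity, fun x hx hr => ?_⟩
  have h1 : ‖x - A‖ < H * s1 := lt_of_lt_of_le hr (min_le_left _ _)
  have h2 : ‖x - A‖ < ε / M := lt_of_lt_of_le hr (min_le_right _ _)
  rw [lt_div_iff₀ M0] at h2
  refine (main x hx ?_).trans ?_
  · have := (hXr x).trans h1.le
    simp only [hX] at this
    rw [hXe] at this
    exact le_of_mul_le_mul_left this H0
  · have := mul_le_mul_of_nonneg_right (hXr x) M0.le
    linarith
end

section
open MeasureTheory Filter Topology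
open scoped ContDiff FourierTransform RealInnerProductSpace

/-- derivative of `u` along the rotation field about `A` -/
def ww (D : Set E2) (A : E2) (u : E2 → ℝ) (x : E2) : ℝ := fderivWithin ℝ u D x (rot (x - A))

theorem ww_eq (D : Set E2) (A : E2) (u : E2 → ℝ) (x : E2) :
    ww D A u x = ⟪x - A, -ee1⟫ * fderivWithin ℝ u D x ee0 + ⟪x - A, ee0⟫ * fderivWithin ℝ u D x ee1 := by
  rw [ww, fderiv_decomp, inner_neg_right, real_inner_comm ee1 (x - A), inner_ee1, real_inner_comm ee0 (x - A), inner_ee0]; simp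

theorem in_cont (A ξ : E2) : Continuous fun x : E2 => ⟪x - A, ξ⟫ := by fun_prop

theorem ww_cont {A B C : E2} {l : ℝ} {u : E2 → ℝ} (h : dt A B C ≠ 0) (hn : ∀ p ∈ TriDom A B C, NiceAt A B C l u p) :
    ContinuousOn (ww (TriDom A B C) A u) (TriDom A B C) := by
  have e : ww (TriDom A B C) A u = _ := funext (ww_eq (TriDom A B C) A u)
  rw [e]
  exact ((in_cont A _).continuousOn.mul (gw_cont h hn ee0)).add ((in_cont A _).continuousOn.mul (gw_cont h hn ee1))

theorem ww_sq (D : Set E2) (A : E2) (u : E2 → ℝ) (x : E2) : (ww D A u x) ^ 2 ≤ ‖x - A‖ ^ 2 * gw D u x := by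
  have e : ww D A u x = (rot (x - A)) 0 * fderivWithin ℝ u D x ee0 + (rot (x - A)) 1 * fderivWithin ℝ u D x ee1 := fderiv_decomp _ _
  rw [e, gw, ← norm_rot (x - A), normsq_e2]
  nlinarith [sq_nonneg ((rot (x - A)) 0 * fderivWithin ℝ u D x ee1 - (rot (x - A)) 1 * fderivWithin ℝ u D x ee0)]

theorem ww_int {A B C x : E2} {l : ℝ} {u : E2 → ℝ} (h : dt A B C ≠ 0) (hn : ∀ p ∈ TriDom A B C, NiceAt A B C l u p)
    (hx : x ∈ interior (Tri A B C)) : ContDiffAt ℝ ∞ (ww (TriDom A B C) A u) x ∧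
      lap (ww (TriDom A B C) A u) x = -(l * ww (TriDom A B C) A u x) := by
  set W : E2 → ℝ := fun y => ⟪y - A, -ee1⟫ * pd ee0 u y + ⟪y - A, ee0⟫ * pd ee1 u y with hW
  have e : ∀ y ∈ interior (Tri A B C), ww (TriDom A B C) A u y = W y := by
    intro y hy
    rw [ww_eq, fderivWithin_of_mem_nhds (mem_of_superset (isOpen_interior.mem_nhds hy) (interior_sub_TriDom h))]; rfl
  have ev : ww (TriDom A B C) A u =ᶠ[𝓝 x] W := by
    filter_upwards [isOpen_interior.mem_nhds hx] with y hy using e y hy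
  have cu : ContDiffAt ℝ ∞ u x := (hn x (interior_sub_TriDom h hx)).cda hx
  have c0 := pd_cda cu ee0
  have c1 := pd_cda cu ee1
  have cl : ∀ ξ, ContDiffAt ℝ ∞ (fun y : E2 => ⟪y - A, ξ⟫) x := fun ξ => ((contDiff_id.sub contDiff_const).inner ℝ contDiff_const).contDiffAt
  have cl2 : ∀ ξ, ContDiffAt ℝ 2 (fun y : E2 => ⟪y - A, ξ⟫) x := fun ξ => (cl ξ).of_le two_le_inf
  have hlap : ∀ᶠ y in 𝓝 x, lap u y = -(l * u y) := by
    filter_upwards [isOpen_interior.mem_nhds hx] with y hy using nice_pde h hn hy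
  refine ⟨(((cl _).mul c0).add ((cl _).mul c1)).congr_of_eventuallyEq ev, ?_⟩
  rw [lap_congr ev, e x hx, hW]
  have a0 := c0.of_le two_le_inf
  have a1 := c1.of_le two_le_inf
  rw [lap_add (a := fun y => ⟪y - A, -ee1⟫ * pd ee0 u y) (b := fun y => ⟪y - A, ee0⟫ * pd ee1 u y) ((cl2 _).mul a0) ((cl2 _).mul a1),
    lap_mul (cl2 _) a0, lap_mul (cl2 _) a1, lap_inner, lap_inner, lap_pd cu hlap, lap_pd cu hlap, pd_inner, pd_inner, pd_inner, pd_inner,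
    pd_comm (cu.of_le two_le_inf) ee1 ee0]
  simp only [inner_ee0, inner_ee1]
  simp [ee0, ee1]
  ring

theorem rot_in (a b : E2) : ⟪rot a, b⟫ = cr a b := by rw [inner_e2]; simp [cr]; ring

theorem ww_CA {A B C x : E2} {μ : ℝ} {u : E2 → ℝ} (h : dt A B C ≠ 0) (hu : IsNeumannEigenfun A B C μ u) (hx : x ∈ TriDom A B C)
    (h0 : ell B C A x = 0) : ww (TriDom A B C) A u x = 0 := by
  have h2 : dt B C A ≠ 0 := by rwa [dt_cyc]
  have hb : cr (A - C) (x - C) = 0 := by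
    have := (bcc_zero_iff h2 x).2 h0
    rw [bcc, div_eq_zero_iff] at this; exact this.resolve_right h2
  obtain ⟨s, hs⟩ := nrm_perp h2 (w := rot (x - A)) (by
    rw [rot_in]; simp only [cr, PiLp.sub_apply] at hb ⊢; linarith)
  rw [ww, hs, map_smul, neumann_n h hu (c := C) (Or.inr (Or.inl ⟨rfl, rfl⟩)) hx h0, smul_zero]

theorem ww_AB {A B C x : E2} {μ : ℝ} {u : E2 → ℝ} (h : dt A B C ≠ 0) (hu : IsNeumannEigenfun A B C μ u) (hx : x ∈ TriDom A B C)
    (h0 : ell C A B x = 0) : ww (TriDom A B C) A u x = 0 := by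
  have h2 : dt C A B ≠ 0 := by rwa [dt_cyc, dt_cyc]
  have hb : cr (B - A) (x - A) = 0 := by
    have := (bcc_zero_iff h2 x).2 h0
    rw [bcc, div_eq_zero_iff] at this; exact this.resolve_right h2
  obtain ⟨s, hs⟩ := nrm_perp h2 (w := rot (x - A)) (by
    rw [rot_in]; simp only [cr, PiLp.sub_apply] at hb ⊢; linarith)
  rw [ww, hs, map_smul, neumann_n h hu (c := A) (Or.inr (Or.inr ⟨rfl, rfl⟩)) hx h0, smul_zero]

theorem ww_BC {A B C x : E2} {μ : ℝ} {u : E2 → ℝ} (h : dt A B C ≠ 0) (hu : IsNeumannEigenfun A B C μ u) (hx : x ∈ TriDom A B C)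
    (h0 : ell A B C x = 0) (hw : ww (TriDom A B C) A u x = 0) : fderivWithin ℝ u (TriDom A B C) x = 0 := by
  have hb : cr (C - B) (x - B) = 0 := by
    have := (bcc_zero_iff h x).2 h0
    rw [bcc, div_eq_zero_iff] at this; exact this.resolve_right h
  have h1 := neumann_n h hu (c := B) (Or.inl ⟨rfl, rfl⟩) hx h0
  have hk : (SignType.sign (dt A B C) / ‖C - B‖ : ℝ) ≠ 0 := by
    intro e
    have := norm_nrm h
    rw [nrm, e, zero_smul, norm_zero] at this; norm_num at this
  rw [nrm, map_smul, smul_eq_mul] at h1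
  have h1 := (mul_eq_zero.1 h1).resolve_left hk
  rw [ww] at hw
  set L := fderivWithin ℝ u (TriDom A B C) x with hL
  rw [fderiv_decomp] at h1 hw
  have hdt : dt A B C = -cr (C - B) (x - A) := by
    simp only [dt, cr, PiLp.sub_apply] at hb ⊢; linarith
  rw [hdt, neg_ne_zero] at h
  simp only [cr, rot_zero_apply, rot_one_apply] at h h1 hw
  set c0 := (C - B) 0
  set c1 := (C - B) 1
  set a0 := (x - A) 0
  set a1 := (x - A) 1
  have e0 : (c0 * a1 - c1 * a0) * L ee0 = 0 := by linear_combination a0 * h1 - c0 * hw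
  have e1 : (c0 * a1 - c1 * a0) * L ee1 = 0 := by linear_combination a1 * h1 - c1 * hw
  have e0 := (mul_eq_zero.1 e0).resolve_left h
  have e1 := (mul_eq_zero.1 e1).resolve_left h
  ext v
  rw [fderiv_decomp, e0, e1]; simp

structure WP (A B C : E2) (μ : ℝ) (w : E2 → ℝ) : Prop where
  cont : ContinuousOn w (TriDom A B C)
  smooth : ∀ x ∈ interior (Tri A B C), ContDiffAt ℝ ∞ w x
  lap_eq : ∀ x ∈ interior (Tri A B C), lap w x = -(μ * w x)
  nonneg : ∀ x ∈ TriDom A B C, x ∉ interior (Tri A B C) → 0 ≤ w x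
  pos : ∀ x ∈ TriDom A B C, ell A B C x = 0 → 0 < w x
  growth : ∀ δ > 0, ∃ ρ > 0, ∀ x ∈ TriDom A B C, (‖x - A‖ < ρ → |w x| * ‖x - A‖ ≤ δ) ∧
    (‖x - B‖ < ρ → |w x| * ‖x - B‖ ≤ δ) ∧ (‖x - C‖ < ρ → |w x| * ‖x - C‖ ≤ δ)

theorem PL_neg {A B C : E2} {μ : ℝ} {w : E2 → ℝ} (h : dt A B C ≠ 0) (hμ : 0 < μ)
    (gc : ContinuousOn w (TriDom A B C)) (g2 : ∀ x ∈ interior (Tri A B C), ContDiffAt ℝ ∞ w x)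
    (gl : ∀ x ∈ interior (Tri A B C), lap w x = -(μ * w x))
    (gs : ∀ x ∈ TriDom A B C, x ∉ interior (Tri A B C) → 0 ≤ w x)
    (hsing : ∀ δ > 0, ∃ ρ > 0, ∀ x ∈ TriDom A B C, ‖x - A‖ < ρ → |w x| * ‖x - A‖ ≤ δ) {ε : ℝ} (hε : 0 < ε) :
    ∃ ρ > 0, ∀ x ∈ TriDom A B C, ‖x - A‖ < ρ → -ε ≤ w x := by
  obtain ⟨ρ, ρ0, hρ⟩ := PL (g := fun x => (-1) * w x) h hμ (continuousOn_const.mul gc)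
    (fun x hx => (contDiffAt_const.mul (g2 x hx)).of_le two_le_inf)
    (fun x hx => by rw [lap_const_mul _ ((g2 x hx).of_le two_le_inf), gl x hx]; ring)
    (fun x hx hi _ => by have := gs x hx hi; linarith)
    (fun δ hδ => by
      obtain ⟨ρ, ρ0, hρ⟩ := hsing δ hδ
      refine ⟨ρ, ρ0, fun x hx hr => le_trans ?_ (hρ x hx hr)⟩
      apply mul_le_mul_of_nonneg_right _ (norm_nonneg _)
      have := neg_abs_le (w x)
      linarith) hε
  exact ⟨ρ, ρ0, fun x hx hr => by have := hρ x hx hr; linarith⟩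

theorem WP.lower {A B C : E2} {μ : ℝ} {w : E2 → ℝ} (h : dt A B C ≠ 0) (hμ : 0 < μ) (W : WP A B C μ w) {ε : ℝ} (hε : 0 < ε) :
    ∃ ρ > 0, ∀ x ∈ TriDom A B C, (‖x - A‖ < ρ ∨ ‖x - B‖ < ρ ∨ ‖x - C‖ < ρ) → -ε ≤ w x := by
  have h2 : dt B C A ≠ 0 := by rwa [dt_cyc]
  have h3 : dt C A B ≠ 0 := by rwa [dt_cyc]
  have T2 := TriDom_cyc A B C
  have T3 := (TriDom_cyc B C A).trans T2
  have S2 := Tri_cyc A B C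
  have S3 := (Tri_cyc B C A).trans S2
  obtain ⟨ρ1, p1, r1⟩ := PL_neg h hμ W.cont W.smooth W.lap_eq W.nonneg (fun δ hδ => by
    obtain ⟨ρ, ρ0, hρ⟩ := W.growth δ hδ
    exact ⟨ρ, ρ0, fun x hx => (hρ x hx).1⟩) hε
  obtain ⟨ρ2, p2, r2⟩ := PL_neg (w := w) h2 hμ (T2.symm ▸ W.cont) (S2.symm ▸ W.smooth) (S2.symm ▸ W.lap_eq) (by rw [T2, S2]; exact W.nonneg) (fun δ hδ => by
    obtain ⟨ρ, ρ0, hρ⟩ := W.growth δ hδ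
    exact ⟨ρ, ρ0, fun x hx => (hρ x (T2 ▸ hx)).2.1⟩) hε
  obtain ⟨ρ3, p3, r3⟩ := PL_neg (w := w) h3 hμ (T3.symm ▸ W.cont) (S3.symm ▸ W.smooth) (S3.symm ▸ W.lap_eq) (by rw [T3, S3]; exact W.nonneg) (fun δ hδ => by
    obtain ⟨ρ, ρ0, hρ⟩ := W.growth δ hδ
    exact ⟨ρ, ρ0, fun x hx => (hρ x (T3 ▸ hx)).2.2⟩) hε
  rw [T2] at r2
  rw [T3] at r3
  refine ⟨min ρ1 (min ρ2 ρ3), by positivity, ?_⟩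
  rintro x hx (hr | hr | hr)
  · exact r1 x hx (lt_of_lt_of_le hr (min_le_left _ _))
  · exact r2 x hx (lt_of_lt_of_le hr ((min_le_right _ _).trans (min_le_left _ _)))
  · exact r3 x hx (lt_of_lt_of_le hr ((min_le_right _ _).trans (min_le_right _ _)))

theorem WP.compact {A B C : E2} {μ : ℝ} {w : E2 → ℝ} (h : dt A B C ≠ 0) (hμ : 0 < μ) (W : WP A B C μ w) {ε : ℝ} (hε : 0 < ε) :
    IsCompact {x | x ∈ TriDom A B C ∧ w x ≤ -ε} ∧ {x | x ∈ TriDom A B C ∧ w x ≤ -ε} ⊆ interior (Tri A B C) := by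
  obtain ⟨ρ, ρ0, hρ⟩ := W.lower h hμ (half_pos hε)
  refine ⟨?_, fun x hx => ?_⟩
  · set K := Tri A B C ∩ {x | ρ ≤ ‖x - A‖ ∧ ρ ≤ ‖x - B‖ ∧ ρ ≤ ‖x - C‖} with hK
    have Kc : IsCompact K := by
      refine (Tri_compact A B C).inter_right ?_
      have : ∀ V : E2, IsClosed {x : E2 | ρ ≤ ‖x - V‖} := fun V => isClosed_le continuous_const (by fun_prop)
      exact (this A).inter ((this B).inter (this C))
    have KD : K ⊆ TriDom A B C := by
      rintro x ⟨hT, h1, h2, h3⟩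
      refine ⟨hT, ?_⟩
      rintro (rfl | rfl | rfl)
      · simp at h1; linarith
      · simp at h2; linarith
      · simp at h3; linarith
    have e : {x | x ∈ TriDom A B C ∧ w x ≤ -ε} = K ∩ w ⁻¹' (Iic (-ε)) := by
      ext x
      constructor
      · rintro ⟨hx, hw⟩
        refine ⟨⟨hx.1, ?_, ?_, ?_⟩, hw⟩
        · by_contra! hc
          have := hρ x hx (Or.inl hc); linarith
        · by_contra! hc
          have := hρ x hx (Or.inr (Or.inl hc)); linarith
        · by_contra! hc
          have := hρ x hx (Or.inr (Or.inr hc)); linarith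
      · rintro ⟨hx, hw⟩
        exact ⟨KD hx, hw⟩
    rw [e]
    exact Kc.of_isClosed_subset ((W.cont.mono KD).preimage_isClosed_of_isClosed Kc.isClosed isClosed_Iic) inter_subset_left
  · by_contra hn
    have := W.nonneg x hx.1 hn
    have := hx.2
    linarith
end

section
open MeasureTheory Filter Topology
open scoped ContDiff FourierTransform RealInnerProductSpace

theorem hopf {μ r : ℝ} {w : E2 → ℝ} {z x0 : E2} (hμ : 0 ≤ μ) (hr : 0 < r)
    (cw : ∀ x ∈ Metric.ball z (4 * r), ContDiffAt ℝ 2 w x) (lw : ∀ x ∈ Metric.ball z (4 * r), lap w x = -(μ * w x))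
    (pw : ∀ x ∈ Metric.ball z (4 * r), 0 ≤ w x) (hz : w z = 0) (hx : x0 ∈ Metric.ball z r) : w x0 = 0 := by
  by_contra hne
  have hzx : ‖z - x0‖ < r := by rw [← dist_eq_norm, dist_comm]; exact hx
  have sub : ∀ y, ‖y - x0‖ ≤ 2 * r → y ∈ Metric.ball z (4 * r) := by
    intro y hy
    rw [Metric.mem_ball]
    have := dist_triangle y x0 z
    rw [dist_eq_norm y x0] at this
    have h2 := Metric.mem_ball.1 hx
    linarith
  have wc : ∀ S : Set E2, (∀ y ∈ S, ‖y - x0‖ ≤ 2 * r) → ContinuousOn w S := fun S hS y hy =>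
    (cw y (sub y (hS y hy))).continuousAt.continuousWithinAt
  have nc : Continuous fun y : E2 => ‖y - x0‖ := by fun_prop
  obtain ⟨y1, ⟨hy1, hy1w⟩, hmin⟩ : ∃ y1 ∈ Metric.closedBall x0 (‖z - x0‖) ∩ w ⁻¹' {0}, IsMinOn (fun y => ‖y - x0‖) (Metric.closedBall x0 (‖z - x0‖) ∩ w ⁻¹' {0}) y1 := by
    refine IsCompact.exists_isMinOn (s := Metric.closedBall x0 (‖z - x0‖) ∩ w ⁻¹' {0}) ?_ ⟨z, ?_, hz⟩ nc.continuousOn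
    · refine (isCompact_closedBall _ _).of_isClosed_subset ?_ inter_subset_left
      refine ContinuousOn.preimage_isClosed_of_isClosed (wc _ fun y hy => ?_) Metric.isClosed_closedBall isClosed_singleton
      rw [Metric.mem_closedBall, dist_eq_norm] at hy; linarith
    · rw [Metric.mem_closedBall, dist_eq_norm]
  rw [Metric.mem_closedBall, dist_eq_norm] at hy1
  have hy1w : w y1 = 0 := hy1w
  set R := ‖y1 - x0‖ with hR
  have R0 : 0 < R := by
    rw [hR]; refine norm_pos_iff.2 (sub_ne_zero.2 ?_)
    rintro rfl; exact hne hy1w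
  have hpos : ∀ y, ‖y - x0‖ < R → 0 < w y := by
    intro y hy
    rcases (pw y (sub y (by linarith))).lt_or_eq with h | h
    · exact h
    · have := hmin (a := y) ⟨by rw [Metric.mem_closedBall, dist_eq_norm]; linarith, h.symm⟩
      simp only [mem_ofPred_eq] at this
      rw [← hR] at this; linarith
  obtain ⟨m, m0, hm⟩ : ∃ m > 0, ∀ y ∈ Metric.sphere x0 (R / 2), m ≤ w y := by
    rcases (Metric.sphere x0 (R / 2)).eq_empty_or_nonempty with he | he
    · exact ⟨1, one_pos, by simp [he]⟩
    · obtain ⟨y, hy, hym⟩ := (isCompact_sphere x0 (R / 2)).exists_isMinOn he (wc _ fun y hy => by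
        rw [mem_sphere_iff_norm] at hy; linarith)
      rw [mem_sphere_iff_norm] at hy
      exact ⟨w y, hpos y (by linarith), fun y' hy' => hym hy'⟩
  set δ := m * R ^ 2 / 8 with hδ
  have δ0 : 0 < δ := by positivity
  have hδm : δ * (4 / R ^ 2) = m / 2 := by rw [hδ]; field_simp; ring
  clear_value δ
  set f : E2 → ℝ := fun y => w y - δ * ((qd x0 y)⁻¹ - (R ^ 2)⁻¹) with hf
  set K : Set E2 := {y | R / 2 ≤ ‖y - x0‖ ∧ ‖y - x0‖ ≤ 2 * R} with hK
  have Kc : IsCompact K := by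
    refine (isCompact_closedBall x0 (2 * R)).of_isClosed_subset ?_ ?_
    · exact (isClosed_le continuous_const nc).inter (isClosed_le nc continuous_const)
    · intro y hy; rw [Metric.mem_closedBall, dist_eq_norm]; exact hy.2
  have Kx : ∀ y ∈ K, y ≠ x0 := by
    rintro y hy rfl
    have := hy.1; simp at this; linarith
  have gc : ∀ t > 0, ContDiffAt ℝ 2 (fun t : ℝ => δ * (t⁻¹ - (R ^ 2)⁻¹)) t := by
    intro t ht
    exact contDiffAt_const.mul ((contDiffAt_inv ℝ ht.ne').sub contDiffAt_const)
  have c2 : ∀ y ∈ K, ContDiffAt ℝ 2 (fun y => δ * ((qd x0 y)⁻¹ - (R ^ 2)⁻¹)) y := fun y hy => cd_radial (G := fun t : ℝ => δ * (t⁻¹ - (R ^ 2)⁻¹)) (Kx y hy) gc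
  have cwK : ∀ y ∈ K, ContDiffAt ℝ 2 w y := fun y hy => cw y (sub y (by linarith [hy.2]))
  have fc : ContinuousOn f K := fun y hy => ((cwK y hy).sub (c2 y hy)).continuousAt.continuousWithinAt
  have y1K : y1 ∈ K := ⟨by linarith, by linarith⟩
  obtain ⟨y, hy, hym⟩ := Kc.exists_isMinOn ⟨y1, y1K⟩ fc
  have f1 : f y1 = 0 := by simp only [hf]; rw [hy1w, qd, ← hR]; ring
  have fy : f y ≤ 0 := f1 ▸ hym y1K
  have hi : R / 2 ≠ ‖y - x0‖ := by
    intro e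
    have := hm y (by rw [mem_sphere_iff_norm, e])
    simp only [hf] at fy
    rw [qd, ← e] at fy
    have e2 : ((R / 2) ^ 2)⁻¹ = 4 / R ^ 2 := by field_simp; norm_num
    rw [e2, mul_sub, hδm] at fy
    have : 0 < δ * (R ^ 2)⁻¹ := by positivity
    linarith
  have ho : ‖y - x0‖ ≠ 2 * R := by
    intro e
    have := pw y (sub y (by linarith [hy.2]))
    simp only [hf] at fy
    rw [qd, e] at fy
    have e2 : ((2 * R) ^ 2)⁻¹ - (R ^ 2)⁻¹ = - (3 / 4 * (R ^ 2)⁻¹) := by field_simp; norm_num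
    rw [e2] at fy
    have : 0 < δ * (3 / 4 * (R ^ 2)⁻¹) := by positivity
    linarith
  have a1 := lt_of_le_of_ne hy.1 hi
  have a2 := lt_of_le_of_ne hy.2 ho
  have lm : IsLocalMin f y := by
    have : ∀ᶠ y' in 𝓝 y, y' ∈ K := by
      filter_upwards [nc.continuousAt.eventually (lt_mem_nhds a1), nc.continuousAt.eventually (gt_mem_nhds a2)] with y' b1 b2
      exact ⟨le_of_lt b1, le_of_lt b2⟩
    filter_upwards [this] with y' hy' using hym hy'
  have := lap_min ((cwK y hy).sub (c2 y hy)) lm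
  have q0 : 0 < qd x0 y := by unfold qd; have := sub_ne_zero.2 (Kx y hy); positivity
  have g1 : ∀ t > 0, HasDerivAt (fun t : ℝ => δ * (t⁻¹ - (R ^ 2)⁻¹)) (δ * (-(t ^ 2)⁻¹)) t := by
    intro t ht
    exact ((hasDerivAt_inv ht.ne').sub_const _).const_mul δ
  have g1' : ∀ t > 0, HasDerivAt (fun t : ℝ => δ * (-(t ^ 2)⁻¹)) (δ * (2 * (t ^ 3)⁻¹)) t := by
    intro t ht
    have := (((hasDerivAt_pow 2 t).inv (by positivity)).neg).const_mul δ
    refine this.congr_deriv ?_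
    field_simp
    norm_num
    ring
  have wy := pw y (sub y (by linarith [hy.2]))
  rw [lap_sub (cwK y hy) (c2 y hy), lw y (sub y (by linarith [hy.2])), lap_radial g1 g1' (Kx y hy)] at this
  have e : 4 * qd x0 y * (δ * (2 * (qd x0 y ^ 3)⁻¹)) + 4 * (δ * (-(qd x0 y ^ 2)⁻¹)) = 4 * δ * (qd x0 y ^ 2)⁻¹ := by field_simp; ring
  rw [e] at this
  have : 0 < 4 * δ * (qd x0 y ^ 2)⁻¹ := by positivity
  have : 0 ≤ μ * w y := by positivity
  linarith

theorem WP.case1 {A B C p : E2} {μ : ℝ} {w : E2 → ℝ} (h : dt A B C ≠ 0) (hμ : 0 < μ) (W : WP A B C μ w)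
    (hw : ∀ x ∈ interior (Tri A B C), 0 ≤ w x) (hp : p ∈ interior (Tri A B C)) (hp0 : w p = 0) : False := by
  set U := interior (Tri A B C) with hU
  have cU : ContinuousOn w U := W.cont.mono (interior_sub_TriDom h)
  obtain ⟨y, hy, hyw⟩ : ∃ y ∈ U, 0 < w y := by
    obtain ⟨m, hm⟩ : (openSegment ℝ B C).Nonempty := ⟨_, (1/2:ℝ), (1/2:ℝ), by norm_num, by norm_num, by norm_num, rfl⟩
    obtain ⟨mD, me⟩ := (mem_openSegment_iff' h).1 hm
    have := W.pos m mD me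
    have ev : ∀ᶠ y in 𝓝[TriDom A B C] m, 0 < w y := (W.cont m mD).eventually (lt_mem_nhds this)
    obtain ⟨V, Vn, hV⟩ := mem_nhdsWithin_iff_exists_mem_nhds_inter.1 ev
    obtain ⟨y, yV, yU⟩ := mem_closure_iff_nhds.1 (Tri_sub_closure h mD.1) V Vn
    exact ⟨y, yU, hV ⟨yV, interior_sub_TriDom h yU⟩⟩
  have oZ : IsOpen {x | x ∈ U ∧ w x = 0} := by
    rw [Metric.isOpen_iff]
    rintro z ⟨zU, hz⟩
    obtain ⟨ε, ε0, hε⟩ := Metric.isOpen_iff.1 isOpen_interior z zU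
    have e4 : 4 * (ε / 4) = ε := by ring
    refine ⟨ε / 4, by positivity, fun x hx => ⟨hε (Metric.ball_subset_ball (by linarith) hx), ?_⟩⟩
    refine hopf hμ.le (by positivity : 0 < ε / 4) ?_ ?_ ?_ hz hx <;> rw [e4]
    · exact fun x hx => (W.smooth x (hε hx)).of_le two_le_inf
    · exact fun x hx => W.lap_eq x (hε hx)
    · exact fun x hx => hw x (hε hx)
  have oV : IsOpen (U ∩ w ⁻¹' (Ioi 0)) := cU.isOpen_inter_preimage isOpen_interior isOpen_Ioi
  have pc : IsPreconnected U := (Tri_convex A B C).interior.isPreconnected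
  obtain ⟨x, -, ⟨-, h1⟩, ⟨-, h2⟩⟩ := pc _ _ oZ oV (fun x hx => by
    rcases (hw x hx).lt_or_eq with h | h
    · exact Or.inr ⟨hx, h⟩
    · exact Or.inl ⟨hx, h.symm⟩) ⟨p, hp, hp, hp0⟩ ⟨y, hy, hy, hyw⟩
  have h2 : 0 < w x := h2
  linarith
end

section
open MeasureTheory Filter Topology
open scoped ContDiff FourierTransform RealInnerProductSpace

theorem maxfun {k k' : ℝ → ℝ} (hk : ∀ t ≥ 0, HasDerivAt k (k' t) t) (k0 : k 0 = 0) (k0' : k' 0 = 0) (hc : ContinuousOn k' (Ici 0)) :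
    (∀ t, HasDerivAt (fun t => k (max 0 t)) (k' (max 0 t)) t) ∧ ContDiff ℝ 1 (fun t => k (max 0 t)) := by
  have hd : ∀ t, HasDerivAt (fun t => k (max 0 t)) (k' (max 0 t)) t := by
    intro t
    rcases lt_trichotomy t 0 with h | h | h
    · rw [max_eq_left h.le, k0']
      refine (hasDerivAt_const t (0:ℝ)).congr_of_eventuallyEq ?_
      filter_upwards [gt_mem_nhds h] with y hy
      rw [max_eq_left (le_of_lt hy), k0]
    · subst h
      rw [max_self, k0']
      have a1 : HasDerivWithinAt (fun t => k (max 0 t)) 0 (Iic 0) 0 := by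
        refine (hasDerivWithinAt_const (0:ℝ) (Iic 0) (0:ℝ)).congr (fun y hy => ?_) (by rw [max_self, k0])
        rw [max_eq_left hy, k0]
      have a2 : HasDerivWithinAt (fun t => k (max 0 t)) 0 (Ici 0) 0 := by
        have := (hk 0 le_rfl).hasDerivWithinAt (s := Ici 0)
        rw [k0'] at this
        refine this.congr (fun y hy => ?_) (by rw [max_self])
        rw [max_eq_right hy]
      have := a1.union a2
      rw [Iic_union_Ici] at this
      exact hasDerivWithinAt_univ.1 this
    · rw [max_eq_right h.le]
      refine (hk t h.le).congr_of_eventuallyEq ?_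
      filter_upwards [lt_mem_nhds h] with y hy
      rw [max_eq_right (le_of_lt hy)]
  refine ⟨hd, contDiff_one_iff_deriv.2 ⟨fun t => (hd t).differentiableAt, ?_⟩⟩
  have : deriv (fun t => k (max 0 t)) = fun t => k' (max 0 t) := funext fun t => (hd t).deriv
  rw [this]
  exact hc.comp_continuous (by fun_prop) fun t => mem_Ici.2 (le_max_left _ _)

theorem gdiv_zero {U : Set E2} {v q : E2 → ℝ} (hv : ContDiff ℝ 1 v) (hc : HasCompactSupport v) (hs : tsupport v ⊆ U)
    (hq : ∀ x ∈ U, ContDiffAt ℝ 2 q x) : Integrable (fun x => gin v q x + v x * lap q x) ∧ ∫ x, (gin v q x + v x * lap q x) = 0 := by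
  have ez : ∀ (e x : E2), x ∉ U → (fun x => v x * pd e q x) =ᶠ[𝓝 x] fun _ => 0 := by
    intro e x hx
    have := notMem_tsupport_iff_eventuallyEq.1 (fun h => hx (hs h))
    filter_upwards [this] with y hy
    rw [hy]; simp
  have cq : ∀ (e x : E2), x ∈ U → ContDiffAt ℝ 1 (pd e q) x := fun e x hx =>
    ((hq x hx).fderiv_right (m := 1) (by norm_num)).clm_apply contDiffAt_const
  have sm : ∀ e, ContDiff ℝ 1 (fun x => v x * pd e q x) := by
    intro e
    rw [contDiff_iff_contDiffAt]
    intro x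
    by_cases hx : x ∈ U
    · exact hv.contDiffAt.mul (cq e x hx)
    · exact contDiffAt_const.congr_of_eventuallyEq (ez e x hx)
  have cs : ∀ e, HasCompactSupport (fun x => v x * pd e q x) := fun e => HasCompactSupport.mul_right hc
  have ee : ∀ e x, pd e (fun x => v x * pd e q x) x = pd e v x * pd e q x + v x * pd e (pd e q) x := by
    intro e x
    by_cases hx : x ∈ U
    · exact pd_mul e (hv.differentiable (by simp) x) ((cq e x hx).differentiableAt (by simp))
    · have z := notMem_tsupport_iff_eventuallyEq.1 (fun h => hx (hs h))
      rw [pd_congr e (ez e x hx), pd_congr e z, z.eq_of_nhds]; simp [pd]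
  have key : (fun x => gin v q x + v x * lap q x) = fun x => pd ee0 (fun x => v x * pd ee0 q x) x + pd ee1 (fun x => v x * pd ee1 q x) x := by
    funext x
    rw [ee, ee, gin, lap]; ring
  have ii : ∀ e, Integrable (pd e (fun x => v x * pd e q x)) := fun e =>
    (pd_cont (sm e) e).integrable_of_hasCompactSupport (pd_hasCompactSupport e (cs e))
  rw [key]
  refine ⟨(ii ee0).add (ii ee1), ?_⟩
  rw [integral_add (ii ee0) (ii ee1), int_pd_zero _ (sm _) (cs _), int_pd_zero _ (sm _) (cs _), add_zero]

open Classical in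
/-- truncation of `w` -/
def cutw (A B C : E2) (w : E2 → ℝ) (ε : ℝ) (k : ℝ → ℝ) (x : E2) : ℝ :=
  if x ∈ interior (Tri A B C) then k (max 0 (-w x - ε)) else 0

def CutOK (A B C : E2) (w : E2 → ℝ) (ε : ℝ) (k k' : ℝ → ℝ) : Prop :=
    ContDiff ℝ 1 (cutw A B C w ε k) ∧ HasCompactSupport (cutw A B C w ε k) ∧ tsupport (cutw A B C w ε k) ⊆ interior (Tri A B C) ∧
    ∀ e x, x ∈ interior (Tri A B C) → pd e (cutw A B C w ε k) x = -(k' (max 0 (-w x - ε)) * pd e w x)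

theorem cutw_facts {A B C : E2} {μ ε : ℝ} {w : E2 → ℝ} (h : dt A B C ≠ 0) (hμ : 0 < μ) (W : WP A B C μ w) (hε : 0 < ε)
    {k k' : ℝ → ℝ} (hk : ∀ t ≥ 0, HasDerivAt k (k' t) t) (k0 : k 0 = 0) (k0' : k' 0 = 0) (hc : ContinuousOn k' (Ici 0)) :
    CutOK A B C w ε k k' := by
  obtain ⟨m1, m2⟩ := maxfun hk k0 k0' hc
  obtain ⟨K1, K2⟩ := W.compact h hμ hε
  set K := {x | x ∈ TriDom A B C ∧ w x ≤ -ε} with hK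
  have sK : Function.support (cutw A B C w ε k) ⊆ K := by
    intro x hx
    by_contra hxK
    apply hx
    unfold cutw
    split_ifs with hi
    · have : -ε < w x := by
        by_contra! hle
        exact hxK ⟨interior_sub_TriDom h hi, hle⟩
      rw [max_eq_left (by linarith), k0]
    · rfl
  have tK : tsupport (cutw A B C w ε k) ⊆ K := closure_minimal sK K1.isClosed
  have ev : ∀ x ∈ interior (Tri A B C), cutw A B C w ε k =ᶠ[𝓝 x] fun y => (fun t => k (max 0 t)) (-w y - ε) := by
    intro x hx
    filter_upwards [isOpen_interior.mem_nhds hx] with y hy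
    simp only [cutw]; rw [if_pos hy]
  have cw : ∀ x ∈ interior (Tri A B C), ContDiffAt ℝ 1 (fun y => -w y - ε) x := fun x hx =>
    (((W.smooth x hx).of_le (by simp)).neg).sub contDiffAt_const
  refine ⟨?_, K1.of_isClosed_subset (isClosed_tsupport _) tK, tK.trans K2, ?_⟩
  · rw [contDiff_iff_contDiffAt]
    intro x
    by_cases hx : x ∈ interior (Tri A B C)
    · exact ((m2.contDiffAt).comp x (cw x hx)).congr_of_eventuallyEq (ev x hx)
    · exact contDiffAt_const.congr_of_eventuallyEq (notMem_tsupport_iff_eventuallyEq.1 fun hh => hx (K2 (tK hh)))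
  · intro e x hx
    have dw : DifferentiableAt ℝ w x := (W.smooth x hx).differentiableAt (by simp)
    rw [pd_congr e (ev x hx), pd_comp e (g' := fun t => k' (max 0 t)) (m1 _) ((cw x hx).differentiableAt (by simp))]
    have : pd e (fun y => -w y - ε) x = -pd e w x := by
      rw [pd, fderiv_sub_const, fderiv_fun_neg]; simp [pd]
    rw [this]; ring

/-- profile functions -/
def h1 (ε t : ℝ) : ℝ := t ^ 2 / (t + ε)
def h1' (ε t : ℝ) : ℝ := (t ^ 2 + 2 * t * ε) / (t + ε) ^ 2
def h2' (ε t : ℝ) : ℝ := (h1' ε t) ^ 2 + h1 ε t * (2 * ε ^ 2 / (t + ε) ^ 3)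

theorem h1_deriv {ε t : ℝ} (hε : 0 < ε) (ht : 0 ≤ t) : HasDerivAt (h1 ε) (h1' ε t) t := by
  have p : t + ε ≠ 0 := by positivity
  have := (hasDerivAt_pow 2 t).div ((hasDerivAt_id t).add_const ε) p
  refine this.congr_deriv ?_
  rw [h1']; norm_num; field_simp; ring

theorem h1'_deriv {ε t : ℝ} (hε : 0 < ε) (ht : 0 ≤ t) : HasDerivAt (h1' ε) (2 * ε ^ 2 / (t + ε) ^ 3) t := by
  have p : t + ε ≠ 0 := by positivity
  have := ((hasDerivAt_pow 2 t).add (((hasDerivAt_id t).const_mul 2).mul_const ε)).div (((hasDerivAt_id t).add_const ε).pow 2) (pow_ne_zero 2 p)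
  refine this.congr_deriv ?_
  norm_num; field_simp; ring

theorem h2_deriv {ε t : ℝ} (hε : 0 < ε) (ht : 0 ≤ t) : HasDerivAt (fun t => h1 ε t * h1' ε t) (h2' ε t) t :=
  ((h1_deriv hε ht).mul (h1'_deriv hε ht)).congr_deriv (by rw [h2']; ring)

theorem h1_facts {A B C : E2} {μ ε : ℝ} {w : E2 → ℝ} (h : dt A B C ≠ 0) (hμ : 0 < μ) (W : WP A B C μ w) (hε : 0 < ε) : CutOK A B C w ε (h1 ε) (h1' ε) :=
  cutw_facts h hμ W hε (k := h1 ε) (k' := h1' ε) (fun t ht => h1_deriv hε ht) (by simp [h1]) (by simp [h1'])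
    (fun t ht => (h1'_deriv hε ht).continuousAt.continuousWithinAt)

theorem h2_facts {A B C : E2} {μ ε : ℝ} {w : E2 → ℝ} (h : dt A B C ≠ 0) (hμ : 0 < μ) (W : WP A B C μ w) (hε : 0 < ε) : CutOK A B C w ε (fun t => h1 ε t * h1' ε t) (h2' ε) :=
  cutw_facts h hμ W hε (k := fun t => h1 ε t * h1' ε t) (k' := h2' ε) (fun t ht => h2_deriv hε ht) (by simp [h1]) (by simp [h2', h1, h1'])
    (fun t ht => by
      have ht : 0 ≤ t := ht
      have p : (t + ε) ^ 3 ≠ 0 := by positivity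
      have c3 : ContinuousAt (fun t : ℝ => 2 * ε ^ 2 / (t + ε) ^ 3) t := by
        refine ContinuousAt.div continuousAt_const ?_ p
        fun_prop
      exact (((h1'_deriv hε ht).continuousAt.pow 2).add ((h1_deriv hε ht).continuousAt.mul c3)).continuousWithinAt)

theorem Q_phi {A B C : E2} {μ ε : ℝ} {w : E2 → ℝ} (h : dt A B C ≠ 0) (hμ : 0 < μ) (W : WP A B C μ w) (hε : 0 < ε) :
    ∫ x, gsq (cutw A B C w ε (h1 ε)) x ≤ μ * (∫ x, (cutw A B C w ε (h1 ε) x) ^ 2) + 2 * ε * μ * ∫ x, cutw A B C w ε (h1 ε) x := by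
  obtain ⟨a1, a2, a3, a4⟩ := h1_facts h hμ W hε
  obtain ⟨b1, b2, b3, b4⟩ := h2_facts h hμ W hε
  set φ := cutw A B C w ε (h1 ε) with hφ
  set v := cutw A B C w ε (fun t => h1 ε t * h1' ε t) with hv
  obtain ⟨i1, i2⟩ := gdiv_zero b1 b2 b3 (q := w) (fun x hx => (W.smooth x hx).of_le two_le_inf)
  have ig : Integrable (gsq φ) := by
    refine (gsq_cont a1).integrable_of_hasCompactSupport ?_
    refine HasCompactSupport.of_support_subset_isCompact a2 ?_
    intro x hx
    by_contra hn
    apply hx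
    have := notMem_tsupport_iff_eventuallyEq.1 hn
    rw [gsq, pd_congr _ this, pd_congr _ this]; simp [pd]
  have is : Integrable (fun x => φ x ^ 2) := by
    refine (a1.continuous.pow 2).integrable_of_hasCompactSupport ?_
    refine a2.mono ?_
    intro x hx hx0
    apply hx; simp [hx0]
  have ip : Integrable φ := a1.continuous.integrable_of_hasCompactSupport a2
  have key : ∀ x, gin v w x + v x * lap w x ≤ (-gsq φ x + μ * φ x ^ 2) + 2 * ε * μ * φ x := by
    intro x
    by_cases hx : x ∈ interior (Tri A B C)
    · have p0 : φ x = h1 ε (max 0 (-w x - ε)) := by rw [hφ, cutw, if_pos hx]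
      have v0 : v x = h1 ε (max 0 (-w x - ε)) * h1' ε (max 0 (-w x - ε)) := by rw [hv, cutw, if_pos hx]
      rw [gin, gsq, b4 _ x hx, b4 _ x hx, a4 _ x hx, a4 _ x hx, W.lap_eq x hx, p0, v0]
      set t := max 0 (-w x - ε) with ht
      have t0 : 0 ≤ t := le_max_left _ _
      have hp : 0 < t + ε := by positivity
      have n1 : 0 ≤ h1 ε t := by unfold h1; positivity
      have n1' : 0 ≤ h1' ε t := by unfold h1'; positivity
      have e1 : h1 ε t * h1' ε t * (-(μ * w x)) = μ * (h1 ε t * (h1' ε t * (t + ε))) := by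
        rcases le_total (-w x - ε) 0 with hh | hh
        · have : t = 0 := max_eq_left hh
          rw [this]; simp [h1]
        · have : t = -w x - ε := max_eq_right hh
          rw [show w x = -(t + ε) by rw [this]; ring]; ring
      have e2 : h1' ε t * (t + ε) ≤ h1 ε t + 2 * ε := by
        have : h1' ε t * (t + ε) = h1 ε t + 2 * ε * (t / (t + ε)) := by unfold h1' h1; field_simp
        rw [this]
        have : t / (t + ε) ≤ 1 := by rw [div_le_one hp]; linarith
        nlinarith
      rw [e1]
      have e3 := mul_le_mul_of_nonneg_left (mul_le_mul_of_nonneg_left e2 n1) hμ.le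
      have e4 : (h1' ε t) ^ 2 ≤ h2' ε t := by
        unfold h2'; have : 0 ≤ h1 ε t * (2 * ε ^ 2 / (t + ε) ^ 3) := by positivity
        linarith
      have e5 := mul_le_mul_of_nonneg_right e4 (by positivity : 0 ≤ (pd ee0 w x) ^ 2 + (pd ee1 w x) ^ 2)
      nlinarith only [e3, e5]
    · have z1 := notMem_tsupport_iff_eventuallyEq.1 (fun hh => hx (a3 hh))
      have z2 := notMem_tsupport_iff_eventuallyEq.1 (fun hh => hx (b3 hh))
      rw [gin, gsq, pd_congr _ z1, pd_congr _ z1, pd_congr _ z2, pd_congr _ z2, z1.eq_of_nhds, z2.eq_of_nhds]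
      simp [pd]
  have := integral_mono i1 ((ig.neg.add (is.const_mul μ)).add (ip.const_mul (2 * ε * μ))) key
  rw [i2] at this
  have e : ∫ x, ((-gsq φ x + μ * φ x ^ 2) + 2 * ε * μ * φ x) = (-(∫ x, gsq φ x) + μ * ∫ x, φ x ^ 2) + 2 * ε * μ * ∫ x, φ x := by
    rw [integral_add (f := fun x => -gsq φ x + μ * φ x ^ 2) (ig.neg.add (is.const_mul μ)) (ip.const_mul (2 * ε * μ)), integral_add (f := fun x => -gsq φ x) ig.neg (is.const_mul μ),
      integral_neg, integral_const_mul, integral_const_mul]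
  have e' : (0:ℝ) ≤ ∫ x, ((-gsq φ x + μ * φ x ^ 2) + 2 * ε * μ * φ x) := this
  rw [e] at e'
  linarith
end

section
open MeasureTheory Filter Topology
open scoped ContDiff FourierTransform RealInnerProductSpace

def gg (A B C : E2) (κ : ℝ) (x : E2) : ℝ := Real.cos (κ * ell A B C x - Real.pi / 4)

theorem gg_smooth (A B C : E2) (κ : ℝ) {n : WithTop ℕ∞} : ContDiff ℝ n (gg A B C κ) := by
  have : ContDiff ℝ n (ell A B C) := (contDiff_id.sub contDiff_const).inner ℝ contDiff_const
  exact Real.contDiff_cos.comp ((contDiff_const.mul this).sub contDiff_const)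

theorem gg_pd {A B C : E2} (κ : ℝ) (x : E2) (h : dt A B C ≠ 0) :
    gsq (gg A B C κ) x = κ ^ 2 * (Real.sin (κ * ell A B C x - Real.pi / 4)) ^ 2 ∧ lap (gg A B C κ) x = -(κ ^ 2 * gg A B C κ x) := by
  have g1 : ∀ t, HasDerivAt (fun t => Real.cos (κ * t - Real.pi / 4)) (-κ * Real.sin (κ * t - Real.pi / 4)) t := by
    intro t
    have := (((hasDerivAt_id t).const_mul κ).sub_const (Real.pi / 4)).cos
    refine this.congr_deriv ?_
    simp; ring
  have g2 : ∀ t, HasDerivAt (fun t => -κ * Real.sin (κ * t - Real.pi / 4)) (-(κ ^ 2 * Real.cos (κ * t - Real.pi / 4))) t := by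
    intro t
    have := ((((hasDerivAt_id t).const_mul κ).sub_const (Real.pi / 4)).sin).const_mul (-κ)
    refine this.congr_deriv ?_
    simp; ring
  have c : ContDiffAt ℝ 2 (ell A B C) x := ((contDiff_id.sub contDiff_const).inner ℝ contDiff_const).contDiffAt
  have pe : ∀ v, pd v (ell A B C) x = ⟪v, nrm A B C⟫ := fun v => pd_inner _ _ _ _
  have le : lap (ell A B C) x = 0 := lap_inner _ _ _
  have n1 : (nrm A B C) 0 ^ 2 + (nrm A B C) 1 ^ 2 = 1 := by rw [← normsq_e2, norm_nrm h, one_pow]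
  constructor
  · have : ∀ v, pd v (gg A B C κ) x = _ := fun v => pd_comp v (g := fun t => Real.cos (κ * t - Real.pi / 4)) (g1 (ell A B C x)) (c.differentiableAt (by norm_num)) (g' := fun t => -κ * Real.sin (κ * t - Real.pi / 4))
    rw [gsq, this, this, pe, pe, inner_ee0, inner_ee1]
    linear_combination (κ ^ 2 * (Real.sin (κ * ell A B C x - Real.pi / 4)) ^ 2) * n1
  · have : lap (gg A B C κ) x = _ := lap_comp (g := fun t => Real.cos (κ * t - Real.pi / 4)) (g' := fun t => -κ * Real.sin (κ * t - Real.pi / 4))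
      (g'' := fun t => -(κ ^ 2 * Real.cos (κ * t - Real.pi / 4))) (Eventually.of_forall g1) (g2 _) c
    rw [this, pe, pe, inner_ee0, inner_ee1, le, n1, gg]; ring

theorem sin_int {a : ℝ} (ha : 0 < a) : 0 < ∫ s in Ioo (0:ℝ) 1, s * Real.sin (a * (1 - s)) := by
  rw [← integral_Ioc_eq_integral_Ioo, ← intervalIntegral.integral_of_le zero_le_one]
  have hd : ∀ s : ℝ, HasDerivAt (fun s => s * Real.cos (a * (1 - s)) / a + Real.sin (a * (1 - s)) / a ^ 2) (s * Real.sin (a * (1 - s))) s := by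
    intro s
    have i := ((hasDerivAt_id s).const_sub 1).const_mul a
    have := (((hasDerivAt_id s).mul i.cos).div_const a).add (i.sin.div_const (a ^ 2))
    refine this.congr_deriv ?_
    simp; field_simp; ring
  rw [intervalIntegral.integral_eq_sub_of_hasDerivAt (fun s _ => hd s) (Continuous.intervalIntegrable (by fun_prop) _ _)]
  have := Real.sin_lt ha
  have e : (1 * Real.cos (a * (1 - 1)) / a + Real.sin (a * (1 - 1)) / a ^ 2) - (0 * Real.cos (a * (1 - 0)) / a + Real.sin (a * (1 - 0)) / a ^ 2) = (a - Real.sin a) / a ^ 2 := by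
    simp; field_simp
  rw [e]
  exact div_pos (by linarith) (by positivity)

theorem int_Tri (A B C : E2) (K : E2 → ℝ) : ∫ x in interior (Tri A B C), K x = ∫ x in Tri A B C, K x :=
  setIntegral_congr_set (interior_ae_eq_of_null_frontier ((Tri_convex A B C).addHaar_frontier volume))

theorem gg_Q {A B C : E2} {κ : ℝ} (h : dt A B C ≠ 0) (hκ : 0 < κ) :
    ∫ x in Tri A B C, gsq (gg A B C κ) x < κ ^ 2 * ∫ x in Tri A B C, (gg A B C κ x) ^ 2 := by
  have c : Continuous (gg A B C κ) := (gg_smooth A B C κ (n := 0)).continuous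
  have hp : 0 < ∫ x in Tri A B C, Real.sin (2 * κ * ell A B C x) := by
    rw [← int_Tri, Ph_int0 h]
    have : ∀ z ∈ Ioo (0:ℝ) 1 ×ˢ Ioo (0:ℝ) 1, (|dt A B C| * z.1) * Real.sin (2 * κ * ell A B C (Ph A B C z.1 z.2)) =
        (fun s => |dt A B C| * (s * Real.sin (2 * κ * hgt A B C * (1 - s)))) z.1 * (fun _ => (1:ℝ)) z.2 := by
      intro z _
      rw [ell_eq h, (bcc_Ph h _ _).1]
      simp only
      rw [show 2 * κ * (hgt A B C * (1 - z.1)) = 2 * κ * hgt A B C * (1 - z.1) by ring]; ring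
    rw [setIntegral_congr_fun (measurableSet_Ioo.prod measurableSet_Ioo) this, Measure.volume_eq_prod]
    refine lt_of_lt_of_eq ?_ (setIntegral_prod_mul (μ := volume) (ν := volume) (fun s : ℝ => |dt A B C| * (s * Real.sin (2 * κ * hgt A B C * (1 - s)))) (fun _ : ℝ => (1:ℝ)) (Ioo (0:ℝ) 1) (Ioo (0:ℝ) 1)).symm
    simp only [integral_const_mul]
    have := sin_int (a := 2 * κ * hgt A B C) (by have := hgt_pos h; positivity)
    have d : 0 < |dt A B C| := abs_pos.2 h
    simp
    positivity
  have e : ∀ x, gsq (gg A B C κ) x = κ ^ 2 * (gg A B C κ x) ^ 2 - κ ^ 2 * Real.sin (2 * κ * ell A B C x) := by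
    intro x
    rw [(gg_pd κ x h).1, gg]
    have := Real.cos_two_mul (κ * ell A B C x - Real.pi / 4)
    rw [show 2 * (κ * ell A B C x - Real.pi / 4) = 2 * κ * ell A B C x - Real.pi / 2 by ring, Real.cos_sub_pi_div_two] at this
    rw [this, Real.sin_sq]; ring
  have ce := continuous_ell A B C
  simp_rw [e]
  rw [integral_sub (intK (Tri_compact A B C) (by fun_prop)) (intK (Tri_compact A B C) (by fun_prop)), integral_const_mul, integral_const_mul]
  have : 0 < κ ^ 2 := by positivity
  nlinarith

set_option maxHeartbeats 1000000 in
theorem WP.case2 {A B C x1 : E2} {μ : ℝ} {w : E2 → ℝ} (h : dt A B C ≠ 0) (hμ : 0 < μ) (W : WP A B C μ w)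
    (hmin : ∀ l f, IsNeumannEigenfun A B C l f → μ ≤ l) (hx1 : x1 ∈ interior (Tri A B C)) (hw1 : w x1 < 0) : False := by
  set κ := Real.sqrt μ with hκ
  have κ0 : 0 < κ := Real.sqrt_pos.2 hμ
  have κ2 : κ ^ 2 = μ := Real.sq_sqrt hμ.le
  set g := gg A B C κ with hg
  have gs : ContDiff ℝ 1 g := gg_smooth A B C κ
  have hQ := gg_Q h κ0
  rw [κ2] at hQ
  have TC := Tri_compact A B C
  set c := μ * (∫ x in Tri A B C, g x ^ 2) - ∫ x in Tri A B C, gsq g x with hc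
  have c0 : 0 < c := by rw [hc]; linarith
  set G := ∫ x in Tri A B C, g x with hG
  by_cases G0 : G = 0
  · have := poinc_mu h hmin gs G0
    linarith
  -- lower bound of masses
  set η := -w x1 / 2 with hη
  have η0 : 0 < η := by rw [hη]; linarith
  have mass : ∀ ε, 0 < ε → ε ≤ η → ∫ x, cutw A B C w η (h1 η) x ≤ ∫ x, cutw A B C w ε (h1 ε) x := by
    intro ε ε0 hle
    obtain ⟨a1, a2, a3, a4⟩ := h1_facts h hμ W ε0
    obtain ⟨b1, b2, b3, b4⟩ := h1_facts h hμ W η0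
    refine integral_mono (b1.continuous.integrable_of_hasCompactSupport b2) (a1.continuous.integrable_of_hasCompactSupport a2) fun x => ?_
    simp only [cutw]
    split_ifs
    · rcases le_total (-w x - η) 0 with h1' | h1'
      · rw [max_eq_left h1']
        have : 0 ≤ max 0 (-w x - ε) := le_max_left _ _
        have h2 : 0 ≤ h1 ε (max 0 (-w x - ε)) := by unfold h1; positivity
        simpa [h1] using h2
      · have h3 : 0 ≤ -w x - ε := by linarith
        rw [max_eq_right h1', max_eq_right h3, h1, h1, sub_add_cancel, sub_add_cancel]
        have : 0 < -w x := by linarith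
        apply div_le_div_of_nonneg_right _ this.le
        apply pow_le_pow_left₀ h1'
        linarith
    · exact le_rfl
  set m0 := ∫ x, cutw A B C w η (h1 η) x with hm0
  have m0p : 0 < m0 := by
    obtain ⟨b1, b2, b3, b4⟩ := h1_facts h hμ W η0
    refine b1.continuous.integral_pos_of_hasCompactSupport_nonneg_nonzero b2 (fun x => ?_) (x := x1) ?_
    · simp only [cutw, Pi.zero_apply]
      split_ifs
      · have : 0 ≤ max 0 (-w x - η) := le_max_left _ _
        unfold h1; positivity
      · exact le_rfl
    · rw [cutw, if_pos hx1]
      have : 0 < max 0 (-w x1 - η) := lt_max_of_lt_right (by rw [hη]; linarith)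
      unfold h1; positivity
  clear_value m0 c
  set ε := min η (c * m0 / (4 * μ * G ^ 2)) with hε
  have G2 : 0 < G ^ 2 := by positivity
  have ε0 : 0 < ε := by positivity
  have εη : ε ≤ η := min_le_left _ _
  have εc : 2 * ε * μ * G ^ 2 < c * m0 := by
    have : ε ≤ c * m0 / (4 * μ * G ^ 2) := min_le_right _ _
    rw [le_div_iff₀ (by positivity)] at this
    have : 0 < c * m0 := by positivity
    nlinarith
  clear_value ε
  have mε := mass ε ε0 εη
  have Qφ := Q_phi h hμ W ε0
  obtain ⟨a1, a2, a3, a4⟩ := h1_facts h hμ W ε0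
  set φ := cutw A B C w ε (h1 ε) with hφ
  obtain ⟨i1, i2⟩ := gdiv_zero a1 a2 a3 (q := g) (fun x _ => (gg_smooth A B C κ).contDiffAt)
  have zero : ∀ x, x ∉ Tri A B C → φ =ᶠ[𝓝 x] 0 := fun x hx => notMem_tsupport_iff_eventuallyEq.1 fun hh => hx (interior_subset (a3 hh))
  have r1 : ∫ x in Tri A B C, φ x = ∫ x, φ x := setIntegral_eq_integral_of_forall_compl_eq_zero fun x hx => (zero x hx).eq_of_nhds
  have r2 : ∫ x in Tri A B C, φ x ^ 2 = ∫ x, φ x ^ 2 := setIntegral_eq_integral_of_forall_compl_eq_zero fun x hx => by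
    rw [(zero x hx).eq_of_nhds]; simp
  have r3 : ∫ x in Tri A B C, gsq φ x = ∫ x, gsq φ x := setIntegral_eq_integral_of_forall_compl_eq_zero fun x hx => by
    rw [gsq, pd_congr _ (zero x hx), pd_congr _ (zero x hx)]; simp [pd]
  have r4 : ∫ x in Tri A B C, gin φ g x = μ * ∫ x in Tri A B C, φ x * g x := by
    rw [← setIntegral_eq_integral_of_forall_compl_eq_zero (s := Tri A B C) (fun x hx => by
      rw [gin, pd_congr _ (zero x hx), pd_congr _ (zero x hx), (zero x hx).eq_of_nhds]; simp [pd])] at i2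
    have : ∀ x, gin φ g x + φ x * lap g x = 1 * gin φ g x + (-μ) * (φ x * g x) := by
      intro x; rw [(gg_pd κ x h).2, κ2]; ring
    simp_rw [this] at i2
    rw [M_lin (f := gin φ g) (h := fun x => φ x * g x) TC (gin_cont a1 gs) (a1.continuous.mul gs.continuous)] at i2
    linarith
  rw [← r1, ← r2, ← r3] at Qφ
  rw [← r1] at mε
  set m := ∫ x in Tri A B C, φ x with hm
  set b := m / G with hb
  have hbG : b * G = m := div_mul_cancel₀ _ G0
  have hmean : ∫ x in Tri A B C, (1 * φ x + (-b) * g x) = 0 := by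
    rw [M_lin TC a1.continuous gs.continuous, ← hG, ← hm]; linarith
  have fin := poinc_mu h hmin (lin_contDiff a1 gs 1 (-b)) hmean
  rw [E_lin TC a1 gs, S_lin TC a1.continuous gs.continuous, r4] at fin
  have f2 : b ^ 2 * c ≤ 2 * ε * μ * m := by rw [hc]; nlinarith only [fin, Qφ]
  have f3 : m ^ 2 * c ≤ 2 * ε * μ * m * G ^ 2 := by
    rw [← hbG]
    have := mul_le_mul_of_nonneg_right f2 G2.le
    rw [← hbG] at this
    nlinarith only [this]
  have mp : 0 < m := lt_of_lt_of_le m0p mε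
  have f4 : m * (2 * ε * μ * G ^ 2) < m * (c * m0) := mul_lt_mul_of_pos_left εc mp
  have f5 : m * (c * m0) ≤ m * (c * m) := mul_le_mul_of_nonneg_left (mul_le_mul_of_nonneg_left mε c0.le) mp.le
  nlinarith only [f3, f4, f5]
end

section
open MeasureTheory Filter Topology
open scoped ContDiff FourierTransform RealInnerProductSpace

theorem growth_V {A B C V : E2} {u : E2 → ℝ} {M δ : ℝ} (hM : ∀ x ∈ Tri A B C, ‖x - A‖ ≤ M) (hM1 : 0 < M) (hδ : 0 < δ)
    (hV : ∀ x ∈ TriDom A B C, x ≠ V)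
    (hg : ∀ d > 0, ∃ ρ > 0, ∀ x ∈ Tri A B C, x ≠ V → ‖x - V‖ < ρ → qd V x * gw (TriDom A B C) u x ≤ d) :
    ∃ ρ > 0, ∀ x ∈ TriDom A B C, ‖x - V‖ < ρ → |ww (TriDom A B C) A u x| * ‖x - V‖ ≤ δ := by
  obtain ⟨ρ, ρ0, hρ⟩ := hg (δ ^ 2 / M ^ 2) (by positivity)
  refine ⟨ρ, ρ0, fun x hx hr => ?_⟩
  have h1 := hρ x hx.1 (hV x hx) hr
  rw [qd, le_div_iff₀ (by positivity)] at h1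
  have h2 := ww_sq (TriDom A B C) A u x
  have g0 : 0 ≤ gw (TriDom A B C) u x := by rw [gw]; positivity
  have h3 : ‖x - A‖ ^ 2 ≤ M ^ 2 := pow_le_pow_left₀ (norm_nonneg _) (hM x hx.1) 2
  refine abs_le_of_sq_le_sq' (a := |ww (TriDom A B C) A u x| * ‖x - V‖) ?_ hδ.le |>.2
  rw [mul_pow, sq_abs]
  have h4 := mul_le_mul_of_nonneg_right (h2.trans (mul_le_mul_of_nonneg_right h3 g0)) (sq_nonneg ‖x - V‖)
  nlinarith only [h4, h1]

theorem eig_cyc {A B C : E2} {μ : ℝ} {u : E2 → ℝ} (hu : IsNeumannEigenfun A B C μ u) : IsNeumannEigenfun B C A μ u where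
  pos := hu.pos
  nonconst := by rw [Tri_cyc]; exact hu.nonconst
  cont := by rw [Tri_cyc]; exact hu.cont
  smooth := by rw [TriDom_cyc]; exact hu.smooth
  eqn := by rw [Tri_cyc]; exact hu.eqn
  neumann₁₂ := by rw [TriDom_cyc]; exact hu.neumann₂₃
  neumann₂₃ := by rw [TriDom_cyc]; exact hu.neumann₃₁
  neumann₃₁ := by rw [TriDom_cyc]; exact hu.neumann₁₂

theorem crit_cyc {A B C q : E2} {u : E2 → ℝ} (hu : IsCritPt A B C u q) : IsCritPt B C A u q := by
  rw [IsCritPt, TriDom_cyc]; exact hu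

theorem one_side {A B C p : E2} {μ : ℝ} {u : E2 → ℝ} (h : dt A B C ≠ 0) (hu : IsNeumannEigenfun A B C μ u)
    (hmin : ∀ l f, IsNeumannEigenfun A B C l f → μ ≤ l) (hp : p ∈ interior (Tri A B C)) (hc : IsCritPt A B C u p) :
    ∃ q ∈ openSegment ℝ B C, IsCritPt A B C u q := by
  by_contra hno
  push Not at hno
  set w := ww (TriDom A B C) A u with hw
  have hn : ∀ p ∈ TriDom A B C, NiceAt A B C μ u p := fun p hp => nice_u h hu hp
  have wc : ContinuousOn w (TriDom A B C) := ww_cont h hn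
  have w0 : ∀ q ∈ openSegment ℝ B C, w q ≠ 0 := fun q hq hz => by
    obtain ⟨q1, q2⟩ := (mem_openSegment_iff' h).1 hq
    exact hno q hq ⟨q1, ww_BC h hu q1 q2 hz⟩
  have sgn : ∃ σ : ℝ, |σ| = 1 ∧ ∀ q ∈ openSegment ℝ B C, 0 < σ * w q := by
    have pc : IsPreconnected (openSegment ℝ B C) := (convex_openSegment B C).isPreconnected
    have wcs : ContinuousOn w (openSegment ℝ B C) := wc.mono fun q hq => ((mem_openSegment_iff' h).1 hq).1
    by_cases hall : ∀ q ∈ openSegment ℝ B C, 0 < w q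
    · exact ⟨1, by simp, fun q hq => by simpa using hall q hq⟩
    · push Not at hall
      obtain ⟨q0, hq0, hn0⟩ := hall
      refine ⟨-1, by simp, fun q hq => ?_⟩
      by_contra hq2
      obtain ⟨z, hz, hz0⟩ := pc.intermediate_value hq0 hq wcs (show (0:ℝ) ∈ Icc (w q0) (w q) from ⟨hn0, by linarith⟩)
      exact w0 z hz hz0
  obtain ⟨σ, σ1, hσ⟩ := sgn
  obtain ⟨M0, hM0⟩ := (Tri_compact A B C).exists_bound_of_continuousOn (f := fun x => x - A) (by fun_prop)
  have hM : ∀ x ∈ Tri A B C, ‖x - A‖ ≤ |M0| + 1 := fun x hx => by linarith [hM0 x hx, le_abs_self M0]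
  have hB : dt B C A ≠ 0 := by rwa [dt_cyc]
  have hC : dt C A B ≠ 0 := by rwa [dt_cyc]
  have tC : Tri C A B = Tri A B C := by rw [Tri_cyc, Tri_cyc]
  have dC : TriDom C A B = TriDom A B C := by rw [TriDom_cyc, TriDom_cyc]
  have W : WP A B C μ (fun x => σ * w x) := by
    have pos : ∀ x ∈ TriDom A B C, ell A B C x = 0 → 0 < σ * w x := fun x hx h0 =>
      hσ x ((mem_openSegment_iff' h).2 ⟨hx, h0⟩)
    refine ⟨continuousOn_const.mul wc, fun x hx => contDiffAt_const.mul (ww_int h hn hx).1, fun x hx => ?_, fun x hx hi => ?_, pos, fun δ hδ => ?_⟩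
    · rw [lap_const_mul σ ((ww_int h hn hx).1.of_le two_le_inf), (ww_int h hn hx).2]; ring
    · obtain ⟨e1, e2, e3⟩ := (mem_Tri h x).1 hx.1
      rcases e1.eq_or_lt with e1 | e1
      · exact (pos x hx e1.symm).le
      rcases e2.eq_or_lt with e2 | e2
      · show 0 ≤ σ * w x
        rw [hw, ww_CA h hu hx e2.symm, mul_zero]
      rcases e3.eq_or_lt with e3 | e3
      · show 0 ≤ σ * w x
        rw [hw, ww_AB h hu hx e3.symm, mul_zero]
      · exact absurd ((mem_int h x).2 ⟨e1, e2, e3⟩) hi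
    · obtain ⟨r1, r10, hr1⟩ := growth_V (u := u) hM (by positivity) hδ (V := A) (fun x hx => dom_ne hx)
        (fun d hd => grad_est h hn hu.pos hu.cont hd)
      obtain ⟨r2, r20, hr2⟩ := growth_V (u := u) hM (by positivity) hδ (V := B) (fun x hx => by
          rw [← TriDom_cyc] at hx; exact dom_ne hx)
        (fun d hd => by
          have := grad_est hB (l := μ) (u := u) (fun p hp => NiceAt_cyc (hn p (by rwa [TriDom_cyc] at hp))) hu.pos
            (by rw [Tri_cyc]; exact hu.cont) hd
          rwa [Tri_cyc, TriDom_cyc] at this)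
      obtain ⟨r3, r30, hr3⟩ := growth_V (u := u) hM (by positivity) hδ (V := C) (fun x hx => by
          rw [← dC] at hx; exact dom_ne hx)
        (fun d hd => by
          have := grad_est hC (l := μ) (u := u) (fun p hp => NiceAt_cyc (NiceAt_cyc (hn p (by rwa [dC] at hp)))) hu.pos
            (by rw [tC]; exact hu.cont) hd
          rwa [tC, dC] at this)
      refine ⟨min r1 (min r2 r3), lt_min r10 (lt_min r20 r30), fun x hx => ?_⟩
      simp only [abs_mul, σ1, one_mul]
      exact ⟨fun hr => hr1 x hx (hr.trans_le (min_le_left _ _)),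
        fun hr => hr2 x hx (hr.trans_le ((min_le_right _ _).trans (min_le_left _ _))),
        fun hr => hr3 x hx (hr.trans_le ((min_le_right _ _).trans (min_le_right _ _)))⟩
  by_cases hall : ∀ x ∈ interior (Tri A B C), 0 ≤ σ * w x
  · refine W.case1 h hu.pos hall hp ?_
    show σ * w p = 0
    rw [hw, ww, hc.2]; simp
  · push Not at hall
    obtain ⟨x1, hx1, hw1⟩ := hall
    exact W.case2 h hu.pos hmin hx1 hw1
end

/-- If a second Neumann eigenfunction of a triangle has a critical point in the open
interior of the triangle, then each side of the triangle contains a critical point in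
its interior. -/
theorem interior_critical_point_gives_side_critical_points
    (v₁ v₂ v₃ : E2) (hT : AffineIndependent ℝ ![v₁, v₂, v₃])
    (u : E2 → ℝ) (hu : IsSecondNeumannEigenfun v₁ v₂ v₃ u)
    (hint : ∃ p ∈ interior (Tri v₁ v₂ v₃), IsCritPt v₁ v₂ v₃ u p) :
    ∀ a b : E2, IsSide v₁ v₂ v₃ a b →
      ∃ q ∈ openSegment ℝ a b, IsCritPt v₁ v₂ v₃ u q := by
  obtain ⟨μ, hu, hmin⟩ := hu
  obtain ⟨p, hp, hc⟩ := hint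
  have h := dt_ne hT
  rintro a b (⟨rfl, rfl⟩ | ⟨rfl, rfl⟩ | ⟨rfl, rfl⟩)
  · have h3 : dt v₃ a b ≠ 0 := by rwa [dt_cyc, dt_cyc]
    obtain ⟨q, hq, hqc⟩ := one_side h3 (eig_cyc (eig_cyc hu)) (fun l f hf => hmin l f (eig_cyc hf))
      (by rwa [Tri_cyc, Tri_cyc]) (crit_cyc (crit_cyc hc))
    exact ⟨q, hq, crit_cyc hqc⟩
  · exact one_side h hu hmin hp hc
  · have h2 : dt v₂ a b ≠ 0 := by rwa [dt_cyc]
    obtain ⟨q, hq, hqc⟩ := one_side h2 (eig_cyc hu) (fun l f hf => hmin l f (eig_cyc (eig_cyc hf)))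
      (by rwa [Tri_cyc]) (crit_cyc hc)
    exact ⟨q, hq, crit_cyc (crit_cyc hqc)⟩

end
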